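/- Assume the Riemann Hypothesis. Then the set M of real numbers x ≥ 2 with ∏_{p≤x}(1−1/p)^{-1} > e^γ log x satisfies δ̲(M) > 0 and δ̄(M) < 1, i.e. both M and its complement in [2,∞) have positive lower logarithmic density. -/

import Mathlib

open Filter MeasureTheory Real Set

/-- The Mertens product `∏_{p ≤ x} (1 - 1/p)⁻¹`. -/
noncomputable def mertensProd (x : ℝ) : ℝ :=
  ∏ p ∈ Finset.filter Nat.Prime (Finset.Iic ⌊x⌋₊), ((1 : ℝ) - 1 / p)⁻¹

/-- The set `M` of real `x ≥ 2` with `∏_{p≤x}(1-1/p)⁻¹ > e^γ log x`. -/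
def MertensSet : Set ℝ :=
  {x : ℝ | 2 ≤ x ∧ Real.exp Real.eulerMascheroniConstant * Real.log x < mertensProd x}

/-- Lower logarithmic density: `liminf_{x→∞} (1/log x) ∫_{S ∩ [2,x]} dt/t`. -/
noncomputable def lowerLogDensity (S : Set ℝ) : ℝ :=
  liminf (fun x : ℝ => (∫ t in S ∩ Set.Icc 2 x, 1 / t) / Real.log x) atTop

/-- Upper logarithmic density: `limsup_{x→∞} (1/log x) ∫_{S ∩ [2,x]} dt/t`. -/
noncomputable def upperLogDensity (S : Set ℝ) : ℝ :=
  limsup (fun x : ℝ => (∫ t in S ∩ Set.Icc 2 x, 1 / t) / Real.log x) atTop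

section SchwarzPick

open ComplexConjugate

lemma norm_sub_lt_norm_add_conj {w a : ℂ} (hw : 0 < w.re) (ha : 0 < a.re) :
    ‖w - a‖ < ‖w + conj a‖ := by
  rw [← sq_lt_sq₀ (norm_nonneg _) (norm_nonneg _), Complex.sq_norm, Complex.sq_norm,
    Complex.normSq_apply, Complex.normSq_apply]
  simp
  nlinarith [mul_pos hw ha]

lemma norm_cayley_lt_one {w a : ℂ} (hw : 0 < w.re) (ha : 0 < a.re) :
    ‖(w - a) / (w + conj a)‖ < 1 := by
  have h := norm_sub_lt_norm_add_conj hw ha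
  rw [norm_div, div_lt_one ((norm_nonneg _).trans_lt h)]
  exact h

lemma cayley_inv_re_pos {ζ a : ℂ} (hζ : ‖ζ‖ < 1) (ha : 0 < a.re) :
    0 < ((a + conj a * ζ) / (1 - ζ)).re := by
  have h1 : (1 - ζ) ≠ 0 := by
    intro h
    have : ζ = 1 := (sub_eq_zero.mp h).symm
    simp [this] at hζ
  have h2 : 0 < Complex.normSq (1 - ζ) := Complex.normSq_pos.mpr h1
  have h3 : ζ.re ^ 2 + ζ.im ^ 2 < 1 := by
    have := Complex.sq_norm ζ
    rw [Complex.normSq_apply] at this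
    nlinarith [norm_nonneg ζ]
  rw [Complex.div_re, ← add_div]
  apply div_pos _ h2
  simp
  nlinarith

/-- The two-point Schwarz-Pick inequality on the right half-plane, strict version. -/
lemma schwarzPick_of_pos {f : ℂ → ℂ} (hf : DifferentiableOn ℂ f {s | 0 < s.re})
    (hpos : ∀ s : ℂ, 0 < s.re → 0 < (f s).re) {z a : ℂ} (hz : 0 < z.re) (ha : 0 < a.re) :
    ‖f z - f a‖ * ‖z + conj a‖ ≤ ‖z - a‖ * ‖f z + conj (f a)‖ := by
  set φ : ℂ → ℂ := fun ζ => (a + conj a * ζ) / (1 - ζ) with hφ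
  set g : ℂ → ℂ := fun ζ => (f (φ ζ) - f a) / (f (φ ζ) + conj (f a)) with hg
  have hφm : ∀ ζ ∈ Metric.ball (0 : ℂ) 1, 0 < (φ ζ).re := fun ζ hζ =>
    cayley_inv_re_pos (by simpa using hζ) ha
  have hne : ∀ ζ ∈ Metric.ball (0 : ℂ) 1, (1 - ζ) ≠ 0 := by
    intro ζ hζ h
    have : ζ = 1 := (sub_eq_zero.mp h).symm
    simp [this] at hζ
  have hne2 : ∀ w b : ℂ, 0 < w.re → 0 < b.re → w + conj b ≠ 0 := by
    intro w b hw hb h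
    have := congrArg Complex.re h
    simp at this
    linarith
  have hgd : DifferentiableOn ℂ g (Metric.ball 0 1) := by
    have h1 : DifferentiableOn ℂ φ (Metric.ball 0 1) := by
      apply DifferentiableOn.div _ _ hne <;> fun_prop
    have h2 : DifferentiableOn ℂ (fun ζ => f (φ ζ)) (Metric.ball 0 1) := hf.comp h1 hφm
    apply DifferentiableOn.div (h2.sub_const _) (h2.add_const _)
    intro ζ hζ
    exact hne2 _ _ (hpos _ (hφm ζ hζ)) (hpos _ ha)
  have hgm : MapsTo g (Metric.ball 0 1) (Metric.ball 0 1) := by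
    intro ζ hζ
    rw [mem_ball_zero_iff]
    exact norm_cayley_lt_one (hpos _ (hφm ζ hζ)) (hpos _ ha)
  have hg0 : g 0 = 0 := by simp [hg, hφ]
  set ζ := (z - a) / (z + conj a) with hζ
  have hζ1 : ‖ζ‖ < 1 := norm_cayley_lt_one hz ha
  have key := Complex.norm_le_norm_of_mapsTo_ball hgd
    (hgm.mono_right Metric.ball_subset_closedBall) hg0 hζ1
  have hza := hne2 z a hz ha
  have haa := hne2 a a ha ha
  have hφζ : φ ζ = z := by
    have h1 : 1 - ζ = (a + conj a) / (z + conj a) := by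
      rw [hζ]; field_simp; ring
    have h2 : a + conj a * ζ = z * (a + conj a) / (z + conj a) := by
      rw [hζ]; field_simp; ring
    simp only [hφ]
    rw [h1, h2]
    field_simp
  have hfz := hne2 _ _ (hpos z hz) (hpos a ha)
  simp only [hg, hφζ, norm_div] at key
  rw [hζ, norm_div] at key
  rwa [div_le_div_iff₀ (norm_pos_iff.mpr hfz) (norm_pos_iff.mpr hza)] at key

/-- The two-point Schwarz-Pick inequality on the right half-plane. -/
lemma schwarzPick {f : ℂ → ℂ} (hf : DifferentiableOn ℂ f {s | 0 < s.re})
    (hpos : ∀ s : ℂ, 0 < s.re → 0 ≤ (f s).re) {z a : ℂ} (hz : 0 < z.re) (ha : 0 < a.re) :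
    ‖f z - f a‖ * ‖z + conj a‖ ≤ ‖z - a‖ * ‖f z + conj (f a)‖ := by
  have h : ∀ ε : ℝ, 0 < ε → ‖f z - f a‖ * ‖z + conj a‖ ≤
      ‖z - a‖ * ‖f z + conj (f a) + 2 * ε‖ := by
    intro ε hε
    have := schwarzPick_of_pos (f := fun s => f s + ε) (hf.add_const _)
      (fun s hs => by simpa using add_pos_of_nonneg_of_pos (hpos s hs) hε) hz ha
    simp only [map_add, Complex.conj_ofReal, add_sub_add_right_eq_sub] at this
    convert this using 3
    ring
  have hlim : Tendsto (fun ε : ℝ => ‖z - a‖ * ‖f z + conj (f a) + 2 * ε‖) (nhdsWithin 0 (Ioi 0))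
      (nhds (‖z - a‖ * ‖f z + conj (f a) + 2 * (0 : ℝ)‖)) := by
    apply Tendsto.mono_left _ nhdsWithin_le_nhds
    apply Continuous.tendsto
    fun_prop
  have := ge_of_tendsto hlim (by filter_upwards [self_mem_nhdsWithin] with ε hε using h ε hε)
  simpa using this

variable {f : ℂ → ℂ}

/-- Harnack-type bound along horizontal lines. -/
lemma re_mul_le_of_re_nonneg (hf : DifferentiableOn ℂ f {s | 0 < s.re})
    (hpos : ∀ s : ℂ, 0 < s.re → 0 ≤ (f s).re) {x y t : ℝ} (hx : 0 < x) (hxy : x ≤ y) :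
    x * (f (x + t * Complex.I)).re ≤ y * (f (y + t * Complex.I)).re ∧
      x * (f (y + t * Complex.I)).re ≤ y * (f (x + t * Complex.I)).re := by
  have hy : 0 < y := hx.trans_le hxy
  have h := schwarzPick hf hpos (z := x + t * Complex.I) (a := y + t * Complex.I)
    (by simpa using hx) (by simpa using hy)
  have p1 := hpos (x + t * Complex.I) (by simpa using hx)
  have p2 := hpos (y + t * Complex.I) (by simpa using hy)
  set F := f (x + t * Complex.I)
  set G := f (y + t * Complex.I)
  have e1 : ((x + t * Complex.I : ℂ) + conj (y + t * Complex.I : ℂ)) = ((x + y : ℝ) : ℂ) := by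
    simp; ring
  have e2 : ((x + t * Complex.I : ℂ) - (y + t * Complex.I : ℂ)) = ((x - y : ℝ) : ℂ) := by
    push_cast; ring
  rw [e1, e2, Complex.norm_real, Complex.norm_real, Real.norm_eq_abs, Real.norm_eq_abs,
    abs_of_pos (by linarith : 0 < x + y), abs_of_nonpos (by linarith : x - y ≤ 0)] at h
  have h2 := pow_le_pow_left₀ (by positivity) h 2
  rw [mul_pow, mul_pow, Complex.sq_norm, Complex.sq_norm, Complex.normSq_apply,
    Complex.normSq_apply] at h2
  simp only [Complex.sub_re, Complex.sub_im, Complex.add_re, Complex.add_im, Complex.conj_re,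
    Complex.conj_im] at h2
  have h3 : ((F.re - G.re) * (x + y)) ^ 2 ≤ ((y - x) * (F.re + G.re)) ^ 2 := by
    nlinarith [mul_nonneg (sq_nonneg (F.im - G.im)) (mul_nonneg hx.le hy.le)]
  have h5 := abs_le_of_sq_le_sq h3 (mul_nonneg (sub_nonneg.mpr hxy) (add_nonneg p1 p2))
  have h6 := abs_le.mp h5
  constructor <;> nlinarith [h6.1, h6.2]

/-- Oscillation bound: if `k = ‖z-a‖/‖z+conj a‖`, the variation of `f` is controlled by its
real part. -/
lemma norm_sub_mul_le_of_re_nonneg (hf : DifferentiableOn ℂ f {s | 0 < s.re})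
    (hpos : ∀ s : ℂ, 0 < s.re → 0 ≤ (f s).re) {z a : ℂ} (hz : 0 < z.re) (ha : 0 < a.re) :
    ‖f z - f a‖ ^ 2 * (4 * z.re * a.re) ≤ (‖z + conj a‖ * ((f z).re + (f a).re)) ^ 2 := by
  have h := schwarzPick hf hpos hz ha
  have p1 := hpos z hz
  have p2 := hpos a ha
  have h2 := pow_le_pow_left₀ (by positivity) h 2
  have e : ‖z + conj a‖ ^ 2 = ‖z - a‖ ^ 2 + 4 * z.re * a.re := by
    rw [Complex.sq_norm, Complex.sq_norm, Complex.normSq_apply, Complex.normSq_apply]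
    simp; ring
  have e' : ‖f z + conj (f a)‖ ^ 2 = ‖f z - f a‖ ^ 2 + 4 * (f z).re * (f a).re := by
    rw [Complex.sq_norm, Complex.sq_norm, Complex.normSq_apply, Complex.normSq_apply]
    simp; ring
  rw [mul_pow, mul_pow, e', ] at h2
  rw [mul_pow]
  have h7 : ‖z - a‖ ^ 2 ≤ ‖z + conj a‖ ^ 2 := by rw [e]; nlinarith [mul_pos hz ha]
  have h8 : 0 ≤ (f z).re * (f a).re := mul_nonneg p1 p2
  have h9 : ‖z - a‖ ^ 2 * (4 * (f z).re * (f a).re) ≤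
      ‖z + conj a‖ ^ 2 * ((f z).re + (f a).re) ^ 2 := by
    apply mul_le_mul h7 _ (by positivity) (by positivity)
    nlinarith [sq_nonneg ((f z).re - (f a).re)]
  have h10 : ‖f z - f a‖ ^ 2 * ‖z + conj a‖ ^ 2 = ‖f z - f a‖ ^ 2 * ‖z - a‖ ^ 2 +
      ‖f z - f a‖ ^ 2 * (4 * z.re * a.re) := by rw [e]; ring
  linarith

end SchwarzPick

section ContourShift

/-- Shifting a vertical line of integration. -/
lemma integral_vertical_eq_of_decay {g : ℂ → ℂ} {a b : ℝ} (hab : a ≤ b)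
    (hg : ∀ s : ℂ, a ≤ s.re → s.re ≤ b → DifferentiableAt ℂ g s)
    (ha : Integrable (fun t : ℝ => g (a + t * Complex.I)))
    (hb : Integrable (fun t : ℝ => g (b + t * Complex.I)))
    (hdecay : ∀ ε > 0, ∃ T₀ : ℝ, ∀ x t : ℝ, a ≤ x → x ≤ b → T₀ ≤ |t| →
      ‖g (x + t * Complex.I)‖ ≤ ε) :
    ∫ t : ℝ, g (a + t * Complex.I) = ∫ t : ℝ, g (b + t * Complex.I) := by
  have key : ∀ T : ℝ, ((∫ x : ℝ in a..b, g (x + (-T : ℝ) * Complex.I)) -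
      (∫ x : ℝ in a..b, g (x + T * Complex.I))) +
      Complex.I • (∫ t : ℝ in (-T)..T, g (b + t * Complex.I)) -
      Complex.I • (∫ t : ℝ in (-T)..T, g (a + t * Complex.I)) = 0 := by
    intro T
    have := Complex.integral_boundary_rect_eq_zero_of_differentiableOn g (a + (-T : ℝ) * Complex.I)
      (b + T * Complex.I) (by
        intro s hs
        rw [Complex.mem_reProdIm] at hs
        have h1 := hs.1
        simp [Set.uIcc_of_le hab] at h1
        exact (hg s h1.1 h1.2).differentiableWithinAt)
    simpa using this
  have hhor : ∀ S : ℝ → ℝ, Tendsto (fun T => |S T|) atTop atTop →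
      Tendsto (fun T : ℝ => ∫ x : ℝ in a..b, g (x + (S T : ℝ) * Complex.I)) atTop (nhds 0) := by
    intro S hS
    rw [Metric.tendsto_nhds]
    intro ε hε
    obtain ⟨T₀, hT₀⟩ := hdecay (ε / (2 * (b - a + 1))) (by
      apply div_pos hε; linarith)
    filter_upwards [hS.eventually_ge_atTop T₀] with T hT
    rw [dist_zero_right]
    have := intervalIntegral.norm_integral_le_of_norm_le_const (a := a) (b := b)
      (f := fun x : ℝ => g (x + (S T : ℝ) * Complex.I)) (C := ε / (2 * (b - a + 1))) (by
        intro x hx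
        rw [Set.uIoc_of_le hab] at hx
        exact hT₀ x (S T) hx.1.le hx.2 hT)
    refine this.trans_lt ?_
    rw [abs_of_nonneg (sub_nonneg.mpr hab), div_mul_eq_mul_div, div_lt_iff₀ (by linarith)]
    nlinarith
  have h1 := hhor (fun T => -T) (by simpa using tendsto_abs_atTop_atTop)
  have h2 := hhor (fun T => T) tendsto_abs_atTop_atTop
  have h3 := intervalIntegral_tendsto_integral ha tendsto_neg_atTop_atBot tendsto_id
  have h4 := intervalIntegral_tendsto_integral hb tendsto_neg_atTop_atBot tendsto_id
  have h5 := ((h1.sub h2).add (h4.const_smul Complex.I)).sub (h3.const_smul Complex.I)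
  have h6 : Tendsto (fun _ : ℝ => (0 : ℂ)) atTop
      (nhds (0 - 0 + Complex.I • (∫ t : ℝ, g (b + t * Complex.I)) -
        Complex.I • ∫ t : ℝ, g (a + t * Complex.I))) := by
    refine h5.congr (fun T => ?_)
    exact key T
  have h7 := tendsto_nhds_unique h6 tendsto_const_nhds
  simp only [sub_zero, zero_add, smul_eq_mul, ← mul_sub] at h7
  rcases mul_eq_zero.mp h7 with h | h
  · exact absurd h Complex.I_ne_zero
  · exact (sub_eq_zero.mp h).symm

end ContourShift

section Parseval

open scoped FourierTransform SchwartzMap ComplexConjugate ContDiff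

set_option maxHeartbeats 1000000 in
lemma fourier_toLp_ae_eq {f : ℝ → ℂ} (h1 : Integrable f) (h2 : MemLp f 2) :
    (𝓕 (h2.toLp f : Lp ℂ 2 (volume : Measure ℝ)) : Lp ℂ 2 (volume : Measure ℝ)) =ᵐ[volume] 𝓕 f := by
  have hcont : Continuous (𝓕 f) :=
    VectorFourier.fourierIntegral_continuous Real.continuous_fourierChar
      (by exact continuous_inner) h1
  apply ae_eq_of_integral_contDiff_smul_eq
  · exact (Lp.memLp _).locallyIntegrable (by norm_num)
  · exact hcont.locallyIntegrable
  intro g hg hgc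
  have hg' : ContDiff ℝ ∞ (fun x => (g x : ℂ)) := Complex.ofRealCLM.contDiff.comp hg
  have hgc' : HasCompactSupport (fun x => (g x : ℂ)) := 
    hgc.comp_left (g := ((↑) : ℝ → ℂ)) Complex.ofReal_zero
  set φ : 𝓢(ℝ, ℂ) := hgc'.toSchwartzMap hg' with hφ
  have hφg : ∀ x, φ x = (g x : ℂ) := fun x => rfl
  have e1 : ∀ F : Lp ℂ 2 (volume : Measure ℝ), ∫ x, g x • F x = Lp.toTemperedDistribution F φ := by
    intro F
    rw [Lp.toTemperedDistribution_apply]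
    rfl
  rw [e1, ← Lp.fourier_toTemperedDistribution_eq, TemperedDistribution.fourier_apply,
    Lp.toTemperedDistribution_apply]
  have e2 : ∫ x, (𝓕 φ) x • (h2.toLp f : Lp ℂ 2 (volume : Measure ℝ)) x =
      ∫ x, (𝓕 (φ : ℝ → ℂ)) x • f x := by
    apply integral_congr_ae
    filter_upwards [h2.coeFn_toLp] with x hx
    rw [hx, SchwartzMap.fourier_coe]
  rw [e2]
  have := VectorFourier.integral_fourierIntegral_smul_eq_flip (L := innerₗ ℝ)
      Real.continuous_fourierChar continuous_inner φ.integrable h1 (μ := volume) (ν := volume)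
  rw [flip_innerₗ] at this
  have e3 : ∫ x, (𝓕 (φ : ℝ → ℂ)) x • f x = ∫ x, φ x • (𝓕 f) x := this
  rw [e3]
  rfl

lemma memLp_fourier {f : ℝ → ℂ} (h1 : Integrable f) (h2 : MemLp f 2) : MemLp (𝓕 f) 2 :=
  (memLp_congr_ae (fourier_toLp_ae_eq h1 h2)).mp (Lp.memLp _)

lemma integral_conj_mul_eq_fourier {f g : ℝ → ℂ} (hf1 : Integrable f) (hf2 : MemLp f 2)
    (hg1 : Integrable g) (hg2 : MemLp g 2) :
    ∫ x, conj (f x) * g x = ∫ w, conj (𝓕 f w) * 𝓕 g w := by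
  have h := Lp.inner_fourier_eq (hf2.toLp f : Lp ℂ 2 (volume : Measure ℝ)) (hg2.toLp g)
  rw [L2.inner_def, L2.inner_def] at h
  have e1 : ∫ a, inner ℂ ((hf2.toLp f : Lp ℂ 2 (volume : Measure ℝ)) a)
      ((hg2.toLp g : Lp ℂ 2 (volume : Measure ℝ)) a) = ∫ x, conj (f x) * g x := by
    apply integral_congr_ae
    filter_upwards [hf2.coeFn_toLp, hg2.coeFn_toLp] with x h1 h2
    rw [h1, h2, RCLike.inner_apply, mul_comm]
  have e2 := integral_congr_ae (μ := volume) (f := fun a => inner ℂ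
    ((𝓕 (hf2.toLp f : Lp ℂ 2 (volume : Measure ℝ)) : Lp ℂ 2 (volume : Measure ℝ)) a)
    ((𝓕 (hg2.toLp g : Lp ℂ 2 (volume : Measure ℝ)) : Lp ℂ 2 (volume : Measure ℝ)) a))
    (g := fun w => conj (𝓕 f w) * 𝓕 g w) (by
      filter_upwards [fourier_toLp_ae_eq hf1 hf2, fourier_toLp_ae_eq hg1 hg2] with x h1 h2
      rw [h1, h2, RCLike.inner_apply, mul_comm])
  rw [← e1, ← e2]
  exact h.symm

/-- The Fourier integral in the normalization `∫ f(y) e^{-ity} dy`. -/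
noncomputable def lineFourier (f : ℝ → ℂ) (t : ℝ) : ℂ :=
  ∫ y : ℝ, f y * Complex.exp (-(t * y * Complex.I))

lemma fourier_eq_lineFourier (f : ℝ → ℂ) (w : ℝ) : 𝓕 f w = lineFourier f (2 * π * w) := by
  rw [Real.fourier_real_eq_integral_exp_smul, lineFourier]
  congr 1
  ext y
  rw [smul_eq_mul, mul_comm]
  congr 2
  push_cast
  ring

lemma lineFourier_eq_fourier (f : ℝ → ℂ) : lineFourier f = fun t => 𝓕 f (t / (2 * π)) := by
  ext t
  rw [fourier_eq_lineFourier]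
  congr 1
  field_simp

lemma continuous_lineFourier {f : ℝ → ℂ} (h : Integrable f) : Continuous (lineFourier f) := by
  have hcont : Continuous (𝓕 f) :=
    VectorFourier.fourierIntegral_continuous Real.continuous_fourierChar
      (by exact continuous_inner) h
  rw [lineFourier_eq_fourier]
  exact hcont.comp (by fun_prop)

lemma memLp_lineFourier {f : ℝ → ℂ} (h1 : Integrable f) (h2 : MemLp f 2) :
    MemLp (lineFourier f) 2 := by
  rw [memLp_two_iff_integrable_sq_norm (continuous_lineFourier h1).aestronglyMeasurable]
  have h := memLp_fourier h1 h2
  rw [memLp_two_iff_integrable_sq_norm h.1] at h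
  have := h.comp_div (show (2 * π : ℝ) ≠ 0 by positivity)
  rwa [lineFourier_eq_fourier]

lemma integral_conj_mul_eq_lineFourier {f g : ℝ → ℂ} (hf1 : Integrable f) (hf2 : MemLp f 2)
    (hg1 : Integrable g) (hg2 : MemLp g 2) :
    ∫ x, conj (f x) * g x =
      (1 / (2 * π)) * ∫ t, conj (lineFourier f t) * lineFourier g t := by
  rw [integral_conj_mul_eq_fourier hf1 hf2 hg1 hg2, lineFourier_eq_fourier, lineFourier_eq_fourier]
  rw [Measure.integral_comp_div (fun t => conj (𝓕 f t) * 𝓕 g t) (2 * π)]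
  rw [abs_of_pos (by positivity), Complex.real_smul]
  push_cast
  field_simp

lemma integral_norm_sq_eq_lineFourier {f : ℝ → ℂ} (hf1 : Integrable f) (hf2 : MemLp f 2) :
    ∫ x, ‖f x‖ ^ 2 = (1 / (2 * π)) * ∫ t, ‖lineFourier f t‖ ^ 2 := by
  have h := integral_conj_mul_eq_lineFourier hf1 hf2 hf1 hf2
  simp only [Complex.conj_mul', ← Complex.ofReal_pow] at h
  rw [integral_complex_ofReal, integral_complex_ofReal] at h
  exact_mod_cast h

end Parseval

section LaplaceTransform

open scoped ComplexConjugate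

lemma abs_mul_exp_le {x x₀ δ y : ℝ} (hδ : 0 < δ) (hx : |x - x₀| ≤ δ / 2) :
    |y| * Real.exp (x * y) ≤
      2 / δ * (Real.exp ((x₀ + δ) * y) + Real.exp ((x₀ - δ) * y)) := by
  have h1 : |y| ≤ 2 / δ * Real.exp (δ / 2 * |y|) := by
    have := Real.add_one_le_exp (δ / 2 * |y|)
    rw [div_mul_eq_mul_div, le_div_iff₀ hδ]
    nlinarith
  have h2 : Real.exp (x * y) ≤ Real.exp (x₀ * y + δ / 2 * |y|) := by
    apply Real.exp_le_exp.mpr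
    have : (x - x₀) * y ≤ δ / 2 * |y| :=
      (le_abs_self _).trans (by rw [abs_mul]; gcongr)
    linarith
  have h3 : Real.exp (x₀ * y + δ * |y|) ≤
      Real.exp ((x₀ + δ) * y) + Real.exp ((x₀ - δ) * y) := by
    rcases abs_cases y with ⟨h, _⟩ | ⟨h, _⟩
    · rw [h, show x₀ * y + δ * y = (x₀ + δ) * y by ring]
      linarith [Real.exp_pos ((x₀ - δ) * y)]
    · rw [h, show x₀ * y + δ * -y = (x₀ - δ) * y by ring]
      linarith [Real.exp_pos ((x₀ + δ) * y)]
  calc |y| * Real.exp (x * y)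
      ≤ (2 / δ * Real.exp (δ / 2 * |y|)) * Real.exp (x₀ * y + δ / 2 * |y|) := by gcongr
    _ = 2 / δ * Real.exp (x₀ * y + δ * |y|) := by
        rw [mul_assoc, ← Real.exp_add]; congr 2; ring
    _ ≤ _ := by gcongr

lemma norm_cexp_mul_ofReal (s : ℂ) (y : ℝ) : ‖Complex.exp (s * y)‖ = Real.exp (s.re * y) := by
  rw [Complex.norm_exp]; simp

/-- Two-sided Laplace transforms are holomorphic inside the strip of absolute convergence. -/
lemma differentiableAt_integral_mul_cexp {ψ : ℝ → ℂ} {s₀ : ℂ} {δ : ℝ} (hδ : 0 < δ)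
    (hm : AEStronglyMeasurable ψ)
    (h1 : Integrable fun y : ℝ => ‖ψ y‖ * Real.exp ((s₀.re + δ) * y))
    (h2 : Integrable fun y : ℝ => ‖ψ y‖ * Real.exp ((s₀.re - δ) * y)) :
    DifferentiableAt ℂ (fun s : ℂ => ∫ y : ℝ, ψ y * Complex.exp (s * y)) s₀ := by
  have hmeas : ∀ s : ℂ, AEStronglyMeasurable (fun y : ℝ => ψ y * Complex.exp (s * y)) := fun s =>
    hm.mul (by fun_prop : Continuous fun y : ℝ => Complex.exp (s * y)).aestronglyMeasurable
  have hmain := hasDerivAt_integral_of_dominated_loc_of_deriv_le (μ := volume)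
    (F := fun (s : ℂ) (y : ℝ) => ψ y * Complex.exp (s * y))
    (F' := fun (s : ℂ) (y : ℝ) => ψ y * (Complex.exp (s * y) * y)) (x₀ := s₀)
    (s := Metric.ball s₀ (δ / 2))
    (bound := fun y => 2 / δ * (‖ψ y‖ * Real.exp ((s₀.re + δ) * y) +
      ‖ψ y‖ * Real.exp ((s₀.re - δ) * y)))
    (Metric.ball_mem_nhds _ (by positivity))
    (Eventually.of_forall hmeas) ?_ ?_ ?_ ?_ ?_
  · exact hmain.2.differentiableAt
  · apply (h1.add h2).mono' (hmeas s₀)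
    filter_upwards with y
    rw [norm_mul, norm_cexp_mul_ofReal]
    simp only [Pi.add_apply]
    rw [← mul_add]
    gcongr
    rcases le_total 0 y with hy | hy
    · have : Real.exp (s₀.re * y) ≤ Real.exp ((s₀.re + δ) * y) := by
        apply Real.exp_le_exp.mpr; nlinarith
      linarith [Real.exp_pos ((s₀.re - δ) * y)]
    · have : Real.exp (s₀.re * y) ≤ Real.exp ((s₀.re - δ) * y) := by
        apply Real.exp_le_exp.mpr; nlinarith
      linarith [Real.exp_pos ((s₀.re + δ) * y)]
  · exact hm.mul (by fun_prop : Continuous fun y : ℝ =>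
      Complex.exp (s₀ * y) * (y : ℂ)).aestronglyMeasurable
  · filter_upwards with y s hs
    rw [norm_mul, norm_mul, norm_cexp_mul_ofReal, Complex.norm_real, Real.norm_eq_abs,
      mul_comm (Real.exp _)]
    have hx : |s.re - s₀.re| ≤ δ / 2 := by
      rw [← Complex.sub_re]
      exact (Complex.abs_re_le_norm _).trans (mem_ball_iff_norm.mp hs).le
    calc _ ≤ ‖ψ y‖ * (2 / δ * (Real.exp ((s₀.re + δ) * y) + Real.exp ((s₀.re - δ) * y))) := by
          exact mul_le_mul_of_nonneg_left (abs_mul_exp_le hδ hx) (norm_nonneg _)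
      _ = _ := by ring
  · exact (h1.add h2).const_mul _
  · filter_upwards with y s hs
    have h : HasDerivAt (fun s : ℂ => s * (y : ℂ)) (y : ℂ) s := by
      simpa using (hasDerivAt_id s).mul_const (y : ℂ)
    exact h.cexp.const_mul _

/-- Mean-square bound obtained by shifting the contour in Parseval's formula. -/
lemma integral_sq_le_of_laplace {ℓ : ℝ → ℝ} (hℓ : Measurable ℓ)
    (hloc : ∀ Y : ℝ, ∃ C : ℝ, ∀ y, 0 < y → y ≤ Y → |ℓ y| ≤ C)
    {σ σ₀ : ℝ} (hσ : 0 < σ) (hσσ : σ ≤ σ₀)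
    (h1 : Integrable ((Ioi 0).indicator fun y => ((ℓ y * Real.exp (-σ₀ * y) : ℝ) : ℂ)))
    (h2 : MemLp ((Ioi 0).indicator fun y => ((ℓ y * Real.exp (-σ₀ * y) : ℝ) : ℂ)) 2)
    {G : ℂ → ℂ} (hG : DifferentiableOn ℂ G {s | 0 < s.re})
    (hGℓ : ∀ t : ℝ, G (σ₀ + t * Complex.I) =
      ∫ y in Ioi (0 : ℝ), ℓ y * Complex.exp (-(σ₀ + t * Complex.I) * y))
    (hdecay : ∀ ε > 0, ∃ T₀ : ℝ, ∀ x t : ℝ, σ ≤ x → x ≤ σ₀ → T₀ ≤ |t| →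
      ‖G (x + t * Complex.I)‖ ≤ ε)
    (hK : Integrable fun t : ℝ => ‖G (σ + t * Complex.I)‖ ^ 2) (Y : ℝ) :
    ∫ y in Ioc 0 Y, (ℓ y) ^ 2 * Real.exp (-(2 * σ) * y) ≤
      1 / (2 * π) * ∫ t : ℝ, ‖G (σ + t * Complex.I)‖ ^ 2 := by
  obtain ⟨C, hC⟩ := hloc Y
  set f₀ : ℝ → ℂ := (Ioi 0).indicator fun y => ((ℓ y * Real.exp (-σ₀ * y) : ℝ) : ℂ) with hf₀
  set ψ : ℝ → ℝ := (Ioc 0 Y).indicator fun y => ℓ y * Real.exp (-(2 * σ) * y) with hψ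
  have hψm : Measurable ψ := (hℓ.mul (by fun_prop)).indicator measurableSet_Ioc
  have hψb : ∀ x : ℝ, ∀ y, |ψ y * Real.exp (x * y)| ≤
      (Ioc 0 Y).indicator (fun _ => C * Real.exp (|x| * Y)) y := by
    intro x y
    by_cases hy : y ∈ Ioc 0 Y
    · rw [hψ, indicator_of_mem hy, indicator_of_mem hy, abs_mul, abs_mul, Real.abs_exp,
        Real.abs_exp]
      have hC0 : 0 ≤ C := (abs_nonneg _).trans (hC y hy.1 hy.2)
      have e1 : Real.exp (-(2 * σ) * y) ≤ 1 := by
        rw [Real.exp_le_one_iff]; nlinarith [hy.1]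
      have e2 : Real.exp (x * y) ≤ Real.exp (|x| * Y) := by
        apply Real.exp_le_exp.mpr
        exact (mul_le_mul_of_nonneg_right (le_abs_self x) hy.1.le).trans
          (mul_le_mul_of_nonneg_left hy.2 (abs_nonneg x))
      calc |ℓ y| * Real.exp (-(2 * σ) * y) * Real.exp (x * y)
          ≤ C * 1 * Real.exp (|x| * Y) := by
            gcongr
            exact hC y hy.1 hy.2
        _ = _ := by ring
    · rw [hψ, indicator_of_notMem hy, indicator_of_notMem hy]; simp
  set p : ℝ → ℝ → ℂ := fun x y => ((ψ y * Real.exp (x * y) : ℝ) : ℂ) with hp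
  have hpm : ∀ x, Measurable (p x) := fun x =>
    Complex.measurable_ofReal.comp (hψm.mul (by fun_prop))
  have hpb : ∀ x y, ‖p x y‖ ≤ (Ioc 0 Y).indicator (fun _ => C * Real.exp (|x| * Y)) y := by
    intro x y
    rw [hp, Complex.norm_real]; exact hψb x y
  have hind : ∀ c : ℝ, Integrable ((Ioc 0 Y).indicator (fun _ : ℝ => c)) := fun c =>
    (integrable_indicator_iff measurableSet_Ioc).mpr (by simp [integrableOn_const_iff])
  have hpi : ∀ x, Integrable (p x) := fun x =>
    (hind _).mono' (hpm x).aestronglyMeasurable (Eventually.of_forall (hpb x))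
  have hp2 : ∀ x, MemLp (p x) 2 := by
    intro x
    rw [memLp_two_iff_integrable_sq_norm (hpm x).aestronglyMeasurable]
    apply (hind ((C * Real.exp (|x| * Y)) ^ 2)).mono'
      ((hpm x).norm.pow_const 2).aestronglyMeasurable
    filter_upwards with y
    rw [Real.norm_of_nonneg (by positivity)]
    have := pow_le_pow_left₀ (norm_nonneg _) (hpb x y) 2
    refine this.trans (le_of_eq ?_)
    by_cases hy : y ∈ Ioc 0 Y <;> simp [hy]
  set Φ : ℂ → ℂ := fun s => ∫ y : ℝ, (ψ y : ℂ) * Complex.exp (s * y) with hΦ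
  have hΦd : Differentiable ℂ Φ := by
    intro s
    have hi : ∀ x : ℝ, Integrable fun y : ℝ => ‖(ψ y : ℂ)‖ * Real.exp (x * y) := by
      intro x
      refine (hpi x).norm.congr (Eventually.of_forall fun y => ?_)
      simp only [hp, Complex.norm_real, norm_mul, Real.norm_eq_abs, Real.abs_exp]
    exact differentiableAt_integral_mul_cexp one_pos
      (Complex.measurable_ofReal.comp hψm).aestronglyMeasurable (hi _) (hi _)
  have hΦp : ∀ x t : ℝ, conj (lineFourier (p x) t) = Φ (x + t * Complex.I) := by
    intro x t
    rw [lineFourier, ← integral_conj, hΦ]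
    congr 1
    ext y
    rw [map_mul, hp, Complex.conj_ofReal, ← Complex.exp_conj]
    push_cast
    rw [mul_assoc, ← Complex.exp_add]
    congr 2
    simp
    ring
  have hfG : ∀ t : ℝ, lineFourier f₀ t = G (σ₀ + t * Complex.I) := by
    intro t
    rw [hGℓ, lineFourier, ← integral_indicator measurableSet_Ioi]
    congr 1
    ext y
    by_cases hy : y ∈ Ioi (0 : ℝ)
    · rw [indicator_of_mem hy, hf₀, indicator_of_mem hy]
      push_cast
      rw [mul_assoc, ← Complex.exp_add]
      congr 2
      ring
    · rw [indicator_of_notMem hy, hf₀, indicator_of_notMem hy, zero_mul]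
  have hGline : ∀ x : ℝ, 0 < x → Continuous fun t : ℝ => G (x + t * Complex.I) := by
    intro x hx
    apply hG.continuousOn.comp_continuous (by fun_prop)
    intro t
    simpa using hx
  have hσ₀ : 0 < σ₀ := hσ.trans_le hσσ
  have hGσ : MemLp (fun t : ℝ => G (σ + t * Complex.I)) 2 := by
    rwa [memLp_two_iff_integrable_sq_norm (hGline σ hσ).aestronglyMeasurable]
  have hGσ₀ : MemLp (fun t : ℝ => G (σ₀ + t * Complex.I)) 2 := by
    have := memLp_lineFourier h1 h2
    simpa only [← hfG] using this
  have hΦ2 : ∀ x : ℝ, MemLp (fun t : ℝ => Φ (x + t * Complex.I)) 2 := by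
    intro x
    have := memLp_lineFourier (hpi x) (hp2 x)
    have := this.star
    refine (memLp_congr_ae (Eventually.of_forall fun t => ?_)).mp this
    exact hΦp x t
  have hΦb : ∀ x t : ℝ, σ ≤ x → x ≤ σ₀ → ‖Φ (x + t * Complex.I)‖ ≤ ∫ y, ‖p σ₀ y‖ := by
    intro x t hx hx'
    refine (norm_integral_le_integral_norm _).trans ?_
    have hrw : (fun y : ℝ => ‖(ψ y : ℂ) * Complex.exp ((x + t * Complex.I) * y)‖) =
        fun y => ‖p x y‖ := by
      ext y
      rw [norm_mul, norm_cexp_mul_ofReal]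
      simp only [hp, Complex.norm_real, norm_mul, Real.norm_eq_abs, Real.abs_exp]
      simp
    rw [hrw]
    apply integral_mono (hpi x).norm (hpi σ₀).norm
    intro y
    simp only [hp, Complex.norm_real, norm_mul, Real.norm_eq_abs, Real.abs_exp]
    by_cases hy : y ∈ Ioc 0 Y
    · gcongr
      exact hy.1.le
    · rw [hψ, indicator_of_notMem hy]; simp
  have hshift := integral_vertical_eq_of_decay (g := fun s => Φ s * G s) hσσ
    (fun s hs _ => hΦd.differentiableAt.mul ((hG s (hσ.trans_le hs)).differentiableAt
      ((isOpen_lt continuous_const Complex.continuous_re).mem_nhds (hσ.trans_le hs))))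
    ((hΦ2 σ).integrable_mul hGσ) ((hΦ2 σ₀).integrable_mul hGσ₀) (by
      intro ε hε
      set B := ∫ y, ‖p σ₀ y‖
      have hB : 0 ≤ B := integral_nonneg fun _ => norm_nonneg _
      obtain ⟨T₀, hT₀⟩ := hdecay (ε / (B + 1)) (by positivity)
      refine ⟨T₀, fun x t hx hx' ht => ?_⟩
      rw [norm_mul]
      calc _ ≤ B * (ε / (B + 1)) := by
            gcongr
            · exact hΦb x t hx hx'
            · exact hT₀ x t hx hx' ht
        _ ≤ ε := by
            rw [mul_div_assoc', div_le_iff₀ (by positivity)]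
            nlinarith)
  set J := ∫ y in Ioc 0 Y, (ℓ y) ^ 2 * Real.exp (-(2 * σ) * y) with hJ
  have hJ1 : (J : ℂ) = 1 / (2 * π) * ∫ t : ℝ, Φ (σ + t * Complex.I) * G (σ + t * Complex.I) := by
    have := integral_conj_mul_eq_lineFourier (hpi σ₀) (hp2 σ₀) h1 h2
    simp only [hΦp] at this
    rw [hshift]
    simp only [← hfG]
    rw [← this, hJ, ← integral_complex_ofReal, ← integral_indicator measurableSet_Ioc]
    congr 1
    ext y
    by_cases hy : y ∈ Ioc 0 Y
    · rw [indicator_of_mem hy, hf₀, indicator_of_mem (show y ∈ Ioi (0 : ℝ) from hy.1), hp,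
        Complex.conj_ofReal, hψ]
      simp only [indicator_of_mem hy]
      norm_cast
      rw [show ℓ y * Real.exp (-(2 * σ) * y) * Real.exp (σ₀ * y) * (ℓ y * Real.exp (-σ₀ * y)) =
        (ℓ y) ^ 2 * Real.exp (-(2 * σ) * y) * (Real.exp (σ₀ * y) * Real.exp (-σ₀ * y)) by ring,
        ← Real.exp_add]
      simp
    · rw [indicator_of_notMem hy, hp, hψ]
      simp only [indicator_of_notMem hy]
      simp
  have hJ2 : ∫ t : ℝ, ‖Φ (σ + t * Complex.I)‖ ^ 2 = 2 * π * J := by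
    have := integral_norm_sq_eq_lineFourier (hpi σ) (hp2 σ)
    have e : ∀ t : ℝ, ‖lineFourier (p σ) t‖ = ‖Φ (σ + t * Complex.I)‖ := by
      intro t; rw [← hΦp, RCLike.norm_conj]
    simp only [e] at this
    have e2 : ∫ y, ‖p σ y‖ ^ 2 = J := by
      rw [hJ, ← integral_indicator measurableSet_Ioc]
      congr 1
      ext y
      simp only [hp, Complex.norm_real, Real.norm_eq_abs, sq_abs, hψ]
      by_cases hy : y ∈ Ioc 0 Y
      · simp only [indicator_of_mem hy]
        rw [show (ℓ y * Real.exp (-(2 * σ) * y) * Real.exp (σ * y)) ^ 2 = (ℓ y) ^ 2 *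
          (Real.exp (-(2 * σ) * y) * Real.exp (σ * y) * Real.exp (-(2 * σ) * y) *
            Real.exp (σ * y)) by ring, ← Real.exp_add, ← Real.exp_add, ← Real.exp_add]
        congr 2
        ring
      · simp only [indicator_of_notMem hy]; simp
    rw [e2] at this
    rw [this, ← mul_assoc, mul_one_div_cancel (by positivity), one_mul]
  have hJ3 : J ≤ 1 / (2 * π) * ∫ t : ℝ, (‖Φ (σ + t * Complex.I)‖ ^ 2 / 2 +
      ‖G (σ + t * Complex.I)‖ ^ 2 / 2) := by
    have h3 : J ≤ ‖(J : ℂ)‖ := by rw [Complex.norm_real]; exact le_abs_self J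
    refine h3.trans ?_
    rw [hJ1, norm_mul]
    have e : ‖(1 / (2 * π) : ℂ)‖ = 1 / (2 * π) := by
      rw [show (1 / (2 * π) : ℂ) = ((1 / (2 * π) : ℝ) : ℂ) by push_cast; rfl, Complex.norm_real,
        Real.norm_of_nonneg (by positivity)]
    rw [e]
    gcongr
    refine (norm_integral_le_integral_norm _).trans ?_
    apply integral_mono ((hΦ2 σ).integrable_mul hGσ).norm
    · exact ((hΦ2 σ).integrable_norm_pow (by norm_num)).div_const 2 |>.add (hK.div_const 2)
    · intro t
      change ‖Φ (σ + t * Complex.I) * G (σ + t * Complex.I)‖ ≤ _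
      rw [norm_mul]
      nlinarith [sq_nonneg (‖Φ (σ + t * Complex.I)‖ - ‖G (σ + t * Complex.I)‖)]
  rw [integral_add (((hΦ2 σ).integrable_norm_pow (by norm_num)).div_const 2) (hK.div_const 2),
    integral_div, integral_div, hJ2] at hJ3
  have e3 : 1 / (2 * π) * (2 * π * J / 2 + (∫ t : ℝ, ‖G (σ + t * Complex.I)‖ ^ 2) / 2) =
      J / 2 + (1 / (2 * π) * ∫ t : ℝ, ‖G (σ + t * Complex.I)‖ ^ 2) / 2 := by
    generalize (∫ t : ℝ, ‖G (σ + t * Complex.I)‖ ^ 2) = K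
    field_simp
  rw [e3] at hJ3
  linarith

end LaplaceTransform

section ZetaGrowth

lemma LSeries_eq_mul_integral_exp (f : ℕ → ℝ) {r : ℝ} (hr : 0 ≤ r) {s : ℂ} (hs : r < s.re)
    (hO : (fun n ↦ ∑ k ∈ Finset.Icc 1 n, f k) =O[atTop] fun n ↦ (n : ℝ) ^ r)
    (hf : ∀ n, 0 ≤ f n) :
    LSeries (fun n ↦ f n) s =
      s * ∫ y in Ioi (0 : ℝ), ((∑ k ∈ Finset.Icc 1 ⌊Real.exp y⌋₊, f k : ℝ) : ℂ) * Complex.exp (-s * y) := by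
  rw [LSeries_eq_mul_integral_of_nonneg f hr hs hO hf]
  congr 1
  have := integral_comp_exp_Ioi
    (fun t : ℝ => (∑ k ∈ Finset.Icc 1 ⌊t⌋₊, (f k : ℂ)) * (t : ℂ) ^ (-(s + 1))) 0
  rw [Real.exp_zero] at this
  rw [← this]
  refine setIntegral_congr_fun measurableSet_Ioi fun y _ => ?_
  simp only [Complex.real_smul]
  rw [Complex.cpow_def_of_ne_zero (by exact_mod_cast (Real.exp_pos y).ne'), ← Complex.ofReal_log
    (Real.exp_pos y).le, Real.log_exp]
  push_cast
  rw [mul_left_comm, ← Complex.exp_add]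
  congr 2
  ring

/-- The Laplace transform of the fractional part of `exp y`. -/
noncomputable def fractLaplace (w : ℂ) : ℂ :=
  ∫ y in Ioi (0 : ℝ), ((Int.fract (Real.exp y) : ℝ) : ℂ) * Complex.exp (-w * y)

lemma integrableOn_rexp_neg_mul_Ioi {c : ℝ} (hc : 0 < c) :
    IntegrableOn (fun y : ℝ => Real.exp (-c * y)) (Ioi 0) := by
  simpa using integrableOn_exp_mul_Ioi (neg_lt_zero.mpr hc) 0

lemma norm_fractLaplace_le {w : ℂ} (hw : 0 < w.re) : ‖fractLaplace w‖ ≤ 1 / w.re := by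
  unfold fractLaplace
  refine (norm_integral_le_of_norm_le (integrableOn_rexp_neg_mul_Ioi hw) ?_).trans ?_
  · refine Eventually.of_forall fun y => ?_
    rw [norm_mul, norm_cexp_mul_ofReal, Complex.norm_real, Complex.neg_re]
    have h0 := Int.fract_nonneg (Real.exp y)
    have h1 := (Int.fract_lt_one (Real.exp y)).le
    rw [Real.norm_of_nonneg h0]
    exact mul_le_of_le_one_left (Real.exp_pos _).le h1
  · have := integral_exp_mul_Ioi (neg_lt_zero.mpr hw) 0
    rw [this]
    simp

lemma differentiableAt_fractLaplace {w : ℂ} (hw : 0 < w.re) :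
    DifferentiableAt ℂ fractLaplace w := by
  set ψ : ℝ → ℂ := (Ioi (0:ℝ)).indicator fun y => ((Int.fract (Real.exp y) : ℝ) : ℂ) with hψ
  have hm : Measurable ψ := by
    refine Measurable.indicator ?_ measurableSet_Ioi
    exact Complex.measurable_ofReal.comp (measurable_fract.comp Real.measurable_exp)
  have hle : ∀ y, ‖ψ y‖ ≤ (Ioi (0:ℝ)).indicator (fun _ => (1:ℝ)) y := by
    intro y
    by_cases hy : y ∈ Ioi (0:ℝ)
    · simp only [hψ, indicator_of_mem hy, Complex.norm_real, Real.norm_eq_abs, Int.abs_fract]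
      exact (Int.fract_lt_one _).le
    · simp [hψ, indicator_of_notMem hy]
  have key : ∀ c : ℝ, c < 0 → Integrable fun y => ‖ψ y‖ * Real.exp (c * y) := by
    intro c hc
    have h1 : Integrable ((Ioi (0:ℝ)).indicator fun y => Real.exp (-(-c) * y)) :=
      (integrable_indicator_iff measurableSet_Ioi).2 (integrableOn_rexp_neg_mul_Ioi (by linarith))
    refine h1.mono' ?_ (Eventually.of_forall fun y => ?_)
    · exact (hm.norm.mul (by fun_prop)).aestronglyMeasurable
    · rw [norm_mul, norm_norm, Real.norm_of_nonneg (Real.exp_pos _).le]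
      refine (mul_le_mul_of_nonneg_right (hle y) (Real.exp_pos _).le).trans ?_
      by_cases hy : y ∈ Ioi (0:ℝ)
      · simp [indicator_of_mem hy]
      · simp [indicator_of_notMem hy]
  have h := differentiableAt_integral_mul_cexp (ψ := ψ) (s₀ := -w) (δ := w.re / 2) (by linarith)
    hm.aestronglyMeasurable (key _ (by simp; linarith)) (key _ (by simp; linarith))
  have h2 : fractLaplace = (fun s : ℂ => ∫ y, ψ y * Complex.exp (s * y)) ∘ fun w => -w := by
    funext w
    simp only [fractLaplace, Function.comp, hψ]
    rw [← integral_indicator measurableSet_Ioi]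
    congr 1
    funext y
    by_cases hy : y ∈ Ioi (0:ℝ)
    · simp [indicator_of_mem hy]
    · simp [indicator_of_notMem hy]
  rw [h2]
  exact DifferentiableAt.comp w h (by fun_prop)

lemma isPreconnected_re_pos : IsPreconnected {s : ℂ | 0 < s.re} :=
  (convex_halfSpace_re_gt 0).isPreconnected

lemma isOpen_re_pos : IsOpen {s : ℂ | 0 < s.re} :=
  isOpen_lt continuous_const Complex.continuous_re

lemma riemannZeta₁_eq_of_one_lt_re {w : ℂ} (hw : 1 < w.re) :
    riemannZeta₁ w = w - w * (w - 1) * fractLaplace w := by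
  have hne : w - 1 ≠ 0 := by
    intro h
    have := congrArg Complex.re h
    simp at this
    linarith
  have h1 : riemannZeta w = LSeries (fun _ => ((1 : ℝ) : ℂ)) w := by
    rw [← LSeries_one_eq_riemannZeta hw]
    simp only [Complex.ofReal_one]
    rfl
  have h2 := LSeries_eq_mul_integral_exp (fun _ => 1) zero_le_one hw (by
    refine Asymptotics.IsBigO.of_bound 1 (Eventually.of_forall fun n => ?_)
    simp) (fun _ => zero_le_one)
  have hint1 : IntegrableOn (fun y : ℝ => Complex.exp ((1 - w) * y)) (Ioi 0) :=
    integrableOn_exp_mul_complex_Ioi (by simp; linarith) 0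
  have hint2 : IntegrableOn (fun y : ℝ => ((Int.fract (Real.exp y) : ℝ) : ℂ) * Complex.exp (-w * y))
      (Ioi 0) := by
    refine (integrableOn_rexp_neg_mul_Ioi (c := w.re) (by linarith)).mono' ?_
      (Eventually.of_forall fun y => ?_)
    · refine Measurable.aestronglyMeasurable ?_
      exact (Complex.measurable_ofReal.comp (measurable_fract.comp Real.measurable_exp)).mul
        (by fun_prop)
    · rw [norm_mul, norm_cexp_mul_ofReal, Complex.norm_real, Complex.neg_re]
      have h0 := Int.fract_nonneg (Real.exp y)
      have h1 := (Int.fract_lt_one (Real.exp y)).le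
      rw [Real.norm_of_nonneg h0]
      exact mul_le_of_le_one_left (Real.exp_pos _).le h1
  have h3 : ∫ y in Ioi (0 : ℝ), ((∑ k ∈ Finset.Icc 1 ⌊Real.exp y⌋₊, (1:ℝ) : ℝ) : ℂ) * Complex.exp (-w * y)
      = 1 / (w - 1) - fractLaplace w := by
    have : ∫ y in Ioi (0 : ℝ), Complex.exp ((1 - w) * y) = 1 / (w - 1) := by
      rw [integral_exp_mul_complex_Ioi (by simp; linarith) 0]
      simp only [Complex.ofReal_zero, mul_zero, Complex.exp_zero]
      rw [← neg_sub w 1, neg_div_neg_eq]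
    rw [← this, fractLaplace, ← integral_sub hint1 hint2]
    refine setIntegral_congr_fun measurableSet_Ioi fun y _ => ?_
    simp only [Finset.sum_const, Nat.card_Icc, add_tsub_cancel_right, nsmul_eq_mul, mul_one]
    have hfl : ((⌊Real.exp y⌋₊ : ℝ)) = Real.exp y - Int.fract (Real.exp y) := by
      rw [natCast_floor_eq_intCast_floor (Real.exp_pos y).le, Int.self_sub_fract]
    rw [hfl]
    have : Complex.exp ((1 - w) * y) = Complex.exp y * Complex.exp (-w * y) := by
      rw [← Complex.exp_add]; congr 1; ring
    rw [this]
    push_cast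
    ring
  rw [h3] at h2
  have h4 := riemannZeta_eq_inv_sub_mul (s := w) (fun h => hne (by rw [h]; ring))
  rw [h1, h2] at h4
  field_simp at h4
  linear_combination -h4

lemma riemannZeta₁_eq {w : ℂ} (hw : 0 < w.re) :
    riemannZeta₁ w = w - w * (w - 1) * fractLaplace w := by
  have h1 : AnalyticOnNhd ℂ riemannZeta₁ {s : ℂ | 0 < s.re} :=
    differentiable_riemannZeta₁.differentiableOn.analyticOnNhd isOpen_re_pos
  have h2 : AnalyticOnNhd ℂ (fun w => w - w * (w - 1) * fractLaplace w) {s : ℂ | 0 < s.re} := by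
    refine DifferentiableOn.analyticOnNhd (fun s hs => ?_) isOpen_re_pos
    have := differentiableAt_fractLaplace hs
    exact (by fun_prop : DifferentiableAt ℂ _ s).differentiableWithinAt
  refine h1.eqOn_of_preconnected_of_eventuallyEq h2 isPreconnected_re_pos (z₀ := 2)
    (by simp) ?_ hw
  have : {s : ℂ | 1 < s.re} ∈ nhds (2:ℂ) :=
    (isOpen_lt continuous_const Complex.continuous_re).mem_nhds (by simp)
  filter_upwards [this] with s hs using riemannZeta₁_eq_of_one_lt_re hs

lemma norm_riemannZeta₁_le {w : ℂ} (hw : 0 < w.re) :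
    ‖riemannZeta₁ w‖ ≤ ‖w‖ + ‖w‖ * (‖w‖ + 1) / w.re := by
  rw [riemannZeta₁_eq hw]
  refine (norm_sub_le _ _).trans ?_
  gcongr
  rw [norm_mul, norm_mul, div_eq_mul_one_div]
  gcongr
  · exact (norm_sub_le _ _).trans (by simp)
  · exact norm_fractLaplace_le hw

end ZetaGrowth

section ZetaLowerBound

lemma exists_norm_LSeries_le {f : ℕ → ℂ} {σ : ℝ} (hf : LSeriesSummable f (σ : ℂ)) :
    ∃ C, 0 < C ∧ ∀ w : ℂ, σ ≤ w.re → ‖LSeries f w‖ ≤ C := by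
  refine ⟨∑' n, ‖LSeries.term f σ n‖ + 1, ?_, fun w hw => ?_⟩
  · have : 0 ≤ ∑' n, ‖LSeries.term f σ n‖ := tsum_nonneg fun n => norm_nonneg _
    linarith
  have hs : Summable fun n => ‖LSeries.term f σ n‖ := hf.norm
  have hle : ∀ n, ‖LSeries.term f w n‖ ≤ ‖LSeries.term f σ n‖ := fun n =>
    LSeries.norm_term_le_of_re_le_re f (by simpa using hw) n
  have hs' : Summable fun n => ‖LSeries.term f w n‖ :=
    hs.of_nonneg_of_le (fun _ => norm_nonneg _) hle
  have := (norm_tsum_le_tsum_norm hs').trans (hs'.tsum_le_tsum hle hs)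
  unfold LSeries
  linarith

lemma exists_norm_inv_riemannZeta_le :
    ∃ C, 0 < C ∧ ∀ w : ℂ, 3 / 2 ≤ w.re → ‖riemannZeta w‖ ≤ C ∧ 1 ≤ C * ‖riemannZeta w‖ ∧
      ‖deriv riemannZeta w / riemannZeta w‖ ≤ C := by
  obtain ⟨C₁, h₁, H₁⟩ := exists_norm_LSeries_le (f := 1) (σ := 3 / 2)
    (LSeriesSummable_one_iff.mpr (by norm_num))
  obtain ⟨C₂, h₂, H₂⟩ := exists_norm_LSeries_le (σ := 3 / 2)
    (ArithmeticFunction.LSeriesSummable_moebius_iff.mpr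
      (by norm_num : 1 < (((3 / 2 : ℝ)) : ℂ).re))
  obtain ⟨C₃, h₃, H₃⟩ := exists_norm_LSeries_le (σ := 3 / 2)
    (ArithmeticFunction.LSeriesSummable_vonMangoldt
      (by norm_num : 1 < (((3 / 2 : ℝ)) : ℂ).re))
  refine ⟨C₁ + C₂ + C₃, by positivity, fun w hw => ?_⟩
  have hw1 : 1 < w.re := by linarith
  refine ⟨?_, ?_, ?_⟩
  · rw [← LSeries_one_eq_riemannZeta hw1]
    linarith [H₁ w hw]
  · have h := ArithmeticFunction.LSeries_zeta_mul_Lseries_moebius hw1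
    rw [ArithmeticFunction.LSeries_zeta_eq_riemannZeta hw1] at h
    have h' := congrArg norm h
    rw [norm_mul, norm_one] at h'
    nlinarith [H₂ w hw, norm_nonneg (riemannZeta w)]
  · have h := ArithmeticFunction.LSeries_vonMangoldt_eq_deriv_riemannZeta_div hw1
    have : deriv riemannZeta w / riemannZeta w =
        -LSeries (fun n => (ArithmeticFunction.vonMangoldt n : ℂ)) w := by
      rw [h]; ring
    rw [this, norm_neg]
    linarith [H₃ w hw]

lemma exp_le_mul_norm_of_ball {g : ℂ → ℂ} {c : ℂ} {R r M : ℝ} (hR : r < R) (hM : 0 < M)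
    (hg : DifferentiableOn ℂ g (Metric.ball c R)) (h0 : ∀ z ∈ Metric.ball c R, g z ≠ 0)
    (hb : ∀ z ∈ Metric.ball c R, ‖g z‖ ≤ Real.exp M * ‖g c‖) {z : ℂ} (hz : ‖z - c‖ ≤ r) :
    ‖g c‖ ≤ Real.exp (2 * M * r / (R - r)) * ‖g z‖ := by
  have hr : 0 ≤ r := (norm_nonneg _).trans hz
  have hR0 : 0 < R := by linarith
  have hcm : c ∈ Metric.ball c R := Metric.mem_ball_self hR0
  have hd : DifferentiableOn ℂ (fun z => deriv g z / g z) (Metric.ball c R) :=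
    (hg.deriv Metric.isOpen_ball).div hg h0
  obtain ⟨F, hF0, hF⟩ := hd.isExactOn_ball.with_val_at c 0
  have hconst : ∀ z ∈ Metric.ball c R, g z * Complex.exp (-F z) = g c := by
    intro z hz
    have hD : ∀ x ∈ Metric.ball c R, HasDerivAt (fun z => g z * Complex.exp (-F z)) 0 x := by
      intro x hx
      have h1 : HasDerivAt g (deriv g x) x :=
        (hg.differentiableAt (Metric.isOpen_ball.mem_nhds hx)).hasDerivAt
      have h2 := h1.mul ((hF x hx).neg.cexp)
      have h3 := h0 x hx
      refine h2.congr_deriv ?_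
      field_simp
      ring
    have := (convex_ball c R).is_const_of_fderivWithin_eq_zero (𝕜 := ℂ)
      (f := fun z => g z * Complex.exp (-F z))
      (fun x hx => (hD x hx).differentiableAt.differentiableWithinAt) (fun x hx => by
        rw [fderivWithin_of_isOpen Metric.isOpen_ball hx]
        ext
        simpa using (hD x hx).deriv) hz hcm
    rw [this, hF0]
    simp
  have hnorm : ∀ z ∈ Metric.ball c R, ‖g z‖ = Real.exp (F z).re * ‖g c‖ := by
    intro z hz
    rw [← hconst z hz, norm_mul, Complex.norm_exp, Complex.neg_re, mul_left_comm, ← Real.exp_add]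
    simp
  have hgc : 0 < ‖g c‖ := norm_pos_iff.mpr (h0 c hcm)
  have hz' : z ∈ Metric.ball c R := by
    rw [Metric.mem_ball, dist_eq_norm]; linarith
  have hmap : ∀ x ∈ Metric.ball (0:ℂ) R, c + x ∈ Metric.ball c R := by
    intro x hx
    rw [Metric.mem_ball, dist_eq_norm] at hx ⊢
    simpa using hx
  have hBC := Complex.borelCaratheodory_zero (f := fun x => F (c + x)) (R := R) (M := M)
    (z := z - c) hM ?_ ?_ hR0 (by rw [Metric.mem_ball, dist_zero_right]; linarith)
    (by simpa using hF0)
  · rw [hnorm z hz', ← mul_assoc, ← Real.exp_add]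
    refine le_mul_of_one_le_left hgc.le (Real.one_le_exp ?_)
    simp only [add_sub_cancel] at hBC
    have h1 := (abs_le.mp ((Complex.abs_re_le_norm (F z)).trans hBC)).1
    have h2 : 2 * M * ‖z - c‖ / (R - ‖z - c‖) ≤ 2 * M * r / (R - r) := by
      gcongr
    linarith
  · intro x hx
    have := (hF _ (hmap x hx)).differentiableAt
    exact (DifferentiableAt.comp x this (by fun_prop)).differentiableWithinAt
  · intro x hx
    have h1 := hb _ (hmap x hx)
    rw [hnorm _ (hmap x hx)] at h1
    exact Real.exp_le_exp.mp (le_of_mul_le_mul_right h1 hgc)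

lemma riemannZeta₁_ne_zero (hRH : RiemannHypothesis) {w : ℂ} (hw : 1 / 2 < w.re) :
    riemannZeta₁ w ≠ 0 := by
  intro h
  by_cases h1 : w = 1
  · rw [h1] at h; simp at h
  have h2 : riemannZeta w = 0 := by rw [riemannZeta_eq_inv_sub_mul h1, h, mul_zero]
  have := hRH w h2 (by
    rintro ⟨n, hn⟩
    have := congrArg Complex.re hn
    simp at this
    have hn : (0:ℝ) ≤ n := n.cast_nonneg
    linarith) h1
  linarith

lemma riemannZeta₁_eq_mul {w : ℂ} (h1 : w ≠ 1) : riemannZeta₁ w = (w - 1) * riemannZeta w := by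
  rw [riemannZeta_eq_inv_sub_mul h1, mul_inv_cancel_left₀ (sub_ne_zero.mpr h1)]

lemma norm_riemannZeta₁_le_exp {w : ℂ} (hw : 1 / 2 ≤ w.re) :
    ‖riemannZeta₁ w‖ ≤ Real.exp (1 + 2 * ‖w‖) := by
  have h1 := norm_riemannZeta₁_le (w := w) (by linarith)
  have h2 : ‖w‖ * (‖w‖ + 1) / w.re ≤ ‖w‖ * (‖w‖ + 1) / (1 / 2) := by gcongr
  have h3 : 1 + ‖w‖ ≤ Real.exp ‖w‖ := by linarith [Real.add_one_le_exp ‖w‖]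
  have h4 : (2 : ℝ) ≤ Real.exp 1 := by linarith [Real.add_one_le_exp (1 : ℝ)]
  have h5 : (1 + ‖w‖) ^ 2 ≤ Real.exp ‖w‖ ^ 2 := by gcongr
  have h6 : Real.exp (1 + 2 * ‖w‖) = Real.exp 1 * Real.exp ‖w‖ ^ 2 := by
    rw [← Real.exp_nat_mul, ← Real.exp_add]; norm_num
  rw [h6]
  have h7 : 2 * (1 + ‖w‖) ^ 2 ≤ Real.exp 1 * Real.exp ‖w‖ ^ 2 := by gcongr
  nlinarith [norm_nonneg w]

lemma exists_one_le_exp_mul_norm_riemannZeta₁ (hRH : RiemannHypothesis) {h : ℝ} (hh : 0 < h)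
    (hh1 : h < 1) :
    ∃ C, 0 < C ∧ ∀ w : ℂ, 1 / 2 + h ≤ w.re →
      1 ≤ Real.exp (C * (1 + ‖w‖)) * ‖riemannZeta₁ w‖ := by
  obtain ⟨K, hK, HK⟩ := exists_norm_inv_riemannZeta_le
  have hlow : ∀ w : ℂ, 2 ≤ w.re → 1 ≤ Real.exp K * ‖riemannZeta₁ w‖ := by
    intro w hw
    have h1 : w ≠ 1 := by rintro rfl; norm_num at hw
    rw [riemannZeta₁_eq_mul h1, norm_mul]
    have h2 := (HK w (by linarith)).2.1
    have h3 : 1 ≤ ‖w - 1‖ := by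
      have := Complex.abs_re_le_norm (w - 1)
      rw [Complex.sub_re, Complex.one_re, abs_of_nonneg (by linarith)] at this
      linarith
    have h4 : K ≤ Real.exp K := by linarith [Real.add_one_le_exp K]
    calc (1:ℝ) ≤ K * ‖riemannZeta w‖ := h2
      _ ≤ Real.exp K * (1 * ‖riemannZeta w‖) := by rw [one_mul]; gcongr
      _ ≤ _ := by gcongr
  set q : ℝ := 2 * (3 / 2 - h) / (h / 2) with hq
  have hq0 : 0 ≤ q := by rw [hq]; apply div_nonneg <;> linarith
  refine ⟨K + q * (K + 20), by positivity, fun w hw => ?_⟩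
  rcases le_total 2 w.re with h2 | h2
  · refine (hlow w h2).trans ?_
    gcongr
    have : 0 ≤ q * (K + 20) := by positivity
    nlinarith [norm_nonneg w]
  set c : ℂ := ⟨2, w.im⟩ with hc
  have hcw : ‖w - c‖ ≤ 3 / 2 - h := by
    have : w - c = ((w.re - 2 : ℝ) : ℂ) := by
      apply Complex.ext <;> simp [hc]
    rw [this, Complex.norm_real, Real.norm_eq_abs, abs_le]
    constructor <;> linarith
  have hball : ∀ z ∈ Metric.ball c (3 / 2 - h / 2), 1 / 2 < z.re ∧ ‖z‖ ≤ ‖w‖ + 5 := by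
    intro z hz
    rw [Metric.mem_ball, dist_eq_norm] at hz
    constructor
    · have := (abs_le.mp (Complex.abs_re_le_norm (z - c))).1
      simp [hc] at this
      linarith
    · calc ‖z‖ = ‖(z - c) - (w - c) + w‖ := by ring_nf
        _ ≤ ‖z - c‖ + ‖w - c‖ + ‖w‖ := (norm_add_le _ _).trans (by gcongr; exact norm_sub_le _ _)
        _ ≤ _ := by linarith
  have hc2 := hlow c (by simp [hc])
  have key := exp_le_mul_norm_of_ball (g := riemannZeta₁) (c := c) (R := 3 / 2 - h / 2)
    (r := 3 / 2 - h) (M := K + (11 + 2 * ‖w‖)) (z := w) (by linarith) (by positivity)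
    differentiable_riemannZeta₁.differentiableOn
    (fun z hz => riemannZeta₁_ne_zero hRH (hball z hz).1) (fun z hz => by
      have h1 := norm_riemannZeta₁_le_exp (hball z hz).1.le
      calc ‖riemannZeta₁ z‖ ≤ Real.exp (11 + 2 * ‖w‖) := h1.trans (by
            rw [Real.exp_le_exp]; linarith [(hball z hz).2])
        _ ≤ Real.exp (11 + 2 * ‖w‖) * (Real.exp K * ‖riemannZeta₁ c‖) :=
            le_mul_of_one_le_right (Real.exp_pos _).le hc2
        _ = _ := by rw [Real.exp_add K]; ring) hcw
  calc (1:ℝ) ≤ Real.exp K * ‖riemannZeta₁ c‖ := hc2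
    _ ≤ Real.exp K * (Real.exp (2 * (K + (11 + 2 * ‖w‖)) * (3 / 2 - h) / (3 / 2 - h / 2 - (3 / 2 - h))) *
        ‖riemannZeta₁ w‖) := by gcongr
    _ = Real.exp (K + q * (K + (11 + 2 * ‖w‖))) * ‖riemannZeta₁ w‖ := by
        rw [← mul_assoc, ← Real.exp_add, hq]; congr 3; ring
    _ ≤ _ := by
        gcongr
        have : q * (K + (11 + 2 * ‖w‖)) ≤ q * (K + 20) * (1 + ‖w‖) := by
          rw [mul_assoc]
          gcongr
          nlinarith [norm_nonneg w]
        nlinarith [norm_nonneg w]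

end ZetaLowerBound

section CenteredXi

open scoped ComplexConjugate

/-- The Riemann `ξ` function (up to a factor `2`), recentred at the symmetry point `1 / 2`. -/
noncomputable def centeredXi (s : ℂ) : ℂ :=
  (s ^ 2 - 1 / 4) * completedRiemannZeta₀ (1 / 2 + s) + 1

lemma differentiable_centeredXi : Differentiable ℂ centeredXi := by
  have := differentiable_completedZeta₀
  unfold centeredXi
  fun_prop

lemma centeredXi_neg (s : ℂ) : centeredXi (-s) = centeredXi s := by
  unfold centeredXi
  rw [← completedRiemannZeta₀_one_sub]
  congr 3
  · ring
  · ring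

lemma centeredXi_eq {s : ℂ} (hs : -(1 / 2) < s.re) :
    centeredXi s = (1 / 2 + s) * Complex.Gammaℝ (1 / 2 + s) * riemannZeta₁ (1 / 2 + s) := by
  have hw0 : 0 < (1 / 2 + s).re := by simp; linarith
  have hopen : IsOpen {s : ℂ | -(1 / 2) < s.re} :=
    isOpen_lt continuous_const Complex.continuous_re
  have hne0 : ∀ z : ℂ, -(1 / 2) < z.re → (1 / 2 + z) ≠ 0 := by
    intro z hz h
    have := congrArg Complex.re h
    simp at this
    linarith
  have hgen : ∀ z : ℂ, -(1 / 2) < z.re → z ≠ 1 / 2 → centeredXi z =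
      (1 / 2 + z) * Complex.Gammaℝ (1 / 2 + z) * riemannZeta₁ (1 / 2 + z) := by
    intro z hz hz1
    have h0 := hne0 z hz
    have hG : Complex.Gammaℝ (1 / 2 + z) ≠ 0 :=
      Complex.Gammaℝ_ne_zero_of_re_pos (by simp; linarith)
    have h1 : (1 / 2 + z) ≠ 1 := by
      intro h; apply hz1; linear_combination h
    have h2 : 1 - (1 / 2 + z) ≠ 0 := fun h => h1 (by linear_combination -h)
    rw [riemannZeta₁_eq_mul h1, riemannZeta_def_of_ne_zero h0, completedRiemannZeta_eq, centeredXi]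
    generalize completedRiemannZeta₀ (1 / 2 + z) = A
    generalize Complex.Gammaℝ (1 / 2 + z) = G at hG ⊢
    obtain ⟨w, rfl⟩ : ∃ w, z = w - 1 / 2 := ⟨z + 1 / 2, by ring⟩
    simp only [add_sub_cancel] at h0 h1 h2 ⊢
    field_simp
    ring
  by_cases h : s = 1 / 2
  · refine tendsto_nhds_unique (f := centeredXi) (l := nhdsWithin s {s}ᶜ)
      ((differentiable_centeredXi.continuous.tendsto s).mono_left nhdsWithin_le_nhds) ?_
    have hcont : ContinuousAt (fun z => (1 / 2 + z) * Complex.Gammaℝ (1 / 2 + z) *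
        riemannZeta₁ (1 / 2 + z)) s := by
      have h1 : DifferentiableAt ℂ Complex.Gammaℝ (1 / 2 + s) := by
        have := Complex.differentiable_Gammaℝ_inv.differentiableAt (x := 1 / 2 + s) |>.inv
          (inv_ne_zero (Complex.Gammaℝ_ne_zero_of_re_pos hw0))
        have h4 : (fun s : ℂ => (Complex.Gammaℝ s)⁻¹)⁻¹ = Complex.Gammaℝ := by
          funext z; simp
        rwa [h4] at this
      have h2 : ContinuousAt (fun z => Complex.Gammaℝ (1 / 2 + z)) s :=
        ContinuousAt.comp (f := fun z : ℂ => 1 / 2 + z) h1.continuousAt (by fun_prop)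
      have h3 : ContinuousAt (fun z => riemannZeta₁ (1 / 2 + z)) s :=
        (differentiable_riemannZeta₁.continuous.comp (by fun_prop)).continuousAt
      exact ((by fun_prop : ContinuousAt (fun z : ℂ => 1 / 2 + z) s).mul h2).mul h3
    refine Tendsto.congr' ?_ (hcont.tendsto.mono_left nhdsWithin_le_nhds)
    have hev : ∀ᶠ z in nhdsWithin s {s}ᶜ, -(1 / 2) < z.re :=
      nhdsWithin_le_nhds (hopen.mem_nhds hs)
    filter_upwards [hev, self_mem_nhdsWithin] with z hz hz1
    exact (hgen z hz (by rw [← h]; exact hz1)).symm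
  · exact hgen s hs h

lemma riemannZeta₁_conj (w : ℂ) : riemannZeta₁ (conj w) = conj (riemannZeta₁ w) := by
  by_cases h : w = 1
  · simp [h]
  · have h' : conj w ≠ 1 := by
      intro h2
      apply h
      rw [← Complex.conj_conj w, h2, map_one]
    rw [riemannZeta₁_eq_mul h, riemannZeta₁_eq_mul h', riemannZeta_conj]
    simp

lemma Gammaℝ_conj (w : ℂ) : Complex.Gammaℝ (conj w) = conj (Complex.Gammaℝ w) := by
  have hpi : Complex.arg (π : ℂ) ≠ π := by
    rw [Complex.arg_ofReal_of_nonneg Real.pi_pos.le]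
    exact Real.pi_pos.ne
  rw [Complex.Gammaℝ_def, Complex.Gammaℝ_def, map_mul, ← Complex.Gamma_conj]
  congr 1
  · have h := Complex.cpow_conj (π : ℂ) (-w / 2) hpi
    rw [Complex.conj_ofReal] at h
    rw [← h]
    simp [map_ofNat]
  · simp [map_ofNat]

lemma centeredXi_conj {s : ℂ} (hs : -(1 / 2) < s.re) :
    centeredXi (conj s) = conj (centeredXi s) := by
  rw [centeredXi_eq hs, centeredXi_eq (by simpa using hs)]
  have : (1 / 2 + conj s) = conj (1 / 2 + s) := by simp [map_ofNat]
  rw [this, Gammaℝ_conj, riemannZeta₁_conj]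
  simp

lemma centeredXi_ne_zero (hRH : RiemannHypothesis) {s : ℂ} (hs : 0 < s.re) :
    centeredXi s ≠ 0 := by
  rw [centeredXi_eq (by linarith)]
  have hw : 1 / 2 < (1 / 2 + s).re := by simpa using hs
  refine mul_ne_zero (mul_ne_zero ?_ (Complex.Gammaℝ_ne_zero_of_re_pos (by linarith)))
    (riemannZeta₁_ne_zero hRH hw)
  intro h
  rw [h] at hw
  norm_num at hw

lemma norm_Gamma_le_mul_norm_Gamma_add {z : ℂ} {a h : ℝ} (ha : 0 < a) (hh : 0 < h)
    (hz : a ≤ z.re) :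
    ‖Complex.Gamma z‖ ≤ (∫ x in (0:ℝ)..1, x ^ (a - 1) * (1 - x) ^ (h - 1)) / Real.Gamma h *
      ‖Complex.Gamma (z + h)‖ := by
  have hΓ : 0 < Real.Gamma h := Real.Gamma_pos_of_pos hh
  have hconv : IntervalIntegrable (fun x : ℝ => x ^ (a - 1) * (1 - x) ^ (h - 1)) volume 0 1 := by
    have := Complex.betaIntegral_convergent (u := (a:ℂ)) (v := (h : ℂ)) (by simpa) (by simpa)
    have h2 := this.norm
    refine h2.congr fun x hx => ?_
    rw [uIoc_of_le zero_le_one] at hx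
    rcases hx.2.lt_or_eq with h1 | h1
    · have h1x : 0 < 1 - x := by linarith
      rw [norm_mul, ← Complex.ofReal_one, ← Complex.ofReal_sub, ← Complex.ofReal_sub,
        ← Complex.ofReal_sub, Complex.norm_cpow_eq_rpow_re_of_pos hx.1,
        Complex.norm_cpow_eq_rpow_re_of_pos h1x]
      simp
    · subst h1
      by_cases hh1 : h = 1
      · simp [hh1]
      · have h3 : (h - 1 : ℝ) ≠ 0 := sub_ne_zero.mpr hh1
        have h4 : (h - 1 : ℂ) ≠ 0 := by exact_mod_cast h3
        simp [Real.zero_rpow h3, Complex.zero_cpow h4]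
  have hbeta := Complex.Gamma_mul_Gamma_eq_betaIntegral (s := z) (t := (h:ℂ)) (by linarith)
    (by simpa)
  have hle : ‖Complex.betaIntegral z h‖ ≤ ∫ x in (0:ℝ)..1, x ^ (a - 1) * (1 - x) ^ (h - 1) := by
    unfold Complex.betaIntegral
    refine intervalIntegral.norm_integral_le_of_norm_le zero_le_one ?_ hconv
    refine Eventually.mono (compl_mem_ae_iff.mpr (measure_singleton (1:ℝ))) ?_
    intro x hx1 hx
    have h1x : 0 < 1 - x := by
      have : x < 1 := lt_of_le_of_ne hx.2 hx1
      linarith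
    rw [norm_mul, ← Complex.ofReal_one, ← Complex.ofReal_sub, Complex.norm_cpow_eq_rpow_re_of_pos hx.1,
      Complex.norm_cpow_eq_rpow_re_of_pos h1x]
    simp only [Complex.sub_re, Complex.ofReal_re]
    have : x ^ (z.re - 1) ≤ x ^ (a - 1) :=
      Real.rpow_le_rpow_of_exponent_ge hx.1 hx.2 (by linarith)
    gcongr
  have h1 := congrArg norm hbeta
  rw [norm_mul, norm_mul, Complex.Gamma_ofReal, Complex.norm_real, Real.norm_of_nonneg hΓ.le] at h1
  rw [div_mul_eq_mul_div, le_div_iff₀ hΓ, h1, mul_comm]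
  gcongr

end CenteredXi

section XiMonotone

open scoped ComplexConjugate

lemma norm_riemannZeta₁_le_mul_exp {w : ℂ} {δ : ℝ} (hδ : 0 < δ) (hw : δ ≤ w.re) :
    ‖riemannZeta₁ w‖ ≤ (1 + 1 / δ) * Real.exp (2 * ‖w‖) := by
  have h1 := norm_riemannZeta₁_le (w := w) (by linarith)
  have h2 : ‖w‖ * (‖w‖ + 1) / w.re ≤ ‖w‖ * (‖w‖ + 1) / δ := by gcongr
  have h3 : 1 + ‖w‖ ≤ Real.exp ‖w‖ := by linarith [Real.add_one_le_exp ‖w‖]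
  have h5 : (1 + ‖w‖) ^ 2 ≤ Real.exp ‖w‖ ^ 2 := by gcongr
  have h6 : Real.exp (2 * ‖w‖) = Real.exp ‖w‖ ^ 2 := by
    rw [← Real.exp_nat_mul]; norm_num
  rw [h6]
  refine le_trans ?_ (mul_le_mul_of_nonneg_left h5 (by positivity))
  have h7 : ‖w‖ * (‖w‖ + 1) / δ ≤ 1 / δ * (1 + ‖w‖) ^ 2 := by
    rw [div_eq_mul_one_div, mul_comm]
    gcongr
    nlinarith [norm_nonneg w]
  nlinarith [norm_nonneg w]

lemma exists_norm_Gammaℝ_sub_le {h : ℝ} (hh : 0 < h) (hh1 : h < 1 / 2) :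
    ∃ K, 0 < K ∧ ∀ w : ℂ, 1 / 2 ≤ w.re →
      ‖Complex.Gammaℝ (w - h)‖ ≤ K * ‖Complex.Gammaℝ (w + h)‖ := by
  set a : ℝ := (1 / 2 - h) / 2
  set K₀ := (∫ x in (0:ℝ)..1, x ^ (a - 1) * (1 - x) ^ (h - 1)) / Real.Gamma h
  refine ⟨π ^ h * |K₀| + 1, by positivity, fun w hw => ?_⟩
  have ha : 0 < a := by simp only [a]; linarith
  have key := norm_Gamma_le_mul_norm_Gamma_add (z := (w - h) / 2) ha hh (by
    simp [a]; linarith)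
  rw [Complex.Gammaℝ_def, Complex.Gammaℝ_def, norm_mul, norm_mul,
    Complex.norm_cpow_eq_rpow_re_of_pos Real.pi_pos,
    Complex.norm_cpow_eq_rpow_re_of_pos Real.pi_pos]
  have e1 : (w - h) / 2 + (h : ℂ) = (w + h) / 2 := by ring
  rw [e1] at key
  have e2 : (-(w - h) / 2).re = (-(w + h) / 2).re + h := by simp; ring
  rw [e2, Real.rpow_add Real.pi_pos]
  calc π ^ (-(w + h) / 2).re * π ^ h * ‖Complex.Gamma ((w - h) / 2)‖
      ≤ π ^ (-(w + h) / 2).re * π ^ h * (|K₀| * ‖Complex.Gamma ((w + h) / 2)‖) := by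
        gcongr
        exact key.trans (by gcongr; exact le_abs_self _)
    _ = π ^ h * |K₀| * (π ^ (-(w + h) / 2).re * ‖Complex.Gamma ((w + h) / 2)‖) := by ring
    _ ≤ _ := by
        gcongr
        linarith

lemma norm_sub_le_norm_add_of_re_nonneg {w : ℂ} {h : ℝ} (hh : 0 ≤ h) (hw : 0 ≤ w.re) :
    ‖w - h‖ ≤ ‖w + h‖ := by
  rw [← sq_le_sq₀ (norm_nonneg _) (norm_nonneg _), Complex.sq_norm, Complex.sq_norm,
    Complex.normSq_apply, Complex.normSq_apply]
  simp
  nlinarith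

lemma norm_centeredXi_sub_le (hRH : RiemannHypothesis) {h : ℝ} (hh : 0 < h) (hh1 : h < 1 / 2)
    {s : ℂ} (hs : 0 ≤ s.re) : ‖centeredXi (s - h)‖ ≤ ‖centeredXi (s + h)‖ := by
  obtain ⟨K, hK, HK⟩ := exists_norm_Gammaℝ_sub_le hh hh1
  obtain ⟨C, hC, HC⟩ := exists_one_le_exp_mul_norm_riemannZeta₁ hRH hh (by linarith)
  obtain ⟨Kz, hKz, HKz⟩ := exists_norm_inv_riemannZeta_le
  have hne : ∀ s : ℂ, -h < s.re → centeredXi (s + h) ≠ 0 := fun s hs =>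
    centeredXi_ne_zero hRH (by simp; linarith)
  have hbd : ∀ s : ℂ, 0 ≤ s.re → ‖centeredXi (s - h) / centeredXi (s + h)‖ ≤
      K * (‖riemannZeta₁ (1 / 2 + s - h)‖ / ‖riemannZeta₁ (1 / 2 + s + h)‖) := by
    intro s hs
    have h1 : 1 / 2 ≤ (1 / 2 + s).re := by simpa using hs
    have hz1 : riemannZeta₁ (1 / 2 + s + h) ≠ 0 := riemannZeta₁_ne_zero hRH (by simp; linarith)
    have hz2 : 0 < ‖riemannZeta₁ (1 / 2 + s + h)‖ := norm_pos_iff.mpr hz1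
    rw [norm_div, div_le_iff₀ (norm_pos_iff.mpr (hne s (by linarith))),
      centeredXi_eq (s := s - h) (by simp; linarith), centeredXi_eq (s := s + h) (by simp; linarith)]
    rw [← add_sub_assoc, ← add_assoc, norm_mul, norm_mul, norm_mul, norm_mul]
    have h2 := norm_sub_le_norm_add_of_re_nonneg hh.le (w := 1 / 2 + s) (by linarith)
    calc _ ≤ ‖1 / 2 + s + h‖ * (K * ‖Complex.Gammaℝ (1 / 2 + s + h)‖) *
          ‖riemannZeta₁ (1 / 2 + s - h)‖ := by
          gcongr
          exact HK _ h1
      _ = _ := by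
        generalize ‖riemannZeta₁ (1 / 2 + s + h)‖ = x at hz2 ⊢
        field_simp
  have hPL := PhragmenLindelof.right_half_plane_of_bounded_on_real (C := 1) (z := s)
    (f := fun s => centeredXi (s - h) / centeredXi (s + h)) ?_ ?_ ?_ ?_ hs
  · rw [norm_div, div_le_one (norm_pos_iff.mpr (hne s (by linarith)))] at hPL
    exact hPL
  · refine DifferentiableOn.diffContOnCl fun z hz => ?_
    have hz0 : 0 ≤ z.re := by
      have := closure_minimal (t := {z : ℂ | 0 ≤ z.re}) (fun z (hz : 0 < z.re) => hz.le)
        (isClosed_le continuous_const Complex.continuous_re) hz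
      exact this
    have hd := differentiable_centeredXi
    refine DifferentiableAt.differentiableWithinAt ?_
    exact DifferentiableAt.div (by fun_prop) (by fun_prop) (hne z (by linarith))
  · refine ⟨1, by norm_num, 2 + C, ?_⟩
    refine Asymptotics.IsBigO.of_bound
      (K * ((1 + 1 / (1 / 2 - h)) * Real.exp (2 * 1)) * Real.exp (C * (1 + 1))) ?_
    refine Filter.Eventually.filter_mono inf_le_right ?_
    filter_upwards [mem_principal_self _] with s (hs : 0 < s.re)
    refine (hbd s hs.le).trans ?_
    have h1 := norm_riemannZeta₁_le_mul_exp (w := 1 / 2 + s - h) (δ := 1 / 2 - h) (by linarith)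
      (by simp; linarith)
    have h2 := HC (1 / 2 + s + h) (by simp; linarith)
    have hz : 0 < ‖riemannZeta₁ (1 / 2 + s + h)‖ := by
      by_contra hcon
      have := norm_nonneg (riemannZeta₁ (1 / 2 + s + h))
      have h0 : ‖riemannZeta₁ (1 / 2 + s + h)‖ = 0 := by linarith
      rw [h0] at h2
      norm_num at h2
    have n1 : ‖1 / 2 + s - h‖ ≤ 1 + ‖s‖ := by
      calc ‖1 / 2 + s - h‖ = ‖((1 / 2 - h : ℝ) : ℂ) + s‖ := by
            congr 1; push_cast; ring
        _ ≤ ‖((1 / 2 - h : ℝ) : ℂ)‖ + ‖s‖ := norm_add_le _ _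
        _ ≤ _ := by
          rw [Complex.norm_real, Real.norm_of_nonneg (by linarith)]
          linarith
    have n2 : ‖1 / 2 + s + h‖ ≤ 1 + ‖s‖ := by
      calc ‖1 / 2 + s + h‖ = ‖((1 / 2 + h : ℝ) : ℂ) + s‖ := by
            congr 1; push_cast; ring
        _ ≤ ‖((1 / 2 + h : ℝ) : ℂ)‖ + ‖s‖ := norm_add_le _ _
        _ ≤ _ := by
          rw [Complex.norm_real, Real.norm_of_nonneg (by linarith)]
          linarith
    have hpos : 0 < 1 / 2 - h := by linarith
    calc K * (‖riemannZeta₁ (1 / 2 + s - h)‖ / ‖riemannZeta₁ (1 / 2 + s + h)‖)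
        ≤ K * (‖riemannZeta₁ (1 / 2 + s - h)‖ * Real.exp (C * (1 + ‖1 / 2 + s + h‖))) := by
          gcongr
          rw [div_le_iff₀ hz, mul_assoc]
          exact le_mul_of_one_le_right (norm_nonneg _) h2
      _ ≤ K * (((1 + 1 / (1 / 2 - h)) * Real.exp (2 * (1 + ‖s‖))) * Real.exp (C * (1 + (1 + ‖s‖)))) := by
          gcongr
          exact h1.trans (by gcongr)
      _ = _ := by
          rw [Real.norm_of_nonneg (Real.exp_pos _).le, Real.rpow_one]
          have e1 : Real.exp (2 * (1 + ‖s‖)) = Real.exp (2 * 1) * Real.exp (2 * ‖s‖) := by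
            rw [← Real.exp_add]; congr 1; ring
          have e2 : Real.exp (C * (1 + (1 + ‖s‖))) = Real.exp (C * (1 + 1)) * Real.exp (C * ‖s‖) := by
            rw [← Real.exp_add]; congr 1; ring
          have e3 : Real.exp ((2 + C) * ‖s‖) = Real.exp (2 * ‖s‖) * Real.exp (C * ‖s‖) := by
            rw [← Real.exp_add]; congr 1; ring
          rw [e1, e2, e3]
          ring
  · refine ⟨K * (Kz * Kz), ?_⟩
    rw [eventually_map]
    filter_upwards [eventually_ge_atTop 2] with x hx
    refine (hbd x (by simp; linarith)).trans ?_
    gcongr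
    have w1 : (1 / 2 + (x : ℂ) - h) ≠ 1 := by
      intro hcon
      have := congrArg Complex.re hcon
      simp at this
      linarith
    have w2 : (1 / 2 + (x : ℂ) + h) ≠ 1 := by
      intro hcon
      have := congrArg Complex.re hcon
      simp at this
      linarith
    have hz1 : riemannZeta₁ (1 / 2 + x + h) ≠ 0 := riemannZeta₁_ne_zero hRH (by simp; linarith)
    rw [div_le_iff₀ (norm_pos_iff.mpr hz1), riemannZeta₁_eq_mul w1, riemannZeta₁_eq_mul w2,
      norm_mul, norm_mul]
    have b1 := (HKz (1 / 2 + x - h) (by simp; linarith)).1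
    have b2 := (HKz (1 / 2 + x + h) (by simp; linarith)).2.1
    have b3 : ‖(1 / 2 + (x : ℂ) - h) - 1‖ ≤ ‖(1 / 2 + (x : ℂ) + h) - 1‖ := by
      have := norm_sub_le_norm_add_of_re_nonneg hh.le (w := 1 / 2 + x - 1) (by simp; linarith)
      convert this using 2 <;> ring
    calc ‖(1 / 2 + (x : ℂ) - h) - 1‖ * ‖riemannZeta (1 / 2 + x - h)‖
        ≤ ‖(1 / 2 + (x : ℂ) + h) - 1‖ * (Kz * (Kz * ‖riemannZeta (1 / 2 + x + h)‖)) := by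
          gcongr
          exact b1.trans (le_mul_of_one_le_right hKz.le b2)
      _ = _ := by ring
  · intro x
    have e1 : (x : ℂ) * Complex.I - h = -conj (x * Complex.I + h) := by simp; ring
    rw [e1, centeredXi_neg, centeredXi_conj (by simp; linarith), norm_div, RCLike.norm_conj]
    exact div_self_le_one _

lemma re_logDeriv_centeredXi_nonneg (hRH : RiemannHypothesis) {s : ℂ} (hs : 0 < s.re) :
    0 ≤ (logDeriv centeredXi s).re := by
  have hZ := centeredXi_ne_zero hRH hs
  have hd : ∀ x : ℝ, HasDerivAt (fun h : ℝ => centeredXi (s + x * h)) (deriv centeredXi s * x) 0 := by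
    intro x
    have h1 : HasDerivAt centeredXi (deriv centeredXi s) (s + x * ((0:ℝ):ℂ)) := by
      simpa using (differentiable_centeredXi s).hasDerivAt
    have h2 : HasDerivAt (fun h : ℝ => s + x * (h : ℂ)) (x : ℂ) 0 := by
      have := ((hasDerivAt_id (0:ℝ)).ofReal_comp.const_mul (x : ℂ)).const_add s
      simpa using this
    exact h1.comp (0:ℝ) h2
  have hsq : ∀ x : ℝ, HasDerivAt (fun h : ℝ => ‖centeredXi (s + x * h)‖ ^ 2)
      (2 * (conj (centeredXi s) * (deriv centeredXi s * x)).re) 0 := by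
    intro x
    have := (hd x).norm_sq
    simpa [Complex.inner, mul_comm] using this
  have hψ := (hsq 1).sub (hsq (-1))
  have hnn : 0 ≤ 2 * (conj (centeredXi s) * (deriv centeredXi s * (1:ℝ))).re -
      2 * (conj (centeredXi s) * (deriv centeredXi s * (-1:ℝ))).re := by
    have hlim := (hasDerivAt_iff_tendsto_slope.mp hψ).mono_left
      (nhdsWithin_mono 0 (fun x (hx : 0 < x) => (ne_of_gt hx : x ≠ 0)) :
        nhdsWithin 0 (Ioi 0) ≤ nhdsWithin (0:ℝ) {0}ᶜ)
    refine ge_of_tendsto hlim ?_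
    filter_upwards [Ioo_mem_nhdsGT (by norm_num : (0:ℝ) < 1 / 2)] with h hh
    rw [slope_def_field]
    have h1 := norm_centeredXi_sub_le hRH hh.1 hh.2 hs.le
    have h2 : ‖centeredXi (s - h)‖ ^ 2 ≤ ‖centeredXi (s + h)‖ ^ 2 := by gcongr
    apply div_nonneg
    · simp only [Pi.sub_apply]
      simp
      simpa [sub_eq_add_neg] using h2
    · linarith [hh.1]
  have hre : (conj (centeredXi s) * deriv centeredXi s).re ≥ 0 := by
    simp at hnn ⊢
    linarith
  rw [logDeriv_apply]
  have : deriv centeredXi s / centeredXi s =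
      conj (centeredXi s) * deriv centeredXi s / ((Complex.normSq (centeredXi s) : ℝ) : ℂ) := by
    rw [Complex.normSq_eq_conj_mul_self]
    have := (map_ne_zero (starRingEnd ℂ)).mpr hZ
    field_simp
  rw [this, Complex.div_ofReal_re]
  exact div_nonneg hre (Complex.normSq_nonneg _)

end XiMonotone

section XiLogDeriv

open scoped ComplexConjugate

lemma differentiableOn_logDeriv_centeredXi (hRH : RiemannHypothesis) :
    DifferentiableOn ℂ (logDeriv centeredXi) {s | 0 < s.re} := by
  have h : DifferentiableOn ℂ centeredXi {s | 0 < s.re} :=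
    differentiable_centeredXi.differentiableOn
  exact (h.deriv isOpen_re_pos).div h fun s hs => centeredXi_ne_zero hRH hs

lemma hasDerivAt_log_norm_sq_centeredXi (hRH : RiemannHypothesis) {s : ℂ} {x : ℝ}
    (hs : 0 < s.re + x) :
    HasDerivAt (fun x : ℝ => Real.log (‖centeredXi (s + x)‖ ^ 2))
      (2 * (logDeriv centeredXi (s + x)).re) x := by
  have hZ := centeredXi_ne_zero hRH (s := s + x) (by simpa using hs)
  have h1 : HasDerivAt (fun x : ℝ => centeredXi (s + x)) (deriv centeredXi (s + x)) x := by
    have h2 : HasDerivAt (fun h : ℝ => s + (h : ℂ)) 1 x :=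
      ((hasDerivAt_id x).ofReal_comp).const_add s
    have h3 := ((differentiable_centeredXi (s + x)).hasDerivAt).comp x h2
    exact h3.congr_deriv (mul_one _)
  have h2 := h1.norm_sq.log (by positivity)
  refine h2.congr_deriv ?_
  rw [logDeriv_apply, Complex.inner]
  have : deriv centeredXi (s + x) / centeredXi (s + x) =
      conj (centeredXi (s + x)) * deriv centeredXi (s + x) /
        ((‖centeredXi (s + x)‖ ^ 2 : ℝ) : ℂ) := by
    rw [← Complex.normSq_eq_norm_sq, Complex.normSq_eq_conj_mul_self]
    have := (map_ne_zero (starRingEnd ℂ)).mpr hZ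
    field_simp
  rw [this, Complex.div_ofReal_re]
  ring_nf

lemma exists_log_norm_centeredXi_eq (hRH : RiemannHypothesis) {s : ℂ} (hs : 0 < s.re) :
    ∃ x ∈ Ioo (0 : ℝ) 2, 2 * (logDeriv centeredXi (s + x)).re =
      Real.log (‖centeredXi (s + 2)‖ / ‖centeredXi s‖) := by
  have hd : ∀ x : ℝ, 0 ≤ x → HasDerivAt (fun x : ℝ => Real.log (‖centeredXi (s + x)‖ ^ 2))
      (2 * (logDeriv centeredXi (s + x)).re) x := fun x hx =>
    hasDerivAt_log_norm_sq_centeredXi hRH (by linarith)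
  obtain ⟨x, hx, h⟩ := exists_hasDerivAt_eq_slope _ _ (zero_lt_two (α := ℝ))
    (fun x hx => (hd x hx.1).continuousAt.continuousWithinAt) fun x hx => hd x hx.1.le
  refine ⟨x, hx, ?_⟩
  rw [h]
  have h1 := centeredXi_ne_zero hRH hs
  have h2 := centeredXi_ne_zero hRH (s := s + 2) (by simp; linarith)
  rw [Real.log_div (norm_ne_zero_iff.mpr h2) (norm_ne_zero_iff.mpr h1), Real.log_pow, Real.log_pow]
  simp
  ring

lemma centeredXi_add_two {s : ℂ} (hs : 1 / 2 < s.re) :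
    centeredXi (s + 2) * (2 * π * (s - 1 / 2)) * riemannZeta (1 / 2 + s) =
      centeredXi s * ((s + 5 / 2) * (s + 3 / 2)) * riemannZeta (5 / 2 + s) := by
  have h0 : (1 / 2 + s) ≠ 0 := by
    intro h
    have := congrArg Complex.re h
    simp at this
    linarith
  have h1 : (1 / 2 + s) ≠ 1 := by
    intro h
    have := congrArg Complex.re h
    simp at this
    linarith
  have h2 : (5 / 2 + s) ≠ 1 := by
    intro h
    have := congrArg Complex.re h
    simp at this
    linarith
  rw [centeredXi_eq (s := s + 2) (by simp; linarith), centeredXi_eq (s := s) (by linarith)]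
  have e : 1 / 2 + (s + 2) = (1 / 2 + s) + 2 := by ring
  have e2 : (1 / 2 + s) + 2 = 5 / 2 + s := by ring
  rw [e, Complex.Gammaℝ_add_two h0, e2, riemannZeta₁_eq_mul h1, riemannZeta₁_eq_mul h2]
  have hpi : (π : ℂ) ≠ 0 := by exact_mod_cast Real.pi_ne_zero
  field_simp
  ring

lemma exists_logDeriv_centeredXi_bounds (hRH : RiemannHypothesis) :
    ∃ C, 0 < C ∧ (∀ s : ℂ, 1 ≤ s.re → (logDeriv centeredXi s).re ≤ 2 * Real.log (C * (1 + ‖s‖))) ∧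
      ∀ t : ℝ, t ≠ 0 → Real.log (|t| / C) ≤ 6 * (logDeriv centeredXi (1 + t * Complex.I)).re := by
  obtain ⟨K, hK, HK⟩ := exists_norm_inv_riemannZeta_le
  have hf := differentiableOn_logDeriv_centeredXi hRH
  have hp : ∀ s : ℂ, 0 < s.re → 0 ≤ (logDeriv centeredXi s).re := fun s hs =>
    re_logDeriv_centeredXi_nonneg hRH hs
  have ratio : ∀ s : ℂ, 1 ≤ s.re →
      ‖centeredXi (s + 2)‖ / ‖centeredXi s‖ = (‖s + 5 / 2‖ * ‖s + 3 / 2‖ / ‖s - 1 / 2‖) / (2 * π) *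
        (‖riemannZeta (5 / 2 + s)‖ / ‖riemannZeta (1 / 2 + s)‖) := by
    intro s hs
    have h1 := congrArg norm (centeredXi_add_two (s := s) (by linarith))
    simp only [norm_mul] at h1
    have h2 : ‖centeredXi s‖ ≠ 0 := norm_ne_zero_iff.mpr (centeredXi_ne_zero hRH (by linarith))
    have h3 : ‖riemannZeta (1 / 2 + s)‖ ≠ 0 := by
      intro h
      have := (HK (1 / 2 + s) (by simp; linarith)).2.1
      rw [h] at this
      norm_num at this
    have h4 : ‖s - 1 / 2‖ ≠ 0 := by
      rw [norm_ne_zero_iff]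
      intro h
      have := congrArg Complex.re h
      simp at this
      linarith
    have h5 : ‖(2:ℂ)‖ * ‖(π:ℂ)‖ = 2 * π := by
      rw [Complex.norm_real, Real.norm_of_nonneg Real.pi_pos.le]; simp
    rw [h5] at h1
    have h6 : 2 * π ≠ 0 := by positivity
    generalize ‖riemannZeta (1 / 2 + s)‖ = a at *
    generalize ‖riemannZeta (5 / 2 + s)‖ = b at *
    generalize ‖s - 1 / 2‖ = c at *
    generalize ‖s + 5 / 2‖ = d at *
    generalize ‖s + 3 / 2‖ = e at *
    field_simp
    linear_combination h1
  have zup : ∀ s : ℂ, 1 ≤ s.re → 1 / K ^ 2 ≤ ‖riemannZeta (5 / 2 + s)‖ / ‖riemannZeta (1 / 2 + s)‖ ∧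
      ‖riemannZeta (5 / 2 + s)‖ / ‖riemannZeta (1 / 2 + s)‖ ≤ K ^ 2 := by
    intro s hs
    have h1 := HK (1 / 2 + s) (by simp; linarith)
    have h2 := HK (5 / 2 + s) (by simp; linarith)
    have h3 : 0 < ‖riemannZeta (1 / 2 + s)‖ := by
      by_contra h
      have h0 : ‖riemannZeta (1 / 2 + s)‖ = 0 := by linarith [norm_nonneg (riemannZeta (1 / 2 + s))]
      have := h1.2.1
      rw [h0] at this
      norm_num at this
    constructor
    · rw [le_div_iff₀ h3, div_mul_eq_mul_div, one_mul, div_le_iff₀ (by positivity)]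
      calc ‖riemannZeta (1 / 2 + s)‖ ≤ K * 1 := by linarith [h1.1]
        _ ≤ K * (K * ‖riemannZeta (5 / 2 + s)‖) := by gcongr; exact h2.2.1
        _ = _ := by ring
    · rw [div_le_iff₀ h3]
      calc ‖riemannZeta (5 / 2 + s)‖ ≤ K * 1 := by linarith [h2.1]
        _ ≤ K * (K * ‖riemannZeta (1 / 2 + s)‖) := by gcongr; exact h1.2.1
        _ = _ := by ring
  have re_le : ∀ s : ℂ, s.re ≤ ‖s‖ := Complex.re_le_norm
  have hpi := Real.pi_gt_three
  refine ⟨20 * K ^ 2 + 2 * π * K ^ 2, by positivity, fun s hs => ?_, fun t ht => ?_⟩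
  · obtain ⟨x, hx, h⟩ := exists_log_norm_centeredXi_eq hRH (s := s) (by linarith)
    have hm := (re_mul_le_of_re_nonneg hf hp (x := s.re) (y := s.re + x) (t := s.im) (by linarith)
      (by linarith [hx.1])).1
    have e1 : ((s.re : ℝ) : ℂ) + s.im * Complex.I = s := Complex.re_add_im s
    have e2 : ((s.re + x : ℝ) : ℂ) + s.im * Complex.I = s + x := by
      push_cast; linear_combination e1
    rw [e1, e2] at hm
    have hpos := hp (s + x) (by simp; linarith [hx.1])
    have h3 : (logDeriv centeredXi s).re ≤ 3 * (logDeriv centeredXi (s + x)).re := by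
      have : (s.re + x) * (logDeriv centeredXi (s + x)).re ≤
          (3 * s.re) * (logDeriv centeredXi (s + x)).re := by
        gcongr; linarith [hx.2]
      have h4 : s.re * (logDeriv centeredXi s).re ≤
          s.re * (3 * (logDeriv centeredXi (s + x)).re) := by linarith
      exact le_of_mul_le_mul_left h4 (by linarith)
    have hs1 : 1 / 2 ≤ ‖s - 1 / 2‖ := by
      have := re_le (s - 1 / 2)
      simp at this
      linarith
    have hup : ‖centeredXi (s + 2)‖ / ‖centeredXi s‖ ≤ (20 * K ^ 2 + 2 * π * K ^ 2) * (1 + ‖s‖) := by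
      rw [ratio s hs]
      have b1 : ‖s + 5 / 2‖ ≤ 5 / 2 * (1 + ‖s‖) := by
        have := norm_add_le s (5 / 2)
        simp at this
        linarith [norm_nonneg s]
      have b2 : ‖s + 3 / 2‖ / ‖s - 1 / 2‖ ≤ 5 := by
        rw [div_le_iff₀ (by linarith)]
        calc ‖s + 3 / 2‖ = ‖(s - 1 / 2) + 2‖ := by congr 1; ring
          _ ≤ ‖s - 1 / 2‖ + 2 := (norm_add_le _ _).trans (by simp)
          _ ≤ _ := by linarith
      rw [mul_div_assoc]
      calc ‖s + 5 / 2‖ * (‖s + 3 / 2‖ / ‖s - 1 / 2‖) / (2 * π) *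
            (‖riemannZeta (5 / 2 + s)‖ / ‖riemannZeta (1 / 2 + s)‖)
          ≤ (5 / 2 * (1 + ‖s‖)) * 5 / 1 * K ^ 2 := by
            gcongr
            · linarith
            · exact (zup s hs).2
        _ ≤ _ := by
          have h5 : 0 ≤ 2 * π * K ^ 2 * (1 + ‖s‖) := by positivity
          have h6 : 0 ≤ K ^ 2 * (1 + ‖s‖) := by positivity
          nlinarith
    have hZ1 := norm_pos_iff.mpr (centeredXi_ne_zero hRH (s := s) (by linarith))
    have hZ2 := norm_pos_iff.mpr (centeredXi_ne_zero hRH (s := s + 2) (by simp; linarith))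
    have hlog := Real.log_le_log (div_pos hZ2 hZ1) hup
    linarith
  · set s : ℂ := 1 + t * Complex.I with hsdef
    have hsre : s.re = 1 := by simp [hsdef]
    have hs : 1 ≤ s.re := hsre.ge
    obtain ⟨x, hx, h⟩ := exists_log_norm_centeredXi_eq hRH (s := s) (by linarith)
    have hm := (re_mul_le_of_re_nonneg hf hp (x := 1) (y := 1 + x) (t := t) (by linarith)
      (by linarith [hx.1])).2
    have e1 : ((1 : ℝ) : ℂ) + t * Complex.I = s := by simp [hsdef]
    have e2 : ((1 + x : ℝ) : ℂ) + t * Complex.I = s + x := by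
      simp [hsdef]; ring
    rw [e1, e2] at hm
    have hpos := hp s (by linarith)
    have h3 : (1 + x) * (logDeriv centeredXi s).re ≤ 3 * (logDeriv centeredXi s).re := by
      gcongr; linarith [hx.2]
    have hlow : |t| / (20 * K ^ 2 + 2 * π * K ^ 2) ≤ ‖centeredXi (s + 2)‖ / ‖centeredXi s‖ := by
      rw [ratio s hs]
      have hs1 : 1 / 2 ≤ ‖s - 1 / 2‖ := by
        have := re_le (s - 1 / 2)
        simp [hsre] at this
        simp
        linarith
      have b1 : |t| ≤ ‖s + 5 / 2‖ := by
        have := Complex.abs_im_le_norm (s + 5 / 2)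
        simpa [hsdef] using this
      have b2 : 1 ≤ ‖s + 3 / 2‖ / ‖s - 1 / 2‖ := by
        rw [le_div_iff₀ (by linarith), one_mul]
        have := norm_sub_le_norm_add_of_re_nonneg (w := s + 1 / 2) (h := 1) zero_le_one
          (by simp [hsre]; norm_num)
        have e3 : s - 1 / 2 = s + 1 / 2 - ((1 : ℝ) : ℂ) := by push_cast; ring
        have e4 : s + 3 / 2 = s + 1 / 2 + ((1 : ℝ) : ℂ) := by push_cast; ring
        rw [e3, e4]
        exact this
      rw [mul_div_assoc]
      calc |t| / (20 * K ^ 2 + 2 * π * K ^ 2) ≤ |t| / (2 * π * K ^ 2) := by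
            gcongr
            have : 0 ≤ K ^ 2 := by positivity
            linarith
        _ = |t| * 1 / (2 * π) * (1 / K ^ 2) := by field_simp
        _ ≤ _ := by
          have z1 := (zup s hs).1
          generalize ‖riemannZeta (5 / 2 + s)‖ / ‖riemannZeta (1 / 2 + s)‖ = q at z1 ⊢
          gcongr
    have hlog := Real.log_le_log (by positivity) hlow
    linarith

end XiLogDeriv

section XiLogDerivGrowth

open scoped ComplexConjugate

lemma exists_norm_logDeriv_centeredXi_le (hRH : RiemannHypothesis) {σ₁ : ℝ} (hσ : 0 < σ₁)
    (hσ1 : σ₁ ≤ 1) :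
    ∃ C, 0 < C ∧ ∀ s : ℂ, σ₁ ≤ s.re → s.re ≤ 5 →
      ‖logDeriv centeredXi s‖ ≤ C * (1 + |s.im|) ^ (2 / 5 : ℝ) := by
  obtain ⟨C, hC, HC, -⟩ := exists_logDeriv_centeredXi_bounds hRH
  have hf := differentiableOn_logDeriv_centeredXi hRH
  have hp : ∀ s : ℂ, 0 < s.re → 0 ≤ (logDeriv centeredXi s).re := fun s hs =>
    re_logDeriv_centeredXi_nonneg hRH hs
  set f := logDeriv centeredXi
  set D : ℝ := 2 * ((C * 7) ^ (1 / 30 : ℝ) / (1 / 30)) / σ₁ with hD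
  have hDpos : 0 < D := by positivity
  -- the real part is tiny compared with any power
  have hU1 : ∀ (q : ℝ) (s : ℂ), 1 ≤ q → 1 ≤ s.re → ‖s‖ ≤ 6 * q ^ 30 → (f s).re ≤ σ₁ * (D * q) := by
    intro q s hq hs hsn
    have hq30 : 1 ≤ q ^ 30 := one_le_pow₀ hq
    refine (HC s hs).trans ?_
    have h1 : Real.log (C * (1 + ‖s‖)) ≤ Real.log (C * 7 * q ^ 30) := by
      apply Real.log_le_log (by positivity)
      rw [mul_assoc]
      gcongr
      linarith
    have h2 := Real.log_le_rpow_div (x := C * 7 * q ^ 30) (ε := 1 / 30) (by positivity) (by norm_num)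
    rw [Real.mul_rpow (by positivity) (by positivity), ← Real.rpow_natCast q 30,
      ← Real.rpow_mul (by linarith)] at h2
    norm_num at h2 h1
    have h3 : σ₁ * (D * q) = 2 * ((C * 7) ^ (1 / 30 : ℝ) * q * 30) := by
      rw [hD]; field_simp
    rw [h3]
    norm_num at h1 ⊢
    linarith
  have hU : ∀ (q : ℝ) (s : ℂ), 1 ≤ q → σ₁ ≤ s.re → ‖s‖ + 1 ≤ 6 * q ^ 30 → (f s).re ≤ D * q := by
    intro q s hq hs hsn
    rcases le_total 1 s.re with h1 | h1
    · refine (hU1 q s hq h1 (by linarith)).trans ?_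
      exact mul_le_of_le_one_left (by positivity) hσ1
    · have hm := (re_mul_le_of_re_nonneg hf hp (x := s.re) (y := 1) (t := s.im) (by linarith) h1).1
      have e1 : ((s.re : ℝ) : ℂ) + s.im * Complex.I = s := Complex.re_add_im s
      rw [e1] at hm
      have hn : ‖((1:ℝ) : ℂ) + s.im * Complex.I‖ ≤ ‖s‖ + 1 := by
        have e2 : ((1:ℝ) : ℂ) + s.im * Complex.I = s + ((1 - s.re : ℝ) : ℂ) := by
          push_cast; linear_combination e1
        rw [e2]
        refine (norm_add_le _ _).trans ?_
        rw [Complex.norm_real, Real.norm_of_nonneg (by linarith)]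
        linarith
      have h2 := hU1 q _ hq (by simp) (hn.trans hsn)
      have h3 : σ₁ * (f s).re ≤ s.re * (f s).re := by
        gcongr
        exact hp s (by linarith)
      have h4 : σ₁ * (f s).re ≤ σ₁ * (D * q) := by linarith
      exact le_of_mul_le_mul_left h4 hσ
  have step : ∀ (q : ℝ) (z : ℂ), 1 ≤ q → σ₁ ≤ z.re → z.re ≤ 5 → |z.im| ≤ q ^ 30 - 1 → 5 ≤ 4 * q ^ 30 →
      ‖f z - f (((q ^ 20 : ℝ) : ℂ) + z.im * Complex.I)‖ ≤ 6 * D / σ₁ * q ^ 11 := by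
    intro q z hq hz hz5 hzi hq5
    have hq20 : 1 ≤ q ^ 20 := one_le_pow₀ hq
    have hq30 : 1 ≤ q ^ 30 := one_le_pow₀ hq
    have hq2030 : q ^ 20 ≤ q ^ 30 := pow_le_pow_right₀ hq (by norm_num)
    set a : ℂ := ((q ^ 20 : ℝ) : ℂ) + z.im * Complex.I with ha
    have hare : a.re = q ^ 20 := by simp [ha, -Complex.ofReal_pow]
    have h1 := norm_sub_mul_le_of_re_nonneg hf hp (z := z) (a := a) (by linarith) (by linarith)
    have e1 : z + conj a = ((z.re + q ^ 20 : ℝ) : ℂ) := by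
      apply Complex.ext <;> simp [ha, -Complex.ofReal_pow]
    have n1 : ‖z‖ ≤ z.re + |z.im| := by
      have := Complex.norm_le_abs_re_add_abs_im z
      rwa [abs_of_nonneg (by linarith : 0 ≤ z.re)] at this
    have n2 : ‖a‖ ≤ q ^ 20 + |z.im| := by
      have := Complex.norm_le_abs_re_add_abs_im a
      rw [hare, abs_of_nonneg (by linarith : 0 ≤ q ^ 20)] at this
      simpa [ha, ← Complex.ofReal_pow] using this
    have u1 := hU q z hq hz (by linarith)
    have u2 := hU q a hq (by linarith) (by linarith)
    have p1 := hp z (by linarith)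
    have p2 := hp a (by linarith)
    rw [e1, Complex.norm_real, Real.norm_of_nonneg (by linarith), hare] at h1
    have h2 : ((z.re + q ^ 20) * ((f z).re + (f a).re)) ^ 2 ≤ ((6 * q ^ 20) * (2 * (D * q))) ^ 2 := by
      refine pow_le_pow_left₀ (mul_nonneg (by linarith) (by linarith)) ?_ 2
      exact mul_le_mul (by linarith) (by linarith) (by linarith) (by linarith)
    have h3 : ‖f z - f a‖ ^ 2 * (4 * σ₁ * q ^ 20) ≤ ‖f z - f a‖ ^ 2 * (4 * z.re * q ^ 20) := by
      gcongr
    have h4 : ‖f z - f a‖ ^ 2 * (4 * σ₁ * q ^ 20) ≤ (6 * D / σ₁ * q ^ 11) ^ 2 * (4 * σ₁ * q ^ 20) := by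
      refine h3.trans (h1.trans (h2.trans ?_))
      have h5 : ((6 * q ^ 20) * (2 * (D * q))) ^ 2 = 144 * D ^ 2 * q ^ 42 := by ring
      have h6 : (6 * D / σ₁ * q ^ 11) ^ 2 * (4 * σ₁ * q ^ 20) = 144 * D ^ 2 * q ^ 42 / σ₁ := by
        field_simp; ring
      rw [h5, h6, le_div_iff₀ hσ]
      exact mul_le_of_le_one_right (by positivity) hσ1
    have h7 := le_of_mul_le_mul_right h4 (by positivity)
    exact le_of_sq_le_sq h7 (by positivity)
  have step2 : ∀ (q t : ℝ), 1 ≤ q → |t| ≤ q ^ 30 - 1 →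
      ‖f (((q ^ 20 : ℝ) : ℂ) + t * Complex.I) - f ((q ^ 20 : ℝ) : ℂ)‖ ≤ 3 * D * q ^ 11 := by
    intro q t hq ht
    have hq20 : 1 ≤ q ^ 20 := one_le_pow₀ hq
    have hq30 : 1 ≤ q ^ 30 := one_le_pow₀ hq
    have hq2030 : q ^ 20 ≤ q ^ 30 := pow_le_pow_right₀ hq (by norm_num)
    set a : ℂ := ((q ^ 20 : ℝ) : ℂ) + t * Complex.I with ha
    set b : ℂ := ((q ^ 20 : ℝ) : ℂ) with hb
    have hare : a.re = q ^ 20 := by simp [ha, hb, -Complex.ofReal_pow]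
    have hbre : b.re = q ^ 20 := by rw [hb, Complex.ofReal_re]
    have haim : a.im = t := by simp [ha, hb, -Complex.ofReal_pow]
    have n2 : ‖a‖ ≤ q ^ 20 + |t| := by
      have := Complex.norm_le_abs_re_add_abs_im a
      rwa [hare, abs_of_nonneg (by linarith : 0 ≤ q ^ 20), haim] at this
    have n3 : ‖b‖ = q ^ 20 := by rw [hb, Complex.norm_real, Real.norm_of_nonneg (by linarith)]
    have h1 := norm_sub_mul_le_of_re_nonneg hf hp (z := a) (a := b) (by linarith) (by linarith)
    have u1 := hU q a hq (by linarith) (by linarith)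
    have u2 := hU q b hq (by linarith) (by linarith)
    have p1 := hp a (by linarith)
    have p2 := hp b (by linarith)
    have n4 : ‖a + conj b‖ ≤ 3 * q ^ 30 := by
      refine (norm_add_le _ _).trans ?_
      rw [RCLike.norm_conj]
      linarith
    rw [hare, hbre] at h1
    have h2 : (‖a + conj b‖ * ((f a).re + (f b).re)) ^ 2 ≤ ((3 * q ^ 30) * (2 * (D * q))) ^ 2 := by
      gcongr
      linarith
    have h4 : ‖f a - f b‖ ^ 2 * (4 * q ^ 20 * q ^ 20) ≤ (3 * D * q ^ 11) ^ 2 * (4 * q ^ 20 * q ^ 20) := by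
      refine h1.trans (h2.trans (le_of_eq ?_))
      ring
    have h7 := le_of_mul_le_mul_right h4 (by positivity)
    exact le_of_sq_le_sq h7 (by positivity)
  refine ⟨(6 * D / σ₁ + 3 * D + 6 * D / σ₁ + ‖f 1‖) * 2 ^ (2 / 5 : ℝ), by positivity, fun s hs hs5 => ?_⟩
  set q : ℝ := (2 * (1 + |s.im|)) ^ (1 / 30 : ℝ) with hq
  have hT : 2 ≤ 2 * (1 + |s.im|) := by linarith [abs_nonneg s.im]
  have hq1 : 1 ≤ q := Real.one_le_rpow (by linarith) (by norm_num)
  have hq30 : q ^ 30 = 2 * (1 + |s.im|) := by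
    rw [hq, ← Real.rpow_natCast, ← Real.rpow_mul (by linarith)]
    norm_num
  have hq12 : q ^ 12 = 2 ^ (2 / 5 : ℝ) * (1 + |s.im|) ^ (2 / 5 : ℝ) := by
    rw [hq, ← Real.rpow_natCast, ← Real.rpow_mul (by linarith),
      ← Real.mul_rpow (by norm_num) (by positivity)]
    norm_num
  have s1 := step q s hq1 hs hs5 (by rw [hq30]; linarith [abs_nonneg s.im]) (by rw [hq30]; linarith)
  have s2 := step2 q s.im hq1 (by rw [hq30]; linarith [abs_nonneg s.im])
  have s3 := step q 1 hq1 (by simpa using hσ1) (by norm_num) (by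
    rw [hq30]; simp; linarith [abs_nonneg s.im]) (by rw [hq30]; linarith)
  simp only [Complex.one_im, Complex.ofReal_zero, zero_mul, add_zero] at s3
  set A := f (((q ^ 20 : ℝ) : ℂ) + s.im * Complex.I)
  set B := f ((q ^ 20 : ℝ) : ℂ)
  have htri : ‖f s‖ ≤ ‖f s - A‖ + ‖A - B‖ + ‖f 1 - B‖ + ‖f 1‖ := by
    calc ‖f s‖ = ‖(f s - A) + (A - B) - (f 1 - B) + f 1‖ := by congr 1; ring
      _ ≤ _ := (norm_add_le _ _).trans (by
        gcongr
        exact (norm_sub_le _ _).trans (by gcongr; exact norm_add_le _ _))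
  have h11 : q ^ 11 ≤ q ^ 12 := pow_le_pow_right₀ hq1 (by norm_num)
  have h12 : 1 ≤ q ^ 12 := one_le_pow₀ hq1
  calc ‖f s‖ ≤ (6 * D / σ₁ + 3 * D + 6 * D / σ₁) * q ^ 11 + ‖f 1‖ * 1 := by linarith
    _ ≤ (6 * D / σ₁ + 3 * D + 6 * D / σ₁) * q ^ 12 + ‖f 1‖ * q ^ 12 := by gcongr
    _ = _ := by rw [hq12]; ring

end XiLogDerivGrowth

section ContourShift

lemma integrable_one_add_abs_rpow {r : ℝ} (hr : 1 < r) :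
    Integrable fun t : ℝ => (1 + |t|) ^ (-r) := by
  have := integrable_one_add_norm (E := ℝ) (μ := volume) (r := r) (by simpa using hr)
  simpa using this

lemma exists_le_one_add_abs_rpow_neg_mul {r ε : ℝ} (hr : 0 < r) (hε : 0 < ε) (D : ℝ) :
    ∃ T₀ : ℝ, ∀ t : ℝ, T₀ ≤ |t| → D * (1 + |t|) ^ (-r) ≤ ε := by
  have h : Tendsto (fun t : ℝ => D * (1 + t) ^ (-r)) atTop (nhds (D * 0)) :=
    ((tendsto_rpow_neg_atTop hr).comp (tendsto_atTop_add_const_left _ 1 tendsto_id)).const_mul D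
  rw [mul_zero] at h
  obtain ⟨T₀, hT⟩ := eventually_atTop.1 (h.eventually (eventually_le_nhds hε))
  exact ⟨T₀, fun t ht => hT _ ht⟩

/-- Moving the line of integration of `g(s) K(s - σ)` from `re s = σ` to `re s = 1`. -/
lemma integral_mul_kernel_shift {g K : ℂ → ℂ} {σ a b C C' : ℝ} (hσ : 0 < σ) (hσ1 : σ ≤ 1)
    (hg : DifferentiableOn ℂ g {s | 0 < s.re})
    (hgb : ∀ s : ℂ, σ ≤ s.re → s.re ≤ 1 → ‖g s‖ ≤ C * (1 + |s.im|) ^ a)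
    (hK : ∀ z : ℂ, 0 ≤ z.re → z.re ≤ 1 → DifferentiableAt ℂ K z)
    (hKb : ∀ z : ℂ, 0 ≤ z.re → z.re ≤ 1 → ‖K z‖ ≤ C' * (1 + |z.im|) ^ (-b))
    (hab : 1 < b - a) :
    Integrable (fun t : ℝ => g (σ + t * Complex.I) * K (t * Complex.I)) ∧
    Integrable (fun t : ℝ => g (1 + t * Complex.I) * K ((1 - σ : ℝ) + t * Complex.I)) ∧
    ∫ t : ℝ, g (σ + t * Complex.I) * K (t * Complex.I) =
      ∫ t : ℝ, g (1 + t * Complex.I) * K ((1 - σ : ℝ) + t * Complex.I) := by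
  have hgd : ∀ s : ℂ, 0 < s.re → DifferentiableAt ℂ g s := fun s hs =>
    (hg s hs).differentiableAt (isOpen_re_pos.mem_nhds hs)
  set h : ℂ → ℂ := fun s => g s * K (s - σ) with hh
  have hd : ∀ s : ℂ, σ ≤ s.re → s.re ≤ 1 → DifferentiableAt ℂ h s := by
    intro s h1 h2
    refine (hgd s (by linarith)).mul ?_
    refine DifferentiableAt.comp (f := fun s : ℂ => s - σ) s (hK _ (by simpa using h1)
      (by simp; linarith)) (by fun_prop)
  have hb : ∀ x t : ℝ, σ ≤ x → x ≤ 1 →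
      ‖h (x + t * Complex.I)‖ ≤ C * C' * (1 + |t|) ^ (-(b - a)) := by
    intro x t h1 h2
    have e1 := hgb (x + t * Complex.I) (by simpa using h1) (by simpa using h2)
    have e2 := hKb (x + t * Complex.I - σ) (by simpa using h1) (by simp; linarith)
    simp only [Complex.add_im, Complex.sub_im, Complex.mul_im, Complex.ofReal_im, Complex.ofReal_re,
      Complex.I_im, Complex.I_re, mul_one, mul_zero, add_zero, zero_add, sub_zero] at e1 e2
    rw [hh]
    simp only [norm_mul]
    calc _ ≤ (C * (1 + |t|) ^ a) * (C' * (1 + |t|) ^ (-b)) :=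
          mul_le_mul e1 e2 (norm_nonneg _) ((norm_nonneg _).trans e1)
      _ = C * C' * ((1 + |t|) ^ a * (1 + |t|) ^ (-b)) := by ring
      _ = _ := by rw [← Real.rpow_add (by positivity)]; ring_nf
  have h_int : ∀ x : ℝ, σ ≤ x → x ≤ 1 → Integrable (fun t : ℝ => h (x + t * Complex.I)) := by
    intro x h1 h2
    refine Integrable.mono' ((integrable_one_add_abs_rpow hab).const_mul (C * C'))
      ?_ (Eventually.of_forall fun t => hb x t h1 h2)
    refine Continuous.aestronglyMeasurable (continuous_iff_continuousAt.2 fun t => ?_)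
    exact ContinuousAt.comp (f := fun t : ℝ => (x + t * Complex.I : ℂ)) (g := h)
      (hd _ (by simpa using h1) (by simpa using h2)).continuousAt (by fun_prop)
  have i1 := h_int σ le_rfl hσ1
  have i2 := h_int 1 hσ1 le_rfl
  have e := integral_vertical_eq_of_decay hσ1 hd i1 i2 (fun ε hε => by
    obtain ⟨T₀, hT⟩ := exists_le_one_add_abs_rpow_neg_mul (r := b - a) (by linarith) hε (C * C')
    exact ⟨T₀, fun x t h1 h2 ht => (hb x t h1 h2).trans (hT t ht)⟩)
  have r1 : (fun t : ℝ => h (σ + t * Complex.I)) =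
      fun t : ℝ => g (σ + t * Complex.I) * K (t * Complex.I) := by
    funext t; simp [hh]
  have r2 : (fun t : ℝ => h ((1 : ℝ) + t * Complex.I)) =
      fun t : ℝ => g (1 + t * Complex.I) * K ((1 - σ : ℝ) + t * Complex.I) := by
    funext t; simp only [hh, Complex.ofReal_one]; congr 2; push_cast; ring
  rw [r1] at i1 e
  rw [r2] at i2 e
  exact ⟨i1, i2, e⟩

end ContourShift

section PoissonKernel

lemma three_quarters_le_re_sq_sub_sq {R : ℝ} (hR : 2 ≤ R) {z : ℂ} (h0 : 0 ≤ z.re) (h1 : z.re ≤ 1) :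
    3 / 4 * (R ^ 2 + z.im ^ 2) ≤ (((R ^ 2 : ℝ) : ℂ) - z ^ 2).re := by
  have : (((R ^ 2 : ℝ) : ℂ) - z ^ 2).re = R ^ 2 - (z.re ^ 2 - z.im ^ 2) := by
    rw [Complex.sub_re, Complex.ofReal_re, pow_two z, Complex.mul_re]; ring
  rw [this]
  nlinarith

lemma one_add_abs_sq_le {R : ℝ} (hR : 2 ≤ R) (t : ℝ) : (1 + |t|) ^ 2 ≤ 2 * (R ^ 2 + t ^ 2) := by
  have := sq_abs t
  nlinarith [sq_nonneg (1 - |t|)]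

lemma norm_sq_sub_sq_ge {R : ℝ} (hR : 2 ≤ R) {z : ℂ} (h0 : 0 ≤ z.re) (h1 : z.re ≤ 1) :
    3 / 4 * (R ^ 2 + z.im ^ 2) ≤ ‖((R ^ 2 : ℝ) : ℂ) - z ^ 2‖ :=
  (three_quarters_le_re_sq_sub_sq hR h0 h1).trans (Complex.re_le_norm _)

lemma sq_sub_sq_ne_zero {R : ℝ} (hR : 2 ≤ R) {z : ℂ} (h0 : 0 ≤ z.re) (h1 : z.re ≤ 1) :
    ((R ^ 2 : ℝ) : ℂ) - z ^ 2 ≠ 0 := by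
  have := norm_sq_sub_sq_ge hR h0 h1
  have h2 : 0 < 3 / 4 * (R ^ 2 + z.im ^ 2) := by positivity
  exact norm_pos_iff.1 (h2.trans_le this)

lemma norm_inv_sq_sub_sq_le {R : ℝ} (hR : 2 ≤ R) {z : ℂ} (h0 : 0 ≤ z.re) (h1 : z.re ≤ 1) :
    ‖(((R ^ 2 : ℝ) : ℂ) - z ^ 2)⁻¹‖ ≤ 8 / 3 * (1 + |z.im|) ^ (-2 : ℝ) := by
  have h2 : 0 < R ^ 2 + z.im ^ 2 := by positivity
  rw [norm_inv, Real.rpow_neg (by positivity), show (2 : ℝ) = (2 : ℕ) by norm_num, Real.rpow_natCast,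
    ← div_eq_mul_inv, inv_eq_one_div]
  have h3 := norm_sq_sub_sq_ge hR h0 h1
  have h4 := one_add_abs_sq_le hR z.im
  rw [div_le_div_iff₀ (by linarith) (by positivity)]
  push_cast at h3 ⊢
  linarith

lemma inv_sq_sub_sq_I_mul (R t : ℝ) :
    (((R ^ 2 : ℝ) : ℂ) - (t * Complex.I) ^ 2)⁻¹ = (((R ^ 2 + t ^ 2)⁻¹ : ℝ) : ℂ) := by
  rw [mul_pow, Complex.I_sq]; push_cast; ring_nf

lemma norm_inv_sq_sub_sq_sub_le {R : ℝ} (hR : 2 ≤ R) {x : ℝ} (h0 : 0 ≤ x) (h1 : x ≤ 1) (t : ℝ) :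
    ‖(((R ^ 2 : ℝ) : ℂ) - (x + t * Complex.I) ^ 2)⁻¹ - (((R ^ 2 + t ^ 2)⁻¹ : ℝ) : ℂ)‖ ≤
      8 / 3 * (1 + |t|) / (R ^ 2 + t ^ 2) ^ 2 := by
  have hz := norm_sq_sub_sq_ge (z := x + t * Complex.I) hR (by simpa using h0) (by simpa using h1)
  have hne := sq_sub_sq_ne_zero (z := x + t * Complex.I) hR (by simpa using h0) (by simpa using h1)
  have hne2 := sq_sub_sq_ne_zero (z := t * Complex.I) hR (by simp) (by simp)
  rw [← inv_sq_sub_sq_I_mul, inv_sub_inv hne hne2, norm_div, norm_mul]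
  have e1 : ‖((R ^ 2 : ℝ) : ℂ) - (t * Complex.I) ^ 2‖ = R ^ 2 + t ^ 2 := by
    have : ((R ^ 2 : ℝ) : ℂ) - (t * Complex.I) ^ 2 = ((R ^ 2 + t ^ 2 : ℝ) : ℂ) := by
      rw [mul_pow, Complex.I_sq]; push_cast; ring
    rw [this, Complex.norm_real, Real.norm_of_nonneg (by positivity)]
  have e2 : ‖((R ^ 2 : ℝ) : ℂ) - (t * Complex.I) ^ 2 - (((R ^ 2 : ℝ) : ℂ) - (x + t * Complex.I) ^ 2)‖ ≤
      2 * (1 + |t|) := by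
    have : ((R ^ 2 : ℝ) : ℂ) - (t * Complex.I) ^ 2 - (((R ^ 2 : ℝ) : ℂ) - (x + t * Complex.I) ^ 2) =
      (x : ℂ) * (x + 2 * t * Complex.I) := by ring
    rw [this, norm_mul, Complex.norm_real, Real.norm_of_nonneg h0]
    have h3 : ‖(x : ℂ) + 2 * t * Complex.I‖ ≤ x + 2 * |t| := by
      refine (norm_add_le _ _).trans ?_
      simp [abs_of_nonneg h0]
    have h4 := norm_nonneg ((x : ℂ) + 2 * t * Complex.I)
    have := abs_nonneg t
    nlinarith
  simp only [Complex.add_im, Complex.mul_im, Complex.ofReal_im, Complex.ofReal_re,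
      Complex.I_im, Complex.I_re, mul_one, mul_zero, add_zero, zero_add] at hz
  rw [e1]
  have hp : 0 < R ^ 2 + t ^ 2 := by positivity
  rw [div_le_div_iff₀ (mul_pos (by linarith) hp) (by positivity)]
  have : 3 / 4 * (R ^ 2 + t ^ 2) * (R ^ 2 + t ^ 2) ≤
    ‖((R ^ 2 : ℝ) : ℂ) - (x + t * Complex.I) ^ 2‖ * (R ^ 2 + t ^ 2) := by gcongr
  have h7 : 0 ≤ 1 + |t| := by positivity
  calc _ ≤ 2 * (1 + |t|) * (R ^ 2 + t ^ 2) ^ 2 := by gcongr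
    _ = 8 / 3 * (1 + |t|) * (3 / 4 * (R ^ 2 + t ^ 2) * (R ^ 2 + t ^ 2)) := by ring
    _ ≤ _ := by gcongr

lemma integrable_inv_sq_add_sq {R : ℝ} (hR : 0 < R) : Integrable fun t : ℝ => (R ^ 2 + t ^ 2)⁻¹ := by
  have h := ((integrable_inv_one_add_sq).comp_div hR.ne').const_mul (R ^ 2)⁻¹
  refine h.congr (Eventually.of_forall fun t => ?_)
  field_simp

lemma integral_inv_sq_add_sq_univ {R : ℝ} (hR : 0 < R) : ∫ t : ℝ, (R ^ 2 + t ^ 2)⁻¹ = π / R := by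
  have h := Measure.integral_comp_div (fun t : ℝ => (1 + t ^ 2)⁻¹) R
  rw [integral_univ_inv_one_add_sq] at h
  have : (fun t : ℝ => (R ^ 2 + t ^ 2)⁻¹) = fun t => (R ^ 2)⁻¹ * (1 + (t / R) ^ 2)⁻¹ := by
    funext t; field_simp
  rw [this, integral_const_mul, h, abs_of_pos hR, smul_eq_mul]
  field_simp

/-- Comparison of Poisson-type averages of `re f` on the lines `re s = σ` and `re s = 1`. -/
lemma integral_poisson_compare {f : ℂ → ℂ} (hf : DifferentiableOn ℂ f {s | 0 < s.re})
    (hb : ∀ σ₁ : ℝ, 0 < σ₁ → σ₁ ≤ 1 → ∃ C, 0 < C ∧ ∀ s : ℂ, σ₁ ≤ s.re → s.re ≤ 5 →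
      ‖f s‖ ≤ C * (1 + |s.im|) ^ (2 / 5 : ℝ)) :
    ∃ B, 0 < B ∧ ∀ σ R : ℝ, 0 < σ → σ ≤ 1 → 2 ≤ R →
      Integrable (fun t : ℝ => (f (σ + t * Complex.I)).re * (R ^ 2 + t ^ 2)⁻¹) ∧
      |(∫ t : ℝ, (f (σ + t * Complex.I)).re * (R ^ 2 + t ^ 2)⁻¹) -
        ∫ t : ℝ, (f (1 + t * Complex.I)).re * (R ^ 2 + t ^ 2)⁻¹| ≤ B / R := by
  obtain ⟨C1, hC1, H1⟩ := hb 1 one_pos le_rfl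
  refine ⟨6 * C1 * π, by positivity, fun σ R hσ hσ1 hR => ?_⟩
  have hR0 : 0 < R := by linarith
  have key : ∀ σ : ℝ, 0 < σ → σ ≤ 1 →
      Integrable (fun t : ℝ => f (σ + t * Complex.I) * (((R ^ 2 + t ^ 2)⁻¹ : ℝ) : ℂ)) ∧
      Integrable (fun t : ℝ => f (1 + t * Complex.I) *
        (((R ^ 2 : ℝ) : ℂ) - ((1 - σ : ℝ) + t * Complex.I) ^ 2)⁻¹) ∧
      ∫ t : ℝ, f (σ + t * Complex.I) * (((R ^ 2 + t ^ 2)⁻¹ : ℝ) : ℂ) =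
      ∫ t : ℝ, f (1 + t * Complex.I) * (((R ^ 2 : ℝ) : ℂ) - ((1 - σ : ℝ) + t * Complex.I) ^ 2)⁻¹ := by
    intro σ hσ hσ1
    obtain ⟨C, hC, H⟩ := hb σ hσ hσ1
    have h := integral_mul_kernel_shift (g := f) (K := fun z => (((R ^ 2 : ℝ) : ℂ) - z ^ 2)⁻¹)
      (σ := σ) (a := 2 / 5) (b := 2) (C := C) (C' := 8 / 3) hσ hσ1 hf
      (fun s h1 h2 => H s h1 (by linarith))
      (fun z h1 h2 => by
        have := sq_sub_sq_ne_zero hR h1 h2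
        fun_prop (disch := assumption))
      (fun z h1 h2 => norm_inv_sq_sub_sq_le hR h1 h2) (by norm_num)
    simp only [inv_sq_sub_sq_I_mul] at h
    exact h
  obtain ⟨i1, i2, e⟩ := key σ hσ hσ1
  obtain ⟨i3, -, -⟩ := key 1 one_pos le_rfl
  simp only [Complex.ofReal_one] at i3
  have r1 : ∀ z : ℂ, ∀ r : ℝ, (z * (r : ℂ)).re = z.re * r := fun z r => by simp
  have j1 := i1.re
  have j3 := i3.re
  simp only [RCLike.re_to_complex, r1] at j1 j3
  refine ⟨j1, ?_⟩
  have q1 := integral_re i1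
  have q3 := integral_re i3
  simp only [RCLike.re_to_complex, r1] at q1 q3
  rw [q1, q3, e, ← Complex.sub_re, ← integral_sub i2 i3]
  refine (Complex.abs_re_le_norm _).trans ?_
  have hbd : ∀ t : ℝ, ‖f (1 + t * Complex.I) * (((R ^ 2 : ℝ) : ℂ) - ((1 - σ : ℝ) + t * Complex.I) ^ 2)⁻¹ -
      f (1 + t * Complex.I) * (((R ^ 2 + t ^ 2)⁻¹ : ℝ) : ℂ)‖ ≤ 6 * C1 * (R ^ 2 + t ^ 2)⁻¹ := by
    intro t
    rw [← mul_sub, norm_mul]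
    have a1 := H1 (1 + t * Complex.I) (by simp) (by norm_num)
    have a2 := norm_inv_sq_sub_sq_sub_le hR (x := 1 - σ) (by linarith) (by linarith) t
    simp only [Complex.add_im, Complex.mul_im, Complex.ofReal_im, Complex.ofReal_re, Complex.one_im,
      Complex.I_im, Complex.I_re, mul_one, mul_zero, add_zero, zero_add] at a1
    have a3 : (1 + |t|) ^ (2 / 5 : ℝ) ≤ 1 + |t| := by
      conv_rhs => rw [← Real.rpow_one (1 + |t|)]
      exact Real.rpow_le_rpow_of_exponent_le (by linarith [abs_nonneg t]) (by norm_num)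
    have a4 := one_add_abs_sq_le hR t
    have hp : 0 < R ^ 2 + t ^ 2 := by positivity
    calc _ ≤ (C1 * (1 + |t|)) * (8 / 3 * (1 + |t|) / (R ^ 2 + t ^ 2) ^ 2) := by
          refine mul_le_mul (a1.trans ?_) a2 (norm_nonneg _) (by positivity)
          gcongr
      _ = (8 / 3 * C1) * ((1 + |t|) ^ 2 / (R ^ 2 + t ^ 2) ^ 2) := by ring
      _ ≤ (8 / 3 * C1) * (2 * (R ^ 2 + t ^ 2) / (R ^ 2 + t ^ 2) ^ 2) := by gcongr
      _ = 16 / 3 * C1 * (R ^ 2 + t ^ 2)⁻¹ := by field_simp; norm_num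
      _ ≤ _ := by gcongr; norm_num
  refine (norm_integral_le_of_norm_le ((integrable_inv_sq_add_sq hR0).const_mul (6 * C1))
    (Eventually.of_forall hbd)).trans ?_
  rw [integral_const_mul, integral_inv_sq_add_sq_univ hR0, mul_div_assoc]

end PoissonKernel

section XiLogDerivAverages

lemma integrable_one_add_abs_rpow_mul_inv :
    Integrable fun t : ℝ => (1 + |t|) ^ (1 / 2 : ℝ) * (1 + t ^ 2)⁻¹ := by
  have h := (integrable_one_add_abs_rpow (r := 3 / 2) (by norm_num)).const_mul 2
  refine h.mono' (by fun_prop (disch := intros; positivity)) (Eventually.of_forall fun t => ?_)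
  rw [Real.norm_of_nonneg (by positivity)]
  have h1 : (1 + t ^ 2)⁻¹ ≤ 2 * (1 + |t|) ^ (-2 : ℝ) := by
    rw [Real.rpow_neg (by positivity), show (2 : ℝ) = (2 : ℕ) by norm_num, Real.rpow_natCast,
      ← div_eq_mul_inv, inv_eq_one_div, div_le_div_iff₀ (by positivity) (by positivity)]
    push_cast
    nlinarith [sq_nonneg (1 - |t|), sq_abs t]
  calc _ ≤ (1 + |t|) ^ (1 / 2 : ℝ) * (2 * (1 + |t|) ^ (-2 : ℝ)) := by gcongr
    _ = 2 * ((1 + |t|) ^ (1 / 2 : ℝ) * (1 + |t|) ^ (-2 : ℝ)) := by ring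
    _ = _ := by rw [← Real.rpow_add (by positivity)]; norm_num

lemma exists_integral_re_logDeriv_centeredXi_bounds (hRH : RiemannHypothesis) :
    ∃ B, 0 < B ∧ ∀ σ R : ℝ, 0 < σ → σ ≤ 1 → 2 ≤ R →
      Integrable (fun t : ℝ => (logDeriv centeredXi (σ + t * Complex.I)).re * (R ^ 2 + t ^ 2)⁻¹) ∧
      ∫ t : ℝ, (logDeriv centeredXi (σ + t * Complex.I)).re * (R ^ 2 + t ^ 2)⁻¹ ≤
        (2 * π * Real.log R + B) / R ∧
      (Real.log R / 30 - B) / R ≤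
        ∫ t : ℝ, (logDeriv centeredXi (σ + t * Complex.I)).re * (R ^ 2 + t ^ 2)⁻¹ := by
  obtain ⟨B₁, hB₁, hcmp⟩ := integral_poisson_compare (differentiableOn_logDeriv_centeredXi hRH)
    (fun σ₁ h1 h2 => exists_norm_logDeriv_centeredXi_le hRH h1 h2)
  obtain ⟨C, hC, HU, HL⟩ := exists_logDeriv_centeredXi_bounds hRH
  set J := ∫ t : ℝ, (1 + |t|) ^ (1 / 2 : ℝ) * (1 + t ^ 2)⁻¹ with hJ
  have hJ0 : 0 ≤ J := integral_nonneg fun t => by positivity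
  set B := 2 * π * |Real.log C| + 4 * J + |Real.log C| + B₁ with hB
  refine ⟨B, by positivity, fun σ R hσ hσ1 hR => ?_⟩
  have hR0 : 0 < R := by linarith
  obtain ⟨i1, hc⟩ := hcmp σ R hσ hσ1 hR
  obtain ⟨i2, -⟩ := hcmp 1 R one_pos le_rfl hR
  simp only [Complex.ofReal_one] at i2
  set f := logDeriv centeredXi
  set I1 := ∫ t : ℝ, (f (1 + t * Complex.I)).re * (R ^ 2 + t ^ 2)⁻¹ with hI1
  have hc' := abs_le.1 hc
  have hup : I1 ≤ (2 * π * Real.log R + 2 * π * |Real.log C| + 4 * J) / R := by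
    have hbase : (fun t : ℝ => (1 + |t / R|) ^ (1 / 2 : ℝ) * (R ^ 2 + t ^ 2)⁻¹) =
        fun t => (R ^ 2)⁻¹ * ((1 + |t / R|) ^ (1 / 2 : ℝ) * (1 + (t / R) ^ 2)⁻¹) := by
      funext t
      have : (R ^ 2 + t ^ 2)⁻¹ = (R ^ 2)⁻¹ * (1 + (t / R) ^ 2)⁻¹ := by field_simp
      rw [this]; ring
    have j1 : Integrable (fun t : ℝ => (1 + |t / R|) ^ (1 / 2 : ℝ) * (R ^ 2 + t ^ 2)⁻¹) := by
      rw [hbase]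
      exact (integrable_one_add_abs_rpow_mul_inv.comp_div hR0.ne').const_mul _
    have j2 : ∫ t : ℝ, (1 + |t / R|) ^ (1 / 2 : ℝ) * (R ^ 2 + t ^ 2)⁻¹ = J / R := by
      rw [hbase, integral_const_mul, Measure.integral_comp_div
        (fun t : ℝ => (1 + |t|) ^ (1 / 2 : ℝ) * (1 + t ^ 2)⁻¹) R, abs_of_pos hR0, ← hJ, smul_eq_mul]
      field_simp
    have hpt : ∀ t : ℝ, (f (1 + t * Complex.I)).re * (R ^ 2 + t ^ 2)⁻¹ ≤
        (2 * Real.log R + 2 * |Real.log C|) * (R ^ 2 + t ^ 2)⁻¹ +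
          4 * ((1 + |t / R|) ^ (1 / 2 : ℝ) * (R ^ 2 + t ^ 2)⁻¹) := by
      intro t
      have a1 := HU (1 + t * Complex.I) (by simp)
      have a2 : ‖(1 : ℂ) + t * Complex.I‖ ≤ 1 + |t| := (norm_add_le _ _).trans (by simp)
      have a3 : Real.log (C * (1 + ‖(1 : ℂ) + t * Complex.I‖)) ≤
          Real.log C + (Real.log R + Real.log (1 + |t / R|)) := by
        rw [← Real.log_mul hR0.ne' (by positivity), ← Real.log_mul hC.ne' (by positivity)]
        apply Real.log_le_log (by positivity)
        gcongr
        rw [abs_div, abs_of_pos hR0, mul_add, mul_div_cancel₀ _ hR0.ne']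
        linarith
      have a4 := Real.log_le_rpow_div (x := 1 + |t / R|) (ε := 1 / 2) (by positivity) (by norm_num)
      have a5 := le_abs_self (Real.log C)
      have a6 : (1 + |t / R|) ^ (1 / 2 : ℝ) / (1 / 2) = 2 * (1 + |t / R|) ^ (1 / 2 : ℝ) := by ring
      rw [a6] at a4
      have : (f (1 + t * Complex.I)).re ≤ (2 * Real.log R + 2 * |Real.log C|) +
        4 * ((1 + |t / R|) ^ (1 / 2 : ℝ)) := by linarith
      rw [← mul_assoc, ← add_mul]
      gcongr
    have := integral_mono i2 (((integrable_inv_sq_add_sq hR0).const_mul _).add (j1.const_mul 4)) hpt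
    refine this.trans (le_of_eq ?_)
    rw [integral_add' ((integrable_inv_sq_add_sq hR0).const_mul _) (j1.const_mul 4),
      integral_const_mul, integral_const_mul, j2, integral_inv_sq_add_sq_univ hR0]
    ring
  have hlo : (Real.log R / 30 - |Real.log C|) / R ≤ I1 := by
    have h1 : ∫ t in Icc R (2 * R), (f (1 + t * Complex.I)).re * (R ^ 2 + t ^ 2)⁻¹ ≤ I1 :=
      setIntegral_le_integral i2 (Eventually.of_forall fun t =>
        mul_nonneg (re_logDeriv_centeredXi_nonneg hRH (by simp)) (by positivity))
    have h2 : ∫ t in Icc R (2 * R), ((Real.log R - |Real.log C|) / 6) * (5 * R ^ 2)⁻¹ ≤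
        ∫ t in Icc R (2 * R), (f (1 + t * Complex.I)).re * (R ^ 2 + t ^ 2)⁻¹ := by
      refine setIntegral_mono_on (integrableOn_const (by simp)) i2.integrableOn measurableSet_Icc fun t ht => ?_
      have b1 := HL t (by linarith [ht.1])
      have b2 : 0 ≤ (f (1 + t * Complex.I)).re := re_logDeriv_centeredXi_nonneg hRH (by simp)
      rw [abs_of_nonneg (by linarith [ht.1]), Real.log_div (by linarith [ht.1]) hC.ne'] at b1
      have b3 := Real.log_le_log hR0 ht.1
      have b4 := le_abs_self (Real.log C)
      refine (mul_le_mul_of_nonneg_right (by linarith : _ ≤ (f (1 + t * Complex.I)).re)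
        (by positivity)).trans ?_
      gcongr
      nlinarith [ht.1, ht.2]
    rw [setIntegral_const, smul_eq_mul, Measure.real, Real.volume_Icc,
      ENNReal.toReal_ofReal (by linarith)] at h2
    refine le_trans ?_ (h2.trans h1)
    have : (2 * R - R) * ((Real.log R - |Real.log C|) / 6 * (5 * R ^ 2)⁻¹) =
      (Real.log R / 30 - |Real.log C| / 30) / R := by field_simp; ring
    rw [this]
    gcongr
    have := abs_nonneg (Real.log C)
    linarith
  refine ⟨i1, ?_, ?_⟩
  · have : (2 * π * Real.log R + B) / R = (2 * π * Real.log R + 2 * π * |Real.log C| + 4 * J) / R +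
      |Real.log C| / R + B₁ / R := by rw [hB]; ring
    rw [this]
    have : 0 ≤ |Real.log C| / R := by positivity
    linarith [hc'.2]
  · have : (Real.log R / 30 - B) / R = (Real.log R / 30 - |Real.log C|) / R - B₁ / R -
      (2 * π * |Real.log C| + 4 * J) / R := by rw [hB]; ring
    rw [this]
    have : 0 ≤ (2 * π * |Real.log C| + 4 * J) / R := by positivity
    linarith [hc'.1]

end XiLogDerivAverages

section XiLogDerivMeanSquare

lemma exists_integral_norm_sq_logDeriv_centeredXi_le (hRH : RiemannHypothesis) :
    ∃ C, 0 < C ∧ ∀ σ : ℝ, 0 < σ → σ ≤ 1 →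
      Integrable (fun t : ℝ => ‖logDeriv centeredXi (σ + t * Complex.I)‖ ^ 2 * (4 + t ^ 2)⁻¹) ∧
      ∫ t : ℝ, ‖logDeriv centeredXi (σ + t * Complex.I)‖ ^ 2 * (4 + t ^ 2)⁻¹ ≤ C / σ := by
  have hf := differentiableOn_logDeriv_centeredXi hRH
  have hgr := fun (σ₁ : ℝ) h1 h2 => exists_norm_logDeriv_centeredXi_le hRH (σ₁ := σ₁) h1 h2
  have hpos := fun s hs => re_logDeriv_centeredXi_nonneg hRH (s := s) hs
  have hmono := fun (σ t : ℝ) (h0 : 0 < σ) (h1 : σ ≤ 1) =>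
    (re_mul_le_of_re_nonneg hf hpos (x := σ) (y := 1) (t := t) h0 h1).1
  obtain ⟨C₁, hC₁, H1⟩ := hgr 1 one_pos le_rfl
  obtain ⟨C, hC, HU, -⟩ := exists_logDeriv_centeredXi_bounds hRH
  set f := logDeriv centeredXi
  have h22 : (4 : ℝ) = 2 ^ 2 := by norm_num
  -- first kernel
  set c : ℝ := (3 / 8 : ℝ) ^ (-(7 / 8) : ℝ) with hc
  have hK7 : ∀ z : ℂ, 0 ≤ z.re → z.re ≤ 1 →
      ‖(((2 ^ 2 : ℝ) : ℂ) - z ^ 2) ^ ((-(7 / 8) : ℝ) : ℂ)‖ ≤ c * (1 + |z.im|) ^ (-(7 / 4) : ℝ) := by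
    intro z h0 h1
    have h2 := norm_sq_sub_sq_ge le_rfl h0 h1
    have h3 := one_add_abs_sq_le le_rfl z.im
    rw [Complex.norm_cpow_real, hc]
    calc _ ≤ (3 / 8 * (1 + |z.im|) ^ 2) ^ (-(7 / 8) : ℝ) :=
          Real.rpow_le_rpow_of_nonpos (by positivity) (by linarith) (by norm_num)
      _ = _ := by
        rw [Real.mul_rpow (by positivity) (by positivity), ← Real.rpow_natCast (1 + |z.im|) 2,
          ← Real.rpow_mul (by positivity)]
        norm_num
  have hI7 : ∀ t : ℝ, (((2 ^ 2 : ℝ) : ℂ) - (t * Complex.I) ^ 2) ^ ((-(7 / 8) : ℝ) : ℂ) =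
      (((4 + t ^ 2) ^ (-(7 / 8) : ℝ) : ℝ) : ℂ) := by
    intro t
    rw [Complex.ofReal_cpow (by positivity)]
    congr 1
    rw [mul_pow, Complex.I_sq]; push_cast; ring
  set A₁ := ∫ t : ℝ, (C₁ * c) * (1 + |t|) ^ (-(27 / 20) : ℝ) with hA₁
  set A₂ := ∫ t : ℝ, (C₁ ^ 2 * (8 / 3)) * (1 + |t|) ^ (-(6 / 5) : ℝ) with hA₂
  have hA₁0 : 0 ≤ A₁ := integral_nonneg fun t => by positivity
  have hA₂0 : 0 ≤ A₂ := integral_nonneg fun t => by positivity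
  have hline : ∀ σ : ℝ, 0 < σ → σ ≤ 1 → Integrable (fun t : ℝ =>
      (f (σ + t * Complex.I)).re * (4 + t ^ 2) ^ (-(7 / 8) : ℝ)) ∧
      ∫ t : ℝ, (f (σ + t * Complex.I)).re * (4 + t ^ 2) ^ (-(7 / 8) : ℝ) ≤ A₁ := by
    intro σ hσ hσ1
    obtain ⟨Cσ, hCσ, H⟩ := hgr σ hσ hσ1
    obtain ⟨i1, i2, e⟩ := integral_mul_kernel_shift (g := f)
      (K := fun z => (((2 ^ 2 : ℝ) : ℂ) - z ^ 2) ^ ((-(7 / 8) : ℝ) : ℂ))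
      (σ := σ) (a := 2 / 5) (b := 7 / 4) (C := Cσ) (C' := c) hσ hσ1 hf
      (fun s h1 h2 => H s h1 (by linarith))
      (fun z h1 h2 => by
        have h3 := three_quarters_le_re_sq_sub_sq le_rfl h1 h2
        have h4 : 0 < 3 / 4 * ((2:ℝ) ^ 2 + z.im ^ 2) := by positivity
        refine DifferentiableAt.cpow_const (by fun_prop) (Or.inl (h4.trans_le h3)))
      hK7 (by norm_num)
    simp only [hI7] at i1 e
    have r1 : ∀ z : ℂ, ∀ r : ℝ, (z * (r : ℂ)).re = z.re * r := fun z r => by simp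
    have j1 := i1.re
    have q1 := integral_re i1
    simp only [RCLike.re_to_complex, r1] at j1 q1
    refine ⟨j1, ?_⟩
    rw [q1, e]
    refine (Complex.re_le_norm _).trans ?_
    refine norm_integral_le_of_norm_le
      ((integrable_one_add_abs_rpow (r := 27 / 20) (by norm_num)).const_mul _)
      (Eventually.of_forall fun t => ?_)
    have a1 := H1 (1 + t * Complex.I) (by simp) (by norm_num)
    have a2 := hK7 ((1 - σ : ℝ) + t * Complex.I) (by simp; linarith) (by simp; linarith)
    simp only [Complex.add_im, Complex.mul_im, Complex.ofReal_im, Complex.ofReal_re, Complex.one_im,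
      Complex.I_im, Complex.I_re, mul_one, mul_zero, add_zero, zero_add] at a1 a2
    rw [norm_mul]
    calc _ ≤ (C₁ * (1 + |t|) ^ (2 / 5 : ℝ)) * (c * (1 + |t|) ^ (-(7 / 4) : ℝ)) :=
          mul_le_mul a1 a2 (norm_nonneg _) (by positivity)
      _ = C₁ * c * ((1 + |t|) ^ (2 / 5 : ℝ) * (1 + |t|) ^ (-(7 / 4) : ℝ)) := by ring
      _ = _ := by rw [← Real.rpow_add (by positivity)]; norm_num
  have hsq : ∀ σ : ℝ, 0 < σ → σ ≤ 1 → Integrable (fun t : ℝ =>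
      f (σ + t * Complex.I) ^ 2 * (((4 + t ^ 2)⁻¹ : ℝ) : ℂ)) ∧
      |∫ t : ℝ, (f (σ + t * Complex.I) ^ 2 * (((4 + t ^ 2)⁻¹ : ℝ) : ℂ)).re| ≤ A₂ := by
    intro σ hσ hσ1
    obtain ⟨Cσ, hCσ, H⟩ := hgr σ hσ hσ1
    have hpw : ∀ (D : ℝ) (s : ℂ), ‖f s‖ ≤ D * (1 + |s.im|) ^ (2 / 5 : ℝ) →
        ‖f s ^ 2‖ ≤ D ^ 2 * (1 + |s.im|) ^ (4 / 5 : ℝ) := by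
      intro D s h
      rw [norm_pow]
      refine (pow_le_pow_left₀ (norm_nonneg _) h 2).trans (le_of_eq ?_)
      rw [mul_pow, ← Real.rpow_natCast ((1 + |s.im|) ^ (2 / 5 : ℝ)) 2, ← Real.rpow_mul (by positivity)]
      norm_num
    obtain ⟨i1, i2, e⟩ := integral_mul_kernel_shift (g := fun s => f s ^ 2)
      (K := fun z => (((2 ^ 2 : ℝ) : ℂ) - z ^ 2)⁻¹)
      (σ := σ) (a := 4 / 5) (b := 2) (C := Cσ ^ 2) (C' := 8 / 3) hσ hσ1 (hf.pow 2)
      (fun s h1 h2 => hpw _ _ (H s h1 (by linarith)))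
      (fun z h1 h2 => by
        have := sq_sub_sq_ne_zero le_rfl h1 h2
        fun_prop (disch := assumption))
      (fun z h1 h2 => norm_inv_sq_sub_sq_le le_rfl h1 h2) (by norm_num)
    simp only [inv_sq_sub_sq_I_mul] at i1 e
    rw [← h22] at i1 e
    have q1 := integral_re i1
    simp only [RCLike.re_to_complex] at q1
    refine ⟨i1, ?_⟩
    rw [q1, e]
    refine (Complex.abs_re_le_norm _).trans ?_
    refine norm_integral_le_of_norm_le
      ((integrable_one_add_abs_rpow (r := 6 / 5) (by norm_num)).const_mul _)
      (Eventually.of_forall fun t => ?_)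
    have a1 := hpw _ _ (H1 (1 + t * Complex.I) (by simp) (by norm_num))
    have a2 := norm_inv_sq_sub_sq_le le_rfl (z := (1 - σ : ℝ) + t * Complex.I)
      (by simp; linarith) (by simp; linarith)
    simp only [Complex.add_im, Complex.mul_im, Complex.ofReal_im, Complex.ofReal_re, Complex.one_im,
      Complex.I_im, Complex.I_re, mul_one, mul_zero, add_zero, zero_add] at a1 a2
    rw [norm_mul]
    rw [← h22] at a2
    calc _ ≤ (C₁ ^ 2 * (1 + |t|) ^ (4 / 5 : ℝ)) * (8 / 3 * (1 + |t|) ^ (-2 : ℝ)) :=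
          mul_le_mul a1 a2 (norm_nonneg _) (by positivity)
      _ = C₁ ^ 2 * (8 / 3) * ((1 + |t|) ^ (4 / 5 : ℝ) * (1 + |t|) ^ (-2 : ℝ)) := by ring
      _ = _ := by rw [← Real.rpow_add (by positivity)]; norm_num
  set D := 8 * (C ^ (1 / 4 : ℝ) * 2 ^ (1 / 8 : ℝ)) with hD
  have hlog : ∀ t : ℝ, 2 * Real.log (C * (1 + ‖(1 : ℂ) + t * Complex.I‖)) ≤ D * (4 + t ^ 2) ^ (1 / 8 : ℝ) := by
    intro t
    have a2 : ‖(1 : ℂ) + t * Complex.I‖ ≤ 1 + |t| := (norm_add_le _ _).trans (by simp)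
    have a4 := Real.log_le_rpow_div (x := C * (2 + |t|)) (ε := 1 / 4) (by positivity) (by norm_num)
    have a3 : Real.log (C * (1 + ‖(1 : ℂ) + t * Complex.I‖)) ≤ Real.log (C * (2 + |t|)) := by
      apply Real.log_le_log (by positivity)
      exact mul_le_mul_of_nonneg_left (by linarith) hC.le
    have a5 : (C * (2 + |t|)) ^ (1 / 4 : ℝ) ≤ C ^ (1 / 4 : ℝ) * 2 ^ (1 / 8 : ℝ) * (4 + t ^ 2) ^ (1 / 8 : ℝ) := by
      rw [Real.mul_rpow hC.le (by positivity), mul_assoc, ← Real.mul_rpow (x := 2) (y := 4 + t ^ 2) (by norm_num) (by positivity)]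
      gcongr
      have : (2 + |t|) ^ (1 / 4 : ℝ) = ((2 + |t|) ^ 2) ^ (1 / 8 : ℝ) := by
        rw [← Real.rpow_natCast (2 + |t|) 2, ← Real.rpow_mul (by positivity)]; norm_num
      rw [this]
      gcongr
      nlinarith [sq_nonneg (2 - |t|), sq_abs t]
    rw [div_eq_mul_inv] at a4
    norm_num at a4 a5
    rw [hD]
    norm_num
    linarith
  refine ⟨2 * D * A₁ + A₂ + 1, by positivity, fun σ hσ hσ1 => ?_⟩
  obtain ⟨i1, h1⟩ := hline σ hσ hσ1
  obtain ⟨i2, h2⟩ := hsq σ hσ hσ1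
  have hn : ∀ t : ℝ, ‖f (σ + t * Complex.I) ^ 2 * (((4 + t ^ 2)⁻¹ : ℝ) : ℂ)‖ =
      ‖f (σ + t * Complex.I)‖ ^ 2 * (4 + t ^ 2)⁻¹ := by
    intro t
    rw [norm_mul, norm_pow, Complex.norm_real, Real.norm_of_nonneg (by positivity)]
  have i3 := i2.norm
  simp only [hn] at i3
  refine ⟨i3, ?_⟩
  have i4 := i2.re
  simp only [RCLike.re_to_complex] at i4
  have hpt : ∀ t : ℝ, ‖f (σ + t * Complex.I)‖ ^ 2 * (4 + t ^ 2)⁻¹ ≤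
      2 * D / σ * ((f (σ + t * Complex.I)).re * (4 + t ^ 2) ^ (-(7 / 8) : ℝ)) -
      (f (σ + t * Complex.I) ^ 2 * (((4 + t ^ 2)⁻¹ : ℝ) : ℂ)).re := by
    intro t
    have b1 := hmono σ t hσ hσ1
    have b2 := HU (1 + t * Complex.I) (by simp)
    have b3 := hlog t
    simp only [Complex.ofReal_one, one_mul] at b1
    set F := f (σ + t * Complex.I) with hF
    have b4 : 0 ≤ F.re := hpos _ (by simpa using hσ)
    have b5 : F.re ≤ D / σ * (4 + t ^ 2) ^ (1 / 8 : ℝ) := by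
      rw [div_mul_eq_mul_div, le_div_iff₀ hσ]; linarith
    have b6 : ‖F‖ ^ 2 = F.re ^ 2 + F.im ^ 2 := by rw [Complex.sq_norm, Complex.normSq_apply]; ring
    have b7 : (F ^ 2 * (((4 + t ^ 2)⁻¹ : ℝ) : ℂ)).re = (F.re ^ 2 - F.im ^ 2) * (4 + t ^ 2)⁻¹ := by
      rw [Complex.mul_re, Complex.ofReal_re, Complex.ofReal_im, pow_two F, Complex.mul_re]; ring
    have b8 : (4 + t ^ 2) ^ (-(7 / 8) : ℝ) = (4 + t ^ 2) ^ (1 / 8 : ℝ) * (4 + t ^ 2)⁻¹ := by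
      rw [← Real.rpow_neg_one, ← Real.rpow_add (by positivity)]; norm_num
    rw [b6, b7, b8]
    have b9 : F.re * F.re * (4 + t ^ 2)⁻¹ ≤ F.re * (D / σ * (4 + t ^ 2) ^ (1 / 8 : ℝ)) * (4 + t ^ 2)⁻¹ := by
      gcongr
    have b10 : 2 * D / σ * (F.re * ((4 + t ^ 2) ^ (1 / 8 : ℝ) * (4 + t ^ 2)⁻¹)) =
      2 * (F.re * (D / σ * (4 + t ^ 2) ^ (1 / 8 : ℝ)) * (4 + t ^ 2)⁻¹) := by ring
    rw [b10]
    linarith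
  refine (integral_mono i3 ((i1.const_mul _).sub i4) hpt).trans ?_
  rw [integral_sub' (i1.const_mul _) i4, integral_const_mul]
  have hA : A₂ ≤ A₂ / σ := le_div_self hA₂0 hσ hσ1
  have h3 : 2 * D / σ * ∫ t : ℝ, (f (σ + t * Complex.I)).re * (4 + t ^ 2) ^ (-(7 / 8) : ℝ) ≤ 2 * D / σ * A₁ := by
    gcongr
  have h4 : (2 * D * A₁ + A₂ + 1) / σ = 2 * D / σ * A₁ + A₂ / σ + 1 / σ := by ring
  have h5 : 0 ≤ 1 / σ := by positivity
  linarith [(abs_le.1 h2).1]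

end XiLogDerivMeanSquare

section LaplaceTransform

open scoped Topology

/-- The transform `-(ζ₁'/ζ₁(s + 1/2) - γ)/(s - 1/2)`, with its removable singularity filled in. -/
noncomputable def mertensTransform (s : ℂ) : ℂ := -dslope (logDeriv riemannZeta₁) 1 (s + 1 / 2)

lemma logDeriv_riemannZeta₁_one : logDeriv riemannZeta₁ 1 = Real.eulerMascheroniConstant := by
  rw [logDeriv_apply, deriv_riemannZeta₁_one, riemannZeta₁_one, div_one]

lemma differentiableOn_logDeriv_riemannZeta₁ (hRH : RiemannHypothesis) :
    DifferentiableOn ℂ (logDeriv riemannZeta₁) {w | 1 / 2 < w.re} := by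
  intro w hw
  have h1 : DifferentiableAt ℂ (deriv riemannZeta₁) w :=
    (differentiable_riemannZeta₁.analyticAt w).deriv.differentiableAt
  exact (h1.div (differentiable_riemannZeta₁ w) (riemannZeta₁_ne_zero hRH hw)).differentiableWithinAt

lemma differentiableOn_mertensTransform (hRH : RiemannHypothesis) :
    DifferentiableOn ℂ mertensTransform {s | 0 < s.re} := by
  have ho : IsOpen {w : ℂ | 1 / 2 < w.re} := isOpen_lt continuous_const Complex.continuous_re
  have h := (Complex.differentiableOn_dslope (c := 1) (ho.mem_nhds (by norm_num))).2
    (differentiableOn_logDeriv_riemannZeta₁ hRH)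
  refine DifferentiableOn.neg (h.comp (f := fun s : ℂ => s + 1 / 2) (by fun_prop) fun s hs => ?_)
  simp only [mem_ofPred_eq, Complex.add_re] at hs ⊢
  norm_num
  exact hs

lemma mertensTransform_eq {s : ℂ} (hs : s ≠ 1 / 2) :
    mertensTransform s = -((logDeriv riemannZeta₁ (s + 1 / 2) - Real.eulerMascheroniConstant) /
      (s - 1 / 2)) := by
  have : s + 1 / 2 ≠ 1 := fun h => hs (by linear_combination h)
  rw [mertensTransform, dslope_of_ne _ this, slope_def_field, logDeriv_riemannZeta₁_one]
  congr 2
  ring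

lemma two_pi_mul_centeredXi_add_two {s : ℂ} (hs : -(1 / 2) < s.re) :
    (2 * π) * (centeredXi (s + 2) * riemannZeta₁ (1 / 2 + s)) =
      (5 / 2 + s) * ((s + 3 / 2) * riemannZeta (5 / 2 + s)) * centeredXi s := by
  have hne : (1 / 2 + s) ≠ 0 := by
    intro h
    have := congrArg Complex.re h
    norm_num at this; linarith
  have h1 : (5 / 2 + s) ≠ 1 := by
    intro h
    have := congrArg Complex.re h
    norm_num at this; linarith
  have hp : (π : ℂ) ≠ 0 := by exact_mod_cast Real.pi_ne_zero
  rw [centeredXi_eq hs, centeredXi_eq (by norm_num; linarith),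
    show 1 / 2 + (s + 2) = (1 / 2 + s) + 2 by ring, Complex.Gammaℝ_add_two hne,
    show 1 / 2 + s + 2 = 5 / 2 + s by ring, riemannZeta₁_eq_mul h1]
  field_simp
  ring

lemma logDeriv_riemannZeta₁_add (hRH : RiemannHypothesis) {s : ℂ} (hs : 0 < s.re) :
    logDeriv centeredXi (s + 2) + logDeriv riemannZeta₁ (1 / 2 + s) =
      (5 / 2 + s)⁻¹ + (s + 3 / 2)⁻¹ + deriv riemannZeta (5 / 2 + s) / riemannZeta (5 / 2 + s) +
        logDeriv centeredXi s := by
  have he : (fun s : ℂ => (2 * π) * (centeredXi (s + 2) * riemannZeta₁ (1 / 2 + s))) =ᶠ[𝓝 s]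
      fun s => (5 / 2 + s) * ((s + 3 / 2) * riemannZeta (5 / 2 + s)) * centeredXi s := by
    filter_upwards [isOpen_re_pos.mem_nhds hs] with z hz
    have hz0 : 0 < z.re := hz
    exact two_pi_mul_centeredXi_add_two (by linarith)
  have hl : logDeriv (fun s : ℂ => (2 * π) * (centeredXi (s + 2) * riemannZeta₁ (1 / 2 + s))) s =
      logDeriv (fun s => (5 / 2 + s) * ((s + 3 / 2) * riemannZeta (5 / 2 + s)) * centeredXi s) s := by
    rw [logDeriv_apply, logDeriv_apply, he.deriv_eq, he.eq_of_nhds]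
  have hp : (2 * π : ℂ) ≠ 0 := by exact_mod_cast (mul_pos two_pos Real.pi_pos).ne'
  obtain ⟨C, hC, HC⟩ := exists_norm_inv_riemannZeta_le
  have z1 : riemannZeta (5 / 2 + s) ≠ 0 := by
    intro h
    have := (HC (5 / 2 + s) (by norm_num; linarith)).2.1
    rw [h] at this; norm_num at this
  have h1 : (5 / 2 + s) ≠ 1 := by
    intro h
    have := congrArg Complex.re h
    norm_num at this; linarith
  have h2 : (5 / 2 + s) ≠ 0 := by
    intro h
    have := congrArg Complex.re h
    norm_num at this; linarith
  have h3 : (s + 3 / 2) ≠ 0 := by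
    intro h
    have := congrArg Complex.re h
    norm_num at this; linarith
  have d1 := differentiable_centeredXi
  have d2 := differentiable_riemannZeta₁
  have d3 : DifferentiableAt ℂ (fun s => riemannZeta (5 / 2 + s)) s :=
    (differentiableAt_riemannZeta h1).comp (f := fun s : ℂ => 5 / 2 + s) s (by fun_prop)
  have n1 := centeredXi_ne_zero hRH hs
  have n2 := centeredXi_ne_zero hRH (s := s + 2) (by simp; linarith)
  have n3 := riemannZeta₁_ne_zero hRH (w := 1 / 2 + s) (by norm_num; linarith)
  have c1 : logDeriv (fun s => centeredXi (s + 2)) s = logDeriv centeredXi (s + 2) := by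
    have := logDeriv_comp (f := centeredXi) (g := fun s : ℂ => s + 2) (x := s) (d1 _) (by fun_prop)
    simpa [Function.comp_def] using this
  have c2 : logDeriv (fun s => riemannZeta₁ (1 / 2 + s)) s = logDeriv riemannZeta₁ (1 / 2 + s) := by
    have := logDeriv_comp (f := riemannZeta₁) (g := fun s : ℂ => 1 / 2 + s) (x := s) (d2 _) (by fun_prop)
    simpa [Function.comp_def] using this
  have c3 : logDeriv (fun s => riemannZeta (5 / 2 + s)) s = logDeriv riemannZeta (5 / 2 + s) := by
    have := logDeriv_comp (f := riemannZeta) (g := fun s : ℂ => 5 / 2 + s) (x := s)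
      (differentiableAt_riemannZeta h1) (by fun_prop)
    simpa [Function.comp_def] using this
  have c4 : logDeriv (fun s : ℂ => 5 / 2 + s) s = (5 / 2 + s)⁻¹ := by
    rw [logDeriv_apply]; simp
  have c5 : logDeriv (fun s : ℂ => s + 3 / 2) s = (s + 3 / 2)⁻¹ := by
    rw [logDeriv_apply]; simp
  rw [logDeriv_const_mul _ _ hp, logDeriv_mul (f := fun s => centeredXi (s + 2))
    (g := fun s => riemannZeta₁ (1 / 2 + s)) s n2 n3 (by fun_prop) (by fun_prop), c1, c2,
    logDeriv_mul (f := fun s => (5 / 2 + s) * ((s + 3 / 2) * riemannZeta (5 / 2 + s)))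
      (g := centeredXi) s (mul_ne_zero h2 (mul_ne_zero h3 z1)) n1 (by fun_prop) (by fun_prop),
    logDeriv_mul (f := fun s => (5 / 2 + s)) (g := fun s => ((s + 3 / 2) * riemannZeta (5 / 2 + s)))
      s h2 (mul_ne_zero h3 z1) (by fun_prop) (by fun_prop),
    logDeriv_mul (f := fun s => (s + 3 / 2)) (g := fun s => riemannZeta (5 / 2 + s))
      s h3 z1 (by fun_prop) (by fun_prop), c3, c4, c5, logDeriv_apply riemannZeta] at hl
  rw [hl]
  ring

lemma exists_norm_mertensTransform_le (hRH : RiemannHypothesis) :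
    ∃ C, 0 < C ∧ ∀ s : ℂ, 0 < s.re → s ≠ 1 / 2 →
      ‖mertensTransform s‖ ≤
        (C + ‖logDeriv centeredXi s‖ + ‖logDeriv centeredXi (s + 2)‖) / ‖s - 1 / 2‖ := by
  obtain ⟨C, hC, HC⟩ := exists_norm_inv_riemannZeta_le
  refine ⟨2 + C + ‖(Real.eulerMascheroniConstant : ℂ)‖, by positivity, fun s hs hne => ?_⟩
  rw [mertensTransform_eq hne, norm_neg, norm_div]
  gcongr
  have h := logDeriv_riemannZeta₁_add hRH hs
  have e : logDeriv riemannZeta₁ (s + 1 / 2) - Real.eulerMascheroniConstant =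
    (5 / 2 + s)⁻¹ + (s + 3 / 2)⁻¹ + deriv riemannZeta (5 / 2 + s) / riemannZeta (5 / 2 + s) +
        logDeriv centeredXi s - logDeriv centeredXi (s + 2) - Real.eulerMascheroniConstant := by
    rw [add_comm s]; linear_combination h
  have b1 : ∀ z : ℂ, 1 ≤ z.re → ‖z⁻¹‖ ≤ 1 := by
    intro z hz
    rw [norm_inv]
    exact inv_le_one_of_one_le₀ (hz.trans (Complex.re_le_norm z))
  have b2 := b1 (5 / 2 + s) (by norm_num; linarith)
  have b3 := b1 (s + 3 / 2) (by norm_num; linarith)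
  have b4 := (HC (5 / 2 + s) (by norm_num; linarith)).2.2
  rw [e]
  refine (norm_sub_le _ _).trans ?_
  have t1 := norm_sub_le ((5 / 2 + s)⁻¹ + (s + 3 / 2)⁻¹ +
    deriv riemannZeta (5 / 2 + s) / riemannZeta (5 / 2 + s) + logDeriv centeredXi s)
    (logDeriv centeredXi (s + 2))
  have t2 := norm_add_le ((5 / 2 + s)⁻¹ + (s + 3 / 2)⁻¹ +
    deriv riemannZeta (5 / 2 + s) / riemannZeta (5 / 2 + s)) (logDeriv centeredXi s)
  have t3 := norm_add_le ((5 / 2 + s)⁻¹ + (s + 3 / 2)⁻¹)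
    (deriv riemannZeta (5 / 2 + s) / riemannZeta (5 / 2 + s))
  have t4 := norm_add_le (5 / 2 + s)⁻¹ (s + 3 / 2)⁻¹
  linarith

end LaplaceTransform

section LaplaceTransformBounds

lemma exists_integral_norm_sq_mertensTransform_le (hRH : RiemannHypothesis) :
    ∃ C, 0 < C ∧ ∀ σ : ℝ, 0 < σ → σ ≤ 1 / 4 →
      Integrable (fun t : ℝ => ‖mertensTransform (σ + t * Complex.I)‖ ^ 2) ∧
      ∫ t : ℝ, ‖mertensTransform (σ + t * Complex.I)‖ ^ 2 ≤ C / σ := by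
  obtain ⟨C, hC, HC⟩ := exists_norm_mertensTransform_le hRH
  obtain ⟨D, hD, HD⟩ := exists_integral_norm_sq_logDeriv_centeredXi_le hRH
  obtain ⟨E, hE, HE⟩ := exists_norm_logDeriv_centeredXi_le hRH one_pos le_rfl
  set f := logDeriv centeredXi
  set A₂ := ∫ t : ℝ, (8 / 3) * (1 + |t|) ^ (-(6 / 5) : ℝ) with hA₂
  have hA₂0 : 0 ≤ A₂ := integral_nonneg fun t => by positivity
  have hker : ∀ t : ℝ, (4 + t ^ 2)⁻¹ ≤ 8 / 3 * (1 + |t|) ^ (-2 : ℝ) := by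
    intro t
    have h := one_add_abs_sq_le le_rfl t
    rw [Real.rpow_neg (by positivity),
      show (2 : ℝ) = (2 : ℕ) by norm_num, Real.rpow_natCast,
      ← div_eq_mul_inv, inv_eq_one_div, div_le_div_iff₀ (by positivity) (by positivity)]
    nlinarith [sq_nonneg t]
  have i0 := (integrable_one_add_abs_rpow (r := 6 / 5) (by norm_num)).const_mul (8 / 3)
  have hcont := differentiableOn_mertensTransform hRH
  refine ⟨192 * (C ^ 2 + E ^ 2) * A₂ + 192 * D, by positivity, fun σ hσ hσ4 => ?_⟩
  obtain ⟨i1, h1⟩ := HD σ hσ (by linarith)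
  have hpt : ∀ t : ℝ, ‖mertensTransform (σ + t * Complex.I)‖ ^ 2 ≤
      192 * (C ^ 2 + E ^ 2) * (8 / 3 * (1 + |t|) ^ (-(6 / 5) : ℝ)) +
        192 * (‖f (σ + t * Complex.I)‖ ^ 2 * (4 + t ^ 2)⁻¹) := by
    intro t
    have b1 := HC (σ + t * Complex.I) (by simpa using hσ) (by
      intro h
      have := congrArg Complex.re h
      norm_num at this; linarith)
    have b2 := HE (σ + t * Complex.I + 2) (by norm_num; linarith) (by norm_num; linarith)
    simp only [Complex.add_im, Complex.mul_im, Complex.ofReal_im, Complex.ofReal_re,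
      Complex.I_im, Complex.I_re, mul_one, mul_zero, add_zero, zero_add, Complex.im_ofNat] at b2
    set X := ‖f (σ + t * Complex.I)‖
    set G := ‖f (σ + t * Complex.I + 2)‖
    have b3 : (4 + t ^ 2) / 64 ≤ ‖(σ : ℂ) + t * Complex.I - 1 / 2‖ ^ 2 := by
      rw [Complex.sq_norm, Complex.normSq_apply]
      norm_num
      nlinarith
    have b4 : ‖mertensTransform (σ + t * Complex.I)‖ ^ 2 ≤ (C + X + G) ^ 2 / ((4 + t ^ 2) / 64) := by
      refine (pow_le_pow_left₀ (norm_nonneg _) b1 2).trans ?_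
      rw [div_pow]
      gcongr
    have b5 : (C + X + G) ^ 2 ≤ 3 * (C ^ 2 + X ^ 2 + G ^ 2) := by
      nlinarith [sq_nonneg (C - X), sq_nonneg (C - G), sq_nonneg (X - G)]
    have b6 : G ^ 2 ≤ E ^ 2 * (1 + |t|) ^ (4 / 5 : ℝ) := by
      refine (pow_le_pow_left₀ (norm_nonneg _) b2 2).trans (le_of_eq ?_)
      rw [mul_pow, ← Real.rpow_natCast ((1 + |t|) ^ (2 / 5 : ℝ)) 2, ← Real.rpow_mul (by positivity)]
      norm_num
    have b7 : C ^ 2 ≤ C ^ 2 * (1 + |t|) ^ (4 / 5 : ℝ) :=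
      le_mul_of_one_le_right (by positivity) (Real.one_le_rpow (by linarith [abs_nonneg t]) (by norm_num))
    have b8 : (1 + |t|) ^ (4 / 5 : ℝ) * (4 + t ^ 2)⁻¹ ≤ 8 / 3 * (1 + |t|) ^ (-(6 / 5) : ℝ) := by
      calc _ ≤ (1 + |t|) ^ (4 / 5 : ℝ) * (8 / 3 * (1 + |t|) ^ (-2 : ℝ)) :=
            mul_le_mul_of_nonneg_left (hker t) (by positivity)
        _ = 8 / 3 * ((1 + |t|) ^ (4 / 5 : ℝ) * (1 + |t|) ^ (-2 : ℝ)) := by ring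
        _ = _ := by rw [← Real.rpow_add (by positivity)]; norm_num
    calc _ ≤ (C + X + G) ^ 2 / ((4 + t ^ 2) / 64) := b4
      _ = 64 * (C + X + G) ^ 2 * (4 + t ^ 2)⁻¹ := by field_simp
      _ ≤ 64 * (3 * (C ^ 2 * (1 + |t|) ^ (4 / 5 : ℝ) + X ^ 2 + E ^ 2 * (1 + |t|) ^ (4 / 5 : ℝ))) *
          (4 + t ^ 2)⁻¹ := by
          refine mul_le_mul_of_nonneg_right ?_ (by positivity)
          linarith
      _ = 192 * (C ^ 2 + E ^ 2) * ((1 + |t|) ^ (4 / 5 : ℝ) * (4 + t ^ 2)⁻¹) +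
          192 * (X ^ 2 * (4 + t ^ 2)⁻¹) := by ring
      _ ≤ _ := by gcongr
  have i2 := (i0.const_mul (192 * (C ^ 2 + E ^ 2))).add (i1.const_mul 192)
  have hmeas : Continuous fun t : ℝ => ‖mertensTransform (σ + t * Complex.I)‖ ^ 2 := by
    refine (Continuous.norm ?_).pow 2
    exact hcont.continuousOn.comp_continuous (f := fun t : ℝ => (σ + t * Complex.I : ℂ)) (by fun_prop)
      fun t => by simpa using hσ
  have i3 : Integrable (fun t : ℝ => ‖mertensTransform (σ + t * Complex.I)‖ ^ 2) := by
    refine i2.mono' hmeas.aestronglyMeasurable (Eventually.of_forall fun t => ?_)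
    rw [Real.norm_of_nonneg (by positivity)]
    exact hpt t
  refine ⟨i3, (integral_mono i3 i2 hpt).trans ?_⟩
  rw [integral_add' (i0.const_mul (192 * (C ^ 2 + E ^ 2))) (i1.const_mul 192), integral_const_mul,
    integral_const_mul 192, ← hA₂]
  have hA : A₂ ≤ A₂ / σ := le_div_self hA₂0 hσ (by linarith)
  have : (192 * (C ^ 2 + E ^ 2) * A₂ + 192 * D) / σ = 192 * (C ^ 2 + E ^ 2) * (A₂ / σ) + 192 * (D / σ) := by
    ring
  rw [this]
  gcongr

lemma exists_norm_mertensTransform_le_of_abs_ge (hRH : RiemannHypothesis) {σ₁ : ℝ} (hσ : 0 < σ₁)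
    (hσ1 : σ₁ ≤ 1) {ε : ℝ} (hε : 0 < ε) :
    ∃ T₀, ∀ x t : ℝ, σ₁ ≤ x → x ≤ 1 → T₀ ≤ |t| → ‖mertensTransform (x + t * Complex.I)‖ ≤ ε := by
  obtain ⟨C, hC, HC⟩ := exists_norm_mertensTransform_le hRH
  obtain ⟨E, hE, HE⟩ := exists_norm_logDeriv_centeredXi_le hRH hσ hσ1
  obtain ⟨T₀, hT₀⟩ := exists_le_one_add_abs_rpow_neg_mul (r := 3 / 5) (by norm_num) hε ((C + 2 * E) * 2)
  refine ⟨max T₀ 1, fun x t hx hx1 ht => ?_⟩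
  have ht1 : 1 ≤ |t| := (le_max_right _ _).trans ht
  have b1 := HC (x + t * Complex.I) (by simp; linarith) (by
    intro h
    have := congrArg Complex.im h
    norm_num at this
    rw [this] at ht1; norm_num at ht1)
  have b0 := HE (x + t * Complex.I) (by simpa using hx) (by norm_num; linarith)
  have b2 := HE (x + t * Complex.I + 2) (by norm_num; linarith) (by norm_num; linarith)
  simp only [Complex.add_im, Complex.mul_im, Complex.ofReal_im, Complex.ofReal_re,
      Complex.I_im, Complex.I_re, mul_one, mul_zero, add_zero, zero_add, Complex.im_ofNat] at b2 b0
  have b3 : |t| ≤ ‖(x : ℂ) + t * Complex.I - 1 / 2‖ := by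
    have := Complex.abs_im_le_norm ((x : ℂ) + t * Complex.I - 1 / 2)
    norm_num at this
    exact this
  have b4 : (1 + |t|) / 2 ≤ |t| := by linarith
  have b5 : 1 ≤ (1 + |t|) ^ (2 / 5 : ℝ) := Real.one_le_rpow (by linarith) (by norm_num)
  refine (b1.trans ?_).trans (hT₀ t ((le_max_left _ _).trans ht))
  rw [div_le_iff₀ (by linarith)]
  calc _ ≤ (C + 2 * E) * (1 + |t|) ^ (2 / 5 : ℝ) := by
        have : C ≤ C * (1 + |t|) ^ (2 / 5 : ℝ) := le_mul_of_one_le_right hC.le b5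
        linarith
    _ = (C + 2 * E) * 2 * (1 + |t|) ^ (-(3 / 5) : ℝ) * ((1 + |t|) / 2) := by
        have : (1 + |t|) ^ (2 / 5 : ℝ) = (1 + |t|) ^ (-(3 / 5) : ℝ) * (1 + |t|) := by
          conv_rhs => rw [← Real.rpow_one (1 + |t|), ← Real.rpow_mul (by positivity), ← Real.rpow_add (by positivity)]
          norm_num
        rw [this]; ring
    _ ≤ _ := by gcongr; linarith

end LaplaceTransformBounds

section ScaledError

open ArithmeticFunction hiding log

/-- `∑_{k ≤ e^y} Λ(k)/k - y + γ`. -/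
noncomputable def vonMangoldtErr (y : ℝ) : ℝ :=
  ∑ k ∈ Finset.Icc 1 ⌊Real.exp y⌋₊, vonMangoldt k / k - y + Real.eulerMascheroniConstant

/-- The error term `vonMangoldtErr` scaled by `e^{y/2}`. -/
noncomputable def scaledErr (y : ℝ) : ℝ := Real.exp (y / 2) * vonMangoldtErr y

lemma sum_vonMangoldt_div_nonneg (n : ℕ) : 0 ≤ ∑ k ∈ Finset.Icc 1 n, vonMangoldt k / (k : ℝ) :=
  Finset.sum_nonneg fun _ _ => div_nonneg vonMangoldt_nonneg (Nat.cast_nonneg _)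

lemma sum_vonMangoldt_div_le {x : ℝ} (hx : 1 ≤ x) :
    ∑ k ∈ Finset.Icc 1 ⌊x⌋₊, vonMangoldt k / (k : ℝ) ≤ Real.log x * (1 + Real.log x) := by
  have hx0 : 0 ≤ Real.log x := Real.log_nonneg hx
  calc _ ≤ ∑ k ∈ Finset.Icc 1 ⌊x⌋₊, Real.log x * ((k : ℝ))⁻¹ := by
        refine Finset.sum_le_sum fun k hk => ?_
        rw [div_eq_mul_inv]
        have hk := Finset.mem_Icc.1 hk
        have : (k : ℝ) ≤ x := (Nat.le_floor_iff (by linarith)).1 hk.2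
        have h1 : (0 : ℝ) < k := by exact_mod_cast hk.1
        exact mul_le_mul_of_nonneg_right (vonMangoldt_le_log.trans (Real.log_le_log h1 this)) (by positivity)
    _ = Real.log x * (harmonic ⌊x⌋₊ : ℝ) := by
        rw [← Finset.mul_sum, harmonic_eq_sum_Icc]; push_cast; rfl
    _ ≤ _ := by gcongr; exact harmonic_floor_le_one_add_log x hx

lemma abs_vonMangoldtErr_le {y : ℝ} (hy : 0 ≤ y) : |vonMangoldtErr y| ≤ (1 + y) ^ 2 := by
  have h1 := sum_vonMangoldt_div_le (x := Real.exp y) (Real.one_le_exp hy)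
  rw [Real.log_exp] at h1
  have h2 := sum_vonMangoldt_div_nonneg ⌊Real.exp y⌋₊
  have h3 := Real.eulerMascheroniConstant_lt_two_thirds
  have h4 := Real.one_half_lt_eulerMascheroniConstant
  rw [vonMangoldtErr, abs_le]
  constructor <;> nlinarith

lemma measurable_sum_vonMangoldt_exp :
    Measurable fun y : ℝ => ∑ k ∈ Finset.Icc 1 ⌊Real.exp y⌋₊, vonMangoldt k / (k : ℝ) :=
  (measurable_from_nat (f := fun n : ℕ => ∑ k ∈ Finset.Icc 1 n, vonMangoldt k / (k : ℝ))).comp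
    (Nat.measurable_floor.comp Real.measurable_exp)

lemma measurable_vonMangoldtErr : Measurable vonMangoldtErr :=
  (measurable_sum_vonMangoldt_exp.sub measurable_id).add_const _

lemma measurable_scaledErr : Measurable scaledErr :=
  (Real.measurable_exp.comp (measurable_id.div_const 2)).mul measurable_vonMangoldtErr

lemma one_add_sq_le_mul_exp {k : ℝ} (hk : 0 < k) (hk1 : k ≤ 1) {y : ℝ} (hy : 0 ≤ y) :
    (1 + y) ^ 2 ≤ (k ^ 2)⁻¹ * Real.exp (2 * k * y) := by
  have h1 := Real.add_one_le_exp (k * y)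
  have h2 : k * (1 + y) ≤ Real.exp (k * y) := by nlinarith
  have h3 : (k * (1 + y)) ^ 2 ≤ (Real.exp (k * y)) ^ 2 := by gcongr
  rw [mul_pow, ← Real.exp_nat_mul, mul_comm (k ^ 2)] at h3
  rw [← div_eq_inv_mul, le_div_iff₀ (by positivity)]
  rw [show 2 * k * y = ((2 : ℕ) : ℝ) * (k * y) by push_cast; ring]
  exact h3

lemma integrableOn_one_add_sq_mul_exp {c : ℝ} (hc : 0 < c) :
    IntegrableOn (fun y : ℝ => (1 + y) ^ 2 * Real.exp (-c * y)) (Ioi 0) := by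
  set k := min 1 (c / 4) with hk
  have hk0 : 0 < k := lt_min one_pos (by linarith)
  have hk4 : k ≤ c / 4 := min_le_right _ _
  refine ((integrableOn_rexp_neg_mul_Ioi (c := c / 2) (by linarith)).const_mul (k ^ 2)⁻¹).mono'
    (by fun_prop) ((ae_restrict_iff' measurableSet_Ioi).2 (Eventually.of_forall fun y hy => ?_))
  have hy0 : 0 ≤ y := le_of_lt hy
  rw [Real.norm_of_nonneg (by positivity)]
  calc _ ≤ (k ^ 2)⁻¹ * Real.exp (2 * k * y) * Real.exp (-c * y) := by
        gcongr; exact one_add_sq_le_mul_exp hk0 (min_le_left _ _) hy0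
    _ = (k ^ 2)⁻¹ * Real.exp (2 * k * y + -c * y) := by rw [mul_assoc, ← Real.exp_add]
    _ ≤ _ := by gcongr; nlinarith

lemma integrableOn_mul_cexp_of_abs_le {h : ℝ → ℝ} (hm : Measurable h)
    (hb : ∀ y, 0 < y → |h y| ≤ (1 + y) ^ 2) {w : ℂ} (hw : 0 < w.re) :
    IntegrableOn (fun y : ℝ => (h y : ℂ) * Complex.exp (-w * y)) (Ioi 0) := by
  refine (integrableOn_one_add_sq_mul_exp hw).mono' ?_
    ((ae_restrict_iff' measurableSet_Ioi).2 (Eventually.of_forall fun y hy => ?_))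
  · exact ((Complex.measurable_ofReal.comp hm).mul (by fun_prop)).aestronglyMeasurable
  · rw [norm_mul, norm_cexp_mul_ofReal, Complex.norm_real, Real.norm_eq_abs, Complex.neg_re]
    gcongr
    exact hb y hy

lemma integral_mul_cexp_Ioi {w : ℂ} (hw : 0 < w.re) :
    ∫ y in Ioi (0 : ℝ), (y : ℂ) * Complex.exp (-w * y) = 1 / w ^ 2 := by
  have hw0 : w ≠ 0 := by rintro rfl; simp at hw
  have hi : IntegrableOn (fun y : ℝ => (y : ℂ) * Complex.exp (-w * y)) (Ioi 0) :=
    integrableOn_mul_cexp_of_abs_le measurable_id (fun y hy => by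
      rw [id, abs_of_pos hy]; nlinarith) hw
  have hd : ∀ y : ℝ, HasDerivAt (fun y : ℝ => -((y : ℂ) / w + 1 / w ^ 2) * Complex.exp (-w * y))
      ((y : ℂ) * Complex.exp (-w * y)) y := by
    intro y
    have h1 : HasDerivAt (fun z : ℂ => -(z / w + 1 / w ^ 2) * Complex.exp (-w * z))
        ((y : ℂ) * Complex.exp (-w * y)) (y : ℂ) := by
      have a1 : HasDerivAt (fun z : ℂ => -(z / w + 1 / w ^ 2)) (-(1 / w)) (y : ℂ) :=
        (((hasDerivAt_id (y : ℂ)).div_const w).add_const _).neg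
      have a2 : HasDerivAt (fun z : ℂ => Complex.exp (-w * z)) (Complex.exp (-w * y) * (-w * 1)) (y : ℂ) :=
        ((hasDerivAt_id (y : ℂ)).const_mul (-w)).cexp
      refine (a1.mul a2).congr_deriv ?_
      field_simp
      ring
    exact h1.comp_ofReal
  have ht : Tendsto (fun y : ℝ => -((y : ℂ) / w + 1 / w ^ 2) * Complex.exp (-w * y)) atTop (nhds 0) := by
    rw [tendsto_zero_iff_norm_tendsto_zero]
    have e1 : Tendsto (fun y : ℝ => y ^ (1 : ℝ) * Real.exp (-w.re * y)) atTop (nhds 0) :=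
      tendsto_rpow_mul_exp_neg_mul_atTop_nhds_zero 1 w.re hw
    have e2 : Tendsto (fun y : ℝ => y ^ (0 : ℝ) * Real.exp (-w.re * y)) atTop (nhds 0) :=
      tendsto_rpow_mul_exp_neg_mul_atTop_nhds_zero 0 w.re hw
    simp only [Real.rpow_one, Real.rpow_zero, one_mul] at e1 e2
    have e3 := (e1.const_mul (1 / ‖w‖)).add (e2.const_mul ‖1 / w ^ 2‖)
    simp only [mul_zero, add_zero] at e3
    refine tendsto_of_tendsto_of_tendsto_of_le_of_le' tendsto_const_nhds e3
      (Eventually.of_forall fun y => norm_nonneg _) ?_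
    filter_upwards [eventually_ge_atTop (0 : ℝ)] with y hy
    rw [norm_mul, norm_neg, norm_cexp_mul_ofReal, Complex.neg_re]
    have := norm_add_le ((y : ℂ) / w) (1 / w ^ 2)
    rw [norm_div, Complex.norm_real, Real.norm_of_nonneg hy] at this
    calc _ ≤ (y / ‖w‖ + ‖1 / w ^ 2‖) * Real.exp (-w.re * y) := by gcongr
      _ = _ := by ring
  have := integral_Ioi_of_hasDerivAt_of_tendsto' (a := 0) (fun y _ => hd y) hi ht
  rw [this]
  simp

lemma sum_vonMangoldt_div_isBigO {r : ℝ} (hr : 0 < r) :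
    (fun n : ℕ => ∑ k ∈ Finset.Icc 1 n, vonMangoldt k / (k : ℝ)) =O[atTop] fun n : ℕ => (n : ℝ) ^ r := by
  refine Asymptotics.IsBigO.of_bound ((1 + 2 / r) ^ 2) ?_
  filter_upwards [eventually_ge_atTop 1] with n hn
  have hn1 : (1 : ℝ) ≤ n := by exact_mod_cast hn
  rw [Real.norm_of_nonneg (sum_vonMangoldt_div_nonneg n), Real.norm_of_nonneg (by positivity)]
  have h1 := sum_vonMangoldt_div_le hn1
  rw [Nat.floor_natCast] at h1
  have h2 := Real.log_le_rpow_div (x := (n : ℝ)) (ε := r / 2) (by positivity) (by positivity)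
  have h3 : 1 ≤ (n : ℝ) ^ (r / 2) := Real.one_le_rpow hn1 (by positivity)
  have h4 : (n : ℝ) ^ r = ((n : ℝ) ^ (r / 2)) ^ 2 := by
    rw [← Real.rpow_natCast, ← Real.rpow_mul (by positivity)]; congr 1; push_cast; ring
  have h5 : 0 ≤ Real.log n := Real.log_nonneg hn1
  have h6 : 1 + Real.log n ≤ (1 + 2 / r) * (n : ℝ) ^ (r / 2) := by
    have : (n : ℝ) ^ (r / 2) / (r / 2) = 2 / r * (n : ℝ) ^ (r / 2) := by field_simp
    rw [this] at h2; linarith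
  calc _ ≤ (1 + Real.log n) ^ 2 := by nlinarith
    _ ≤ ((1 + 2 / r) * (n : ℝ) ^ (r / 2)) ^ 2 := by gcongr
    _ = _ := by rw [mul_pow, h4]

lemma integral_vonMangoldtErr_mul_cexp {w : ℂ} (hw : 0 < w.re) :
    ∫ y in Ioi (0 : ℝ), (vonMangoldtErr y : ℂ) * Complex.exp (-w * y) = mertensTransform (w + 1 / 2) := by
  have hw0 : w ≠ 0 := by rintro rfl; simp at hw
  set S : ℝ → ℝ := fun y => ∑ k ∈ Finset.Icc 1 ⌊Real.exp y⌋₊, vonMangoldt k / (k : ℝ) with hS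
  have hL : LSeries (fun n => ((vonMangoldt n / n : ℝ) : ℂ)) w =
      w * ∫ y in Ioi (0 : ℝ), (S y : ℂ) * Complex.exp (-w * y) :=
    LSeries_eq_mul_integral_exp (fun n => vonMangoldt n / n) (r := w.re / 2) (by linarith) (by linarith)
      (sum_vonMangoldt_div_isBigO (by linarith)) (fun n => div_nonneg vonMangoldt_nonneg (Nat.cast_nonneg _))
  have hw1 : w + 1 ≠ 1 := by simpa using hw0
  have hL2 : LSeries (fun n => ((vonMangoldt n / n : ℝ) : ℂ)) w =
      -deriv riemannZeta (w + 1) / riemannZeta (w + 1) := by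
    rw [← LSeries_vonMangoldt_eq_deriv_riemannZeta_div (by simpa using hw)]
    unfold LSeries
    congr 1
    funext n
    rcases Nat.eq_zero_or_pos n with rfl | hn
    · simp
    · rw [LSeries.term_of_ne_zero hn.ne', LSeries.term_of_ne_zero hn.ne',
        Complex.cpow_add _ _ (by exact_mod_cast hn.ne'), Complex.cpow_one]
      push_cast
      field_simp
  have i1 : IntegrableOn (fun y : ℝ => (S y : ℂ) * Complex.exp (-w * y)) (Ioi 0) :=
    integrableOn_mul_cexp_of_abs_le measurable_sum_vonMangoldt_exp (fun y hy => by
      have h1 := sum_vonMangoldt_div_le (x := Real.exp y) (Real.one_le_exp hy.le)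
      rw [Real.log_exp] at h1
      rw [abs_of_nonneg (sum_vonMangoldt_div_nonneg _)]
      nlinarith) hw
  have i2 : IntegrableOn (fun y : ℝ => (y : ℂ) * Complex.exp (-w * y)) (Ioi 0) :=
    integrableOn_mul_cexp_of_abs_le measurable_id (fun y hy => by
      rw [id, abs_of_pos hy]; nlinarith) hw
  have i3 : IntegrableOn (fun y : ℝ => ((Real.eulerMascheroniConstant : ℝ) : ℂ) * Complex.exp (-w * y)) (Ioi 0) :=
    integrableOn_mul_cexp_of_abs_le measurable_const (fun y hy => by
      have h3 := Real.eulerMascheroniConstant_lt_two_thirds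
      have h4 := Real.one_half_lt_eulerMascheroniConstant
      rw [abs_of_nonneg (by linarith)]; nlinarith) hw
  have e : ∀ y : ℝ, (vonMangoldtErr y : ℂ) * Complex.exp (-w * y) = (S y : ℂ) * Complex.exp (-w * y) -
      (y : ℂ) * Complex.exp (-w * y) + (Real.eulerMascheroniConstant : ℂ) * Complex.exp (-w * y) := by
    intro y
    have : vonMangoldtErr y = S y - y + Real.eulerMascheroniConstant := rfl
    rw [this]; push_cast; ring
  simp only [e]
  have hne : w + 1 / 2 ≠ 1 / 2 := by simpa using hw0
  have i12 : IntegrableOn (fun y : ℝ => (S y : ℂ) * Complex.exp (-w * y) -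
      (y : ℂ) * Complex.exp (-w * y)) (Ioi 0) := i1.sub i2
  rw [integral_add i12 i3, integral_sub i1 i2, integral_mul_cexp_Ioi hw, integral_const_mul,
    integral_exp_mul_complex_Ioi (by simpa using hw), mertensTransform_eq hne]
  have hz : riemannZeta (w + 1) ≠ 0 := riemannZeta_ne_zero_of_one_le_re (by simp; linarith)
  have hz1 : riemannZeta₁ (w + 1) = w * riemannZeta (w + 1) := by
    rw [riemannZeta₁_eq_mul hw1]; ring
  have hz2 := deriv_riemannZeta_eq_neg_inv_sub_sq_mul_add hw1
  rw [hz1] at hz2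
  rw [hL2] at hL
  rw [show w + 1 / 2 + 1 / 2 = w + 1 by ring, logDeriv_apply, hz1]
  have hS1 : ∫ y in Ioi (0 : ℝ), (S y : ℂ) * Complex.exp (-w * y) =
    -deriv riemannZeta (w + 1) / riemannZeta (w + 1) / w := by
    rw [hL]; field_simp
  rw [hS1, hz2]
  simp only [add_sub_cancel_right, Complex.ofReal_zero, mul_zero, Complex.exp_zero]
  field_simp
  ring

end ScaledError

section ScaledErrorMeanSquare

open scoped Topology

lemma abs_scaledErr_le {y : ℝ} (hy : 0 ≤ y) : |scaledErr y| ≤ Real.exp (y / 2) * (1 + y) ^ 2 := by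
  rw [scaledErr, abs_mul, abs_of_pos (Real.exp_pos _)]
  gcongr
  exact abs_vonMangoldtErr_le hy

lemma exists_abs_scaledErr_le (Y : ℝ) : ∃ C, ∀ y, 0 < y → y ≤ Y → |scaledErr y| ≤ C := by
  refine ⟨Real.exp (Y / 2) * (1 + Y) ^ 2, fun y hy hY => (abs_scaledErr_le hy.le).trans ?_⟩
  gcongr

lemma integrableOn_scaledErr_sq (Y : ℝ) : IntegrableOn (fun y => scaledErr y ^ 2) (Ioc 0 Y) := by
  obtain ⟨C, hC⟩ := exists_abs_scaledErr_le Y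
  refine Measure.integrableOn_of_bounded (M := C ^ 2) (by simp)
    (measurable_scaledErr.pow_const 2).aestronglyMeasurable ?_
  refine (ae_restrict_iff' measurableSet_Ioc).2 (Eventually.of_forall fun y hy => ?_)
  rw [norm_pow, Real.norm_eq_abs]
  exact pow_le_pow_left₀ (abs_nonneg _) (hC y hy.1 hy.2) 2

lemma integral_scaledErr_mul_cexp {s : ℂ} (hs : 1 / 2 < s.re) :
    ∫ y in Ioi (0 : ℝ), (scaledErr y : ℂ) * Complex.exp (-s * y) = mertensTransform s := by
  have h := integral_vonMangoldtErr_mul_cexp (w := s - 1 / 2) (by norm_num; linarith)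
  rw [sub_add_cancel] at h
  rw [← h]
  congr 1
  funext y
  rw [scaledErr, Complex.ofReal_mul, Complex.ofReal_exp, mul_comm (Complex.exp _), mul_assoc, ← Complex.exp_add]
  congr 2
  push_cast; ring

lemma abs_scaledErr_mul_exp_le {y : ℝ} (hy : 0 ≤ y) :
    |scaledErr y * Real.exp (-1 * y)| ≤ 64 * Real.exp (-(1 / 4) * y) := by
  rw [abs_mul, abs_of_pos (Real.exp_pos _)]
  have h1 := one_add_sq_le_mul_exp (k := 1 / 8) (by norm_num) (by norm_num) hy
  calc _ ≤ Real.exp (y / 2) * ((((1 / 8 : ℝ)) ^ 2)⁻¹ * Real.exp (2 * (1 / 8) * y)) * Real.exp (-1 * y) := by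
        gcongr
        exact (abs_scaledErr_le hy).trans (by gcongr)
    _ = 64 * (Real.exp (y / 2) * Real.exp (2 * (1 / 8) * y) * Real.exp (-1 * y)) := by ring
    _ = _ := by rw [← Real.exp_add, ← Real.exp_add]; congr 2; ring

lemma exists_integral_scaledErr_sq_mul_exp_le (hRH : RiemannHypothesis) :
    ∃ C, 0 < C ∧ ∀ σ : ℝ, 0 < σ → σ ≤ 1 / 4 → ∀ Y : ℝ,
      ∫ y in Ioc 0 Y, scaledErr y ^ 2 * Real.exp (-(2 * σ) * y) ≤ C / σ := by
  obtain ⟨C, hC, H⟩ := exists_integral_norm_sq_mertensTransform_le hRH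
  refine ⟨1 / (2 * π) * C, by positivity, fun σ hσ hσ4 Y => ?_⟩
  obtain ⟨i1, h1⟩ := H σ hσ hσ4
  set φ : ℝ → ℂ := (Ioi 0).indicator fun y => ((scaledErr y * Real.exp (-1 * y) : ℝ) : ℂ) with hφ
  have hm : Measurable φ := by
    refine Measurable.indicator (Complex.measurable_ofReal.comp ?_) measurableSet_Ioi
    exact measurable_scaledErr.mul (by fun_prop)
  have hb : ∀ y, ‖φ y‖ ≤ (Ioi (0 : ℝ)).indicator (fun y => 64 * Real.exp (-(1 / 4) * y)) y := by
    intro y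
    by_cases hy : y ∈ Ioi (0 : ℝ)
    · rw [hφ, indicator_of_mem hy, indicator_of_mem hy, Complex.norm_real, Real.norm_eq_abs]
      exact abs_scaledErr_mul_exp_le (le_of_lt hy)
    · rw [hφ, indicator_of_notMem hy, indicator_of_notMem hy, norm_zero]
  have iφ : Integrable φ := by
    refine Integrable.mono' ((integrable_indicator_iff measurableSet_Ioi).2
      ((integrableOn_rexp_neg_mul_Ioi (c := 1 / 4) (by norm_num)).const_mul 64)) hm.aestronglyMeasurable (Eventually.of_forall hb)
  have mφ : MemLp φ 2 := by
    rw [memLp_two_iff_integrable_sq_norm hm.aestronglyMeasurable]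
    refine Integrable.mono' ((integrable_indicator_iff measurableSet_Ioi).2
      ((integrableOn_rexp_neg_mul_Ioi (c := 1 / 2) (by norm_num)).const_mul (64 ^ 2))) (hm.norm.pow_const 2).aestronglyMeasurable
      (Eventually.of_forall fun y => ?_)
    rw [Real.norm_of_nonneg (by positivity)]
    have := hb y
    by_cases hy : y ∈ Ioi (0 : ℝ)
    · rw [indicator_of_mem hy] at this ⊢
      refine (pow_le_pow_left₀ (norm_nonneg _) this 2).trans (le_of_eq ?_)
      rw [mul_pow, ← Real.exp_nat_mul]
      congr 2
      push_cast; ring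
    · rw [indicator_of_notMem hy] at this ⊢
      have : ‖φ y‖ = 0 := le_antisymm this (norm_nonneg _)
      rw [this]; norm_num
  have := integral_sq_le_of_laplace measurable_scaledErr exists_abs_scaledErr_le hσ
    (by linarith : σ ≤ 1) iφ mφ (differentiableOn_mertensTransform hRH)
    (fun t => by
      rw [integral_scaledErr_mul_cexp (by norm_num)])
    (fun ε hε => exists_norm_mertensTransform_le_of_abs_ge hRH hσ (by linarith) hε) i1 Y
  refine this.trans ?_
  rw [mul_div_assoc]
  gcongr

lemma exists_integral_scaledErr_sq_le (hRH : RiemannHypothesis) :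
    ∃ C, 0 < C ∧ ∀ Y : ℝ, 1 ≤ Y → ∫ y in Ioc 0 Y, scaledErr y ^ 2 ≤ C * Y := by
  obtain ⟨C, hC, H⟩ := exists_integral_scaledErr_sq_mul_exp_le hRH
  refine ⟨Real.exp (1 / 2) * (4 * C), by positivity, fun Y hY => ?_⟩
  have h := H (1 / (4 * Y)) (by positivity) (by
    rw [div_le_div_iff₀ (by positivity) (by norm_num)]; linarith) Y
  have hi := integrableOn_scaledErr_sq Y
  have h2 : Real.exp (-(1 / 2)) * ∫ y in Ioc 0 Y, scaledErr y ^ 2 ≤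
      ∫ y in Ioc 0 Y, scaledErr y ^ 2 * Real.exp (-(2 * (1 / (4 * Y))) * y) := by
    rw [← integral_const_mul]
    refine setIntegral_mono_on (hi.const_mul _) ?_ measurableSet_Ioc fun y hy => ?_
    · refine hi.mul_bdd (c := 1) (by fun_prop) ?_
      refine (ae_restrict_iff' measurableSet_Ioc).2 (Eventually.of_forall fun y hy => ?_)
      rw [Real.norm_of_nonneg (by positivity), Real.exp_le_one_iff]
      have := hy.1
      have : 0 ≤ 2 * (1 / (4 * Y)) * y := by positivity
      linarith
    · rw [mul_comm]
      gcongr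
      have : 2 * (1 / (4 * Y)) * y = (y / Y) / 2 := by field_simp; norm_num
      have h3 : y / Y ≤ 1 := (div_le_one (by linarith)).2 hy.2
      linarith
  have h3 : ∫ y in Ioc 0 Y, scaledErr y ^ 2 =
      Real.exp (1 / 2) * (Real.exp (-(1 / 2)) * ∫ y in Ioc 0 Y, scaledErr y ^ 2) := by
    rw [← mul_assoc, ← Real.exp_add]; norm_num
  rw [h3, mul_assoc]
  have h4 : C / (1 / (4 * Y)) = 4 * C * Y := by field_simp
  rw [h4] at h
  exact mul_le_mul_of_nonneg_left (h2.trans h) (Real.exp_pos _).le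

lemma integrableOn_abs_scaledErr_mul_exp (hRH : RiemannHypothesis) {σ : ℝ} (hσ : 0 < σ) :
    IntegrableOn (fun y => |scaledErr y| * Real.exp (-σ * y)) (Ioi 0) := by
  obtain ⟨C, hC, H⟩ := exists_integral_scaledErr_sq_mul_exp_le hRH
  set τ := min (σ / 2) (1 / 4) with hτ
  have hτ0 : 0 < τ := lt_min (by linarith) (by norm_num)
  have hτσ : τ ≤ σ / 2 := min_le_left _ _
  have i1 : IntegrableOn (fun y => scaledErr y ^ 2 * Real.exp (-(2 * τ) * y)) (Ioi 0) := by
    refine integrableOn_Ioi_of_intervalIntegral_norm_bounded (C / τ) 0 (fun Y : ℝ => ?_) tendsto_id ?_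
    · refine (integrableOn_scaledErr_sq Y).mul_bdd (c := 1) (by fun_prop) ?_
      refine (ae_restrict_iff' measurableSet_Ioc).2 (Eventually.of_forall fun y hy => ?_)
      rw [Real.norm_of_nonneg (by positivity), Real.exp_le_one_iff]
      have := hy.1
      have : 0 ≤ 2 * τ * y := by positivity
      linarith
    · filter_upwards [eventually_ge_atTop 0] with Y hY
      rw [id, intervalIntegral.integral_of_le hY]
      refine le_trans (le_of_eq ?_) (H τ hτ0 (min_le_right _ _) Y)
      congr 1
      funext y
      rw [Real.norm_of_nonneg (by positivity)]
  have i2 := i1.add (integrableOn_rexp_neg_mul_Ioi (c := σ) (by linarith))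
  refine i2.mono' (measurable_scaledErr.norm.mul (by fun_prop)).aestronglyMeasurable
    ((ae_restrict_iff' measurableSet_Ioi).2 (Eventually.of_forall fun y hy => ?_))
  have hy0 : (0 : ℝ) < y := hy
  rw [Real.norm_of_nonneg (by positivity)]
  have e1 : Real.exp (-σ * y) = Real.exp (-(σ / 2) * y) ^ 2 := by
    rw [← Real.exp_nat_mul]; congr 1; push_cast; ring
  have e2 : Real.exp (-(2 * τ) * y) = Real.exp (-τ * y) ^ 2 := by
    rw [← Real.exp_nat_mul]; congr 1; push_cast; ring
  have e3 : Real.exp (-(σ / 2) * y) ≤ Real.exp (-τ * y) := by gcongr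
  simp only [Pi.add_apply]
  rw [e1, e2, ← sq_abs (scaledErr y)]
  have h0 := abs_nonneg (scaledErr y)
  have h1 := Real.exp_pos (-(σ / 2) * y)
  set a := Real.exp (-(σ / 2) * y)
  set b := Real.exp (-τ * y)
  have : |scaledErr y| ^ 2 * a ^ 2 ≤ |scaledErr y| ^ 2 * b ^ 2 := by gcongr
  have h4 : |scaledErr y| * a * a ≤ |scaledErr y| ^ 2 * a ^ 2 + a ^ 2 := by
    nlinarith [sq_nonneg (|scaledErr y| * a - a), sq_nonneg (|scaledErr y| * a), sq_nonneg a]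
  nlinarith

lemma integral_scaledErr_mul_cexp_eq_mertensTransform (hRH : RiemannHypothesis) {s : ℂ} (hs : 0 < s.re) :
    ∫ y in Ioi (0 : ℝ), (scaledErr y : ℂ) * Complex.exp (-s * y) = mertensTransform s := by
  set ψ : ℝ → ℂ := (Ioi 0).indicator fun y => (scaledErr y : ℂ) with hψ
  have hm : Measurable ψ :=
    (Complex.measurable_ofReal.comp measurable_scaledErr).indicator measurableSet_Ioi
  have hi : ∀ c : ℝ, c < 0 → Integrable fun y => ‖ψ y‖ * Real.exp (c * y) := by
    intro c hc
    have h := (integrableOn_abs_scaledErr_mul_exp hRH (σ := -c) (by linarith)).integrable_indicator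
      measurableSet_Ioi
    refine h.congr (Eventually.of_forall fun y => ?_)
    by_cases hy : y ∈ Ioi (0 : ℝ)
    · simp [hψ, indicator_of_mem hy]
    · simp [hψ, indicator_of_notMem hy]
  set F : ℂ → ℂ := fun s => ∫ y in Ioi (0 : ℝ), (scaledErr y : ℂ) * Complex.exp (-s * y) with hF
  have hFe : ∀ s, F s = ∫ y, ψ y * Complex.exp (-s * y) := by
    intro s
    simp only [hF]
    rw [← integral_indicator measurableSet_Ioi]
    congr 1
    funext y
    by_cases hy : y ∈ Ioi (0 : ℝ)
    · simp [hψ, indicator_of_mem hy]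
    · simp [hψ, indicator_of_notMem hy]
  have hFd : DifferentiableOn ℂ F {s | 0 < s.re} := by
    intro s hs
    have hs0 : 0 < s.re := hs
    have h := differentiableAt_integral_mul_cexp (s₀ := -s) (δ := s.re / 2) (by linarith)
      hm.aestronglyMeasurable (hi _ (by simp; linarith)) (hi _ (by simp; linarith))
    have h2 : DifferentiableAt ℂ (fun s : ℂ => ∫ y, ψ y * Complex.exp (-s * y)) s :=
      DifferentiableAt.comp (g := fun s : ℂ => ∫ y, ψ y * Complex.exp (s * y)) (f := fun s : ℂ => -s) s h
        (by fun_prop)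
    have e : F = fun s => ∫ y, ψ y * Complex.exp (-s * y) := funext hFe
    rw [e]
    exact h2.differentiableWithinAt
  have heq : EqOn F mertensTransform {s | 0 < s.re} := by
    refine AnalyticOnNhd.eqOn_of_preconnected_of_eventuallyEq (z₀ := 1)
      (hFd.analyticOnNhd isOpen_re_pos)
      ((differentiableOn_mertensTransform hRH).analyticOnNhd isOpen_re_pos) isPreconnected_re_pos
      (by simp) ?_
    have ho : IsOpen {w : ℂ | 1 / 2 < w.re} := isOpen_lt continuous_const Complex.continuous_re
    filter_upwards [ho.mem_nhds (show (1 : ℂ) ∈ {w : ℂ | 1 / 2 < w.re} by norm_num)] with z hz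
    exact integral_scaledErr_mul_cexp hz
  exact heq hs

end ScaledErrorMeanSquare

section PartialFractions

open scoped Topology

lemma exists_logDeriv_centeredXi_eq_sum (R : ℝ) :
    ∃ (S : Finset ℂ) (m : ℂ → ℤ) (g : ℂ → ℂ), (∀ ρ ∈ S, centeredXi ρ = 0) ∧
      AnalyticOnNhd ℂ g (Metric.closedBall 0 R) ∧ (∀ s ∈ Metric.closedBall (0 : ℂ) R, g s ≠ 0) ∧
      ∀ s ∈ Metric.ball (0 : ℂ) R, centeredXi s ≠ 0 →
        logDeriv centeredXi s = ∑ ρ ∈ S, m ρ / (s - ρ) + logDeriv g s := by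
  classical
  have hZan : AnalyticOnNhd ℂ centeredXi univ := fun z _ => differentiable_centeredXi.analyticAt z
  have hne : ∃ x : ℂ, centeredXi x ≠ 0 := by
    by_contra! h
    have h2 := centeredXi_eq (s := 1 / 2) (by norm_num)
    rw [h] at h2
    norm_num [Complex.Gammaℝ_one] at h2
  obtain ⟨x₀, hx₀⟩ := hne
  have hcod := hZan.preimage_zero_mem_codiscrete hx₀
  have hord : ∀ u : ℂ, meromorphicOrderAt centeredXi u ≠ ⊤ := by
    intro u
    rw [meromorphicOrderAt_ne_top_iff_eventually_ne_zero (hZan u trivial).meromorphicAt]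
    have := (mem_codiscrete.1 hcod) u
    rw [Filter.disjoint_principal_right] at this
    filter_upwards [this] with z hz
    simpa using hz
  set U := Metric.closedBall (0 : ℂ) R with hU
  have hmer : MeromorphicOn centeredXi U := fun z _ => (hZan z trivial).meromorphicAt
  have hfin : (MeromorphicOn.divisor centeredXi U).support.Finite :=
    (MeromorphicOn.divisor centeredXi U).finiteSupport (isCompact_closedBall _ _)
  obtain ⟨g, hg, hg0, hEq⟩ := hmer.extract_zeros_poles (fun u => hord u) hfin
  set D := MeromorphicOn.divisor centeredXi U with hD
  have hDz : ∀ ρ, D ρ ≠ 0 → centeredXi ρ = 0 := by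
    intro ρ hρ
    by_contra h
    have hρU : ρ ∈ U := D.supportWithinDomain hρ
    apply hρ
    rw [hD, MeromorphicOn.divisor_apply hmer hρU,
      (hZan ρ trivial).meromorphicOrderAt_eq, (hZan ρ trivial).analyticOrderAt_eq_zero.2 h]
    simp
  refine ⟨hfin.toFinset, fun ρ => D ρ, g, fun ρ hρ => hDz ρ (by simpa using hρ), hg,
    fun s hs => hg0 ⟨s, hs⟩, fun s hs hZ => ?_⟩
  have hsU : s ∈ U := Metric.ball_subset_closedBall hs
  have hsρ : ∀ ρ ∈ hfin.toFinset, s - ρ ≠ 0 := by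
    intro ρ hρ h
    rw [sub_eq_zero] at h
    exact hZ (h ▸ hDz ρ (by simpa using hρ))
  have hprod : (∏ᶠ (u : ℂ), (fun x => x - u) ^ D u) =
      fun x => ∏ ρ ∈ hfin.toFinset, (x - ρ) ^ D ρ := by
    rw [finprod_eq_prod_of_mulSupport_subset (s := hfin.toFinset)]
    · funext x; simp [Finset.prod_apply]
    · intro u hu
      simp only [Function.mem_mulSupport] at hu
      simp only [Finite.coe_toFinset, Function.mem_support]
      intro h
      exact hu (by rw [h, zpow_zero])
  rw [hprod] at hEq
  set F : ℂ → ℂ := fun x => ∏ ρ ∈ hfin.toFinset, (x - ρ) ^ D ρ with hF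
  have hev : ∀ᶠ z in 𝓝[≠] s, centeredXi z = F z * g z := by
    have h1 : {z | centeredXi z = (F • g) z} ∈ codiscreteWithin U := hEq
    rw [mem_codiscreteWithin] at h1
    have h2 := h1 s hsU
    rw [Filter.disjoint_principal_right] at h2
    have h3 : Metric.ball (0 : ℂ) R ∈ 𝓝[≠] s := nhdsWithin_le_nhds (Metric.isOpen_ball.mem_nhds hs)
    filter_upwards [h2, h3] with z hz hz3
    simp only [mem_compl_iff, Set.mem_sdiff, not_and, not_not] at hz
    exact hz (Metric.ball_subset_closedBall hz3)
  have hdF : DifferentiableAt ℂ F s := by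
    refine DifferentiableAt.fun_finsetProd fun ρ hρ => ?_
    exact (differentiableAt_id.sub_const ρ).zpow (Or.inl (hsρ ρ hρ))
  have hdg : DifferentiableAt ℂ g s := (hg s hsU).differentiableAt
  have hev2 : centeredXi =ᶠ[𝓝 s] fun z => F z * g z := by
    refine (ContinuousAt.eventuallyEq_nhds_iff_eventuallyEq_nhdsNE
      (differentiable_centeredXi s).continuousAt (hdF.continuousAt.mul hdg.continuousAt)).1 hev
  have hF0 : F s ≠ 0 := Finset.prod_ne_zero_iff.2 fun ρ hρ => zpow_ne_zero _ (hsρ ρ hρ)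
  have : logDeriv centeredXi s = logDeriv (fun z => F z * g z) s := by
    rw [logDeriv_apply, logDeriv_apply, hev2.deriv_eq, hev2.eq_of_nhds]
  rw [this, logDeriv_mul s hF0 (hg0 ⟨s, hsU⟩) hdF hdg]
  congr 1
  rw [hF, logDeriv_prod (f := fun ρ x => (x - ρ) ^ D ρ) (fun ρ hρ => zpow_ne_zero _ (hsρ ρ hρ))
    (fun ρ hρ => (differentiableAt_id.sub_const ρ).zpow (Or.inl (hsρ ρ hρ)))]
  refine Finset.sum_congr rfl fun ρ hρ => ?_
  rw [logDeriv_fun_zpow (by fun_prop)]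
  simp [logDeriv_apply, div_eq_mul_inv]

lemma re_eq_zero_of_centeredXi_eq_zero (hRH : RiemannHypothesis) {s : ℂ}
    (h : centeredXi s = 0) : s.re = 0 := by
  rcases lt_trichotomy s.re 0 with h1 | h1 | h1
  · refine absurd (centeredXi_neg s ▸ h : centeredXi (-s) = 0) (centeredXi_ne_zero hRH ?_)
    simpa using h1
  · exact h1
  · exact absurd h (centeredXi_ne_zero hRH h1)

lemma logDeriv_centeredXi_neg (s : ℂ) : logDeriv centeredXi (-s) = -logDeriv centeredXi s := by
  have h : deriv (fun z => centeredXi (-z)) s = -deriv centeredXi (-s) := by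
    rw [deriv_comp_neg]
  rw [logDeriv_apply, logDeriv_apply, centeredXi_neg, ← neg_div, ← neg_eq_iff_eq_neg.2 h]
  simp_rw [centeredXi_neg]

lemma logDeriv_centeredXi_conj {s : ℂ} (hs : 0 < s.re) :
    logDeriv centeredXi (starRingEnd ℂ s) = starRingEnd ℂ (logDeriv centeredXi s) := by
  have h1 := (differentiable_centeredXi s).hasDerivAt.conj_conj
  have h2 : (starRingEnd ℂ ∘ centeredXi ∘ starRingEnd ℂ) =ᶠ[𝓝 (starRingEnd ℂ s)] centeredXi := by
    filter_upwards [isOpen_re_pos.mem_nhds (show 0 < (starRingEnd ℂ s).re by simpa using hs)]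
      with z hz
    have : 0 < z.re := hz
    simp only [Function.comp_apply]
    rw [centeredXi_conj (by linarith), Complex.conj_conj]
  have h3 := (h1.congr_of_eventuallyEq h2.symm).deriv
  rw [logDeriv_apply, logDeriv_apply, h3, centeredXi_conj (by linarith), map_div₀]

/-- The closed box on which the boundary behaviour of the transforms is studied. -/
def boundaryBox (T : ℝ) : Set ℂ := {s | (0 ≤ s.re ∧ s.re ≤ 1 / 4) ∧ |s.im| ≤ T}

lemma exists_partialFractions (hRH : RiemannHypothesis) (T : ℝ) :
    ∃ (S : Finset ℝ) (m : ℝ → ℝ) (h H : ℂ → ℂ), ContinuousOn h (boundaryBox T) ∧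
      ContinuousOn H (boundaryBox T) ∧ (∀ t : ℝ, |t| ≤ T → (h (t * Complex.I)).re = 0) ∧
      ∀ s ∈ boundaryBox T, 0 < s.re →
        logDeriv centeredXi s = ∑ γ ∈ S, m γ * (s - γ * Complex.I)⁻¹ + h s ∧
        mertensTransform s =
          ∑ γ ∈ S, m γ / (1 / 2 - γ * Complex.I) * (s - γ * Complex.I)⁻¹ + H s := by
  obtain ⟨S, m, g, hS, hg, hg0, hf⟩ := exists_logDeriv_centeredXi_eq_sum (T + 1)
  have hρ : ∀ ρ ∈ S, ρ = ρ.im * Complex.I := by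
    intro ρ h
    apply Complex.ext
    · simpa using re_eq_zero_of_centeredXi_eq_zero hRH (hS ρ h)
    · simp
  have hinj : Set.InjOn Complex.im S := by
    intro a ha b hb hab
    rw [hρ a ha, hρ b hb, hab]
  have hbox : boundaryBox T ⊆ Metric.ball (0 : ℂ) (T + 1) := by
    intro s hs
    rw [mem_ball_zero_iff]
    have h1 := Complex.norm_le_abs_re_add_abs_im s
    have h2 : |s.re| ≤ 1 / 4 := abs_le.2 ⟨by linarith [hs.1.1], hs.1.2⟩
    linarith [hs.2]
  have hsum : ∀ s : ℂ, ∀ c : ℂ → ℂ, ∑ γ ∈ S.image Complex.im, c (γ * Complex.I) = ∑ ρ ∈ S, c ρ := by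
    intro s c
    rw [Finset.sum_image hinj]
    exact Finset.sum_congr rfl fun ρ h => by rw [← hρ ρ h]
  have hhc : ContinuousOn (logDeriv g) (Metric.ball (0 : ℂ) (T + 1)) := by
    intro s hs
    have hs' := Metric.ball_subset_closedBall hs
    exact ((hg s hs').deriv.continuousAt.div (hg s hs').continuousAt (hg0 s hs')).continuousWithinAt
  set e : ℂ → ℂ := fun s => (5 / 2 + s)⁻¹ + (s + 3 / 2)⁻¹ +
    deriv riemannZeta (5 / 2 + s) / riemannZeta (5 / 2 + s) - logDeriv centeredXi (s + 2) with he
  have hec : ContinuousOn e (boundaryBox T) := by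
    intro s hs
    have hs0 := hs.1.1
    refine ContinuousAt.continuousWithinAt ?_
    have h1 : (5 / 2 + s) ≠ 0 := fun h => by
      have := congrArg Complex.re h; norm_num at this; linarith
    have h2 : (s + 3 / 2) ≠ 0 := fun h => by
      have := congrArg Complex.re h; norm_num at this; linarith
    have h3 : (5 / 2 + s) ≠ 1 := fun h => by
      have := congrArg Complex.re h; norm_num at this; linarith
    have h4 : riemannZeta (5 / 2 + s) ≠ 0 := by
      apply riemannZeta_ne_zero_of_one_le_re; norm_num; linarith
    have h5 : ContinuousAt (logDeriv centeredXi) (s + 2) :=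
      ((differentiableOn_logDeriv_centeredXi hRH).differentiableAt
        (isOpen_re_pos.mem_nhds (by simp only [mem_ofPred_eq]; norm_num; linarith))).continuousAt
    have h6 : ContinuousAt (deriv riemannZeta) (5 / 2 + s) := by
      have : AnalyticAt ℂ riemannZeta (5 / 2 + s) := by
        have : DifferentiableOn ℂ riemannZeta {1}ᶜ := fun z hz =>
          (differentiableAt_riemannZeta hz).differentiableWithinAt
        exact this.analyticAt (isOpen_compl_singleton.mem_nhds h3)
      exact this.deriv.continuousAt
    have h7 : ContinuousAt riemannZeta (5 / 2 + s) := (differentiableAt_riemannZeta h3).continuousAt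
    have h8 : ContinuousAt (fun s : ℂ => 5 / 2 + s) s := by fun_prop
    have h9 : ContinuousAt (fun s : ℂ => s + 2) s := by fun_prop
    refine ContinuousAt.sub (ContinuousAt.add (ContinuousAt.add (h8.inv₀ h1) ?_) ?_) ?_
    · exact ContinuousAt.inv₀ (by fun_prop) h2
    · exact ContinuousAt.div (ContinuousAt.comp' h6 h8) (ContinuousAt.comp' h7 h8) h4
    · exact ContinuousAt.comp' h5 h9
  have hhalf : ∀ s ∈ boundaryBox T, s - 1 / 2 ≠ 0 := by
    intro s hs h
    have := congrArg Complex.re h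
    norm_num at this
    linarith [hs.1.2]
  set c : ℂ := ∑ ρ ∈ S, (m ρ : ℂ) / (1 / 2 - ρ) with hc
  refine ⟨S.image Complex.im, fun γ => m (γ * Complex.I), logDeriv g,
    fun s => -(logDeriv g s + e s - eulerMascheroniConstant) / (s - 1 / 2) - c / (s - 1 / 2),
    hhc.mono hbox, ?_, ?_, ?_⟩
  · have h1 := hhc.mono hbox
    exact ((((h1.add hec).sub continuousOn_const).neg).div (by fun_prop) hhalf).sub
      (continuousOn_const.div (by fun_prop) hhalf)
  · intro t ht
    have hlim : Tendsto (fun ε : ℝ => (t * Complex.I + ε : ℂ)) (𝓝[>] 0) (𝓝 (t * Complex.I)) := by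
      have : Continuous (fun ε : ℝ => (t * Complex.I + ε : ℂ)) := by fun_prop
      have h := this.tendsto 0
      simp only [Complex.ofReal_zero, add_zero] at h
      exact h.mono_left nhdsWithin_le_nhds
    have hlim2 : Tendsto (fun ε : ℝ => (t * Complex.I - ε : ℂ)) (𝓝[>] 0) (𝓝 (t * Complex.I)) := by
      have : Continuous (fun ε : ℝ => (t * Complex.I - ε : ℂ)) := by fun_prop
      have h := this.tendsto 0
      simp only [Complex.ofReal_zero, sub_zero] at h
      exact h.mono_left nhdsWithin_le_nhds
    have hmem : (t * Complex.I : ℂ) ∈ Metric.ball (0 : ℂ) (T + 1) := by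
      rw [mem_ball_zero_iff]; simp; linarith
    have hnhds := Metric.isOpen_ball.mem_nhds hmem
    have hca : ContinuousAt (fun s => (logDeriv g s).re) (t * Complex.I) :=
      Complex.continuous_re.continuousAt.comp (hhc.continuousAt hnhds)
    have hA := hca.tendsto.comp hlim
    have hB := hca.tendsto.comp hlim2
    have hev : ∀ᶠ ε : ℝ in 𝓝[>] 0, ((fun s => (logDeriv g s).re) ∘ fun ε : ℝ => (t * Complex.I - ε : ℂ)) ε
        = -((fun s => (logDeriv g s).re) ∘ fun ε : ℝ => (t * Complex.I + ε : ℂ)) ε := by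
      filter_upwards [hlim hnhds, hlim2 hnhds, self_mem_nhdsWithin] with ε h1 h2 hε
      have hε0 : 0 < ε := hε
      simp only [Function.comp_apply]
      have hZ1 : centeredXi (t * Complex.I + ε) ≠ 0 := centeredXi_ne_zero hRH (by simpa using hε0)
      have hconj : (t * Complex.I - ε : ℂ) = -(starRingEnd ℂ (t * Complex.I + ε)) := by
        simp [Complex.conj_ofReal]; ring
      have hZ2 : centeredXi (t * Complex.I - ε) ≠ 0 := by
        rw [hconj, centeredXi_neg]; exact centeredXi_ne_zero hRH (by simpa using hε0)
      have e1 := hf _ h1 hZ1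
      have e2 := hf _ h2 hZ2
      have e3 : logDeriv centeredXi (t * Complex.I - ε) =
          -starRingEnd ℂ (logDeriv centeredXi (t * Complex.I + ε)) := by
        rw [hconj, logDeriv_centeredXi_neg, logDeriv_centeredXi_conj (by simpa using hε0)]
      have e4 : ∑ ρ ∈ S, (m ρ : ℂ) / (t * Complex.I - ε - ρ) =
          -starRingEnd ℂ (∑ ρ ∈ S, (m ρ : ℂ) / (t * Complex.I + ε - ρ)) := by
        rw [map_sum, ← Finset.sum_neg_distrib]
        refine Finset.sum_congr rfl fun ρ h => ?_
        rw [map_div₀, ← div_neg, map_sub, hconj, hρ ρ h]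
        congr 1
        · simp
        · simp [Complex.conj_ofReal]; ring
      rw [e3, e4, e1] at e2
      have := congrArg Complex.re e2
      simp only [Complex.neg_re, Complex.conj_re, Complex.add_re] at this
      linarith
    have h0 : (logDeriv g (t * Complex.I)).re = -(logDeriv g (t * Complex.I)).re :=
      tendsto_nhds_unique (hB.congr' hev) hA.neg
    linarith
  · intro s hs hs0
    have hZ := centeredXi_ne_zero hRH hs0
    have e1 : logDeriv centeredXi s = ∑ ρ ∈ S, (m ρ : ℂ) * (s - ρ)⁻¹ + logDeriv g s := by
      simpa only [div_eq_mul_inv] using hf s (hbox hs) hZ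
    constructor
    · rw [e1, ← hsum s (fun ρ => (m ρ : ℂ) * (s - ρ)⁻¹)]
      simp
    · have e2 := logDeriv_riemannZeta₁_add hRH hs0
      have e3 : logDeriv riemannZeta₁ (s + 1 / 2) = logDeriv centeredXi s + e s := by
        rw [add_comm s, he]; linear_combination e2
      have hs1 := hhalf s hs
      rw [mertensTransform_eq (fun h => hs1 (by rw [h]; ring)), e3, e1]
      have e4 : ∀ ρ ∈ S, (m ρ : ℂ) / (1 / 2 - ρ) * (s - ρ)⁻¹ =
          -((m ρ : ℂ) * (s - ρ)⁻¹ / (s - 1 / 2)) + (m ρ : ℂ) / (1 / 2 - ρ) / (s - 1 / 2) := by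
        intro ρ h
        have h0 := re_eq_zero_of_centeredXi_eq_zero hRH (hS ρ h)
        have h1 : s - ρ ≠ 0 := fun h => by
          have := congrArg Complex.re h; simp [h0] at this; linarith
        have h2 : (1 / 2 : ℂ) - ρ ≠ 0 := fun h => by
          have := congrArg Complex.re h; norm_num [h0] at this
        have h3 : s - ρ = (s - 1 / 2) + (1 / 2 - ρ) := by ring
        rw [h3] at h1 ⊢
        generalize s - 1 / 2 = d at *
        generalize (1 / 2 : ℂ) - ρ = b at *
        field_simp
        ring
      have e5 := hsum s (fun ρ => (m ρ : ℂ) / (1 / 2 - ρ) * (s - ρ)⁻¹)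
      push_cast
      rw [e5, Finset.sum_congr rfl e4, Finset.sum_add_distrib, Finset.sum_neg_distrib,
        ← Finset.sum_div, ← Finset.sum_div]
      rw [← hc]
      ring

end PartialFractions

section WeakLimit

open scoped Topology

lemma tendsto_integral_poisson {ψ : ℝ → ℝ} (hψ : Continuous ψ) {M : ℝ} (hM : ∀ t, |ψ t| ≤ M) (γ : ℝ) :
    Tendsto (fun σ : ℝ => ∫ t, σ / (σ ^ 2 + (t - γ) ^ 2) * ψ t) (𝓝[>] 0) (𝓝 (π * ψ γ)) := by
  have h1 : ∀ σ : ℝ, 0 < σ → ∫ t, σ / (σ ^ 2 + (t - γ) ^ 2) * ψ t =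
      ∫ x, (1 + x ^ 2)⁻¹ * ψ (γ + σ * x) := by
    intro σ hσ
    have e1 := integral_sub_right_eq_self (μ := volume)
      (fun t : ℝ => σ / (σ ^ 2 + t ^ 2) * ψ (t + γ)) γ
    simp only [sub_add_cancel] at e1
    rw [e1]
    have e2 := Measure.integral_comp_mul_left (fun t : ℝ => σ / (σ ^ 2 + t ^ 2) * ψ (t + γ)) σ
    rw [abs_of_pos (inv_pos.2 hσ), smul_eq_mul] at e2
    have e3 : ∫ t, σ / (σ ^ 2 + t ^ 2) * ψ (t + γ) =
        σ * ∫ x, σ / (σ ^ 2 + (σ * x) ^ 2) * ψ (σ * x + γ) := by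
      rw [e2]; field_simp
    rw [e3, ← integral_const_mul]
    congr 1
    funext x
    rw [add_comm γ]
    have : 1 + x ^ 2 ≠ 0 := by positivity
    have : σ ^ 2 + (σ * x) ^ 2 = σ ^ 2 * (1 + x ^ 2) := by ring
    rw [this]
    field_simp
  have h2 : Tendsto (fun σ : ℝ => ∫ x, (1 + x ^ 2)⁻¹ * ψ (γ + σ * x)) (𝓝[>] 0)
      (𝓝 (∫ x, (1 + x ^ 2)⁻¹ * ψ γ)) := by
    refine tendsto_integral_filter_of_dominated_convergence (fun x => M * (1 + x ^ 2)⁻¹) ?_ ?_ ?_ ?_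
    · refine Eventually.of_forall fun σ => Continuous.aestronglyMeasurable ?_
      have : Continuous fun x : ℝ => (1 + x ^ 2)⁻¹ :=
        (by fun_prop : Continuous fun x : ℝ => 1 + x ^ 2).inv₀ (fun x => by positivity)
      fun_prop
    · refine Eventually.of_forall fun σ => Eventually.of_forall fun x => ?_
      rw [norm_mul, Real.norm_of_nonneg (by positivity), mul_comm]
      exact mul_le_mul_of_nonneg_right (hM _) (by positivity)
    · exact integrable_inv_one_add_sq.const_mul M
    · refine Eventually.of_forall fun x => ?_
      have : Continuous fun σ : ℝ => (1 + x ^ 2)⁻¹ * ψ (γ + σ * x) := by fun_prop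
      have := this.tendsto 0
      simp only [zero_mul, add_zero] at this
      exact this.mono_left nhdsWithin_le_nhds
  rw [integral_mul_const, integral_univ_inv_one_add_sq] at h2
  refine h2.congr' ?_
  filter_upwards [self_mem_nhdsWithin] with σ hσ
  exact (h1 σ hσ).symm

lemma isCompact_boundaryBox (T : ℝ) : IsCompact (boundaryBox T) := by
  have : boundaryBox T = (Icc 0 (1 / 4)) ×ℂ (Icc (-T) T) := by
    ext s
    simp only [boundaryBox, mem_ofPred_eq, Complex.mem_reProdIm, mem_Icc, abs_le]
  rw [this]
  exact isCompact_Icc.reProdIm isCompact_Icc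

lemma mem_boundaryBox {σ t T : ℝ} (h0 : 0 ≤ σ) (h1 : σ ≤ 1 / 4) (ht : t ∈ Icc (-T) T) :
    (σ + t * Complex.I : ℂ) ∈ boundaryBox T := by
  refine ⟨⟨by simpa using h0, by simpa using h1⟩, ?_⟩
  simpa using abs_le.2 ht

lemma integrableOn_boundaryBox {T : ℝ} {H : ℂ → ℂ} (hH : ContinuousOn H (boundaryBox T))
    {φ : ℝ → ℂ} (hφ : Continuous φ) {σ : ℝ} (h0 : 0 ≤ σ) (h1 : σ ≤ 1 / 4) :
    IntegrableOn (fun t : ℝ => H (σ + t * Complex.I) * φ t) (Icc (-T) T) := by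
  refine ContinuousOn.integrableOn_compact isCompact_Icc ?_
  refine ContinuousOn.mul (hH.comp (by fun_prop) fun t ht => mem_boundaryBox h0 h1 ht) hφ.continuousOn

lemma tendsto_integral_boundaryBox {T : ℝ} {H : ℂ → ℂ} (hH : ContinuousOn H (boundaryBox T))
    {φ : ℝ → ℂ} (hφ : Continuous φ) :
    Tendsto (fun σ : ℝ => ∫ t in Icc (-T) T, H (σ + t * Complex.I) * φ t) (𝓝[>] 0)
      (𝓝 (∫ t in Icc (-T) T, H (t * Complex.I) * φ t)) := by
  obtain ⟨C, hC⟩ := (isCompact_boundaryBox T).exists_bound_of_continuousOn hH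
  have hsmall : ∀ᶠ σ : ℝ in 𝓝[>] 0, 0 < σ ∧ σ ≤ 1 / 4 :=
    Ioc_mem_nhdsGT (by norm_num : (0 : ℝ) < 1 / 4)
  refine tendsto_integral_filter_of_dominated_convergence (fun t => C * ‖φ t‖) ?_ ?_ ?_ ?_
  · filter_upwards [hsmall] with σ hσ
    exact (integrableOn_boundaryBox hH hφ hσ.1.le hσ.2).aestronglyMeasurable
  · filter_upwards [hsmall] with σ hσ
    refine (ae_restrict_iff' measurableSet_Icc).2 (Eventually.of_forall fun t ht => ?_)
    rw [norm_mul]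
    exact mul_le_mul_of_nonneg_right (hC _ (mem_boundaryBox hσ.1.le hσ.2 ht)) (norm_nonneg _)
  · exact ((by fun_prop : Continuous fun t => C * ‖φ t‖).continuousOn).integrableOn_compact isCompact_Icc
  · refine (ae_restrict_iff' measurableSet_Icc).2 (Eventually.of_forall fun t ht => ?_)
    refine Tendsto.mul_const _ ?_
    have h1 : Tendsto (fun σ : ℝ => (σ + t * Complex.I : ℂ)) (𝓝[>] 0)
        (𝓝[boundaryBox T] (t * Complex.I)) := by
      refine tendsto_nhdsWithin_iff.2 ⟨?_, hsmall.mono fun σ hσ => mem_boundaryBox hσ.1.le hσ.2 ht⟩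
      have : Continuous (fun ε : ℝ => (ε + t * Complex.I : ℂ)) := by fun_prop
      have h := this.tendsto 0
      simp only [Complex.ofReal_zero, zero_add] at h
      exact h.mono_left nhdsWithin_le_nhds
    have h2 : (t * Complex.I : ℂ) ∈ boundaryBox T := by
      have := mem_boundaryBox (σ := 0) (T := T) le_rfl (by norm_num) ht
      simpa using this
    exact (hH _ h2).tendsto.comp h1

lemma re_inv_sub_mul_I (σ t γ : ℝ) :
    ((σ + t * Complex.I - γ * Complex.I : ℂ)⁻¹).re = σ / (σ ^ 2 + (t - γ) ^ 2) := by
  have : (σ + t * Complex.I - γ * Complex.I : ℂ) = ⟨σ, t - γ⟩ := by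
    apply Complex.ext <;> simp
  rw [this, Complex.inv_re, Complex.normSq_mk]
  ring

lemma tendsto_integral_re_logDeriv_centeredXi {T : ℝ} {S : Finset ℝ} {m : ℝ → ℝ} {h : ℂ → ℂ}
    (hh : ContinuousOn h (boundaryBox T)) (h0 : ∀ t : ℝ, |t| ≤ T → (h (t * Complex.I)).re = 0)
    (hf : ∀ s ∈ boundaryBox T, 0 < s.re →
      logDeriv centeredXi s = ∑ γ ∈ S, m γ * (s - γ * Complex.I)⁻¹ + h s)
    {ψ : ℝ → ℝ} (hψ : Continuous ψ) (hψT : ∀ t, t ∉ Icc (-T) T → ψ t = 0) :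
    Tendsto (fun σ : ℝ => ∫ t in Icc (-T) T, (logDeriv centeredXi (σ + t * Complex.I)).re * ψ t)
      (𝓝[>] 0) (𝓝 (π * ∑ γ ∈ S, m γ * ψ γ)) := by
  obtain ⟨M, hM⟩ : ∃ M, ∀ t, |ψ t| ≤ M := by
    obtain ⟨M, hM⟩ := isCompact_Icc.exists_bound_of_continuousOn (s := Icc (-T) T) hψ.continuousOn
    refine ⟨max M 0, fun t => ?_⟩
    by_cases ht : t ∈ Icc (-T) T
    · exact (hM t ht).trans (le_max_left _ _)
    · rw [hψT t ht, abs_zero]; exact le_max_right _ _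
  have hsmall : ∀ᶠ σ : ℝ in 𝓝[>] 0, 0 < σ ∧ σ ≤ 1 / 4 :=
    Ioc_mem_nhdsGT (by norm_num : (0 : ℝ) < 1 / 4)
  have hψc : Continuous fun t => (ψ t : ℂ) := by fun_prop
  have hlimh := (Complex.continuous_re.tendsto _).comp (tendsto_integral_boundaryBox hh hψc)
  have hre : ∀ σ : ℝ, 0 ≤ σ → σ ≤ 1 / 4 → (∫ t in Icc (-T) T, h (σ + t * Complex.I) * ψ t).re =
      ∫ t in Icc (-T) T, (h (σ + t * Complex.I)).re * ψ t := by
    intro σ h1 h2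
    have := integral_re (integrableOn_boundaryBox hh hψc h1 h2)
    simp only [RCLike.re_eq_complex_re] at this
    rw [← this]
    simp only [Complex.re_mul_ofReal]
  have hz : (∫ t in Icc (-T) T, h (t * Complex.I) * ψ t).re = 0 := by
    have h1 := hre 0 le_rfl (by norm_num)
    simp only [Complex.ofReal_zero, zero_add] at h1
    rw [h1]
    refine setIntegral_eq_zero_of_forall_eq_zero fun t ht => ?_
    rw [h0 t (abs_le.2 ht), zero_mul]
  rw [hz] at hlimh
  have hlimS : Tendsto (fun σ : ℝ => ∑ γ ∈ S, m γ * ∫ t, σ / (σ ^ 2 + (t - γ) ^ 2) * ψ t) (𝓝[>] 0)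
      (𝓝 (∑ γ ∈ S, m γ * (π * ψ γ))) :=
    tendsto_finsetSum _ fun γ _ => (tendsto_integral_poisson hψ hM γ).const_mul _
  have hlim := hlimS.add hlimh
  rw [add_zero] at hlim
  have e : π * ∑ γ ∈ S, m γ * ψ γ = ∑ γ ∈ S, m γ * (π * ψ γ) := by
    rw [Finset.mul_sum]; exact Finset.sum_congr rfl fun γ _ => by ring
  rw [e]
  refine hlim.congr' ?_
  filter_upwards [hsmall] with σ hσ
  have hpc : ∀ γ : ℝ, Continuous fun t : ℝ => σ / (σ ^ 2 + (t - γ) ^ 2) * ψ t := by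
    intro γ
    have : Continuous fun t : ℝ => σ / (σ ^ 2 + (t - γ) ^ 2) :=
      continuous_const.div (by fun_prop) fun t => by
        have := hσ.1
        positivity
    fun_prop
  have e1 : ∀ γ : ℝ, ∫ t, σ / (σ ^ 2 + (t - γ) ^ 2) * ψ t =
      ∫ t in Icc (-T) T, σ / (σ ^ 2 + (t - γ) ^ 2) * ψ t := by
    intro γ
    refine (setIntegral_eq_integral_of_forall_compl_eq_zero fun t ht => ?_).symm
    rw [hψT t ht, mul_zero]
  simp only [Function.comp_apply]
  rw [hre σ hσ.1.le hσ.2]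
  simp_rw [e1, ← integral_const_mul]
  rw [← integral_finsetSum _ fun γ _ =>
    ((hpc γ).const_mul (m γ)).continuousOn.integrableOn_compact isCompact_Icc, ← integral_add]
  · refine setIntegral_congr_fun measurableSet_Icc fun t ht => ?_
    rw [hf _ (mem_boundaryBox hσ.1.le hσ.2 ht) (by simpa using hσ.1), Complex.add_re, add_mul,
      Complex.re_sum, Finset.sum_mul]
    congr 1
    refine Finset.sum_congr rfl fun γ _ => ?_
    rw [Complex.re_ofReal_mul, re_inv_sub_mul_I]
    ring
  · exact integrable_finsetSum _ fun γ _ =>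
      ((hpc γ).const_mul (m γ)).continuousOn.integrableOn_compact isCompact_Icc
  · have := (integrableOn_boundaryBox hh hψc hσ.1.le hσ.2).re
    simpa only [RCLike.re_eq_complex_re, Complex.re_mul_ofReal] using this

end WeakLimit

section FejerWeight

open scoped Topology

/-- The triangular weight supported on `[-T, T]`. -/
noncomputable def fejerWeight (T t : ℝ) : ℝ := max 0 (1 - |t| / T)

lemma continuous_fejerWeight (T : ℝ) : Continuous (fejerWeight T) := by
  unfold fejerWeight; fun_prop

lemma fejerWeight_nonneg (T t : ℝ) : 0 ≤ fejerWeight T t := le_max_left _ _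

lemma fejerWeight_le_one {T : ℝ} (hT : 0 < T) (t : ℝ) : fejerWeight T t ≤ 1 :=
  max_le zero_le_one (by have := div_nonneg (abs_nonneg t) hT.le; linarith)

lemma fejerWeight_eq_zero {T t : ℝ} (hT : 0 < T) (ht : t ∉ Icc (-T) T) : fejerWeight T t = 0 := by
  refine max_eq_left ?_
  have h : T < |t| := by
    by_contra! h
    exact ht (abs_le.1 h)
  have := (one_lt_div hT).2 h
  linarith

lemma fejerWeight_eq {T t : ℝ} (hT : 0 < T) (ht : |t| ≤ T) : fejerWeight T t = 1 - |t| / T := by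
  refine max_eq_right ?_
  have := (div_le_one hT).2 ht
  linarith

lemma mul_sin_nonneg {T t : ℝ} (hT : 0 < T) (ht : |t| ≤ T) : 0 ≤ t * Real.sin (π * t / T) := by
  have h0 := abs_le.1 ht
  rcases le_total 0 t with h | h
  · refine mul_nonneg h (Real.sin_nonneg_of_nonneg_of_le_pi (by positivity) ?_)
    rw [div_le_iff₀ hT]; exact mul_le_mul_of_nonneg_left h0.2 pi_pos.le
  · refine mul_nonneg_of_nonpos_of_nonpos h (Real.sin_nonpos_of_nonpos_of_neg_pi_le ?_ ?_)
    · exact div_nonpos_of_nonpos_of_nonneg (mul_nonpos_of_nonneg_of_nonpos pi_pos.le h) hT.le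
    · rw [le_div_iff₀ hT]; nlinarith [pi_pos]

lemma sq_le_mul_sin {T t : ℝ} (hT : 0 < T) (ht : |t| ≤ T / 2) :
    2 * t ^ 2 / T ≤ t * Real.sin (π * t / T) := by
  have key : ∀ x : ℝ, 0 ≤ x → x ≤ T / 2 → 2 * x / T ≤ Real.sin (π * x / T) := by
    intro x h0 h1
    have := Real.mul_le_sin (x := π * x / T) (by positivity) (by
      rw [div_le_div_iff₀ hT (by norm_num)]; nlinarith [pi_pos])
    convert this using 1
    field_simp
  have h0 := abs_le.1 ht
  rcases le_total 0 t with h | h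
  · have := mul_le_mul_of_nonneg_left (key t h h0.2) h
    calc 2 * t ^ 2 / T = t * (2 * t / T) := by ring
      _ ≤ _ := this
  · have := mul_le_mul_of_nonneg_left (key (-t) (by linarith) (by linarith)) (neg_nonneg.2 h)
    calc 2 * t ^ 2 / T = -t * (2 * (-t) / T) := by ring
      _ ≤ -t * Real.sin (π * (-t) / T) := this
      _ = t * Real.sin (π * t / T) := by rw [mul_neg, neg_div, Real.sin_neg]; ring

lemma poisson_le_fejerWeight_mul {A R : ℝ} (hA : 1 ≤ A) (hR : 1 ≤ R) (t : ℝ) :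
    4 / (5 * (2 * A * R)) * (R ^ 2 * (R ^ 2 + t ^ 2)⁻¹ - 2 * R ^ 2 * ((A * R) ^ 2 + t ^ 2)⁻¹
      - 5 * (2 ^ 2 + t ^ 2)⁻¹) - 8 * (2 ^ 2 + t ^ 2)⁻¹ ≤
    fejerWeight (2 * A * R) t * (t * Real.sin (π * t / (2 * A * R)) - 1 / 2) / (1 / 4 + t ^ 2) := by
  set T := 2 * A * R with hT
  have hAR : 1 ≤ A * R := by nlinarith
  have hT0 : 0 < T := by positivity
  have hw0 := fejerWeight_nonneg T t
  have hw1 := fejerWeight_le_one hT0 t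
  have h8 : fejerWeight T t * (1 / 2) / (1 / 4 + t ^ 2) ≤ 8 * (2 ^ 2 + t ^ 2)⁻¹ := by
    rw [← div_eq_mul_inv, div_le_div_iff₀ (by positivity) (by positivity)]
    nlinarith [sq_nonneg t, mul_le_mul_of_nonneg_right hw1 (by positivity : 0 ≤ (2 : ℝ) ^ 2 + t ^ 2)]
  have hK1 : R ^ 2 * (R ^ 2 + t ^ 2)⁻¹ ≤ 1 := by
    rw [← div_eq_mul_inv, div_le_one (by positivity)]; nlinarith [sq_nonneg t]
  have hK2 : 0 ≤ 2 * R ^ 2 * ((A * R) ^ 2 + t ^ 2)⁻¹ := by positivity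
  have hK3 : 0 ≤ 5 * ((2 : ℝ) ^ 2 + t ^ 2)⁻¹ := by positivity
  have hc : 0 < 4 / (5 * T) := by positivity
  have hQ : 4 / (5 * T) * (R ^ 2 * (R ^ 2 + t ^ 2)⁻¹ - 2 * R ^ 2 * ((A * R) ^ 2 + t ^ 2)⁻¹
      - 5 * (2 ^ 2 + t ^ 2)⁻¹) ≤
      fejerWeight T t * (t * Real.sin (π * t / T)) / (1 / 4 + t ^ 2) := by
    have hQ0 : 0 ≤ fejerWeight T t * (t * Real.sin (π * t / T)) / (1 / 4 + t ^ 2) := by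
      by_cases ht : t ∈ Icc (-T) T
      · have := mul_sin_nonneg hT0 (abs_le.2 ht)
        positivity
      · rw [fejerWeight_eq_zero hT0 ht]; simp
    rcases lt_or_ge |t| 1 with h1 | h1
    · refine le_trans (mul_nonpos_of_nonneg_of_nonpos hc.le ?_) hQ0
      have : 1 ≤ 5 * ((2 : ℝ) ^ 2 + t ^ 2)⁻¹ := by
        rw [← div_eq_mul_inv, one_le_div (by positivity)]
        nlinarith [sq_abs t, abs_nonneg t]
      linarith
    rcases le_or_gt |t| (T / 2) with h2 | h2
    · have hw : 1 / 2 ≤ fejerWeight T t := by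
        rw [fejerWeight_eq hT0 (by linarith)]
        have : |t| / T ≤ 1 / 2 := by rw [div_le_iff₀ hT0]; linarith
        linarith
      have hs := sq_le_mul_sin hT0 h2
      have ht2 : 1 ≤ t ^ 2 := by nlinarith [sq_abs t]
      calc _ ≤ 4 / (5 * T) * 1 := mul_le_mul_of_nonneg_left (by linarith) hc.le
        _ ≤ 1 / 2 * (2 * t ^ 2 / T) / (1 / 4 + t ^ 2) := by
          rw [mul_one, div_le_div_iff₀ (by positivity) (by positivity)]
          have : 1 / 2 * (2 * t ^ 2 / T) * (5 * T) = 5 * t ^ 2 := by field_simp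
          rw [this]; linarith
        _ ≤ _ := by
          refine div_le_div_of_nonneg_right ?_ (by positivity)
          exact mul_le_mul hw hs (by positivity) hw0
    · refine le_trans (mul_nonpos_of_nonneg_of_nonpos hc.le ?_) hQ0
      have : R ^ 2 * (R ^ 2 + t ^ 2)⁻¹ ≤ 2 * R ^ 2 * ((A * R) ^ 2 + t ^ 2)⁻¹ := by
        rw [← div_eq_mul_inv, ← div_eq_mul_inv, div_le_div_iff₀ (by positivity) (by positivity)]
        have h3 : A * R < |t| := by rw [hT] at h2; linarith
        have h4 : (A * R) ^ 2 ≤ t ^ 2 := by rw [← sq_abs t]; gcongr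
        nlinarith [mul_le_mul_of_nonneg_left h4 (sq_nonneg R), sq_nonneg (R ^ 2)]
      linarith
  have : fejerWeight T t * (t * Real.sin (π * t / T) - 1 / 2) / (1 / 4 + t ^ 2) =
    fejerWeight T t * (t * Real.sin (π * t / T)) / (1 / 4 + t ^ 2) -
      fejerWeight T t * (1 / 2) / (1 / 4 + t ^ 2) := by ring
  rw [this]
  linarith

lemma exists_le_integral_re_logDeriv_centeredXi (hRH : RiemannHypothesis) (V : ℝ) :
    ∃ T, 0 < T ∧ ∀ ψ : ℝ → ℝ, Continuous ψ → (∀ t, t ∉ Icc (-T) T → ψ t = 0) →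
      (∀ t, fejerWeight T t * (t * Real.sin (π * t / T) - 1 / 2) / (1 / 4 + t ^ 2) ≤ ψ t) →
      ∀ σ : ℝ, 0 < σ → σ ≤ 1 / 4 →
        V ≤ ∫ t in Icc (-T) T, (logDeriv centeredXi (σ + t * Complex.I)).re * ψ t := by
  obtain ⟨B, hB, H⟩ := exists_integral_re_logDeriv_centeredXi_bounds hRH
  set A : ℝ := 1000 with hA
  set C : ℝ := (2 * π * Real.log 2 + B) / 2 with hC
  have hC0 : 0 < C := by have := Real.log_pos (by norm_num : (1 : ℝ) < 2); positivity
  -- a lower bound for the integral in terms of `log R`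
  have hT : ∃ R : ℝ, 2 ≤ R ∧ V ≤ 2 / (5 * A) * (Real.log R / 30 - B -
      2 / A * (2 * π * (Real.log A + Real.log R) + B) - 5 * C) - 8 * C := by
    have : Tendsto (fun R : ℝ => 2 / (5 * A) * ((1 / 30 - 4 * π / A) * Real.log R +
        (- B - 2 / A * (2 * π * Real.log A + B) - 5 * C)) - 8 * C) atTop atTop := by
      refine tendsto_atTop_add_const_right _ _ (Tendsto.const_mul_atTop (by positivity) ?_)
      refine tendsto_atTop_add_const_right _ _ (Tendsto.const_mul_atTop ?_ Real.tendsto_log_atTop)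
      have := Real.pi_lt_four
      rw [hA]; linarith
    obtain ⟨R, h1, h2⟩ := ((this.eventually_ge_atTop V).and (eventually_ge_atTop 2)).exists
    exact ⟨R, h2, h1.trans (le_of_eq (by ring))⟩
  obtain ⟨R, hR2, hV⟩ := hT
  have hAR : 2 ≤ A * R := by rw [hA]; linarith
  have hA0 : 0 < A := by rw [hA]; norm_num
  refine ⟨2 * A * R, by positivity, fun ψ hψ hψT hle σ hσ hσ1 => hV.trans ?_⟩
  set T := 2 * A * R with hTd
  set u : ℝ → ℝ := fun t => (logDeriv centeredXi (σ + t * Complex.I)).re with hu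
  have hu0 : ∀ t, 0 ≤ u t := fun t => re_logDeriv_centeredXi_nonneg hRH (by simpa using hσ)
  have huc : Continuous u := by
    refine Complex.continuous_re.comp (continuous_iff_continuousAt.2 fun t => ?_)
    have h1 : (σ + t * Complex.I : ℂ) ∈ {s : ℂ | 0 < s.re} := by simpa using hσ
    exact ContinuousAt.comp' ((differentiableOn_logDeriv_centeredXi hRH).differentiableAt
      (isOpen_re_pos.mem_nhds h1)).continuousAt (by fun_prop)
  obtain ⟨i1, -, l1⟩ := H σ R hσ (by linarith) hR2
  obtain ⟨i2, l2, -⟩ := H σ (A * R) hσ (by linarith) hAR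
  obtain ⟨i3, l3, -⟩ := H σ 2 hσ (by linarith) le_rfl
  have hiψ : Integrable fun t => u t * ψ t := by
    refine (integrableOn_iff_integrable_of_support_subset (s := Icc (-T) T) ?_).1
      ((huc.mul hψ).continuousOn.integrableOn_compact isCompact_Icc)
    intro t ht
    by_contra h
    exact ht (by simp [hψT t h])
  have hL : Integrable fun t => 4 / (5 * T) * (R ^ 2 * (u t * (R ^ 2 + t ^ 2)⁻¹)
      - 2 * R ^ 2 * (u t * ((A * R) ^ 2 + t ^ 2)⁻¹) - 5 * (u t * (2 ^ 2 + t ^ 2)⁻¹)) -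
      8 * (u t * (2 ^ 2 + t ^ 2)⁻¹) :=
    ((((i1.const_mul _).sub (i2.const_mul _)).sub (i3.const_mul _)).const_mul _).sub (i3.const_mul _)
  have hmono := integral_mono hL hiψ fun t => by
    have h1 := mul_le_mul_of_nonneg_left ((poisson_le_fejerWeight_mul (A := A) (R := R) (by rw [hA]; norm_num)
      (by linarith) t).trans (hle t)) (hu0 t)
    refine le_trans (le_of_eq ?_) h1
    ring
  have j1 : Integrable fun t => R ^ 2 * (u t * (R ^ 2 + t ^ 2)⁻¹) := i1.const_mul _
  have j2 : Integrable fun t => 2 * R ^ 2 * (u t * ((A * R) ^ 2 + t ^ 2)⁻¹) := i2.const_mul _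
  have j3 : Integrable fun t => 5 * (u t * (2 ^ 2 + t ^ 2)⁻¹) := i3.const_mul _
  have j4 : Integrable fun t => 8 * (u t * (2 ^ 2 + t ^ 2)⁻¹) := i3.const_mul _
  have j12 : Integrable fun t => R ^ 2 * (u t * (R ^ 2 + t ^ 2)⁻¹) -
      2 * R ^ 2 * (u t * ((A * R) ^ 2 + t ^ 2)⁻¹) := j1.sub j2
  have j123 : Integrable fun t => R ^ 2 * (u t * (R ^ 2 + t ^ 2)⁻¹) -
      2 * R ^ 2 * (u t * ((A * R) ^ 2 + t ^ 2)⁻¹) - 5 * (u t * (2 ^ 2 + t ^ 2)⁻¹) := j12.sub j3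
  rw [integral_sub (j123.const_mul _) j4, integral_const_mul, integral_sub j12 j3,
    integral_sub j1 j2, integral_const_mul, integral_const_mul, integral_const_mul,
    integral_const_mul] at hmono
  rw [setIntegral_eq_integral_of_forall_compl_eq_zero (fun t ht => by rw [hψT t ht, mul_zero])]
  refine le_trans ?_ hmono
  rw [Real.log_mul hA0.ne' (by linarith)] at l2
  generalize (∫ t, u t * (R ^ 2 + t ^ 2)⁻¹) = I1 at *
  generalize (∫ t, u t * ((A * R) ^ 2 + t ^ 2)⁻¹) = I2 at *
  generalize (∫ t, u t * (2 ^ 2 + t ^ 2)⁻¹) = I3 at *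
  have hR0 : 0 < R := by linarith
  have e1 : R ^ 2 * ((Real.log R / 30 - B) / R) ≤ R ^ 2 * I1 := by gcongr
  have e2 : 2 * R ^ 2 * I2 ≤ 2 * R ^ 2 * ((2 * π * (Real.log A + Real.log R) + B) / (A * R)) := by gcongr
  have e3 : 4 / (5 * T) * (R * (Real.log R / 30 - B -
      2 / A * (2 * π * (Real.log A + Real.log R) + B) - 5 * C)) ≤
      4 / (5 * T) * (R ^ 2 * I1 - 2 * R ^ 2 * I2 - 5 * I3) := by
    refine mul_le_mul_of_nonneg_left ?_ (by positivity)
    have e4 : R ^ 2 * ((Real.log R / 30 - B) / R) = R * (Real.log R / 30 - B) := by field_simp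
    have e5 : 2 * R ^ 2 * ((2 * π * (Real.log A + Real.log R) + B) / (A * R)) =
      R * (2 / A * (2 * π * (Real.log A + Real.log R) + B)) := by field_simp
    have e6 : 5 * I3 ≤ R * (5 * C) := by nlinarith
    linarith
  have e7 : 4 / (5 * T) * (R * (Real.log R / 30 - B -
      2 / A * (2 * π * (Real.log A + Real.log R) + B) - 5 * C)) = 2 / (5 * A) * (Real.log R / 30 - B -
      2 / A * (2 * π * (Real.log A + Real.log R) + B) - 5 * C) := by
    rw [hTd]; field_simp; ring
  linarith

end FejerWeight

section FejerKernel

open scoped Topology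

/-- The Fejér kernel on the line, the inverse Fourier transform of `fejerWeight T`. -/
noncomputable def fejerKernel (T v : ℝ) : ℝ := T / (2 * π) * Real.sinc (T * v / 2) ^ 2

lemma continuous_fejerKernel (T : ℝ) : Continuous (fejerKernel T) := by
  have := Real.continuous_sinc
  unfold fejerKernel; fun_prop

lemma fejerKernel_nonneg {T : ℝ} (hT : 0 < T) (v : ℝ) : 0 ≤ fejerKernel T v := by
  unfold fejerKernel; positivity

lemma sinc_sq_le (x : ℝ) : Real.sinc x ^ 2 ≤ 2 * (1 + x ^ 2)⁻¹ := by
  rw [← div_eq_mul_inv, le_div_iff₀ (by positivity)]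
  have h1 : Real.sinc x ^ 2 ≤ 1 := by
    rw [sq_le_one_iff_abs_le_one, abs_le]
    exact ⟨Real.neg_one_le_sinc x, Real.sinc_le_one x⟩
  have h2 : Real.sinc x ^ 2 * x ^ 2 ≤ 1 := by
    by_cases hx : x = 0
    · simp [hx]
    · rw [Real.sinc_of_ne_zero hx, div_pow, div_mul_cancel₀ _ (by positivity)]
      exact Real.sin_sq_le_one x
  linarith

lemma fejerKernel_le {T : ℝ} (hT : 0 < T) (v : ℝ) :
    fejerKernel T v ≤ T / π * (1 + (T / 2 * v) ^ 2)⁻¹ := by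
  have h := mul_le_mul_of_nonneg_left (sinc_sq_le (T * v / 2)) (by positivity : 0 ≤ T / (2 * π))
  unfold fejerKernel
  calc _ ≤ _ := h
    _ = T / π * (1 + (T * v / 2) ^ 2)⁻¹ := by field_simp
    _ = _ := by congr 4; ring

lemma integrable_fejerKernel {T : ℝ} (hT : 0 < T) : Integrable (fejerKernel T) := by
  refine Integrable.mono' ((integrable_inv_one_add_sq.comp_mul_left' (show T / 2 ≠ 0 by positivity)).const_mul
    (T / π)) (continuous_fejerKernel T).aestronglyMeasurable (Eventually.of_forall fun v => ?_)
  rw [Real.norm_of_nonneg (fejerKernel_nonneg hT v)]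
  exact fejerKernel_le hT v

lemma integral_fejerKernel_le {T : ℝ} (hT : 0 < T) : ∫ v, fejerKernel T v ≤ 2 := by
  have h2 : T / 2 ≠ 0 := by positivity
  have h := integral_mono (integrable_fejerKernel hT)
    ((integrable_inv_one_add_sq.comp_mul_left' h2).const_mul (T / π)) (fejerKernel_le hT)
  refine h.trans (le_of_eq ?_)
  rw [integral_const_mul, Measure.integral_comp_mul_left (fun x : ℝ => (1 + x ^ 2)⁻¹),
    integral_univ_inv_one_add_sq, abs_of_pos (by positivity), smul_eq_mul]
  field_simp

lemma exists_fejerKernel_le {T : ℝ} (hT : 0 < T) :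
    ∃ K, 0 < K ∧ ∀ v, fejerKernel T v ≤ K * (1 + v ^ 2)⁻¹ := by
  refine ⟨T / π * (1 + 4 / T ^ 2), by positivity, fun v => (fejerKernel_le hT v).trans ?_⟩
  rw [mul_assoc]
  refine mul_le_mul_of_nonneg_left ?_ (by positivity)
  rw [← div_eq_mul_inv, ← one_div, div_le_div_iff₀ (by positivity) (by positivity)]
  have : (1 + 4 / T ^ 2) * (1 + (T / 2 * v) ^ 2) = 1 + v ^ 2 + 4 / T ^ 2 + (T / 2 * v) ^ 2 := by
    field_simp; ring
  rw [this, one_mul]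
  have : 0 ≤ 4 / T ^ 2 := by positivity
  nlinarith [sq_nonneg (T / 2 * v)]

lemma integral_one_sub_div_mul_cos {T : ℝ} (hT : 0 < T) (v : ℝ) :
    ∫ t in (0 : ℝ)..T, (1 - t / T) * Real.cos (t * v) = π * fejerKernel T v := by
  by_cases hv : v = 0
  · subst hv
    have hd : ∀ t ∈ uIcc 0 T, HasDerivAt (fun t : ℝ => t - t ^ 2 / (2 * T)) ((1 - t / T) * Real.cos (t * 0)) t := by
      intro t _
      have := (hasDerivAt_id t).sub (((hasDerivAt_id t).pow 2).div_const (2 * T))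
      refine this.congr_deriv ?_
      simp; field_simp
    rw [intervalIntegral.integral_eq_sub_of_hasDerivAt hd (Continuous.intervalIntegrable (by fun_prop) _ _)]
    simp [fejerKernel]
    field_simp
    norm_num
  · have hd : ∀ t ∈ uIcc 0 T, HasDerivAt
        (fun t : ℝ => (1 - t / T) * Real.sin (t * v) / v - Real.cos (t * v) / (T * v ^ 2))
        ((1 - t / T) * Real.cos (t * v)) t := by
      intro t _
      have h1 : HasDerivAt (fun t : ℝ => t * v) v t := by simpa using (hasDerivAt_id t).mul_const v
      have h2 : HasDerivAt (fun t : ℝ => 1 - t / T) (-(1 / T)) t := by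
        simpa using ((hasDerivAt_id t).div_const T).const_sub 1
      refine (((h2.mul h1.sin).div_const v).sub (h1.cos.div_const (T * v ^ 2))).congr_deriv ?_
      field_simp
      ring
    rw [intervalIntegral.integral_eq_sub_of_hasDerivAt hd (Continuous.intervalIntegrable (by fun_prop) _ _)]
    have hs : Real.cos (T * v) = 1 - 2 * Real.sin (T * v / 2) ^ 2 := by
      have := Real.cos_sq' (T * v / 2)
      have h2 := Real.cos_two_mul (T * v / 2)
      rw [show 2 * (T * v / 2) = T * v by ring] at h2
      linarith
    simp only [fejerKernel]
    rw [Real.sinc_of_ne_zero (by positivity), hs]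
    simp
    field_simp
    ring

lemma integral_fejerWeight_mul_cexp {T : ℝ} (hT : 0 < T) (v : ℝ) :
    ∫ t in Icc (-T) T, (fejerWeight T t : ℂ) * Complex.exp (t * v * Complex.I) = 2 * π * fejerKernel T v := by
  have hc : Continuous fun t : ℝ => (fejerWeight T t : ℂ) * Complex.exp (t * v * Complex.I) := by
    have := continuous_fejerWeight T
    fun_prop
  rw [integral_Icc_eq_integral_Ioc, ← intervalIntegral.integral_of_le (by linarith),
    ← intervalIntegral.integral_add_adjacent_intervals (hc.intervalIntegrable (-T) 0)
      (hc.intervalIntegrable 0 T)]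
  have h1 := intervalIntegral.integral_comp_neg (a := 0) (b := T)
    (fun t : ℝ => (fejerWeight T t : ℂ) * Complex.exp (t * v * Complex.I))
  rw [neg_zero] at h1
  have hc' : Continuous fun t : ℝ =>
      (fejerWeight T (-t) : ℂ) * Complex.exp (((-t : ℝ) : ℂ) * v * Complex.I) := hc.comp continuous_neg
  rw [← h1, ← intervalIntegral.integral_add (hc'.intervalIntegrable 0 T) (hc.intervalIntegrable 0 T)]
  have h2 : ∀ t ∈ uIcc 0 T, (fejerWeight T (-t) : ℂ) * Complex.exp (((-t : ℝ) : ℂ) * v * Complex.I) +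
      (fejerWeight T t : ℂ) * Complex.exp (t * v * Complex.I) =
      ((2 * ((1 - t / T) * Real.cos (t * v)) : ℝ) : ℂ) := by
    intro t ht
    rw [uIcc_of_le hT.le] at ht
    have ht1 : |t| ≤ T := abs_le.2 ⟨by linarith [ht.1], ht.2⟩
    rw [fejerWeight_eq hT (by rwa [abs_neg]), fejerWeight_eq hT ht1, abs_neg, abs_of_nonneg ht.1]
    push_cast
    rw [Complex.cos]
    simp only [neg_mul]
    ring
  rw [intervalIntegral.integral_congr h2, intervalIntegral.integral_ofReal,
    intervalIntegral.integral_const_mul, integral_one_sub_div_mul_cos hT]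
  push_cast; ring

lemma integral_fejerKernel_mul_cexp {T : ℝ} (hT : 0 < T) (γ : ℝ) :
    ∫ x, (fejerKernel T x : ℂ) * Complex.exp (γ * x * Complex.I) = fejerWeight T γ := by
  set F : ℝ → ℂ := fun t => (fejerWeight T t : ℂ) with hF
  have hFc : Continuous F := by have := continuous_fejerWeight T; fun_prop
  have hsupp : ∀ t, t ∉ Icc (-T) T → F t = 0 := fun t ht => by simp [hF, fejerWeight_eq_zero hT ht]
  have hFi : Integrable F := by
    refine (integrableOn_iff_integrable_of_support_subset (s := Icc (-T) T) ?_).1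
      (hFc.continuousOn.integrableOn_compact isCompact_Icc)
    intro t ht
    by_contra h
    exact ht (hsupp t h)
  have hk : ∀ v : ℝ, ∫ t, F t * Complex.exp (t * v * Complex.I) = 2 * π * fejerKernel T v := by
    intro v
    rw [← integral_fejerWeight_mul_cexp hT, setIntegral_eq_integral_of_forall_compl_eq_zero]
    intro t ht
    have := hsupp t ht
    simp only [hF] at this
    rw [this, zero_mul]
  have hfou : ∀ ξ : ℝ, FourierTransform.fourier F ξ = 2 * π * fejerKernel T (2 * π * ξ) := by
    intro ξ
    rw [Real.fourier_eq']
    have hev : fejerKernel T (2 * π * ξ) = fejerKernel T (-(2 * π * ξ)) := by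
      simp [fejerKernel, neg_div, mul_neg, Real.sinc_neg]
    rw [hev, ← hk]
    congr 1
    funext t
    rw [smul_eq_mul, mul_comm]
    congr 2
    simp
    ring
  have hFfi : Integrable (FourierTransform.fourier F) := by
    have h1 := ((integrable_fejerKernel hT).comp_mul_left' (show 2 * π ≠ 0 by positivity)).ofReal (𝕜 := ℂ)
    refine (h1.const_mul (2 * π)).congr (Eventually.of_forall fun ξ => ?_)
    simp only [hfou]
    rfl
  have hinv := congrFun (Continuous.fourierInv_fourier_eq hFc hFi hFfi) γ
  rw [Real.fourierInv_eq'] at hinv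
  have e1 := Measure.integral_comp_mul_left
    (fun x : ℝ => (fejerKernel T x : ℂ) * Complex.exp (γ * x * Complex.I)) (2 * π)
  rw [abs_of_pos (by positivity)] at e1
  have e2 : ∫ x, (fejerKernel T x : ℂ) * Complex.exp (γ * x * Complex.I) =
      (2 * π : ℝ) • ∫ ξ : ℝ, (fejerKernel T (2 * π * ξ) : ℂ) *
        Complex.exp (γ * ((2 * π * ξ : ℝ) : ℂ) * Complex.I) := by
    rw [e1, smul_smul, mul_inv_cancel₀ (by positivity), one_smul]
  rw [e2, show (fejerWeight T γ : ℂ) = F γ from rfl, ← hinv, Complex.real_smul, ← integral_const_mul]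
  congr 1
  funext ξ
  rw [hfou, smul_eq_mul]
  have : Complex.exp (γ * ((2 * π * ξ : ℝ) : ℂ) * Complex.I) =
      Complex.exp (((2 * π * inner ℝ ξ γ : ℝ) : ℂ) * Complex.I) := by
    congr 1
    simp
    ring
  rw [this]
  push_cast
  ring

end FejerKernel

section MeanSquare

open scoped Topology

/-- `f` is measurable with mean square at most `C` over the intervals `(0, Y]`. -/
structure MeanSquareBounded (f : ℝ → ℝ) (C : ℝ) : Prop where
  measurable : Measurable f
  integrableOn_sq : ∀ Y, IntegrableOn (fun y => f y ^ 2) (Ioc 0 Y)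
  integral_sq_le : ∀ Y, 1 ≤ Y → ∫ y in Ioc 0 Y, f y ^ 2 ≤ C * Y

lemma MeanSquareBounded.neg {f : ℝ → ℝ} {C : ℝ} (h : MeanSquareBounded f C) :
    MeanSquareBounded (fun y => -f y) C where
  measurable := h.measurable.neg
  integrableOn_sq := by simpa using h.integrableOn_sq
  integral_sq_le := by simpa using h.integral_sq_le

lemma exists_meanSquareBounded_scaledErr (hRH : RiemannHypothesis) :
    ∃ C, 0 < C ∧ MeanSquareBounded scaledErr C := by
  obtain ⟨C, hC, h⟩ := exists_integral_scaledErr_sq_le hRH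
  exact ⟨C, hC, measurable_scaledErr, integrableOn_scaledErr_sq, h⟩

lemma integrableOn_mul_inv_one_add_sq {g : ℝ → ℝ} {C : ℝ} (hg : ∀ v, 0 ≤ g v)
    (hi : ∀ Y, IntegrableOn g (Ioc 0 Y)) (hC : ∀ Y, 1 ≤ Y → ∫ y in Ioc 0 Y, g y ≤ C * Y) :
    IntegrableOn (fun v => g v * (1 + v ^ 2)⁻¹) (Ioi 0) := by
  have hcont : Continuous fun v : ℝ => (1 + v ^ 2)⁻¹ :=
    (by fun_prop : Continuous fun x : ℝ => 1 + x ^ 2).inv₀ (fun x => by positivity)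
  have hC0 : 0 ≤ C := by
    have := hC 1 le_rfl
    have h2 : 0 ≤ ∫ y in Ioc 0 1, g y := integral_nonneg hg
    linarith
  have hi2 : ∀ Y, IntegrableOn (fun v => g v * (1 + v ^ 2)⁻¹) (Ioc 0 Y) := by
    intro Y
    refine (hi Y).mul_bdd (c := 1) hcont.aestronglyMeasurable (Eventually.of_forall fun v => ?_)
    rw [Real.norm_of_nonneg (by positivity)]
    exact inv_le_one_of_one_le₀ (by nlinarith [sq_nonneg v])
  refine integrableOn_Ioi_of_intervalIntegral_norm_bounded (l := atTop) (b := fun n : ℕ => (2 : ℝ) ^ n)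
    (C + 4 * C) 0 (fun n => hi2 _) (tendsto_pow_atTop_atTop_of_one_lt (by norm_num)) ?_
  have hdyadic : ∀ n : ℕ, ∫ v in Ioc 0 ((2 : ℝ) ^ n), g v * (1 + v ^ 2)⁻¹ ≤
      C + 4 * C * (1 - (1 / 2) ^ n) := by
    intro n
    induction n with
    | zero =>
      have h1 := hC 1 le_rfl
      have h2 : ∫ v in Ioc (0 : ℝ) 1, g v * (1 + v ^ 2)⁻¹ ≤ ∫ v in Ioc (0 : ℝ) 1, g v := by
        refine integral_mono (hi2 1) (hi 1) fun v => ?_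
        exact mul_le_of_le_one_right (hg v) (inv_le_one_of_one_le₀ (by nlinarith [sq_nonneg v]))
      simp
      linarith
    | succ n ih =>
      have h0 : (0 : ℝ) < 2 ^ n := by positivity
      have hle : (2 : ℝ) ^ n ≤ 2 ^ (n + 1) := by gcongr; norm_num; omega
      have hsplit : Ioc (0 : ℝ) (2 ^ (n + 1)) = Ioc 0 (2 ^ n) ∪ Ioc (2 ^ n) (2 ^ (n + 1)) :=
        (Ioc_union_Ioc_eq_Ioc h0.le hle).symm
      have hsub : Ioc ((2 : ℝ) ^ n) (2 ^ (n + 1)) ⊆ Ioc 0 (2 ^ (n + 1)) := Ioc_subset_Ioc_left h0.le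
      rw [hsplit, setIntegral_union (Ioc_disjoint_Ioc_of_le le_rfl) measurableSet_Ioc (hi2 _)
        ((hi2 _).mono_set hsub)]
      have h1 : ∫ v in Ioc ((2 : ℝ) ^ n) (2 ^ (n + 1)), g v * (1 + v ^ 2)⁻¹ ≤
          ∫ v in Ioc ((2 : ℝ) ^ n) (2 ^ (n + 1)), (1 / 4) ^ n * g v := by
        refine setIntegral_mono_on ((hi2 _).mono_set hsub) (((hi _).mono_set hsub).const_mul _)
          measurableSet_Ioc fun v hv => ?_
        rw [mul_comm]
        refine mul_le_mul_of_nonneg_right ?_ (hg v)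
        rw [one_div, inv_pow]
        refine inv_anti₀ (by positivity) ?_
        have h3 : (4 : ℝ) ^ n = (2 ^ n) ^ 2 := by rw [← pow_mul, mul_comm, pow_mul]; norm_num
        rw [h3]
        nlinarith [hv.1]
      have h2 : ∫ v in Ioc ((2 : ℝ) ^ n) (2 ^ (n + 1)), g v ≤ C * 2 ^ (n + 1) := by
        refine le_trans ?_ (hC _ (one_le_pow₀ (by norm_num)))
        exact setIntegral_mono_set (hi _) (Eventually.of_forall hg) hsub.eventuallyLE
      rw [integral_const_mul] at h1
      have h3 : (1 / 4 : ℝ) ^ n * (C * 2 ^ (n + 1)) = 4 * C * ((1 / 2) ^ n - (1 / 2) ^ (n + 1)) := by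
        have : (1 / 4 : ℝ) ^ n * 2 ^ n = (1 / 2) ^ n := by rw [← mul_pow]; norm_num
        rw [pow_succ, pow_succ]
        linear_combination 2 * C * this
      have h4 := mul_le_mul_of_nonneg_left h2 (by positivity : (0 : ℝ) ≤ (1 / 4) ^ n)
      linarith
  refine Eventually.of_forall fun n => ?_
  rw [intervalIntegral.integral_of_le (by positivity)]
  have h1 : ∀ v, ‖g v * (1 + v ^ 2)⁻¹‖ = g v * (1 + v ^ 2)⁻¹ := fun v =>
    Real.norm_of_nonneg (mul_nonneg (hg v) (by positivity))
  simp only [h1]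
  refine (hdyadic n).trans ?_
  have : (0 : ℝ) ≤ (1 / 2) ^ n := by positivity
  nlinarith

lemma MeanSquareBounded.integrableOn_abs_mul_inv {f : ℝ → ℝ} {C : ℝ} (h : MeanSquareBounded f C) :
    IntegrableOn (fun v => |f v| * (1 + v ^ 2)⁻¹) (Ioi 0) := by
  have h1 := integrableOn_mul_inv_one_add_sq (fun v => sq_nonneg (f v)) h.integrableOn_sq h.integral_sq_le
  have h2 : IntegrableOn (fun v : ℝ => (1 + v ^ 2)⁻¹) (Ioi 0) := integrable_inv_one_add_sq.integrableOn
  have hcont : Continuous fun v : ℝ => (1 + v ^ 2)⁻¹ :=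
    (by fun_prop : Continuous fun x : ℝ => 1 + x ^ 2).inv₀ (fun x => by positivity)
  refine Integrable.mono' (h1.add h2)
    ((h.measurable.norm.mul hcont.measurable).aestronglyMeasurable) (Eventually.of_forall fun v => ?_)
  rw [Real.norm_of_nonneg (by positivity)]
  have h3 : |f v| ≤ f v ^ 2 + 1 := by nlinarith [sq_abs (f v), sq_nonneg (|f v| - 1), abs_nonneg (f v)]
  calc |f v| * (1 + v ^ 2)⁻¹ ≤ (f v ^ 2 + 1) * (1 + v ^ 2)⁻¹ :=
        mul_le_mul_of_nonneg_right h3 (by positivity)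
    _ = _ := by simp only [Pi.add_apply]; ring

lemma inv_one_add_sub_sq_le (y v : ℝ) :
    (1 + (y - v) ^ 2)⁻¹ ≤ 2 * (1 + y ^ 2) * (1 + v ^ 2)⁻¹ := by
  rw [← div_eq_mul_inv, ← one_div, div_le_div_iff₀ (by positivity) (by positivity)]
  nlinarith [sq_nonneg (y - v), sq_nonneg (2 * y - v), sq_nonneg (y * (y - v)), sq_nonneg y]

lemma fejerKernel_sub_le {T : ℝ} (hT : 0 < T) (y : ℝ) :
    ∃ K, 0 < K ∧ ∀ v, fejerKernel T (y - v) ≤ K * (1 + v ^ 2)⁻¹ := by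
  obtain ⟨K, hK, h⟩ := exists_fejerKernel_le hT
  refine ⟨K * (2 * (1 + y ^ 2)), by positivity, fun v => (h _).trans ?_⟩
  rw [mul_assoc]
  exact mul_le_mul_of_nonneg_left (inv_one_add_sub_sq_le y v) hK.le

lemma MeanSquareBounded.integrableOn_mul_fejerKernel {f : ℝ → ℝ} {C T : ℝ}
    (h : MeanSquareBounded f C) (hT : 0 < T) (y : ℝ) :
    IntegrableOn (fun v => f v * fejerKernel T (y - v)) (Ioi 0) := by
  obtain ⟨K, hK, hle⟩ := fejerKernel_sub_le hT y
  have hc := continuous_fejerKernel T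
  refine Integrable.mono' (h.integrableOn_abs_mul_inv.const_mul K)
    (h.measurable.mul (by fun_prop : Continuous fun v => fejerKernel T (y - v)).measurable).aestronglyMeasurable
    (Eventually.of_forall fun v => ?_)
  rw [norm_mul, Real.norm_of_nonneg (fejerKernel_nonneg hT _), Real.norm_eq_abs]
  calc _ ≤ |f v| * (K * (1 + v ^ 2)⁻¹) := mul_le_mul_of_nonneg_left (hle v) (abs_nonneg _)
    _ = _ := by ring

end MeanSquare

section ConvolutionAsymptotics

open scoped Topology

lemma integral_fejerWeight_mul_laplace {T σ : ℝ} (hT : 0 < T) {g : ℝ → ℂ}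
    (hg : IntegrableOn (fun v => g v * Complex.exp (-σ * v)) (Ioi 0)) (y : ℝ) :
    ∫ t in Icc (-T) T, fejerWeight T t * Complex.exp (t * y * Complex.I) *
        ∫ v in Ioi (0 : ℝ), g v * Complex.exp (-(σ + t * Complex.I) * v) =
      2 * π * ∫ v in Ioi (0 : ℝ), g v * Complex.exp (-σ * v) * fejerKernel T (y - v) := by
  have hwc : Continuous fun t : ℝ => (fejerWeight T t : ℂ) := by
    have := continuous_fejerWeight T
    fun_prop
  have hwi : IntegrableOn (fun t : ℝ => (fejerWeight T t : ℂ)) (Icc (-T) T) :=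
    hwc.continuousOn.integrableOn_compact isCompact_Icc
  have hprod := Integrable.mul_prod hwi hg
  have hprod2 : Integrable (Function.uncurry fun (t v : ℝ) =>
      Complex.exp (t * (y - v) * Complex.I) *
        ((fejerWeight T t : ℂ) * (g v * Complex.exp (-σ * v))))
      ((volume.restrict (Icc (-T) T)).prod (volume.restrict (Ioi 0))) := by
    refine Integrable.bdd_mul (c := 1) hprod
      (by fun_prop : Continuous fun z : ℝ × ℝ =>
        Complex.exp (z.1 * (y - z.2) * Complex.I)).aestronglyMeasurable
      (Eventually.of_forall fun z => ?_)
    have : (z.1 * (y - z.2) * Complex.I : ℂ) = ((z.1 * (y - z.2) : ℝ) : ℂ) * Complex.I := by push_cast; ring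
    rw [this, Complex.norm_exp_ofReal_mul_I]
  have hswap := integral_integral_swap hprod2
  have e1 : ∀ t : ℝ, fejerWeight T t * Complex.exp (t * y * Complex.I) *
        ∫ v in Ioi (0 : ℝ), g v * Complex.exp (-(σ + t * Complex.I) * v) =
      ∫ v in Ioi (0 : ℝ), Complex.exp (t * (y - v) * Complex.I) *
        ((fejerWeight T t : ℂ) * (g v * Complex.exp (-σ * v))) := by
    intro t
    rw [← integral_const_mul]
    congr 1
    funext v
    have h1 : Complex.exp (-(σ + t * Complex.I) * v) =
        Complex.exp (-σ * v) * Complex.exp (-(t * v) * Complex.I) := by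
      rw [← Complex.exp_add]; congr 1; ring
    have h2 : Complex.exp (t * (y - v) * Complex.I) =
        Complex.exp (t * y * Complex.I) * Complex.exp (-(t * v) * Complex.I) := by
      rw [← Complex.exp_add]; congr 1; ring
    rw [h1, h2]; ring
  simp_rw [e1]
  rw [hswap, ← integral_const_mul]
  congr 1
  funext v
  have h3 := integral_fejerWeight_mul_cexp hT (y - v)
  have h4 : ∫ t in Icc (-T) T, Complex.exp (t * (y - v) * Complex.I) *
      ((fejerWeight T t : ℂ) * (g v * Complex.exp (-σ * v))) =
      (∫ t in Icc (-T) T, (fejerWeight T t : ℂ) * Complex.exp (t * ((y - v : ℝ) : ℂ) * Complex.I)) *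
        (g v * Complex.exp (-σ * v)) := by
    rw [← integral_mul_const]
    congr 1
    funext t
    push_cast
    ring
  rw [h4, h3]
  ring

lemma tendsto_integral_mul_cexp_atTop {T : ℝ} (φ : ℝ → ℂ) :
    Tendsto (fun y : ℝ => ∫ t in Icc (-T) T, φ t * Complex.exp (t * y * Complex.I)) atTop (𝓝 0) := by
  have h := Real.tendsto_integral_exp_smul_cocompact ((Icc (-T) T).indicator φ)
  have h2 : Tendsto (fun y : ℝ => -(y / (2 * π))) atTop (cocompact ℝ) := by
    rw [cocompact_eq_atBot_atTop]
    refine Tendsto.mono_right ?_ le_sup_left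
    exact tendsto_neg_atTop_atBot.comp (tendsto_id.atTop_div_const (by positivity))
  refine (h.comp h2).congr fun y => ?_
  simp only [Function.comp_apply]
  rw [← integral_indicator measurableSet_Icc]
  congr 1
  funext t
  by_cases ht : t ∈ Icc (-T) T
  · rw [indicator_of_mem ht, indicator_of_mem ht, Circle.smul_def, Real.fourierChar_apply, smul_eq_mul,
      mul_comm]
    congr 2
    have : 2 * π * -(t * -(y / (2 * π))) = t * y := by field_simp
    rw [this]
    push_cast
    rfl
  · rw [indicator_of_notMem ht, indicator_of_notMem ht, smul_zero]

lemma integral_cexp_Ioi_zero {w : ℂ} (hw : 0 < w.re) :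
    ∫ v in Ioi (0 : ℝ), Complex.exp (-w * v) = w⁻¹ := by
  rw [integral_exp_mul_complex_Ioi (by simpa using hw)]
  simp

lemma tendsto_integral_cexp_mul_fejerKernel {T : ℝ} (hT : 0 < T) (γ : ℝ) :
    Tendsto (fun y : ℝ => (∫ v in Ioi (0 : ℝ), Complex.exp (γ * v * Complex.I) * fejerKernel T (y - v)) -
      fejerWeight T γ * Complex.exp (γ * y * Complex.I)) atTop (𝓝 0) := by
  have hkint := integrable_fejerKernel hT
  have hneg : ∀ x, fejerKernel T (-x) = fejerKernel T x := fun x => by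
    simp [fejerKernel, neg_div, mul_neg, Real.sinc_neg]
  have h_int : Integrable fun x : ℝ => (fejerKernel T x : ℂ) * Complex.exp (γ * x * Complex.I) := by
    refine hkint.ofReal.mul_bdd (c := 1)
      (by fun_prop : Continuous fun x : ℝ => Complex.exp (γ * x * Complex.I)).aestronglyMeasurable
      (Eventually.of_forall fun x => ?_)
    have : (γ * x * Complex.I : ℂ) = ((γ * x : ℝ) : ℂ) * Complex.I := by push_cast; ring
    rw [this, Complex.norm_exp_ofReal_mul_I]
  have e1 : ∀ y : ℝ, ∫ v in Ioi (0 : ℝ), Complex.exp (γ * v * Complex.I) * fejerKernel T (y - v) =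
      Complex.exp (γ * y * Complex.I) *
        ∫ x in Ioi (-y), (fejerKernel T x : ℂ) * Complex.exp (γ * x * Complex.I) := by
    intro y
    rw [← integral_const_mul, ← integral_indicator measurableSet_Ioi,
      ← integral_indicator measurableSet_Ioi, ← integral_add_right_eq_self _ y]
    congr 1
    funext x
    by_cases hx : x ∈ Ioi (-y)
    · have hx2 : x + y ∈ Ioi (0 : ℝ) := by simp only [mem_Ioi] at hx ⊢; linarith
      rw [indicator_of_mem hx, indicator_of_mem hx2, show y - (x + y) = -x by ring, hneg,
        show (γ * ((x + y : ℝ) : ℂ) * Complex.I) = γ * y * Complex.I + γ * x * Complex.I by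
          push_cast; ring, Complex.exp_add]
      ring
    · have hx2 : x + y ∉ Ioi (0 : ℝ) := by simp only [mem_Ioi] at hx ⊢; linarith
      rw [indicator_of_notMem hx, indicator_of_notMem hx2]
  have hlim := ((aecover_Ioi (μ := volume) (tendsto_neg_atTop_atBot (G := ℝ))).integral_tendsto_of_countably_generated
    h_int).sub_const (fejerWeight T γ : ℂ)
  rw [integral_fejerKernel_mul_cexp hT, sub_self] at hlim
  rw [tendsto_zero_iff_norm_tendsto_zero] at hlim ⊢
  refine hlim.congr fun y => ?_
  rw [e1 y, mul_comm (fejerWeight T γ : ℂ), ← mul_sub, norm_mul]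
  have : (γ * y * Complex.I : ℂ) = ((γ * y : ℝ) : ℂ) * Complex.I := by push_cast; ring
  rw [this, Complex.norm_exp_ofReal_mul_I, one_mul]

/-- The almost periodic main term of the smoothed error. -/
noncomputable def smoothedMainTerm (T : ℝ) (S : Finset ℝ) (m : ℝ → ℝ) (y : ℝ) : ℂ :=
  ∑ γ ∈ S, (m γ / (1 / 2 - γ * Complex.I)) * (fejerWeight T γ * Complex.exp (γ * y * Complex.I))

lemma tendsto_integral_scaledErr_mul_fejerKernel (hRH : RiemannHypothesis) {T : ℝ} (hT : 0 < T)
    {S : Finset ℝ} {m : ℝ → ℝ} {H : ℂ → ℂ} (hH : ContinuousOn H (boundaryBox T))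
    (hG : ∀ s ∈ boundaryBox T, 0 < s.re → mertensTransform s =
      ∑ γ ∈ S, m γ / (1 / 2 - γ * Complex.I) * (s - γ * Complex.I)⁻¹ + H s) :
    Tendsto (fun y : ℝ => (∫ v in Ioi (0 : ℝ), scaledErr v * fejerKernel T (y - v)) -
      (smoothedMainTerm T S m y).re) atTop (𝓝 0) := by
  obtain ⟨C, hC, hms⟩ := exists_meanSquareBounded_scaledErr hRH
  set a : ℝ → ℂ := fun γ => m γ / (1 / 2 - γ * Complex.I) with ha
  set p : ℝ → ℂ := fun v => ∑ γ ∈ S, a γ * Complex.exp (γ * v * Complex.I) with hp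
  have hpc : Continuous p := by fun_prop
  have hunit : ∀ γ v : ℝ, ‖Complex.exp (γ * v * Complex.I)‖ = 1 := by
    intro γ v
    have : (γ * v * Complex.I : ℂ) = ((γ * v : ℝ) : ℂ) * Complex.I := by push_cast; ring
    rw [this, Complex.norm_exp_ofReal_mul_I]
  set g : ℝ → ℂ := fun v => scaledErr v - p v with hg
  -- the smoothed identity for `σ > 0`
  have hkc := continuous_fejerKernel T
  have hki : ∀ y, Integrable fun v => fejerKernel T (y - v) := fun y =>
    (integrable_fejerKernel hT).comp_sub_left y
  have hik : ∀ y, IntegrableOn (fun v => (scaledErr v : ℂ) * fejerKernel T (y - v)) (Ioi 0) := by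
    intro y
    refine (hms.integrableOn_mul_fejerKernel hT y).ofReal (𝕜 := ℂ) |>.congr
      (Eventually.of_forall fun v => ?_)
    simp
  have hikγ : ∀ γ y : ℝ, IntegrableOn (fun v : ℝ => Complex.exp (γ * v * Complex.I) * fejerKernel T (y - v))
      (Ioi 0) := by
    intro γ y
    exact ((hki y).ofReal.bdd_mul (c := 1) (by fun_prop : Continuous fun v : ℝ =>
      Complex.exp (γ * v * Complex.I)).aestronglyMeasurable
      (Eventually.of_forall fun v => (hunit γ v).le)).integrableOn
  have hpk : ∀ y v : ℝ, p v * fejerKernel T (y - v) =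
      ∑ γ ∈ S, a γ * (Complex.exp (γ * v * Complex.I) * fejerKernel T (y - v)) := by
    intro y v
    rw [hp, Finset.sum_mul]
    exact Finset.sum_congr rfl fun γ _ => by ring
  have hikp : ∀ y, IntegrableOn (fun v => p v * fejerKernel T (y - v)) (Ioi 0) := by
    intro y
    simp_rw [hpk]
    exact integrable_finsetSum _ fun γ _ => (hikγ γ y).const_mul _
  have hikg : ∀ y, IntegrableOn (fun v => g v * fejerKernel T (y - v)) (Ioi 0) := by
    intro y
    refine ((hik y).sub (hikp y)).congr (Eventually.of_forall fun v => ?_)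
    simp only [hg, Pi.sub_apply]; ring
  have hlap : ∀ σ t : ℝ, 0 < σ →
      IntegrableOn (fun v => g v * Complex.exp (-(σ + t * Complex.I) * v)) (Ioi 0) ∧
      ∫ v in Ioi (0 : ℝ), g v * Complex.exp (-(σ + t * Complex.I) * v) =
        mertensTransform (σ + t * Complex.I) -
          ∑ γ ∈ S, a γ * (σ + t * Complex.I - γ * Complex.I)⁻¹ := by
    intro σ t hσ
    have i1 : IntegrableOn (fun v => (scaledErr v : ℂ) * Complex.exp (-(σ + t * Complex.I) * v)) (Ioi 0) := by
      have h := integrableOn_abs_scaledErr_mul_exp hRH hσ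
      refine Integrable.mono' h ?_ (Eventually.of_forall fun v => ?_)
      · exact (measurable_scaledErr.complex_ofReal.mul (by fun_prop : Continuous fun v : ℝ =>
          Complex.exp (-(σ + t * Complex.I) * v)).measurable).aestronglyMeasurable
      · rw [norm_mul, norm_cexp_mul_ofReal, Complex.norm_real, Real.norm_eq_abs]
        simp
    have i2 : ∀ γ : ℝ, IntegrableOn (fun v : ℝ =>
        Complex.exp (-(σ + t * Complex.I - γ * Complex.I) * v)) (Ioi 0) := by
      intro γ
      refine integrableOn_exp_mul_complex_Ioi ?_ 0
      simpa using hσ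
    have e1 : ∀ v : ℝ, g v * Complex.exp (-(σ + t * Complex.I) * v) =
        (scaledErr v : ℂ) * Complex.exp (-(σ + t * Complex.I) * v) -
          ∑ γ ∈ S, a γ * Complex.exp (-(σ + t * Complex.I - γ * Complex.I) * v) := by
      intro v
      simp only [hg, hp]
      rw [sub_mul, Finset.sum_mul]
      congr 1
      refine Finset.sum_congr rfl fun γ _ => ?_
      rw [mul_assoc, ← Complex.exp_add]
      congr 2
      ring
    have i3 : IntegrableOn (fun v : ℝ =>
        ∑ γ ∈ S, a γ * Complex.exp (-(σ + t * Complex.I - γ * Complex.I) * v)) (Ioi 0) :=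
      integrable_finsetSum _ fun γ _ => (i2 γ).const_mul _
    simp_rw [e1]
    refine ⟨i1.sub i3, ?_⟩
    rw [integral_sub i1 i3, integral_scaledErr_mul_cexp_eq_mertensTransform hRH (by simpa using hσ),
      integral_finsetSum _ fun γ _ => (i2 γ).const_mul _]
    congr 1
    refine Finset.sum_congr rfl fun γ _ => ?_
    rw [integral_const_mul, integral_cexp_Ioi_zero (by simpa using hσ)]
  have hsmall : ∀ᶠ σ : ℝ in 𝓝[>] 0, 0 < σ ∧ σ ≤ 1 / 4 :=
    Ioc_mem_nhdsGT (by norm_num : (0 : ℝ) < 1 / 4)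
  have hwc := continuous_fejerWeight T
  have hmain : ∀ y : ℝ, 2 * π * ∫ v in Ioi (0 : ℝ), g v * fejerKernel T (y - v) =
      ∫ t in Icc (-T) T, H (t * Complex.I) * (fejerWeight T t * Complex.exp (t * y * Complex.I)) := by
    intro y
    have l1 := tendsto_integral_boundaryBox hH (φ := fun t : ℝ =>
      (fejerWeight T t : ℂ) * Complex.exp (t * y * Complex.I)) (by fun_prop)
    have l2 : Tendsto (fun σ : ℝ => 2 * π * ∫ v in Ioi (0 : ℝ),
        g v * Complex.exp (-σ * v) * fejerKernel T (y - v)) (𝓝[>] 0)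
        (𝓝 (2 * π * ∫ v in Ioi (0 : ℝ), g v * fejerKernel T (y - v))) := by
      refine Tendsto.const_mul _ ?_
      refine tendsto_integral_filter_of_dominated_convergence
        (fun v => ‖g v * fejerKernel T (y - v)‖) ?_ ?_ (hikg y).norm ?_
      · refine Eventually.of_forall fun σ => ?_
        have h := (hikg y).aestronglyMeasurable.mul ((by fun_prop : Continuous fun v : ℝ =>
          Complex.exp (-σ * v)).aestronglyMeasurable (μ := volume.restrict (Ioi 0)))
        refine h.congr (Eventually.of_forall fun v => ?_)
        simp only [Pi.mul_apply]; ring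
      · filter_upwards [hsmall] with σ hσ
        refine (ae_restrict_iff' measurableSet_Ioi).2 (Eventually.of_forall fun v hv => ?_)
        have hv0 : 0 < v := hv
        have h1 : ‖Complex.exp (-σ * v)‖ ≤ 1 := by
          rw [norm_cexp_mul_ofReal, Real.exp_le_one_iff]
          simp
          nlinarith [hσ.1]
        rw [norm_mul, norm_mul, norm_mul]
        have h2 := mul_le_mul_of_nonneg_left h1 (norm_nonneg (g v))
        rw [mul_one] at h2
        exact mul_le_mul_of_nonneg_right h2 (norm_nonneg _)
      · refine Eventually.of_forall fun v => ?_
        have : Continuous fun σ : ℝ => g v * Complex.exp (-σ * v) * fejerKernel T (y - v) := by fun_prop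
        have h := this.tendsto 0
        simp only [Complex.ofReal_zero, neg_zero, zero_mul, Complex.exp_zero, mul_one] at h
        exact h.mono_left nhdsWithin_le_nhds
    refine tendsto_nhds_unique l2 (l1.congr' ?_)
    filter_upwards [hsmall] with σ hσ
    have h0 := (hlap σ 0 hσ.1).1
    simp only [Complex.ofReal_zero, zero_mul, add_zero] at h0
    rw [← integral_fejerWeight_mul_laplace hT h0 y]
    refine setIntegral_congr_fun measurableSet_Icc fun t ht => ?_
    rw [(hlap σ t hσ.1).2, hG _ (mem_boundaryBox hσ.1.le hσ.2 ht) (by simpa using hσ.1)]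
    simp only [ha]
    ring
  have hlim1 : Tendsto (fun y : ℝ => ∫ v in Ioi (0 : ℝ), g v * fejerKernel T (y - v)) atTop (𝓝 0) := by
    have h := (tendsto_integral_mul_cexp_atTop (T := T)
      (fun t : ℝ => H (t * Complex.I) * fejerWeight T t)).const_mul ((2 * π : ℂ)⁻¹)
    rw [mul_zero] at h
    refine h.congr fun y => ?_
    have h2 := hmain y
    have hpi : (2 * π : ℂ) ≠ 0 := by
      simp [pi_ne_zero]
    rw [inv_mul_eq_iff_eq_mul₀ hpi, h2]
    congr 1
    funext t
    ring
  have hlim2 : Tendsto (fun y : ℝ => ∑ γ ∈ S, a γ *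
      ((∫ v in Ioi (0 : ℝ), Complex.exp (γ * v * Complex.I) * fejerKernel T (y - v)) -
        fejerWeight T γ * Complex.exp (γ * y * Complex.I))) atTop (𝓝 0) := by
    have h := tendsto_finsetSum S fun γ _ => (tendsto_integral_cexp_mul_fejerKernel hT γ).const_mul (a γ)
    simpa using h
  have hlim := (Complex.continuous_re.tendsto _).comp (hlim1.add hlim2)
  simp only [add_zero, Complex.zero_re] at hlim
  refine hlim.congr fun y => ?_
  simp only [Function.comp_apply]
  have e2 : ∫ v in Ioi (0 : ℝ), g v * fejerKernel T (y - v) =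
      (∫ v in Ioi (0 : ℝ), (scaledErr v : ℂ) * fejerKernel T (y - v)) -
        ∑ γ ∈ S, a γ * ∫ v in Ioi (0 : ℝ), Complex.exp (γ * v * Complex.I) * fejerKernel T (y - v) := by
    have : ∀ v, g v * fejerKernel T (y - v) = (scaledErr v : ℂ) * fejerKernel T (y - v) -
        p v * fejerKernel T (y - v) := fun v => by simp only [hg]; ring
    simp_rw [this]
    rw [integral_sub (hik y) (hikp y)]
    congr 1
    simp_rw [hpk]
    rw [integral_finsetSum _ fun γ _ => (hikγ γ y).const_mul _]
    simp_rw [integral_const_mul]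
  have e3 : ∫ v in Ioi (0 : ℝ), (scaledErr v : ℂ) * fejerKernel T (y - v) =
      ((∫ v in Ioi (0 : ℝ), scaledErr v * fejerKernel T (y - v) : ℝ) : ℂ) := by
    rw [← integral_complex_ofReal]
    simp
  have e4 : (∫ v in Ioi (0 : ℝ), g v * fejerKernel T (y - v)) + ∑ γ ∈ S, a γ *
      ((∫ v in Ioi (0 : ℝ), Complex.exp (γ * v * Complex.I) * fejerKernel T (y - v)) -
        fejerWeight T γ * Complex.exp (γ * y * Complex.I)) =
      ((∫ v in Ioi (0 : ℝ), scaledErr v * fejerKernel T (y - v) : ℝ) : ℂ) - smoothedMainTerm T S m y := by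
    rw [e2, e3, smoothedMainTerm]
    simp_rw [mul_sub]
    rw [Finset.sum_sub_distrib]
    simp only [ha]
    ring
  rw [e4, Complex.sub_re, Complex.ofReal_re]

end ConvolutionAsymptotics

section LargeValues

open scoped Topology

lemma re_smoothedMainTerm (T : ℝ) (S : Finset ℝ) (m : ℝ → ℝ) (y : ℝ) :
    (smoothedMainTerm T S m y).re = ∑ γ ∈ S, m γ * (fejerWeight T γ *
      (Real.cos (γ * y) / 2 - γ * Real.sin (γ * y)) / (1 / 4 + γ ^ 2)) := by
  rw [smoothedMainTerm, Complex.re_sum]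
  refine Finset.sum_congr rfl fun γ _ => ?_
  have hpos : (0 : ℝ) < 1 / 4 + γ ^ 2 := by positivity
  have hne : (1 / 2 - γ * Complex.I : ℂ) ≠ 0 := by
    intro h
    have := congrArg Complex.re h
    norm_num at this
  have hinv : (m γ : ℂ) / (1 / 2 - γ * Complex.I) =
      ((m γ / (1 / 4 + γ ^ 2) : ℝ) : ℂ) * (1 / 2 + γ * Complex.I) := by
    rw [div_eq_iff hne]
    have h1 : ((1 / 4 + γ ^ 2 : ℝ) : ℂ) ≠ 0 := by exact_mod_cast hpos.ne'
    have h2 : (1 / 2 + γ * Complex.I) * (1 / 2 - γ * Complex.I) = ((1 / 4 + γ ^ 2 : ℝ) : ℂ) := by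
      push_cast
      linear_combination (-(γ : ℂ) ^ 2) * Complex.I_sq
    rw [mul_assoc, h2, Complex.ofReal_div, div_mul_cancel₀ _ h1]
  have hexp : Complex.exp (γ * y * Complex.I) =
      (Real.cos (γ * y) : ℂ) + (Real.sin (γ * y) : ℂ) * Complex.I := by
    have : (γ * y * Complex.I : ℂ) = ((γ * y : ℝ) : ℂ) * Complex.I := by push_cast; ring
    rw [this, Complex.exp_mul_I, Complex.ofReal_cos, Complex.ofReal_sin]
  rw [hinv, hexp]
  simp only [Complex.mul_re, Complex.mul_im, Complex.add_re, Complex.add_im, Complex.ofReal_re,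
    Complex.ofReal_im, Complex.I_re, Complex.I_im]
  norm_num
  field_simp

/-- The main term of the smoothed error takes arbitrarily large values of both signs. -/
lemma exists_smoothedMainTerm_le_and_le (hRH : RiemannHypothesis) (V : ℝ) :
    ∃ (T : ℝ) (S : Finset ℝ) (m : ℝ → ℝ) (H : ℂ → ℂ), 0 < T ∧
      ContinuousOn H (boundaryBox T) ∧
      (∀ s ∈ boundaryBox T, 0 < s.re → mertensTransform s =
        ∑ γ ∈ S, m γ / (1 / 2 - γ * Complex.I) * (s - γ * Complex.I)⁻¹ + H s) ∧
      (∃ y, (smoothedMainTerm T S m y).re ≤ -V) ∧ ∃ y, V ≤ (smoothedMainTerm T S m y).re := by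
  obtain ⟨T, hT, hV⟩ := exists_le_integral_re_logDeriv_centeredXi hRH (π * V)
  obtain ⟨S, m, h, H, hh, hH, h0, hf⟩ := exists_partialFractions hRH T
  have hwc := continuous_fejerWeight T
  have key : ∀ ψ : ℝ → ℝ, Continuous ψ → (∀ t ∉ Icc (-T) T, ψ t = 0) →
      (∀ t, fejerWeight T t * (t * Real.sin (π * t / T) - 1 / 2) / (1 / 4 + t ^ 2) ≤ ψ t) →
      V ≤ ∑ γ ∈ S, m γ * ψ γ := by
    intro ψ hψ hψT hle
    have hlim := tendsto_integral_re_logDeriv_centeredXi hh h0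
      (fun s hs hs0 => (hf s hs hs0).1) hψ hψT
    have hge : π * V ≤ π * ∑ γ ∈ S, m γ * ψ γ := by
      refine ge_of_tendsto hlim ?_
      filter_upwards [Ioc_mem_nhdsGT (by norm_num : (0 : ℝ) < 1 / 4)] with σ hσ
      exact hV ψ hψ hψT hle σ hσ.1 hσ.2
    exact le_of_mul_le_mul_left hge pi_pos
  have hpos : ∀ t : ℝ, 0 < 1 / 4 + t ^ 2 := fun t => by positivity
  have hcont : ∀ ε : ℝ, Continuous fun t => fejerWeight T t *
      (t * Real.sin (π * t / T) + ε * Real.cos (π * t / T) / 2) / (1 / 4 + t ^ 2) := fun ε =>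
    Continuous.div (by fun_prop) (by fun_prop) fun t => (hpos t).ne'
  have hbase : ∀ ε : ℝ, |ε| ≤ 1 → ∀ t : ℝ,
      fejerWeight T t * (t * Real.sin (π * t / T) - 1 / 2) / (1 / 4 + t ^ 2) ≤
      fejerWeight T t * (t * Real.sin (π * t / T) + ε * Real.cos (π * t / T) / 2) /
        (1 / 4 + t ^ 2) := by
    intro ε hε t
    have h1 : |ε * Real.cos (π * t / T)| ≤ 1 := by
      rw [abs_mul]
      exact mul_le_one₀ hε (abs_nonneg _) (Real.abs_cos_le_one _)
    have h2 := (abs_le.1 h1).1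
    have h3 := fejerWeight_nonneg T t
    refine div_le_div_of_nonneg_right (mul_le_mul_of_nonneg_left ?_ h3) (hpos t).le
    linarith
  have hzero : ∀ ε : ℝ, ∀ t ∉ Icc (-T) T, fejerWeight T t *
      (t * Real.sin (π * t / T) + ε * Real.cos (π * t / T) / 2) / (1 / 4 + t ^ 2) = 0 := by
    intro ε t ht
    rw [fejerWeight_eq_zero hT ht, zero_mul, zero_div]
  refine ⟨T, S, m, H, hT, hH, fun s hs hs0 => (hf s hs hs0).2, ⟨π / T, ?_⟩, -(π / T), ?_⟩
  · have h := key _ (hcont (-1)) (hzero (-1)) (hbase (-1) (by simp))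
    rw [re_smoothedMainTerm, le_neg, ← Finset.sum_neg_distrib]
    refine h.trans_eq (Finset.sum_congr rfl fun γ _ => ?_)
    have : γ * (π / T) = π * γ / T := by ring
    rw [this]
    ring
  · have h := key _ (hcont 1) (hzero 1) (hbase 1 (by simp))
    rw [re_smoothedMainTerm]
    refine h.trans_eq (Finset.sum_congr rfl fun γ _ => ?_)
    have : γ * -(π / T) = -(π * γ / T) := by ring
    rw [this, Real.cos_neg, Real.sin_neg]
    ring

end LargeValues

section Recurrence

open scoped Topology

lemma exists_mul_le_measureReal_recurrence (S : Finset ℝ) (c : ℝ → ℂ) :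
    ∃ κ, 0 < κ ∧ ∀ Y : ℝ, 0 < Y → κ * Y ≤ volume.real
      ({τ : ℝ | ∑ γ ∈ S, ‖c γ‖ * ‖Complex.exp (γ * τ * Complex.I) - 1‖ < 1} ∩ Icc 0 Y) := by
  set E : Set ℝ := {τ : ℝ | ∑ γ ∈ S, ‖c γ‖ * ‖Complex.exp (γ * τ * Complex.I) - 1‖ < 1} with hE
  have hEm : MeasurableSet E := by
    refine (isOpen_lt ?_ continuous_const).measurableSet
    fun_prop
  have hunit : ∀ γ v : ℝ, ‖Complex.exp (γ * v * Complex.I)‖ = 1 := by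
    intro γ v
    have : (γ * v * Complex.I : ℂ) = ((γ * v : ℝ) : ℂ) * Complex.I := by push_cast; ring
    rw [this, Complex.norm_exp_ofReal_mul_I]
  have hconj : ∀ γ τ : ℝ, ‖Complex.exp (γ * (-τ : ℝ) * Complex.I) - 1‖ =
      ‖Complex.exp (γ * τ * Complex.I) - 1‖ := by
    intro γ τ
    have h1 : Complex.exp (γ * (-τ : ℝ) * Complex.I) - 1 =
        -(Complex.exp (γ * (-τ : ℝ) * Complex.I) * (Complex.exp (γ * τ * Complex.I) - 1)) := by
      rw [mul_sub, ← Complex.exp_add]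
      have : (γ * (-τ : ℝ) * Complex.I + γ * τ * Complex.I : ℂ) = 0 := by push_cast; ring
      rw [this, Complex.exp_zero]
      ring
    rw [h1, norm_neg, norm_mul, hunit, one_mul]
  have hEneg : ∀ τ, -τ ∈ E ↔ τ ∈ E := by
    intro τ
    simp only [hE, mem_ofPred_eq, hconj]
  set Φ : ℝ → (S → ℂ) := fun y γ => Complex.exp ((γ : ℝ) * y * Complex.I) with hΦ
  have hΦc : Continuous Φ := by
    refine continuous_pi fun γ => ?_
    simp only [hΦ]
    fun_prop
  set A : ℝ := ∑ γ ∈ S, ‖c γ‖ with hA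
  have hA0 : 0 ≤ A := Finset.sum_nonneg fun _ _ => norm_nonneg _
  set ε : ℝ := 1 / (2 * (1 + A)) with hε
  have hεpos : 0 < ε := by positivity
  obtain ⟨t, htfin, ht⟩ := Metric.totallyBounded_iff.1
    (isCompact_closedBall (0 : S → ℂ) 1).totallyBounded ε hεpos
  have hcover : ∀ y, ∃ x ∈ t, dist (Φ y) x < ε := by
    intro y
    have h1 : Φ y ∈ Metric.closedBall (0 : S → ℂ) 1 := by
      rw [mem_closedBall_zero_iff, pi_norm_le_iff_of_nonneg zero_le_one]
      exact fun γ => (hunit γ y).le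
    simpa using ht h1
  set N : ℕ := htfin.toFinset.card with hN
  have hNpos : 0 < N := by
    rw [hN, Finset.card_pos]
    obtain ⟨x, hx, -⟩ := hcover 0
    exact ⟨x, by simpa using hx⟩
  have hNr : (0 : ℝ) < N := by exact_mod_cast hNpos
  refine ⟨1 / (2 * N), by positivity, fun Y hY => ?_⟩
  -- pigeonhole
  obtain ⟨x, hxt, hx⟩ : ∃ x ∈ htfin.toFinset, Y / N ≤
      volume.real (Φ ⁻¹' Metric.ball x ε ∩ Icc 0 Y) := by
    by_contra! hcon
    have h1 : volume.real (Icc 0 Y) ≤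
        ∑ x ∈ htfin.toFinset, volume.real (Φ ⁻¹' Metric.ball x ε ∩ Icc 0 Y) := by
      refine (measureReal_mono ?_ ?_).trans (measureReal_biUnion_finset_le _ _)
      · intro y hy
        obtain ⟨x, hx, hd⟩ := hcover y
        simp only [mem_iUnion]
        exact ⟨x, by simpa using hx, hd, hy⟩
      · refine ((measure_biUnion_finset_le _ _).trans_lt
          (ENNReal.sum_lt_top.2 fun x _ => ?_)).ne
        exact (measure_mono inter_subset_right).trans_lt (by simp)
    have h2 : ∑ x ∈ htfin.toFinset, volume.real (Φ ⁻¹' Metric.ball x ε ∩ Icc 0 Y) <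
        ∑ x ∈ htfin.toFinset, Y / N := by
      refine Finset.sum_lt_sum_of_nonempty (Finset.card_pos.1 hNpos) hcon
    rw [Finset.sum_const, nsmul_eq_mul, ← hN, mul_div_cancel₀ _ hNr.ne'] at h2
    rw [Real.volume_real_Icc_of_le hY.le] at h1
    linarith
  set P : Set ℝ := Φ ⁻¹' Metric.ball x ε ∩ Icc 0 Y with hP
  have hPpos : 0 < volume.real P := (by positivity : 0 < Y / N).trans_le hx
  obtain ⟨y₁, hy₁⟩ : P.Nonempty := by
    by_contra hne
    rw [not_nonempty_iff_eq_empty] at hne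
    rw [hne] at hPpos
    simp at hPpos
  have hsub : P ⊆ (fun y => y - y₁) ⁻¹' (E ∩ Icc (-Y) Y) := by
    intro y hy
    refine ⟨?_, ?_, ?_⟩
    · have hd : dist (Φ y) (Φ y₁) < 2 * ε := by
        have h1 : dist (Φ y) x < ε := hy.1
        have h2 : dist (Φ y₁) x < ε := hy₁.1
        have := dist_triangle_right (Φ y) (Φ y₁) x
        linarith
      have h3 : ∀ γ ∈ S, ‖c γ‖ * ‖Complex.exp (γ * (y - y₁ : ℝ) * Complex.I) - 1‖ ≤ ‖c γ‖ * (2 * ε) := by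
        intro γ hγ
        refine mul_le_mul_of_nonneg_left ?_ (norm_nonneg _)
        have h4 : ‖Complex.exp (γ * (y - y₁ : ℝ) * Complex.I) - 1‖ =
            ‖Complex.exp (γ * y * Complex.I) - Complex.exp (γ * y₁ * Complex.I)‖ := by
          have : Complex.exp (γ * y * Complex.I) - Complex.exp (γ * y₁ * Complex.I) =
              Complex.exp (γ * y₁ * Complex.I) * (Complex.exp (γ * (y - y₁ : ℝ) * Complex.I) - 1) := by
            rw [mul_sub, ← Complex.exp_add, mul_one]
            congr 2
            push_cast
            ring
          rw [this, norm_mul, hunit, one_mul]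
        rw [h4]
        have h5 := dist_le_pi_dist (Φ y) (Φ y₁) ⟨γ, hγ⟩
        rw [dist_eq_norm] at h5
        exact h5.trans hd.le
      have h6 := Finset.sum_le_sum h3
      rw [← Finset.sum_mul, ← hA] at h6
      refine h6.trans_lt ?_
      have : 2 * ε = 1 / (1 + A) := by rw [hε]; field_simp
      rw [this, mul_one_div, div_lt_one (by positivity)]
      linarith
    · linarith [hy.2.1, hy₁.2.2]
    · linarith [hy.2.2, hy₁.2.1]
  have hfin : ∀ a b : ℝ, volume (E ∩ Icc a b) ≠ ⊤ := fun a b =>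
    ((measure_mono inter_subset_right).trans_lt (by simp)).ne
  have hle1 : volume.real P ≤ volume.real (E ∩ Icc (-Y) Y) := by
    have hpre : volume ((fun y => y - y₁) ⁻¹' (E ∩ Icc (-Y) Y)) = volume (E ∩ Icc (-Y) Y) := by
      simp_rw [sub_eq_add_neg]
      exact measure_preimage_add_right volume (-y₁) _
    refine ENNReal.toReal_mono (hfin _ _) ?_
    rw [← hpre]
    exact measure_mono hsub
  have hle2 : volume.real (E ∩ Icc (-Y) Y) ≤ volume.real (E ∩ Icc (-Y) 0) +
      volume.real (E ∩ Icc 0 Y) := by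
    refine (measureReal_mono ?_ ?_).trans (measureReal_union_le _ _)
    · rw [← inter_union_distrib_left, Icc_union_Icc_eq_Icc (by linarith) hY.le]
    · exact (measure_union_lt_top (hfin _ _).lt_top (hfin _ _).lt_top).ne
  have heq : volume.real (E ∩ Icc (-Y) 0) = volume.real (E ∩ Icc 0 Y) := by
    have : Neg.neg ⁻¹' (E ∩ Icc 0 Y) = E ∩ Icc (-Y) 0 := by
      ext τ
      simp only [mem_preimage, mem_inter_iff, hEneg, mem_Icc]
      constructor
      · rintro ⟨h, h1, h2⟩; exact ⟨h, by linarith, by linarith⟩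
      · rintro ⟨h, h1, h2⟩; exact ⟨h, by linarith, by linarith⟩
    rw [← this, Measure.real, Measure.measure_preimage_neg]
    rfl
  have : 1 / (2 * (N : ℝ)) * Y = Y / N / 2 := by field_simp
  rw [this]
  linarith

/-- A trigonometric polynomial returns close to any of its values with positive density. -/
lemma exists_mul_le_measureReal_re_sum_lt (S : Finset ℝ) (c : ℝ → ℂ) (y₀ : ℝ) :
    ∃ κ, 0 < κ ∧ ∀ᶠ Y : ℝ in atTop, κ * Y ≤ volume.real
      ({y : ℝ | (∑ γ ∈ S, c γ * Complex.exp (γ * y * Complex.I)).re <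
        (∑ γ ∈ S, c γ * Complex.exp (γ * y₀ * Complex.I)).re + 1} ∩ Ioc 0 Y) := by
  obtain ⟨κ, hκ, h⟩ := exists_mul_le_measureReal_recurrence S c
  set E : Set ℝ := {τ : ℝ | ∑ γ ∈ S, ‖c γ‖ * ‖Complex.exp (γ * τ * Complex.I) - 1‖ < 1} with hE
  set Q : Set ℝ := {y : ℝ | (∑ γ ∈ S, c γ * Complex.exp (γ * y * Complex.I)).re <
        (∑ γ ∈ S, c γ * Complex.exp (γ * y₀ * Complex.I)).re + 1} with hQ
  have hmem : ∀ τ ∈ E, τ + y₀ ∈ Q := by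
    intro τ hτ
    simp only [hQ, mem_ofPred_eq]
    have h1 : ‖∑ γ ∈ S, c γ * Complex.exp (γ * (τ + y₀ : ℝ) * Complex.I) -
        ∑ γ ∈ S, c γ * Complex.exp (γ * y₀ * Complex.I)‖ < 1 := by
      rw [← Finset.sum_sub_distrib]
      refine (norm_sum_le _ _).trans_lt (lt_of_le_of_lt (le_of_eq ?_) hτ)
      refine Finset.sum_congr rfl fun γ _ => ?_
      have : c γ * Complex.exp (γ * (τ + y₀ : ℝ) * Complex.I) - c γ * Complex.exp (γ * y₀ * Complex.I) =
          c γ * (Complex.exp (γ * τ * Complex.I) - 1) * Complex.exp ((γ * y₀ : ℝ) * Complex.I) := by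
        have h3 : Complex.exp (γ * (τ + y₀ : ℝ) * Complex.I) =
            Complex.exp (γ * τ * Complex.I) * Complex.exp ((γ * y₀ : ℝ) * Complex.I) := by
          rw [← Complex.exp_add]
          congr 1
          push_cast
          ring
        rw [h3]
        push_cast
        ring
      rw [this, norm_mul, norm_mul, Complex.norm_exp_ofReal_mul_I, mul_one]
    have h2 := (Complex.abs_re_le_norm _).trans_lt h1
    rw [Complex.sub_re] at h2
    linarith [(abs_lt.1 h2).2]
  refine ⟨κ / 2, by positivity, ?_⟩
  filter_upwards [eventually_gt_atTop (|y₀|), eventually_ge_atTop ((2 * κ * |y₀| + 2 * |y₀|) / κ)]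
    with Y hY1 hY2
  have hsub : E ∩ Icc 0 (Y - |y₀|) ⊆ (fun τ => τ + y₀) ⁻¹' (Q ∩ Ioc 0 Y ∪ Icc (-|y₀|) 0) := by
    rintro τ ⟨hτ, h0, h1⟩
    have h2 := le_abs_self y₀
    have h3 := neg_abs_le y₀
    simp only [mem_preimage]
    rcases le_or_gt (τ + y₀) 0 with h4 | h4
    · exact Or.inr ⟨by linarith, h4⟩
    · exact Or.inl ⟨hmem τ hτ, h4, by linarith⟩
  have hfin : volume (Q ∩ Ioc 0 Y ∪ Icc (-|y₀|) 0) ≠ ⊤ := by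
    refine (measure_union_lt_top ((measure_mono inter_subset_right).trans_lt ?_) ?_).ne <;> simp
  have hle : volume.real (E ∩ Icc 0 (Y - |y₀|)) ≤ volume.real (Q ∩ Ioc 0 Y ∪ Icc (-|y₀|) 0) := by
    refine ENNReal.toReal_mono hfin ?_
    rw [← measure_preimage_add_right volume y₀ (Q ∩ Ioc 0 Y ∪ Icc (-|y₀|) 0)]
    exact measure_mono hsub
  have hle2 := measureReal_union_le (μ := volume) (Q ∩ Ioc 0 Y) (Icc (-|y₀|) 0)
  rw [Real.volume_real_Icc_of_le (by simp)] at hle2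
  have h5 := h (Y - |y₀|) (by linarith)
  rw [div_le_iff₀ hκ] at hY2
  linarith

end Recurrence

section DensityTransfer

open scoped Topology

lemma meanSquareBounded_one : MeanSquareBounded (fun _ => 1) 1 where
  measurable := measurable_const
  integrableOn_sq Y := integrableOn_const (by simp)
  integral_sq_le Y hY := by
    simp only [one_pow]
    rw [setIntegral_const, Real.volume_real_Ioc_of_le (by linarith)]
    simp

lemma MeanSquareBounded.integrable_prod_fejerKernel {f : ℝ → ℝ} {C T Y : ℝ} {A : Set ℝ}
    (h : MeanSquareBounded f C) (hT : 0 < T) (hAm : MeasurableSet A) (hA : A ⊆ Ioc 0 Y) :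
    Integrable (fun z : ℝ × ℝ => f z.2 * fejerKernel T (z.1 - z.2))
      ((volume.restrict A).prod (volume.restrict (Ioi 0))) := by
  obtain ⟨K, hK, hle⟩ := exists_fejerKernel_le hT
  have hc := continuous_fejerKernel T
  have hAfin : volume A ≠ ⊤ := ((measure_mono hA).trans_lt (by simp)).ne
  have h1 : Integrable (fun _ : ℝ => 2 * K * (1 + Y ^ 2)) (volume.restrict A) :=
    integrableOn_const hAfin
  refine Integrable.mono' (h1.mul_prod h.integrableOn_abs_mul_inv) ?_ ?_
  · exact ((h.measurable.comp measurable_snd).mul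
      (by fun_prop : Continuous fun z : ℝ × ℝ => fejerKernel T (z.1 - z.2)).measurable).aestronglyMeasurable
  · rw [Measure.prod_restrict]
    refine (ae_restrict_iff' (hAm.prod measurableSet_Ioi)).2 (Eventually.of_forall ?_)
    rintro ⟨y, v⟩ ⟨hy, hv⟩
    have hy' := hA hy
    simp only at hy' ⊢
    rw [norm_mul, Real.norm_eq_abs, Real.norm_of_nonneg (fejerKernel_nonneg hT _)]
    have h2 : fejerKernel T (y - v) ≤ 2 * K * (1 + Y ^ 2) * (1 + v ^ 2)⁻¹ := by
      refine (hle _).trans ?_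
      have h3 := mul_le_mul_of_nonneg_left (inv_one_add_sub_sq_le y v) hK.le
      have h4 : y ^ 2 ≤ Y ^ 2 := pow_le_pow_left₀ hy'.1.le hy'.2 2
      have h5 : (0 : ℝ) ≤ (1 + v ^ 2)⁻¹ := by positivity
      have h6 : K * (2 * (1 + y ^ 2) * (1 + v ^ 2)⁻¹) ≤ 2 * K * (1 + Y ^ 2) * (1 + v ^ 2)⁻¹ := by
        rw [← mul_assoc]
        refine mul_le_mul_of_nonneg_right ?_ h5
        nlinarith
      exact h3.trans h6
    have h7 := mul_le_mul_of_nonneg_left h2 (abs_nonneg (f v))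
    refine h7.trans_eq (by ring)

lemma MeanSquareBounded.integrableOn_mul_integral_fejerKernel {f : ℝ → ℝ} {C T Y : ℝ} {A : Set ℝ}
    (h : MeanSquareBounded f C) (hT : 0 < T) (hAm : MeasurableSet A) (hA : A ⊆ Ioc 0 Y) :
    IntegrableOn (fun v => f v * ∫ y in A, fejerKernel T (y - v)) (Ioi 0) ∧
    ∫ y in A, ∫ v in Ioi 0, f v * fejerKernel T (y - v) =
      ∫ v in Ioi 0, f v * ∫ y in A, fejerKernel T (y - v) := by
  have hi := h.integrable_prod_fejerKernel hT hAm hA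
  constructor
  · have := hi.integral_prod_right
    simp only [integral_const_mul] at this
    exact this
  · rw [integral_integral_swap hi]
    simp_rw [integral_const_mul]

lemma tendsto_setIntegral_Ioi_atTop {g : ℝ → ℝ} (hg : IntegrableOn g (Ioi 0)) :
    Tendsto (fun Y : ℝ => ∫ v in Ioi Y, g v) atTop (𝓝 0) := by
  have h : Tendsto (fun Y : ℝ => ∫ v in Ioi (0 : ℝ), (Ioi Y).indicator g v) atTop
      (𝓝 (∫ v in Ioi (0 : ℝ), (0 : ℝ))) := by
    refine tendsto_integral_filter_of_dominated_convergence (fun v => ‖g v‖) ?_ ?_ hg.norm ?_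
    · exact Eventually.of_forall fun Y => hg.aestronglyMeasurable.indicator measurableSet_Ioi
    · exact Eventually.of_forall fun Y => Eventually.of_forall fun v => norm_indicator_le_norm_self _ _
    · refine Eventually.of_forall fun v => tendsto_const_nhds.congr' ?_
      filter_upwards [eventually_ge_atTop v] with Y hY
      rw [indicator_of_notMem (by simpa using hY)]
  rw [integral_zero] at h
  refine h.congr' ?_
  filter_upwards [eventually_ge_atTop (0 : ℝ)] with Y hY
  rw [integral_indicator measurableSet_Ioi, Measure.restrict_restrict measurableSet_Ioi,
    inter_eq_left.2 (Ioi_subset_Ioi hY)]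

lemma MeanSquareBounded.exists_mul_le_measureReal_lt {f : ℝ → ℝ} {C T V κ : ℝ} {A : Set ℝ}
    (h : MeanSquareBounded f C) (hC : 0 < C) (hT : 0 < T) (hV : 0 ≤ V) (hκ : 0 < κ)
    (hAm : MeasurableSet A)
    (hA : ∀ y ∈ A, ∫ v in Ioi 0, f v * fejerKernel T (y - v) ≤ -(2 * V + 1))
    (hAκ : ∀ᶠ Y : ℝ in atTop, κ * Y ≤ volume.real (A ∩ Ioc 0 Y)) :
    ∃ κ', 0 < κ' ∧ ∀ᶠ Y : ℝ in atTop, κ' * Y ≤ volume.real ({y | f y < -V} ∩ Ioc 0 Y) := by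
  obtain ⟨K, hK, hle⟩ := exists_fejerKernel_le hT
  have hkc := continuous_fejerKernel T
  set D : Set ℝ := {y | f y < -V} with hD
  have hDm : MeasurableSet D := measurableSet_lt h.measurable measurable_const
  set lam : ℝ := κ / (16 * C) with hlam
  have hlampos : 0 < lam := by positivity
  have htail := (tendsto_setIntegral_Ioi_atTop h.integrableOn_abs_mul_inv).comp
    (tendsto_id.const_mul_atTop (by norm_num : (0 : ℝ) < 2))
  have htail' := htail.eventually (gt_mem_nhds (by positivity : 0 < κ / (16 * K)))
  have hmain : ∀ᶠ Y : ℝ in atTop, lam * κ / 4 * Y ≤ volume.real (D ∩ Ioc 0 (2 * Y)) := by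
    filter_upwards [htail', hAκ, eventually_ge_atTop 1] with Y htY hAY hY1
    simp only [Function.comp_apply, id_eq] at htY
    set A' : Set ℝ := A ∩ Ioc 0 Y with hA'
    have hA'm : MeasurableSet A' := hAm.inter measurableSet_Ioc
    have hA's : A' ⊆ Ioc 0 Y := inter_subset_right
    have hA'fin : volume A' ≠ ⊤ := ((measure_mono hA's).trans_lt (by simp)).ne
    have hA'le : volume.real A' ≤ Y := by
      have := measureReal_mono (μ := volume) hA's (by simp)
      rwa [Real.volume_real_Ioc_of_le (by linarith), sub_zero] at this
    set W : ℝ → ℝ := fun v => ∫ y in A', fejerKernel T (y - v) with hW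
    obtain ⟨iW, eW⟩ := h.integrableOn_mul_integral_fejerKernel hT hA'm hA's
    obtain ⟨iW1, eW1⟩ := meanSquareBounded_one.integrableOn_mul_integral_fejerKernel hT hA'm hA's
    simp only [one_mul] at iW1 eW1
    have hki : ∀ v, Integrable fun y => fejerKernel T (y - v) := fun v =>
      (integrable_fejerKernel hT).comp_sub_right v
    have hW0 : ∀ v, 0 ≤ W v := fun v => integral_nonneg fun y => fejerKernel_nonneg hT _
    have hW2 : ∀ v, W v ≤ 2 := by
      intro v
      calc W v ≤ ∫ y, fejerKernel T (y - v) :=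
            setIntegral_le_integral (hki v) (Eventually.of_forall fun y => fejerKernel_nonneg hT _)
        _ = ∫ y, fejerKernel T y := integral_sub_right_eq_self _ v
        _ ≤ 2 := integral_fejerKernel_le hT
    have hWfar : ∀ v, 2 * Y < v → W v ≤ 4 * K * Y * (1 + v ^ 2)⁻¹ := by
      intro v hv
      have h1 : ∀ y ∈ A', fejerKernel T (y - v) ≤ 4 * K * (1 + v ^ 2)⁻¹ := by
        intro y hy
        have hy' := hA's hy
        refine (hle _).trans ?_
        have h2 : (1 + (y - v) ^ 2)⁻¹ ≤ 4 * (1 + v ^ 2)⁻¹ := by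
          rw [← div_eq_mul_inv, ← one_div, div_le_div_iff₀ (by positivity) (by positivity)]
          nlinarith [hy'.1, hy'.2]
        calc K * (1 + (y - v) ^ 2)⁻¹ ≤ K * (4 * (1 + v ^ 2)⁻¹) := mul_le_mul_of_nonneg_left h2 hK.le
          _ = _ := by ring
      have h3 : W v ≤ ∫ y in A', 4 * K * (1 + v ^ 2)⁻¹ :=
        setIntegral_mono_on (hki v).integrableOn (integrableOn_const hA'fin) hA'm h1
      rw [setIntegral_const, smul_eq_mul] at h3
      have h4 : (0 : ℝ) ≤ 4 * K * (1 + v ^ 2)⁻¹ := by positivity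
      calc W v ≤ _ := h3
        _ ≤ Y * (4 * K * (1 + v ^ 2)⁻¹) := mul_le_mul_of_nonneg_right hA'le h4
        _ = _ := by ring
    have hIW : ∫ v in Ioi 0, W v ≤ 2 * volume.real A' := by
      rw [← eW1]
      have h1 : ∫ y in A', ∫ v in Ioi 0, fejerKernel T (y - v) ≤ ∫ y in A', (2 : ℝ) := by
        refine integral_mono_of_nonneg (Eventually.of_forall fun y =>
          integral_nonneg fun v => fejerKernel_nonneg hT _) (integrableOn_const hA'fin)
          (Eventually.of_forall fun y => ?_)
        calc ∫ v in Ioi 0, fejerKernel T (y - v) ≤ ∫ v, fejerKernel T (y - v) :=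
              setIntegral_le_integral ((integrable_fejerKernel hT).comp_sub_left y)
                (Eventually.of_forall fun v => fejerKernel_nonneg hT _)
          _ = ∫ v, fejerKernel T v := integral_sub_left_eq_self _ volume y
          _ ≤ 2 := integral_fejerKernel_le hT
      rw [setIntegral_const, smul_eq_mul] at h1
      linarith
    have hIfW : ∫ v in Ioi 0, f v * W v ≤ -(2 * V + 1) * volume.real A' := by
      rw [← eW]
      have h1 : ∫ y in A', ∫ v in Ioi 0, f v * fejerKernel T (y - v) ≤ ∫ y in A', -(2 * V + 1) := by
        refine setIntegral_mono_on ?_ (integrableOn_const hA'fin) hA'm fun y hy => hA y hy.1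
        exact (h.integrable_prod_fejerKernel hT hA'm hA's).integral_prod_left
      rw [setIntegral_const, smul_eq_mul] at h1
      linarith
    -- pointwise lower bound
    have hpt : ∀ v ∈ Ioi (0 : ℝ), -(f v * W v) - V * W v ≤
        (Ioc 0 (2 * Y)).indicator (fun v => 2 * lam * f v ^ 2 + D.indicator (fun _ => 2 / lam) v) v +
        (Ioi (2 * Y)).indicator (fun v => 4 * K * Y * (|f v| * (1 + v ^ 2)⁻¹)) v := by
      intro v hv
      have hv0 : 0 < v := hv
      rcases le_or_gt v (2 * Y) with hvY | hvY
      · rw [indicator_of_mem (show v ∈ Ioc 0 (2 * Y) from ⟨hv0, hvY⟩),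
          indicator_of_notMem (show v ∉ Ioi (2 * Y) by simpa using hvY), add_zero]
        by_cases hvD : v ∈ D
        · rw [indicator_of_mem hvD]
          have h1 : -f v ≤ lam * f v ^ 2 + 1 / lam := by
            have h2 : 0 ≤ lam * (f v + 1 / (2 * lam)) ^ 2 := by positivity
            have h3 : lam * (f v + 1 / (2 * lam)) ^ 2 = lam * f v ^ 2 + f v + 1 / (4 * lam) := by
              field_simp
              ring
            have h4 : 1 / (4 * lam) ≤ 1 / lam := by
              rw [div_le_div_iff₀ (by positivity) hlampos]
              linarith
            linarith
          have h5 : 0 ≤ lam * f v ^ 2 + 1 / lam := by positivity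
          have h6 : -f v * W v ≤ (lam * f v ^ 2 + 1 / lam) * 2 :=
            (mul_le_mul_of_nonneg_right h1 (hW0 v)).trans (mul_le_mul_of_nonneg_left (hW2 v) h5)
          have h7 : 0 ≤ V * W v := mul_nonneg hV (hW0 v)
          have h8 : 2 / lam = 2 * (1 / lam) := by ring
          rw [h8]
          linarith
        · rw [indicator_of_notMem hvD]
          have h1 : -V ≤ f v := by simpa [hD] using hvD
          have h2 : 0 ≤ (f v + V) * W v := mul_nonneg (by linarith) (hW0 v)
          have h3 : 0 ≤ 2 * lam * f v ^ 2 := by positivity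
          linarith
      · rw [indicator_of_notMem (show v ∉ Ioc 0 (2 * Y) from fun h => not_lt.2 h.2 hvY),
          indicator_of_mem (show v ∈ Ioi (2 * Y) from hvY), zero_add]
        have h1 : -f v * W v ≤ |f v| * (4 * K * Y * (1 + v ^ 2)⁻¹) :=
          (mul_le_mul_of_nonneg_right (neg_le_abs _) (hW0 v)).trans
            (mul_le_mul_of_nonneg_left (hWfar v hvY) (abs_nonneg _))
        have h7 : 0 ≤ V * W v := mul_nonneg hV (hW0 v)
        linarith
    have hDfin : volume (D ∩ Ioc 0 (2 * Y)) ≠ ⊤ :=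
      ((measure_mono inter_subset_right).trans_lt measure_Ioc_lt_top).ne
    have j1 : IntegrableOn (fun v => 2 * lam * f v ^ 2) (Ioc 0 (2 * Y)) :=
      (h.integrableOn_sq _).const_mul _
    have j2 : IntegrableOn (fun v => D.indicator (fun _ => 2 / lam) v) (Ioc 0 (2 * Y)) :=
      (integrableOn_const measure_Ioc_lt_top.ne).indicator hDm
    have j12 : IntegrableOn (fun v => 2 * lam * f v ^ 2 + D.indicator (fun _ => 2 / lam) v)
        (Ioc 0 (2 * Y)) := j1.add j2
    have j3 : IntegrableOn (fun v => 4 * K * Y * (|f v| * (1 + v ^ 2)⁻¹)) (Ioi (2 * Y)) :=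
      (h.integrableOn_abs_mul_inv.mono_set (Ioi_subset_Ioi (by linarith))).const_mul _
    have i1 : IntegrableOn ((Ioc 0 (2 * Y)).indicator
        (fun v => 2 * lam * f v ^ 2 + D.indicator (fun _ => 2 / lam) v)) (Ioi 0) :=
      ((integrable_indicator_iff measurableSet_Ioc).2 j12).integrableOn
    have i2 : IntegrableOn ((Ioi (2 * Y)).indicator
        (fun v => 4 * K * Y * (|f v| * (1 + v ^ 2)⁻¹))) (Ioi 0) :=
      ((integrable_indicator_iff measurableSet_Ioi).2 j3).integrableOn
    have i3 : IntegrableOn (fun v => -(f v * W v)) (Ioi 0) := iW.neg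
    have i4 : IntegrableOn (fun v => V * W v) (Ioi 0) := iW1.const_mul V
    have h_int := setIntegral_mono_on (i3.sub i4) (i1.add i2) measurableSet_Ioi hpt
    simp only [Pi.add_apply, Pi.sub_apply] at h_int
    rw [integral_sub i3 i4, integral_add i1 i2, integral_neg, integral_const_mul,
      setIntegral_indicator measurableSet_Ioc, setIntegral_indicator measurableSet_Ioi,
      inter_eq_right.2 Ioc_subset_Ioi_self, inter_eq_right.2 (Ioi_subset_Ioi (by linarith)),
      integral_add j1 j2, integral_const_mul, integral_const_mul,
      setIntegral_indicator hDm, setIntegral_const, smul_eq_mul, inter_comm] at h_int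
    have hsq := h.integral_sq_le (2 * Y) (by linarith)
    have hb1 : 2 * lam * ∫ v in Ioc 0 (2 * Y), f v ^ 2 ≤ κ / 4 * Y := by
      have := mul_le_mul_of_nonneg_left hsq (by positivity : 0 ≤ 2 * lam)
      refine this.trans_eq ?_
      rw [hlam]
      field_simp
      ring
    have hb2 : 4 * K * Y * ∫ v in Ioi (2 * Y), |f v| * (1 + v ^ 2)⁻¹ ≤ κ / 4 * Y := by
      have := mul_le_mul_of_nonneg_left htY.le (by positivity : 0 ≤ 4 * K * Y)
      refine this.trans_eq ?_
      field_simp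
      ring
    have hVW := mul_le_mul_of_nonneg_left hIW hV
    have hfinal : κ / 2 * Y ≤ volume.real (D ∩ Ioc 0 (2 * Y)) * (2 / lam) := by
      linarith
    rw [mul_div_assoc', le_div_iff₀ hlampos] at hfinal
    linarith
  refine ⟨lam * κ / 8, by positivity, ?_⟩
  filter_upwards [(tendsto_id.atTop_div_const (by norm_num : (0 : ℝ) < 2)).eventually hmain] with Y hY
  simp only [id_eq] at hY
  rw [mul_div_cancel₀ Y (by norm_num : (2 : ℝ) ≠ 0)] at hY
  linarith

end DensityTransfer

section LargeDeviations

open scoped Topology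

lemma MeanSquareBounded.exists_mul_le_measureReal_lt_of_tendsto {f : ℝ → ℝ} {C T V y₀ : ℝ}
    {S : Finset ℝ} {c : ℝ → ℂ} (h : MeanSquareBounded f C) (hC : 0 < C) (hT : 0 < T) (hV : 0 ≤ V)
    (hlim : Tendsto (fun y : ℝ => (∫ v in Ioi (0 : ℝ), f v * fejerKernel T (y - v)) -
      (∑ γ ∈ S, c γ * Complex.exp (γ * y * Complex.I)).re) atTop (𝓝 0))
    (hy₀ : (∑ γ ∈ S, c γ * Complex.exp (γ * y₀ * Complex.I)).re ≤ -(2 * V + 3)) :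
    ∃ κ, 0 < κ ∧ ∀ᶠ Y : ℝ in atTop, κ * Y ≤ volume.real ({y | f y < -V} ∩ Ioc 0 Y) := by
  obtain ⟨κ, hκ, hrec⟩ := exists_mul_le_measureReal_re_sum_lt S c y₀
  set Q : Set ℝ := {y : ℝ | (∑ γ ∈ S, c γ * Complex.exp (γ * y * Complex.I)).re <
        (∑ γ ∈ S, c γ * Complex.exp (γ * y₀ * Complex.I)).re + 1} with hQ
  have hQm : MeasurableSet Q := by
    refine (isOpen_lt (Complex.continuous_re.comp ?_) continuous_const).measurableSet
    fun_prop
  obtain ⟨b, hb⟩ := eventually_atTop.1 (hlim.eventually (gt_mem_nhds one_pos))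
  refine h.exists_mul_le_measureReal_lt (A := Q ∩ Ici b) hC hT hV (half_pos hκ)
    (hQm.inter measurableSet_Ici) ?_ ?_
  · rintro y ⟨hyQ, hyb⟩
    have h1 := hb y hyb
    simp only [hQ, mem_ofPred_eq] at hyQ
    linarith
  · filter_upwards [hrec, eventually_ge_atTop (2 * |b| / κ)] with Y hY hYb
    have hsub : Q ∩ Ioc 0 Y ⊆ (Q ∩ Ici b ∩ Ioc 0 Y) ∪ Icc 0 |b| := by
      rintro y ⟨hyQ, hy⟩
      rcases le_or_gt b y with h1 | h1
      · exact Or.inl ⟨⟨hyQ, h1⟩, hy⟩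
      · exact Or.inr ⟨hy.1.le, h1.le.trans (le_abs_self b)⟩
    have hfin : volume ((Q ∩ Ici b ∩ Ioc 0 Y) ∪ Icc 0 |b|) ≠ ⊤ :=
      (measure_union_lt_top ((measure_mono inter_subset_right).trans_lt measure_Ioc_lt_top)
        measure_Icc_lt_top).ne
    have h1 := (measureReal_mono hsub hfin).trans (measureReal_union_le _ _)
    rw [Real.volume_real_Icc_of_le (abs_nonneg b), sub_zero] at h1
    rw [div_le_iff₀ hκ] at hYb
    linarith

/-- Under RH, the scaled error in Mertens' formula for `Λ(n)/n` is large of either sign on sets of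
positive lower density. -/
lemma exists_mul_le_measureReal_scaledErr (hRH : RiemannHypothesis) {V : ℝ} (hV : 0 ≤ V) :
    ∃ κ, 0 < κ ∧ ∀ᶠ Y : ℝ in atTop,
      κ * Y ≤ volume.real ({y | scaledErr y < -V} ∩ Ioc 0 Y) ∧
      κ * Y ≤ volume.real ({y | V < scaledErr y} ∩ Ioc 0 Y) := by
  obtain ⟨C, hC, hms⟩ := exists_meanSquareBounded_scaledErr hRH
  obtain ⟨T, S, m, H, hT, hH, hG, ⟨y₁, hy₁⟩, y₂, hy₂⟩ :=
    exists_smoothedMainTerm_le_and_le hRH (2 * V + 3)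
  have hlim := tendsto_integral_scaledErr_mul_fejerKernel hRH hT hH hG
  set c : ℝ → ℂ := fun γ => (m γ / (1 / 2 - γ * Complex.I)) * fejerWeight T γ with hc
  have hmain : ∀ y, smoothedMainTerm T S m y = ∑ γ ∈ S, c γ * Complex.exp (γ * y * Complex.I) := by
    intro y
    rw [smoothedMainTerm]
    exact Finset.sum_congr rfl fun γ _ => by simp only [hc]; ring
  have hneg : ∀ y : ℝ, ∑ γ ∈ S, -c γ * Complex.exp (γ * y * Complex.I) = -smoothedMainTerm T S m y := by
    intro y
    rw [hmain, ← Finset.sum_neg_distrib]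
    exact Finset.sum_congr rfl fun γ _ => by ring
  obtain ⟨κ₁, hκ₁, h₁⟩ := hms.exists_mul_le_measureReal_lt_of_tendsto (c := c) hC hT hV
    (by simpa only [hmain] using hlim) (by simpa only [hmain] using hy₁)
  obtain ⟨κ₂, hκ₂, h₂⟩ := hms.neg.exists_mul_le_measureReal_lt_of_tendsto (S := S) (y₀ := y₂)
    (c := fun γ => -c γ) hC hT hV (by
      have h := hlim.neg
      rw [neg_zero] at h
      refine h.congr fun y => ?_
      rw [hneg, Complex.neg_re]
      simp only [neg_mul, integral_neg]
      ring) (by rw [hneg, Complex.neg_re]; linarith)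
  refine ⟨min κ₁ κ₂, lt_min hκ₁ hκ₂, ?_⟩
  filter_upwards [h₁, h₂, eventually_ge_atTop 0] with Y hY1 hY2 hY0
  refine ⟨(mul_le_mul_of_nonneg_right (min_le_left _ _) hY0).trans hY1,
    (mul_le_mul_of_nonneg_right (min_le_right _ _) hY0).trans ?_⟩
  simpa only [neg_lt_neg_iff] using hY2

end LargeDeviations

section MertensProduct

open scoped Topology

/-- The sum `∑_{n ≤ x} Λ(n)/(n log n)`. -/
noncomputable def vonMangoldtLogSum (x : ℝ) : ℝ :=
  ∑ n ∈ Finset.Icc 1 ⌊x⌋₊, ArithmeticFunction.vonMangoldt n / (n * Real.log n)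

lemma sum_vonMangoldt_mul_eq (N : ℕ) (g : ℕ → ℝ) :
    ∑ n ∈ Finset.Icc 1 N, ArithmeticFunction.vonMangoldt n * g n =
      ∑ p ∈ Nat.primesLE N, ∑ k ∈ Finset.Icc 1 (p.log N), Real.log p * g (p ^ k) := by
  calc _ = ∑ m ∈ ((Finset.Icc 1 N).filter Nat.Prime).biUnion
        fun p ↦ Finset.image (p ^ ·) (Finset.Icc 1 (p.log N)), ArithmeticFunction.vonMangoldt m * g m := by
        refine (Finset.sum_subset (fun q hq ↦ ?_) fun x hx h ↦ ?_).symm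
        · simp only [Finset.mem_biUnion, Finset.mem_filter, Finset.mem_Icc, Finset.mem_image] at hq ⊢
          obtain ⟨p, hp, k, ⟨_, hk⟩, rfl⟩ := hq
          exact ⟨Nat.one_le_pow _ _ hp.2.pos, Nat.pow_le_of_le_log (by lia) hk⟩
        · have : ArithmeticFunction.vonMangoldt x = 0 := by
            revert h
            simp only [Finset.mem_biUnion, Finset.mem_filter, Finset.mem_Icc, Finset.mem_image,
              not_exists, not_and, and_imp, ArithmeticFunction.vonMangoldt_eq_zero_iff,
              isPrimePow_nat_iff]
            contrapose!
            rintro ⟨p, k, hp, hk, rfl⟩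
            simp only [Finset.mem_Icc] at hx
            have hpn : p ≤ N := (Nat.le_of_dvd (by lia) (dvd_pow_self p hk.ne')).trans hx.2
            exact ⟨p, ⟨hp.one_le, hpn, hp, ⟨k, ⟨by lia, Nat.le_log_of_pow_le hp.one_lt hx.2, rfl⟩⟩⟩⟩
          rw [this, zero_mul]
    _ = ∑ p ∈ Finset.Icc 1 N with p.Prime, ∑ q ∈ Finset.image (fun k ↦ p ^ k) (Finset.Icc 1 (p.log N)),
        ArithmeticFunction.vonMangoldt q * g q := by
        rw [Finset.sum_biUnion <| by rw [Finset.pairwiseDisjoint_iff]; grind [Nat.Prime.pow_inj']]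
    _ = ∑ p ∈ Nat.primesLE N, ∑ k ∈ Finset.Icc 1 (p.log N),
        ArithmeticFunction.vonMangoldt (p ^ k) * g (p ^ k) := by
        refine Finset.sum_congr (Nat.primesLE_eq_filter_Icc_one N).symm fun p hp ↦ ?_
        exact Finset.sum_image fun a _ b _ hab ↦
          Nat.pow_right_injective (Nat.two_le_of_mem_primesLE hp) hab
    _ = _ := by
        refine Finset.sum_congr rfl fun p hp ↦ Finset.sum_congr rfl fun k hk ↦ ?_
        rw [ArithmeticFunction.vonMangoldt_apply_pow (by grind),
          ArithmeticFunction.vonMangoldt_apply_prime <| Nat.prime_of_mem_primesLE hp]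

lemma vonMangoldtLogSum_eq (x : ℝ) : vonMangoldtLogSum x =
    ∑ p ∈ Nat.primesLE ⌊x⌋₊, ∑ i ∈ Finset.range (p.log ⌊x⌋₊), ((p : ℝ)⁻¹) ^ (i + 1) / (i + 1) := by
  have h := sum_vonMangoldt_mul_eq ⌊x⌋₊ (fun n => ((n * Real.log n : ℝ))⁻¹)
  simp_rw [← div_eq_mul_inv] at h
  rw [vonMangoldtLogSum, h]
  refine Finset.sum_congr rfl fun p hp => ?_
  have hp' := Nat.prime_of_mem_primesLE hp
  have hlog : 0 < Real.log p := Real.log_pos (by exact_mod_cast hp'.one_lt)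
  have hp0 : (0 : ℝ) < p := by exact_mod_cast hp'.pos
  have hshift := Finset.sum_Ico_add' (fun k : ℕ => ((p : ℝ)⁻¹) ^ k / (k : ℝ)) 0 (p.log ⌊x⌋₊) 1
  push_cast at hshift
  rw [Finset.range_eq_Ico, hshift]
  refine Finset.sum_congr (by ext; simp only [Finset.mem_Icc, Finset.mem_Ico]; lia) fun k hk => ?_
  have hk : 1 ≤ k := by simp at hk; lia
  have hk0 : (0 : ℝ) < k := by exact_mod_cast hk
  rw [Nat.cast_pow, Real.log_pow, inv_pow]
  field_simp

lemma mertensProd_pos (x : ℝ) : 0 < mertensProd x := by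
  refine Finset.prod_pos fun p hp => ?_
  simp only [Finset.mem_filter] at hp
  have : (1 : ℝ) < p := by exact_mod_cast hp.2.one_lt
  have h2 : 1 / (p : ℝ) < 1 := by rw [div_lt_one (by linarith)]; exact this
  exact inv_pos.2 (by linarith)

lemma log_mertensProd (x : ℝ) :
    Real.log (mertensProd x) = ∑ p ∈ Nat.primesLE ⌊x⌋₊, -Real.log (1 - (p : ℝ)⁻¹) := by
  have hset : Finset.filter Nat.Prime (Finset.Iic ⌊x⌋₊) = Nat.primesLE ⌊x⌋₊ := by
    ext p; simp [Nat.mem_primesLE]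
  rw [mertensProd, hset, Real.log_prod]
  · exact Finset.sum_congr rfl fun p _ => by rw [Real.log_inv, one_div]
  · intro p hp
    have hp' := Nat.prime_of_mem_primesLE hp
    have : (1 : ℝ) < p := by exact_mod_cast hp'.one_lt
    have h2 : 1 / (p : ℝ) < 1 := by rw [div_lt_one (by linarith)]; exact this
    exact inv_ne_zero (by linarith)

lemma abs_log_one_sub_inv_add_sum_le {p N : ℕ} (hp : p ∈ Nat.primesLE N) :
    |-Real.log (1 - (p : ℝ)⁻¹) - ∑ i ∈ Finset.range (p.log N), ((p : ℝ)⁻¹) ^ (i + 1) / (i + 1)| ≤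
      2 * ((p : ℝ) ^ (p.log N + 1))⁻¹ := by
  have hp' := Nat.prime_of_mem_primesLE hp
  have hp2 : (2 : ℝ) ≤ p := by exact_mod_cast hp'.two_le
  have hinv : (p : ℝ)⁻¹ ≤ 1 / 2 := by rw [← one_div]; exact one_div_le_one_div_of_le (by norm_num) hp2
  have hinv0 : 0 < (p : ℝ)⁻¹ := by positivity
  have habs : |(p : ℝ)⁻¹| = (p : ℝ)⁻¹ := abs_of_pos hinv0
  have h := Real.abs_log_sub_add_sum_range_le (x := (p : ℝ)⁻¹) (by rw [habs]; linarith) (p.log N)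
  rw [habs] at h
  rw [show -Real.log (1 - (p : ℝ)⁻¹) - ∑ i ∈ Finset.range (p.log N), ((p : ℝ)⁻¹) ^ (i + 1) / (i + 1) =
    -((∑ i ∈ Finset.range (p.log N), ((p : ℝ)⁻¹) ^ (i + 1) / (i + 1)) + Real.log (1 - (p : ℝ)⁻¹)) by ring,
    abs_neg]
  refine h.trans ?_
  rw [inv_pow, div_le_iff₀ (by linarith)]
  have : (0 : ℝ) < ((p : ℝ) ^ (p.log N + 1))⁻¹ := by positivity
  nlinarith

lemma sum_log_div_sq_le (j : ℕ) : ∀ z x : ℝ, 1 ≤ z → x ≤ 2 ^ j * z →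
    ∑ p ∈ Nat.primesLE ⌊x⌋₊ with (z < ((p : ℕ) : ℝ)), Real.log p / (p : ℝ) ^ 2 ≤ 4 * Real.log 4 / z := by
  have hlog4 : 0 < Real.log 4 := Real.log_pos (by norm_num)
  induction j with
  | zero =>
    intro z x hz hx
    rw [Finset.sum_eq_zero]
    · positivity
    · intro p hp
      exfalso
      simp only [Finset.mem_filter, Nat.mem_primesLE] at hp
      have := (Nat.le_floor_iff' hp.1.2.pos.ne').1 hp.1.1
      linarith [hp.2]
  | succ j ih =>
    intro z x hz hx
    have h1 := ih (2 * z) x (by linarith) (by rw [pow_succ] at hx; linarith)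
    have hsplit : ∑ p ∈ Nat.primesLE ⌊x⌋₊ with (z < ((p : ℕ) : ℝ)), Real.log p / (p : ℝ) ^ 2 ≤
        ∑ p ∈ Nat.primesLE ⌊2 * z⌋₊, Real.log p / z ^ 2 +
        ∑ p ∈ Nat.primesLE ⌊x⌋₊ with (2 * z < ((p : ℕ) : ℝ)), Real.log p / (p : ℝ) ^ 2 := by
      rw [← Finset.sum_filter_add_sum_filter_not
        ((Nat.primesLE ⌊x⌋₊).filter fun p => z < ((p : ℕ) : ℝ)) (fun p => ((p : ℕ) : ℝ) ≤ 2 * z)]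
      refine add_le_add ?_ (le_of_eq ?_)
      · calc _ ≤ ∑ p ∈ ((Nat.primesLE ⌊x⌋₊).filter fun p => z < ((p : ℕ) : ℝ)).filter
              (fun p => ((p : ℕ) : ℝ) ≤ 2 * z), Real.log p / z ^ 2 := by
              refine Finset.sum_le_sum fun p hp => ?_
              simp only [Finset.mem_filter] at hp
              have : z ^ 2 ≤ (p : ℝ) ^ 2 := pow_le_pow_left₀ (by linarith) hp.1.2.le 2
              exact div_le_div_of_nonneg_left (Real.log_natCast_nonneg p) (by positivity) this
          _ ≤ _ := by
              refine Finset.sum_le_sum_of_subset_of_nonneg (fun p hp => ?_) fun p _ _ =>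
                div_nonneg (Real.log_natCast_nonneg p) (by positivity)
              simp only [Finset.mem_filter, Nat.mem_primesLE] at hp ⊢
              exact ⟨Nat.le_floor hp.2, hp.1.1.2⟩
      · refine Finset.sum_congr ?_ fun _ _ => rfl
        ext p
        simp only [Finset.mem_filter, not_le]
        constructor
        · rintro ⟨⟨h1, h2⟩, h3⟩; exact ⟨h1, h3⟩
        · rintro ⟨h1, h3⟩; exact ⟨⟨h1, by linarith⟩, h3⟩
    have hth : ∑ p ∈ Nat.primesLE ⌊2 * z⌋₊, Real.log p / z ^ 2 ≤ 2 * Real.log 4 / z := by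
      rw [← Finset.sum_div, ← Chebyshev.theta_eq_sum_primesLE]
      have := Chebyshev.theta_le_log4_mul_x (show 0 ≤ 2 * z by linarith)
      rw [div_le_div_iff₀ (by positivity) (by positivity)]
      nlinarith [mul_le_mul_of_nonneg_right this (show 0 ≤ z by linarith)]
    have h3 : 4 * Real.log 4 / (2 * z) = 2 * Real.log 4 / z := by field_simp; ring
    have h4 : 4 * Real.log 4 / z = 2 * Real.log 4 / z + 2 * Real.log 4 / z := by ring
    linarith

/-- Prime powers exceeding `x` contribute `O(1/(√x log x))` to the logarithm of the Mertens product. -/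
lemma exists_abs_log_mertensProd_sub_le : ∃ C, 0 < C ∧ ∀ᶠ x : ℝ in atTop,
    |Real.log (mertensProd x) - vonMangoldtLogSum x| ≤ C / (√x * Real.log x) := by
  have hlog4 : 0 < Real.log 4 := Real.log_pos (by norm_num)
  refine ⟨4 * (Real.log 4 + 1) + 16 * Real.log 4, by positivity, ?_⟩
  have hpi := Real.tendsto_sqrt_atTop.eventually (Chebyshev.eventually_primeCounting_le one_pos)
  filter_upwards [hpi, eventually_ge_atTop 4] with x hx hx4
  have hx0 : 0 < x := by linarith
  have hz2 : 2 ≤ √x := by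
    rw [show (2 : ℝ) = √4 by rw [show (4 : ℝ) = 2 ^ 2 by norm_num]; simp]
    exact Real.sqrt_le_sqrt hx4
  have hlogz : 0 < Real.log √x := Real.log_pos (by linarith)
  have hlogx : Real.log x = 2 * Real.log √x := by rw [Real.log_sqrt hx0.le]; ring
  have hzz : √x * √x = x := Real.mul_self_sqrt hx0.le
  set z := √x with hz
  set N := ⌊x⌋₊ with hN
  rw [log_mertensProd, vonMangoldtLogSum_eq, ← Finset.sum_sub_distrib]
  refine (Finset.abs_sum_le_sum_abs _ _).trans ?_
  have hbig : ∀ p ∈ Nat.primesLE N, 2 * ((p : ℝ) ^ (p.log N + 1))⁻¹ ≤ 2 / x := by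
    intro p hp
    have hp' := Nat.prime_of_mem_primesLE hp
    have h1 := Nat.lt_pow_succ_log_self hp'.one_lt N
    have h2 : x < (p : ℝ) ^ (p.log N + 1) := by
      refine (Nat.lt_floor_add_one x).trans_le ?_
      exact_mod_cast h1
    rw [← div_eq_mul_inv]
    exact div_le_div_of_nonneg_left zero_le_two hx0 h2.le
  have hsq : ∀ p ∈ Nat.primesLE N, 2 * ((p : ℝ) ^ (p.log N + 1))⁻¹ ≤ 2 / (p : ℝ) ^ 2 := by
    intro p hp
    have hp' := Nat.prime_of_mem_primesLE hp
    have h1 : 1 ≤ p.log N :=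
      Nat.log_pos hp'.one_lt (Nat.mem_primesLE.1 hp).1
    have h2 : (p : ℝ) ^ 2 ≤ (p : ℝ) ^ (p.log N + 1) :=
      pow_le_pow_right₀ (by exact_mod_cast hp'.one_le) (by lia)
    rw [← div_eq_mul_inv]
    exact div_le_div_of_nonneg_left zero_le_two (pow_pos (by exact_mod_cast hp'.pos) 2) h2
  have hsum : ∑ p ∈ Nat.primesLE N, |-Real.log (1 - (p : ℝ)⁻¹) -
        ∑ i ∈ Finset.range (p.log N), ((p : ℝ)⁻¹) ^ (i + 1) / (i + 1)| ≤
      ∑ p ∈ Nat.primesLE ⌊z⌋₊, 2 / x +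
      ∑ p ∈ Nat.primesLE N with (z < ((p : ℕ) : ℝ)), 2 / Real.log z * (Real.log p / (p : ℝ) ^ 2) := by
    rw [← Finset.sum_filter_add_sum_filter_not (Nat.primesLE N) (fun p => ((p : ℕ) : ℝ) ≤ z)]
    refine add_le_add ?_ ?_
    · calc _ ≤ ∑ p ∈ Nat.primesLE N with ((p : ℕ) : ℝ) ≤ z, 2 / x := by
            refine Finset.sum_le_sum fun p hp => ?_
            have hp1 := (Finset.mem_filter.1 hp).1
            exact (abs_log_one_sub_inv_add_sum_le hp1).trans (hbig p hp1)
        _ ≤ _ := by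
            refine Finset.sum_le_sum_of_subset_of_nonneg (fun p hp => ?_) fun p _ _ => by positivity
            simp only [Finset.mem_filter, Nat.mem_primesLE] at hp ⊢
            exact ⟨Nat.le_floor hp.2, hp.1.2⟩
    · simp only [not_le]
      refine Finset.sum_le_sum fun p hp => ?_
      obtain ⟨hp1, hp2⟩ := Finset.mem_filter.1 hp
      refine ((abs_log_one_sub_inv_add_sum_le hp1).trans (hsq p hp1)).trans ?_
      have h1 : Real.log z ≤ Real.log p := Real.log_le_log (by linarith) hp2.le
      have hp0 : (0 : ℝ) < p := by linarith
      have h2 : 2 / Real.log z * (Real.log p / (p : ℝ) ^ 2) =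
          (Real.log p / Real.log z) * (2 / (p : ℝ) ^ 2) := by ring
      rw [h2]
      refine le_mul_of_one_le_left (by positivity) ?_
      rwa [one_le_div hlogz]
  refine hsum.trans ?_
  rw [Finset.sum_const, nsmul_eq_mul, Nat.primesLE_card_eq_primeCounting, ← Finset.mul_sum]
  obtain ⟨j, hj⟩ := pow_unbounded_of_one_lt x (one_lt_two (α := ℝ))
  have h5 := sum_log_div_sq_le j z x (by linarith) (by nlinarith [pow_pos (two_pos (α := ℝ)) j])
  have h6 : 2 / Real.log z * ∑ p ∈ Nat.primesLE N with (z < ((p : ℕ) : ℝ)), Real.log p / (p : ℝ) ^ 2 ≤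
      2 / Real.log z * (4 * Real.log 4 / z) := mul_le_mul_of_nonneg_left h5 (by positivity)
  have h7 : (Nat.primeCounting ⌊z⌋₊ : ℝ) * (2 / x) ≤ (Real.log 4 + 1) * z / Real.log z * (2 / x) :=
    mul_le_mul_of_nonneg_right hx (by positivity)
  refine (add_le_add h7 h6).trans (le_of_eq ?_)
  rw [hlogx, ← hzz]
  field_simp
  ring

end MertensProduct

section PartialSummation

open scoped Topology

lemma integral_Ioc_comp_exp {a b : ℝ} (g : ℝ → ℝ) :
    ∫ x in Ioc (Real.exp a) (Real.exp b), g x = ∫ t in Ioc a b, Real.exp t * g (Real.exp t) := by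
  have himg : Real.exp '' Ioc a b = Ioc (Real.exp a) (Real.exp b) := by
    ext x
    simp only [mem_image, mem_Ioc]
    constructor
    · rintro ⟨t, ⟨h1, h2⟩, rfl⟩
      exact ⟨Real.exp_lt_exp.2 h1, Real.exp_le_exp.2 h2⟩
    · rintro ⟨h1, h2⟩
      have hx : 0 < x := (Real.exp_pos a).trans h1
      exact ⟨Real.log x, ⟨(Real.lt_log_iff_exp_lt hx).2 h1, (Real.log_le_iff_le_exp hx).2 h2⟩,
        Real.exp_log hx⟩
  rw [← himg, integral_image_eq_integral_abs_deriv_smul measurableSet_Ioc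
    (fun x _ => (Real.hasDerivAt_exp x).hasDerivWithinAt) Real.exp_injective.injOn]
  simp [abs_of_pos (Real.exp_pos _)]

lemma sum_vonMangoldt_div_exp_eq (y : ℝ) :
    ∑ k ∈ Finset.Icc 1 ⌊Real.exp y⌋₊, ArithmeticFunction.vonMangoldt k / (k : ℝ) =
      y - Real.eulerMascheroniConstant + vonMangoldtErr y := by
  rw [vonMangoldtErr]; ring

lemma sum_Icc_zero_eq_sum_Icc_one {f : ℕ → ℝ} (hf : f 0 = 0) (n : ℕ) :
    ∑ k ∈ Finset.Icc 0 n, f k = ∑ k ∈ Finset.Icc 1 n, f k := by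
  refine (Finset.sum_subset (fun k hk => ?_) fun k hk hk' => ?_).symm
  · simp at hk ⊢; exact hk.2
  · have : k = 0 := by simp at hk hk'; lia
    rw [this, hf]

lemma vonMangoldtLogSum_exp (y : ℝ) :
    vonMangoldtLogSum (Real.exp y) = (y - Real.eulerMascheroniConstant + vonMangoldtErr y) / y +
      ∫ t in Ioc (Real.log 2) y,
        (t - Real.eulerMascheroniConstant + vonMangoldtErr t) / t ^ 2 := by
  have hder : ∀ t : ℝ, 2 ≤ t → HasDerivAt (fun t : ℝ => (Real.log t)⁻¹)
      (-(t⁻¹) / Real.log t ^ 2) t := fun t ht =>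
    (Real.hasDerivAt_log (by linarith)).fun_inv (Real.log_pos (by linarith)).ne'
  have hE : Real.exp (Real.log 2) = 2 := Real.exp_log (by norm_num)
  have h := sum_mul_eq_sub_integral_mul₁ (𝕜 := ℝ) (f := fun t : ℝ => (Real.log t)⁻¹)
    (fun n : ℕ => ArithmeticFunction.vonMangoldt n / (n : ℝ)) (by simp) (by simp) (Real.exp y)
    (fun t ht => (hder t ht.1).differentiableAt) (by
      refine (ContinuousOn.integrableOn_Icc (f := fun t : ℝ => -(t⁻¹) / Real.log t ^ 2) ?_).congr_fun
        (fun t ht => ((hder t ht.1).deriv).symm) measurableSet_Icc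
      refine ContinuousOn.div ?_ ?_ ?_
      · exact (continuousOn_inv₀.mono fun t ht => by
          simp only [mem_compl_iff, mem_singleton_iff]; linarith [ht.1]).neg
      · exact (Real.continuousOn_log.mono fun t ht => by
          simp only [mem_compl_iff, mem_singleton_iff]; linarith [ht.1]).pow 2
      · exact fun t ht => pow_ne_zero 2 (Real.log_pos (by linarith [ht.1])).ne')
  rw [sum_Icc_zero_eq_sum_Icc_one (by simp), sum_Icc_zero_eq_sum_Icc_one (by simp), Real.log_exp,
    sum_vonMangoldt_div_exp_eq] at h
  have h1 : vonMangoldtLogSum (Real.exp y) = ∑ k ∈ Finset.Icc 1 ⌊Real.exp y⌋₊,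
      (Real.log k)⁻¹ * (ArithmeticFunction.vonMangoldt k / (k : ℝ)) := by
    rw [vonMangoldtLogSum]
    refine Finset.sum_congr rfl fun k _ => ?_
    rw [mul_comm (k : ℝ), div_mul_eq_div_div_swap, inv_mul_eq_div]
  rw [h1, h, inv_mul_eq_div, sub_eq_add_neg, ← integral_neg]
  congr 1
  have h2 := integral_Ioc_comp_exp (a := Real.log 2) (b := y) (fun t => -(deriv (fun t : ℝ => (Real.log t)⁻¹) t *
    ∑ k ∈ Finset.Icc 0 ⌊t⌋₊, ArithmeticFunction.vonMangoldt k / (k : ℝ)))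
  rw [hE] at h2
  rw [h2]
  refine setIntegral_congr_fun measurableSet_Ioc fun t ht => ?_
  have ht2 : 2 ≤ Real.exp t := by rw [← hE]; exact Real.exp_le_exp.2 ht.1.le
  have ht0 : t ≠ 0 := by have := Real.log_pos (x := 2) (by norm_num); linarith [ht.1]
  rw [(hder _ ht2).deriv, sum_Icc_zero_eq_sum_Icc_one (by simp), sum_vonMangoldt_div_exp_eq, Real.log_exp]
  have := Real.exp_ne_zero t
  field_simp

lemma integrableOn_vonMangoldtErr (hRH : RiemannHypothesis) :
    IntegrableOn vonMangoldtErr (Ioi 0) := by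
  refine (integrableOn_abs_scaledErr_mul_exp hRH (σ := 1 / 2) (by norm_num)).mono'
    measurable_vonMangoldtErr.aestronglyMeasurable (Eventually.of_forall fun t => ?_)
  have h1 : Real.exp (t / 2) * Real.exp (-(1 / 2) * t) = 1 := by
    rw [← Real.exp_add]; simp; ring
  rw [scaledErr, abs_mul, abs_of_pos (Real.exp_pos _), mul_right_comm, h1, one_mul, Real.norm_eq_abs]

lemma integrableOn_vonMangoldtErr_div_sq (hRH : RiemannHypothesis) {a : ℝ} (ha : 0 < a) :
    IntegrableOn (fun t => vonMangoldtErr t / t ^ 2) (Ioi a) := by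
  refine (((integrableOn_vonMangoldtErr hRH).mono_set (Ioi_subset_Ioi ha.le)).norm.div_const (a ^ 2)).mono'
    (measurable_vonMangoldtErr.div (by fun_prop)).aestronglyMeasurable ?_
  refine (ae_restrict_iff' measurableSet_Ioi).2 (Eventually.of_forall fun t ht => ?_)
  have ht : a < t := ht
  rw [norm_div, norm_pow]
  gcongr
  rw [Real.norm_eq_abs, abs_of_pos (ha.trans ht)]
  exact ht.le

/-- The constant term in the expansion of `vonMangoldtLogSum (exp y)`. -/
noncomputable def vonMangoldtLogConst : ℝ :=
  1 - Real.log (Real.log 2) - Real.eulerMascheroniConstant / Real.log 2 +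
    ∫ t in Ioi (Real.log 2), vonMangoldtErr t / t ^ 2

lemma vonMangoldtLogSum_exp_eq (hRH : RiemannHypothesis) {y : ℝ} (hy : Real.log 2 ≤ y) :
    vonMangoldtLogSum (Real.exp y) = Real.log y + vonMangoldtLogConst + vonMangoldtErr y / y -
      ∫ t in Ioi y, vonMangoldtErr t / t ^ 2 := by
  have hl : 0 < Real.log 2 := Real.log_pos (by norm_num)
  have hy0 : 0 < y := hl.trans_le hy
  set γ := Real.eulerMascheroniConstant with hγ
  have h_int := integrableOn_vonMangoldtErr_div_sq hRH hl
  have hsplit : ∫ t in Ioi (Real.log 2), vonMangoldtErr t / t ^ 2 =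
      (∫ t in Ioc (Real.log 2) y, vonMangoldtErr t / t ^ 2) +
        ∫ t in Ioi y, vonMangoldtErr t / t ^ 2 := by
    rw [← setIntegral_union (Ioc_disjoint_Ioi le_rfl) measurableSet_Ioi
      (h_int.mono_set Ioc_subset_Ioi_self) (h_int.mono_set (Ioi_subset_Ioi hy)),
      Ioc_union_Ioi_eq_Ioi hy]
  have hmain : IntegrableOn (fun t : ℝ => (t - γ) / t ^ 2) (Ioc (Real.log 2) y) := by
    refine (ContinuousOn.integrableOn_Icc ?_).mono_set Ioc_subset_Icc_self
    exact ContinuousOn.div (by fun_prop) (by fun_prop) fun t ht => pow_ne_zero 2 (by linarith [ht.1])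
  have hval : ∫ t in Ioc (Real.log 2) y, (t - γ) / t ^ 2 =
      (Real.log y + γ / y) - (Real.log (Real.log 2) + γ / Real.log 2) := by
    rw [← intervalIntegral.integral_of_le hy]
    refine intervalIntegral.integral_eq_sub_of_hasDerivAt (f := fun t => Real.log t + γ / t)
      (fun t ht => ?_) ((intervalIntegrable_iff_integrableOn_Ioc_of_le hy).2 hmain)
    rw [uIcc_of_le hy] at ht
    have ht0 : t ≠ 0 := by linarith [ht.1]
    refine ((Real.hasDerivAt_log ht0).add
      ((hasDerivAt_const t γ).div (hasDerivAt_id t) ht0)).congr_deriv ?_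
    simp only [id]
    field_simp
    ring
  have hadd : ∫ t in Ioc (Real.log 2) y, (t - γ + vonMangoldtErr t) / t ^ 2 =
      (∫ t in Ioc (Real.log 2) y, (t - γ) / t ^ 2) +
        ∫ t in Ioc (Real.log 2) y, vonMangoldtErr t / t ^ 2 := by
    rw [← integral_add hmain (h_int.mono_set Ioc_subset_Ioi_self)]
    simp_rw [add_div]
  rw [vonMangoldtLogSum_exp y, hadd, hval, vonMangoldtLogConst, hsplit]
  field_simp
  ring

end PartialSummation

section Tail

open scoped Topology

lemma abs_vonMangoldtErr_div_sq_le {y t : ℝ} (hy : 4 ≤ y) (ht : y ≤ t) :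
    |vonMangoldtErr t / t ^ 2| ≤ Real.exp (2 - y / 2) / y ^ 2 *
      (Real.exp (-(2 * y⁻¹) * t) + scaledErr t ^ 2 * Real.exp (-(2 * y⁻¹) * t)) := by
  have hy0 : 0 < y := by linarith
  have hE : |vonMangoldtErr t| = Real.exp (-(t / 2)) * |scaledErr t| := by
    rw [scaledErr, abs_mul, abs_of_pos (Real.exp_pos _), ← mul_assoc, ← Real.exp_add]
    simp
  have h1 : |scaledErr t| ≤ 1 + scaledErr t ^ 2 := by
    rw [← sq_abs]; nlinarith [sq_nonneg (|scaledErr t| - 1)]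
  have h2 : Real.exp (-(t / 2)) ≤ Real.exp (2 - y / 2) * Real.exp (-(2 * y⁻¹) * t) := by
    rw [← Real.exp_add]
    refine Real.exp_le_exp.2 ?_
    have h3 : y⁻¹ ≤ 1 / 4 := by rw [inv_le_comm₀ hy0 (by norm_num)]; norm_num; exact hy
    have h4 : y⁻¹ * y = 1 := inv_mul_cancel₀ hy0.ne'
    nlinarith [mul_nonneg (sub_nonneg.2 ht) (sub_nonneg.2 h3)]
  rw [abs_div, abs_of_nonneg (sq_nonneg t), hE]
  calc _ ≤ (Real.exp (2 - y / 2) * Real.exp (-(2 * y⁻¹) * t)) * (1 + scaledErr t ^ 2) / y ^ 2 := by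
        gcongr
    _ = _ := by ring

lemma exists_abs_integral_Ioi_vonMangoldtErr_le (hRH : RiemannHypothesis) :
    ∃ K, 0 < K ∧ ∀ y : ℝ, 4 ≤ y →
      |∫ t in Ioi y, vonMangoldtErr t / t ^ 2| ≤ K * Real.exp (-(y / 2)) / y := by
  obtain ⟨C, hC, hbound⟩ := exists_integral_scaledErr_sq_mul_exp_le hRH
  refine ⟨Real.exp 2 * (1 + C), by positivity, fun y hy => ?_⟩
  have hy0 : 0 < y := by linarith
  have h_int := integrableOn_vonMangoldtErr_div_sq hRH hy0
  refine le_of_tendsto (intervalIntegral_tendsto_integral_Ioi y h_int tendsto_id).abs ?_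
  filter_upwards [eventually_ge_atTop y] with Y hY
  have hσ : 0 < y⁻¹ := by positivity
  have hσ4 : y⁻¹ ≤ 1 / 4 := by rw [inv_le_comm₀ hy0 (by norm_num)]; norm_num; exact hy
  have hexp : IntegrableOn (fun t => Real.exp (-(2 * y⁻¹) * t)) (Ioi 0) :=
    integrableOn_rexp_neg_mul_Ioi (c := 2 * y⁻¹) (by positivity)
  have hsq : IntegrableOn (fun t => scaledErr t ^ 2 * Real.exp (-(2 * y⁻¹) * t)) (Ioc 0 Y) := by
    refine (integrableOn_scaledErr_sq Y).mono'
      ((measurable_scaledErr.pow_const 2).mul (by fun_prop)).aestronglyMeasurable ?_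
    refine (ae_restrict_iff' measurableSet_Ioc).2 (Eventually.of_forall fun t ht => ?_)
    rw [Real.norm_eq_abs, abs_of_nonneg (by positivity)]
    refine mul_le_of_le_one_right (sq_nonneg _) (Real.exp_le_one_iff.2 ?_)
    have := mul_pos hσ ht.1
    linarith
  have hadd : IntegrableOn (fun t => Real.exp (-(2 * y⁻¹) * t) +
      scaledErr t ^ 2 * Real.exp (-(2 * y⁻¹) * t)) (Ioc 0 Y) :=
    (hexp.mono_set Ioc_subset_Ioi_self).add hsq
  have hsub : Ioc y Y ⊆ Ioc 0 Y := Ioc_subset_Ioc_left hy0.le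
  have h1 : ∫ t in Ioc 0 Y, Real.exp (-(2 * y⁻¹) * t) ≤ y := by
    calc _ ≤ ∫ t in Ioi 0, Real.exp (-(2 * y⁻¹) * t) :=
          setIntegral_mono_set hexp (Eventually.of_forall fun t => (Real.exp_pos _).le)
            Ioc_subset_Ioi_self.eventuallyLE
      _ = y / 2 := by
          rw [integral_exp_mul_Ioi (by simp; positivity)]
          simp
          field_simp
      _ ≤ y := by linarith
  have h2 : ∫ t in Ioc 0 Y, scaledErr t ^ 2 * Real.exp (-(2 * y⁻¹) * t) ≤ C * y := by
    have := hbound y⁻¹ hσ hσ4 Y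
    rwa [div_inv_eq_mul] at this
  rw [id, intervalIntegral.integral_of_le hY]
  calc _ ≤ ∫ t in Ioc y Y, |vonMangoldtErr t / t ^ 2| := abs_integral_le_integral_abs
    _ ≤ ∫ t in Ioc y Y, Real.exp (2 - y / 2) / y ^ 2 *
        (Real.exp (-(2 * y⁻¹) * t) + scaledErr t ^ 2 * Real.exp (-(2 * y⁻¹) * t)) :=
        setIntegral_mono_on (h_int.mono_set Ioc_subset_Ioi_self).abs ((hadd.mono_set hsub).const_mul _)
          measurableSet_Ioc fun t ht => abs_vonMangoldtErr_div_sq_le hy ht.1.le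
    _ = Real.exp (2 - y / 2) / y ^ 2 * ∫ t in Ioc y Y,
        (Real.exp (-(2 * y⁻¹) * t) + scaledErr t ^ 2 * Real.exp (-(2 * y⁻¹) * t)) :=
        integral_const_mul _ _
    _ ≤ Real.exp (2 - y / 2) / y ^ 2 * ∫ t in Ioc 0 Y,
        (Real.exp (-(2 * y⁻¹) * t) + scaledErr t ^ 2 * Real.exp (-(2 * y⁻¹) * t)) := by
        refine mul_le_mul_of_nonneg_left ?_ (by positivity)
        exact setIntegral_mono_set hadd (Eventually.of_forall fun t => by positivity) hsub.eventuallyLE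
    _ ≤ Real.exp (2 - y / 2) / y ^ 2 * (y + C * y) := by
        rw [integral_add (hexp.mono_set Ioc_subset_Ioi_self) hsq]
        gcongr
    _ = _ := by
        rw [sub_eq_add_neg, Real.exp_add]
        field_simp

end Tail

section ZetaLog

open scoped Topology

/-- The coefficients `Λ(n)/(n log n)`. -/
noncomputable def vonMangoldtLogCoeff (n : ℕ) : ℝ :=
  ArithmeticFunction.vonMangoldt n / (n * Real.log n)

lemma vonMangoldtLogCoeff_nonneg (n : ℕ) : 0 ≤ vonMangoldtLogCoeff n :=
  div_nonneg ArithmeticFunction.vonMangoldt_nonneg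
    (mul_nonneg (Nat.cast_nonneg _) (Real.log_natCast_nonneg n))

lemma vonMangoldtLogCoeff_le_inv (n : ℕ) : vonMangoldtLogCoeff n ≤ (n : ℝ)⁻¹ := by
  rw [vonMangoldtLogCoeff, div_mul_eq_div_div_swap, div_eq_mul_inv _ (n : ℝ)]
  refine mul_le_of_le_one_left (by positivity) ?_
  exact div_le_one_of_le₀ ArithmeticFunction.vonMangoldt_le_log (Real.log_natCast_nonneg n)

lemma vonMangoldtLogCoeff_prime_pow {p : ℕ} (hp : p.Prime) (k : ℕ) :
    vonMangoldtLogCoeff (p ^ (k + 1)) = ((p : ℝ)⁻¹) ^ (k + 1) / (k + 1) := by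
  have hlog : 0 < Real.log p := Real.log_pos (by exact_mod_cast hp.one_lt)
  have hp0 : (0 : ℝ) < p := by exact_mod_cast hp.pos
  rw [vonMangoldtLogCoeff, ArithmeticFunction.vonMangoldt_apply_pow (by lia),
    ArithmeticFunction.vonMangoldt_apply_prime hp, Nat.cast_pow, Real.log_pow, inv_pow]
  push_cast
  field_simp

lemma exp_LSeries_vonMangoldtLogCoeff {s : ℂ} (hs : 0 < s.re) :
    Complex.exp (LSeries (fun n => (vonMangoldtLogCoeff n : ℂ)) s) = riemannZeta (1 + s) := by
  have hsum : LSeriesSummable (fun n => (vonMangoldtLogCoeff n : ℂ)) s := by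
    refine LSeriesSummable_of_le_const_mul_rpow (x := 0) hs ⟨1, fun n _ => ?_⟩
    rw [Complex.norm_real, Real.norm_of_nonneg (vonMangoldtLogCoeff_nonneg n), one_mul, zero_sub,
      Real.rpow_neg_one]
    exact vonMangoldtLogCoeff_le_inv n
  rw [← riemannZeta_eulerProduct_exp_log (s := 1 + s) (by simpa using hs), LSeries,
    tsum_eq_tsum_primes_of_support_subset_prime_powers hsum fun n hn => ?_]
  · congr 1
    refine tsum_congr fun p => ?_
    have hp0 : ((p : ℕ) : ℂ) ≠ 0 := by exact_mod_cast p.2.ne_zero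
    set z : ℂ := (p : ℂ) ^ (-(1 + s)) with hz
    have hz1 : ‖z‖ < 1 := by
      rw [hz, Complex.norm_natCast_cpow_of_pos p.2.pos]
      refine Real.rpow_lt_one_of_one_lt_of_neg (by exact_mod_cast p.2.one_lt) ?_
      simp only [Complex.neg_re, Complex.add_re, Complex.one_re]
      linarith
    have h := Complex.hasSum_taylorSeries_neg_log hz1
    have h' := (hasSum_nat_add_iff (f := fun n : ℕ => z ^ n / (n : ℂ)) 1
      (g := -Complex.log (1 - z))).2 (by simpa using h)
    rw [← h'.tsum_eq]
    refine tsum_congr fun k => ?_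
    have hz' : z = (p : ℂ)⁻¹ * ((p : ℂ) ^ s)⁻¹ := by
      rw [hz, Complex.cpow_neg, Complex.cpow_add _ _ hp0, Complex.cpow_one, mul_inv]
    rw [LSeries.term_of_ne_zero (pow_ne_zero _ p.2.ne_zero), vonMangoldtLogCoeff_prime_pow p.2, hz',
      Nat.cast_pow, ← Complex.natCast_cpow_natCast_mul, mul_comm ((k + 1 : ℕ) : ℂ) s,
      Complex.cpow_mul_nat]
    push_cast
    rw [mul_pow, inv_pow, inv_pow]
    field_simp
  · contrapose! hn
    have : vonMangoldtLogCoeff n = 0 := by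
      rw [vonMangoldtLogCoeff, ArithmeticFunction.vonMangoldt_eq_zero_iff.2 hn, zero_div]
    rcases eq_or_ne n 0 with rfl | hn0
    · simp
    · simp [LSeries.term_of_ne_zero hn0, this]

lemma LSeries_vonMangoldtLogCoeff_eq {w : ℝ} (hw : 0 < w) :
    LSeries (fun n => (vonMangoldtLogCoeff n : ℂ)) w =
      ((w * ∫ t in Ioi 0, vonMangoldtLogSum (Real.exp t) * Real.exp (-w * t) : ℝ) : ℂ) := by
  rw [LSeries_eq_mul_integral_exp vonMangoldtLogCoeff (r := w / 2) (by positivity)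
    (by simpa using hw) ?_ vonMangoldtLogCoeff_nonneg]
  · rw [Complex.ofReal_mul, ← integral_complex_ofReal]
    congr 1
    refine integral_congr_ae (Eventually.of_forall fun t => ?_)
    simp only [vonMangoldtLogSum, vonMangoldtLogCoeff]
    push_cast
    rfl
  · refine Asymptotics.IsBigO.trans (Asymptotics.IsBigO.of_bound (Real.log 2)⁻¹
      (Eventually.of_forall fun n => ?_)) (sum_vonMangoldt_div_isBigO (r := w / 2) (by positivity))
    have hl : 0 < Real.log 2 := Real.log_pos (by norm_num)
    rw [Real.norm_of_nonneg (Finset.sum_nonneg fun k _ => vonMangoldtLogCoeff_nonneg k),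
      Real.norm_of_nonneg (sum_vonMangoldt_div_nonneg n), Finset.mul_sum]
    refine Finset.sum_le_sum fun k hk => ?_
    have hk1 : 1 ≤ k := (Finset.mem_Icc.1 hk).1
    rcases eq_or_lt_of_le hk1 with rfl | hk2
    · simp [vonMangoldtLogCoeff]
    · have h2 : (2 : ℝ) ≤ k := by exact_mod_cast hk2
      rw [vonMangoldtLogCoeff, div_mul_eq_div_div, inv_mul_eq_div]
      exact div_le_div_of_nonneg_left
        (div_nonneg ArithmeticFunction.vonMangoldt_nonneg (Nat.cast_nonneg _)) hl
        (Real.log_le_log (by norm_num) h2)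

lemma tendsto_log_add_mul_integral_vonMangoldtLogSum :
    Tendsto (fun w : ℝ => Real.log w +
      w * ∫ t in Ioi 0, vonMangoldtLogSum (Real.exp t) * Real.exp (-w * t)) (𝓝[>] 0) (𝓝 0) := by
  set F : ℝ → ℝ := fun w => w * ∫ t in Ioi 0, vonMangoldtLogSum (Real.exp t) * Real.exp (-w * t)
  have h1 : Tendsto (fun w : ℝ => (1 + (w : ℂ))) (𝓝[>] 0) (𝓝[≠] 1) := by
    refine tendsto_nhdsWithin_iff.2 ⟨?_, ?_⟩
    · have : Tendsto (fun w : ℝ => (1 + (w : ℂ))) (𝓝 0) (𝓝 (1 + ((0 : ℝ) : ℂ))) :=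
        Continuous.tendsto (by fun_prop) 0
      simpa using this.mono_left nhdsWithin_le_nhds
    · filter_upwards [self_mem_nhdsWithin] with w hw
      have hw : w ≠ 0 := (show (0 : ℝ) < w from hw).ne'
      simpa using hw
  have h2 := (riemannZeta_residue_one.comp h1).norm
  have h3 : Tendsto (fun w : ℝ => Real.log (w * Real.exp (F w))) (𝓝[>] 0) (𝓝 (Real.log 1)) := by
    refine Tendsto.log ?_ one_ne_zero
    rw [norm_one] at h2
    refine h2.congr' ?_
    filter_upwards [self_mem_nhdsWithin] with w hw
    have hw : 0 < w := hw
    simp only [Function.comp, add_sub_cancel_left]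
    rw [← exp_LSeries_vonMangoldtLogCoeff (by simpa using hw), LSeries_vonMangoldtLogCoeff_eq hw,
      ← Complex.ofReal_exp, norm_mul, Complex.norm_real, Complex.norm_real,
      Real.norm_of_nonneg hw.le, Real.norm_of_nonneg (Real.exp_pos _).le]
  rw [Real.log_one] at h3
  refine h3.congr' ?_
  filter_upwards [self_mem_nhdsWithin] with w hw
  have hw : 0 < w := hw
  rw [Real.log_mul hw.ne' (Real.exp_ne_zero _), Real.log_exp]

end ZetaLog

section MertensConstant

open scoped Topology

lemma integral_log_mul_exp_neg :
    ∫ t in Ioi 0, Real.log t * Real.exp (-t) = -Real.eulerMascheroniConstant := by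
  have h1 := Complex.hasDerivAt_GammaIntegral (s := 1) (by simp)
  have h2 : HasDerivAt Complex.GammaIntegral (-(Real.eulerMascheroniConstant : ℂ)) 1 := by
    refine Complex.hasDerivAt_Gamma_one.congr_of_eventuallyEq ?_
    filter_upwards [isOpen_re_pos.mem_nhds (show (0 : ℝ) < (1 : ℂ).re by simp)] with s hs
    exact (Complex.Gamma_eq_integral hs).symm
  have h3 := h1.unique h2
  simp only [sub_self, Complex.cpow_zero, one_mul, ← Complex.ofReal_mul] at h3
  rw [integral_complex_ofReal] at h3
  exact_mod_cast h3

lemma integrableOn_log_mul_exp_neg :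
    IntegrableOn (fun t => Real.log t * Real.exp (-t)) (Ioi 0) := by
  refine Integrable.of_integral_ne_zero ?_
  rw [integral_log_mul_exp_neg]
  have := Real.one_half_lt_eulerMascheroniConstant
  exact neg_ne_zero.2 (by linarith)

lemma integrableOn_log_mul_exp_neg_mul {w : ℝ} (hw : 0 < w) :
    IntegrableOn (fun t => Real.log t * Real.exp (-w * t)) (Ioi 0) := by
  have h1 : IntegrableOn (fun t => Real.log (w * t) * Real.exp (-(w * t))) (Ioi 0) :=
    (integrableOn_Ioi_comp_mul_left_iff (fun t => Real.log t * Real.exp (-t)) 0 hw).2 (by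
      rw [mul_zero]; exact integrableOn_log_mul_exp_neg)
  refine (h1.sub ((integrableOn_rexp_neg_mul_Ioi hw).const_mul (Real.log w))).congr_fun
    (fun t ht => ?_) measurableSet_Ioi
  have ht : 0 < t := ht
  simp only [Pi.sub_apply]
  rw [Real.log_mul hw.ne' ht.ne', ← neg_mul]
  ring

lemma mul_integral_rexp_neg_mul {w : ℝ} (hw : 0 < w) :
    w * ∫ t in Ioi 0, Real.exp (-w * t) = 1 := by
  rw [integral_exp_mul_Ioi (by simpa using hw)]
  simp
  field_simp

lemma mul_integral_log_mul_exp_neg_mul {w : ℝ} (hw : 0 < w) :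
    w * ∫ t in Ioi 0, Real.log t * Real.exp (-w * t) =
      -Real.eulerMascheroniConstant - Real.log w := by
  have h := integral_comp_mul_left_Ioi (fun t => Real.log t * Real.exp (-t)) 0 hw
  rw [mul_zero, integral_log_mul_exp_neg, smul_eq_mul] at h
  have h1 : ∫ t in Ioi 0, Real.log (w * t) * Real.exp (-(w * t)) =
      (∫ t in Ioi 0, Real.log w * Real.exp (-w * t)) +
        ∫ t in Ioi 0, Real.log t * Real.exp (-w * t) := by
    rw [← integral_add ((integrableOn_rexp_neg_mul_Ioi hw).const_mul _)
      (integrableOn_log_mul_exp_neg_mul hw)]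
    refine setIntegral_congr_fun measurableSet_Ioi fun t ht => ?_
    have ht : 0 < t := ht
    rw [Real.log_mul hw.ne' ht.ne', ← neg_mul]
    ring
  rw [h1, integral_const_mul] at h
  have h2 := mul_integral_rexp_neg_mul hw
  have h3 : w * w⁻¹ = 1 := mul_inv_cancel₀ hw.ne'
  linear_combination w * h - Real.log w * h2 - Real.eulerMascheroniConstant * h3

lemma vonMangoldtLogSum_nonneg (x : ℝ) : 0 ≤ vonMangoldtLogSum x :=
  Finset.sum_nonneg fun n _ => vonMangoldtLogCoeff_nonneg n

lemma vonMangoldtLogSum_mono : Monotone vonMangoldtLogSum := fun _ _ h =>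
  Finset.sum_le_sum_of_subset_of_nonneg
    (Finset.Icc_subset_Icc_right (Nat.floor_mono h)) fun n _ _ => vonMangoldtLogCoeff_nonneg n

/-- The remainder in Mertens' estimate for `∑_{n ≤ e^t} Λ(n)/(n log n)`. -/
noncomputable def vonMangoldtLogErr (t : ℝ) : ℝ :=
  vonMangoldtLogSum (Real.exp t) - Real.log t - vonMangoldtLogConst

lemma measurable_vonMangoldtLogErr : Measurable vonMangoldtLogErr :=
  ((vonMangoldtLogSum_mono.measurable.comp Real.measurable_exp).sub Real.measurable_log).sub_const _

lemma integrableOn_vonMangoldtLogErr (hRH : RiemannHypothesis) :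
    IntegrableOn vonMangoldtLogErr (Ioi 0) := by
  rw [← Ioc_union_Ioi_eq_Ioi (show (0 : ℝ) ≤ 4 by norm_num), integrableOn_union]
  constructor
  · have hlog : IntegrableOn Real.log (Ioc 0 4) :=
      (intervalIntegrable_iff_integrableOn_Ioc_of_le (by norm_num)).1
        intervalIntegral.intervalIntegrable_log'
    have hconst : ∀ c : ℝ, IntegrableOn (fun _ => c) (Ioc (0 : ℝ) 4) := fun c =>
      integrableOn_const (by simp)
    refine (IntegrableOn.sub (IntegrableOn.sub (Integrable.mono' (hconst (vonMangoldtLogSum (Real.exp 4)))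
      (vonMangoldtLogSum_mono.measurable.comp Real.measurable_exp).aestronglyMeasurable ?_) hlog)
      (hconst vonMangoldtLogConst))
    refine (ae_restrict_iff' measurableSet_Ioc).2 (Eventually.of_forall fun t ht => ?_)
    rw [Real.norm_of_nonneg (vonMangoldtLogSum_nonneg _)]
    exact vonMangoldtLogSum_mono (Real.exp_le_exp.2 ht.2)
  · obtain ⟨K, hK, hbound⟩ := exists_abs_integral_Ioi_vonMangoldtErr_le hRH
    have hE := ((integrableOn_vonMangoldtErr hRH).mono_set
      (Ioi_subset_Ioi (show (0 : ℝ) ≤ 4 by norm_num))).abs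
    have hexp := ((integrableOn_rexp_neg_mul_Ioi (c := 1 / 2) (by norm_num)).mono_set
      (Ioi_subset_Ioi (show (0 : ℝ) ≤ 4 by norm_num))).const_mul K
    refine (hE.add hexp).mono' measurable_vonMangoldtLogErr.aestronglyMeasurable ?_
    refine (ae_restrict_iff' measurableSet_Ioi).2 (Eventually.of_forall fun t ht => ?_)
    have ht : 4 < t := ht
    have hl : Real.log 2 ≤ t := by have := Real.log_two_lt_d9; linarith
    have h1 : vonMangoldtLogErr t =
        vonMangoldtErr t / t - ∫ u in Ioi t, vonMangoldtErr u / u ^ 2 := by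
      rw [vonMangoldtLogErr, vonMangoldtLogSum_exp_eq hRH hl]; ring
    rw [h1, Real.norm_eq_abs]
    refine (abs_sub _ _).trans (add_le_add ?_ ((hbound t ht.le).trans ?_))
    · rw [abs_div]
      exact div_le_self (abs_nonneg _) ((by linarith : 1 ≤ t).trans (le_abs_self t))
    · refine (div_le_self (by positivity) (by linarith)).trans (le_of_eq ?_)
      ring_nf

lemma vonMangoldtLogConst_eq (hRH : RiemannHypothesis) :
    vonMangoldtLogConst = Real.eulerMascheroniConstant := by
  have hR := integrableOn_vonMangoldtLogErr hRH
  have hexp : ∀ {w : ℝ}, 0 < w → ∀ t ∈ Ioi (0 : ℝ), ‖Real.exp (-w * t)‖ ≤ 1 := fun {w} hw t ht => by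
    rw [Real.norm_of_nonneg (Real.exp_pos _).le, Real.exp_le_one_iff]
    have := mul_pos hw (show 0 < t from ht)
    linarith
  have hRw : ∀ {w : ℝ}, 0 < w →
      IntegrableOn (fun t => vonMangoldtLogErr t * Real.exp (-w * t)) (Ioi 0) := fun {w} hw =>
    Integrable.mul_bdd (c := 1) hR (by fun_prop)
      ((ae_restrict_iff' measurableSet_Ioi).2 (Eventually.of_forall (hexp hw)))
  have hlim0 : Tendsto (fun w : ℝ => w * ∫ t in Ioi 0, vonMangoldtLogErr t * Real.exp (-w * t))
      (𝓝[>] 0) (𝓝 0) := by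
    have h0 : Tendsto (fun w : ℝ => w * ∫ t in Ioi 0, |vonMangoldtLogErr t|) (𝓝[>] 0) (𝓝 0) := by
      have : Tendsto (fun w : ℝ => w * ∫ t in Ioi 0, |vonMangoldtLogErr t|) (𝓝 0)
          (𝓝 (0 * ∫ t in Ioi 0, |vonMangoldtLogErr t|)) := Continuous.tendsto (by fun_prop) 0
      rw [zero_mul] at this
      exact this.mono_left nhdsWithin_le_nhds
    refine squeeze_zero_norm' ?_ h0
    filter_upwards [self_mem_nhdsWithin] with w hw
    have hw : 0 < w := hw
    rw [norm_mul, Real.norm_of_nonneg hw.le]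
    gcongr
    refine norm_integral_le_of_norm_le hR.abs
      ((ae_restrict_iff' measurableSet_Ioi).2 (Eventually.of_forall fun t ht => ?_))
    rw [norm_mul]
    exact mul_le_of_le_one_right (norm_nonneg _) (hexp hw t ht)
  have hlim1 := tendsto_log_add_mul_integral_vonMangoldtLogSum
  have hlim2 := hlim0.add_const (vonMangoldtLogConst - Real.eulerMascheroniConstant)
  rw [zero_add] at hlim2
  have heq := tendsto_nhds_unique (hlim2.congr' ?_) hlim1
  · linarith
  filter_upwards [self_mem_nhdsWithin] with w hw
  have hw : 0 < w := hw
  have hsum : ∫ t in Ioi 0, vonMangoldtLogSum (Real.exp t) * Real.exp (-w * t) =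
      (∫ t in Ioi 0, vonMangoldtLogErr t * Real.exp (-w * t)) +
        ((∫ t in Ioi 0, Real.log t * Real.exp (-w * t)) +
          ∫ t in Ioi 0, vonMangoldtLogConst * Real.exp (-w * t)) := by
    have hlc : IntegrableOn (fun t => Real.log t * Real.exp (-w * t) +
        vonMangoldtLogConst * Real.exp (-w * t)) (Ioi 0) :=
      (integrableOn_log_mul_exp_neg_mul hw).add ((integrableOn_rexp_neg_mul_Ioi hw).const_mul _)
    rw [← integral_add (integrableOn_log_mul_exp_neg_mul hw)
      ((integrableOn_rexp_neg_mul_Ioi hw).const_mul _), ← integral_add (hRw hw) hlc]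
    refine integral_congr_ae (Eventually.of_forall fun t => ?_)
    simp only [vonMangoldtLogErr]
    ring
  rw [hsum, integral_const_mul]
  have h1 := mul_integral_log_mul_exp_neg_mul hw
  have h2 := mul_integral_rexp_neg_mul hw
  linear_combination -h1 - vonMangoldtLogConst * h2

end MertensConstant

section LogDensity

open scoped Topology

lemma exists_abs_log_mertensProd_exp_sub_scaledErr_le (hRH : RiemannHypothesis) :
    ∃ C, 0 < C ∧ ∀ᶠ y : ℝ in atTop,
      |y * Real.exp (y / 2) * (Real.log (mertensProd (Real.exp y)) -
        Real.eulerMascheroniConstant - Real.log y) - scaledErr y| ≤ C := by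
  obtain ⟨C, hC, hprod⟩ := exists_abs_log_mertensProd_sub_le
  obtain ⟨K, hK, htail⟩ := exists_abs_integral_Ioi_vonMangoldtErr_le hRH
  refine ⟨C + K, by positivity, ?_⟩
  filter_upwards [Real.tendsto_exp_atTop.eventually hprod, eventually_ge_atTop (4 : ℝ)] with y h1 hy
  have hy0 : 0 < y := by linarith
  have hl : Real.log 2 ≤ y := by have := Real.log_two_lt_d9; linarith
  have h2 := htail y hy
  have h3 := vonMangoldtLogSum_exp_eq hRH hl
  rw [vonMangoldtLogConst_eq hRH] at h3
  set D := Real.log (mertensProd (Real.exp y)) - vonMangoldtLogSum (Real.exp y) with hD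
  set T := ∫ t in Ioi y, vonMangoldtErr t / t ^ 2
  have hexp : Real.exp (y / 2) * Real.exp (-(y / 2)) = 1 := by rw [← Real.exp_add]; simp
  have hD' : y * Real.exp (y / 2) * |D| ≤ C := by
    rw [Real.log_exp, Real.sqrt_eq_rpow, ← Real.exp_mul] at h1
    have := mul_le_mul_of_nonneg_left h1 (show 0 ≤ y * Real.exp (y / 2) by positivity)
    refine this.trans (le_of_eq ?_)
    rw [mul_one_div]
    field_simp
  have hT' : y * Real.exp (y / 2) * |T| ≤ K := by
    have := mul_le_mul_of_nonneg_left h2 (show 0 ≤ y * Real.exp (y / 2) by positivity)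
    refine this.trans (le_of_eq ?_)
    have : y * Real.exp (y / 2) * (K * Real.exp (-(y / 2)) / y) =
        K * (Real.exp (y / 2) * Real.exp (-(y / 2))) := by field_simp
    rw [this, hexp, mul_one]
  have hkey : y * Real.exp (y / 2) * (Real.log (mertensProd (Real.exp y)) -
      Real.eulerMascheroniConstant - Real.log y) - scaledErr y =
      y * Real.exp (y / 2) * D - y * Real.exp (y / 2) * T := by
    rw [scaledErr, hD, h3]
    field_simp
    ring
  rw [hkey]
  refine (abs_sub _ _).trans (add_le_add ?_ ?_)
  · rwa [abs_mul, abs_of_pos (by positivity : 0 < y * Real.exp (y / 2))]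
  · rwa [abs_mul, abs_of_pos (by positivity : 0 < y * Real.exp (y / 2))]

lemma exp_mem_mertensSet_iff {y : ℝ} (hy : Real.log 2 ≤ y) :
    Real.exp y ∈ MertensSet ↔
      0 < y * Real.exp (y / 2) * (Real.log (mertensProd (Real.exp y)) -
        Real.eulerMascheroniConstant - Real.log y) := by
  have hy0 : 0 < y := (Real.log_pos (by norm_num)).trans_le hy
  have h2 : 2 ≤ Real.exp y := (Real.log_le_iff_le_exp (by norm_num)).1 hy
  rw [mul_pos_iff_of_pos_left (by positivity)]
  simp only [MertensSet, mem_ofPred_eq, h2, true_and, Real.log_exp]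
  rw [← Real.log_lt_log_iff (by positivity) (mertensProd_pos _),
    Real.log_mul (Real.exp_ne_zero _) hy0.ne', Real.log_exp]
  constructor <;> intro h <;> linarith

lemma measurableSet_mertensSet : MeasurableSet MertensSet := by
  have h1 : Measurable mertensProd :=
    (measurable_from_nat (f := fun n : ℕ =>
      ∏ p ∈ Finset.filter Nat.Prime (Finset.Iic n), ((1 : ℝ) - 1 / p)⁻¹)).comp Nat.measurable_floor
  exact measurableSet_Ici.inter (measurableSet_lt (Real.measurable_log.const_mul _) h1)

lemma integral_inter_Icc_one_div {S : Set ℝ} (hS : MeasurableSet S) (Y : ℝ) :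
    ∫ t in S ∩ Icc 2 (Real.exp Y), 1 / t =
      volume.real ({y | Real.exp y ∈ S} ∩ Icc (Real.log 2) Y) := by
  have himg : Real.exp '' ({y | Real.exp y ∈ S} ∩ Icc (Real.log 2) Y) =
      S ∩ Icc 2 (Real.exp Y) := by
    ext x
    simp only [mem_image, mem_inter_iff, mem_ofPred_eq, mem_Icc]
    constructor
    · rintro ⟨t, ⟨h0, h1, h2⟩, rfl⟩
      exact ⟨h0, (Real.log_le_iff_le_exp (by norm_num)).1 h1, Real.exp_le_exp.2 h2⟩
    · rintro ⟨h0, h1, h2⟩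
      have hx : 0 < x := by linarith
      refine ⟨Real.log x, ⟨by rwa [Real.exp_log hx], Real.log_le_log (by norm_num) h1,
        (Real.log_le_iff_le_exp hx).2 h2⟩, Real.exp_log hx⟩
  have hm : MeasurableSet ({y | Real.exp y ∈ S} ∩ Icc (Real.log 2) Y) :=
    MeasurableSet.inter (Real.measurable_exp hS) measurableSet_Icc
  rw [← himg, integral_image_eq_integral_abs_deriv_smul hm
    (fun x _ => (Real.hasDerivAt_exp x).hasDerivWithinAt) Real.exp_injective.injOn]
  simp [abs_of_pos (Real.exp_pos _), Real.exp_ne_zero]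

/-- Both `e^y ∈ M` and `e^y ∉ M` hold for a positive proportion of `y ≤ Y`. -/
lemma exists_mul_le_measureReal_exp_mem_mertensSet (hRH : RiemannHypothesis) :
    ∃ κ, 0 < κ ∧ ∀ᶠ Y : ℝ in atTop,
      κ * Y ≤ volume.real ({y | Real.exp y ∈ MertensSet} ∩ Icc (Real.log 2) Y) ∧
      volume.real ({y | Real.exp y ∈ MertensSet} ∩ Icc (Real.log 2) Y) ≤ (1 - κ) * Y := by
  obtain ⟨C, hC, hcomp⟩ := exists_abs_log_mertensProd_exp_sub_scaledErr_le hRH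
  obtain ⟨κ, hκ, hdens⟩ := exists_mul_le_measureReal_scaledErr hRH hC.le
  obtain ⟨Z, hZ⟩ := eventually_atTop.1 hcomp
  have hl0 : 0 < Real.log 2 := Real.log_pos (by norm_num)
  set G : Set ℝ := {y | Real.exp y ∈ MertensSet} with hG
  have hGm : MeasurableSet G := Real.measurable_exp measurableSet_mertensSet
  set Z₀ := max Z (Real.log 2) with hZ₀
  have hZ0 : Real.log 2 ≤ Z₀ := le_max_right _ _
  have hpos : ∀ y, Z₀ ≤ y → C < scaledErr y → y ∈ G := fun y hy h => by
    have h1 := (abs_le.1 (hZ y ((le_max_left _ _).trans hy))).1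
    exact (exp_mem_mertensSet_iff (hZ0.trans hy)).2 (by linarith)
  have hneg : ∀ y, Z₀ ≤ y → scaledErr y < -C → y ∉ G := fun y hy h hyG => by
    have h1 := (abs_le.1 (hZ y ((le_max_left _ _).trans hy))).2
    have h2 := (exp_mem_mertensSet_iff (hZ0.trans hy)).1 hyG
    linarith
  have hfin : ∀ (s : Set ℝ) (a b : ℝ), volume (s ∩ Icc a b) ≠ ⊤ := fun s a b =>
    measure_inter_ne_top_of_right_ne_top measure_Icc_lt_top.ne
  have hfin' : ∀ (s : Set ℝ) (a b : ℝ), volume (s ∩ Ioc a b) ≠ ⊤ := fun s a b =>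
    measure_inter_ne_top_of_right_ne_top measure_Ioc_lt_top.ne
  have hvolZ : volume.real (Ioc 0 Z₀) = Z₀ := by
    rw [Real.volume_real_Ioc_of_le (by linarith), sub_zero]
  refine ⟨κ / 2, by positivity, ?_⟩
  filter_upwards [hdens, eventually_ge_atTop (2 * Z₀ / κ), eventually_ge_atTop Z₀] with Y hY hYκ hYZ
  rw [div_le_iff₀ hκ] at hYκ
  constructor
  · have hsub : {y | C < scaledErr y} ∩ Ioc 0 Y ⊆ (G ∩ Icc (Real.log 2) Y) ∪ Ioc 0 Z₀ := by
      rintro y ⟨h1, h2, h3⟩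
      rcases le_total y Z₀ with h | h
      · exact Or.inr ⟨h2, h⟩
      · exact Or.inl ⟨hpos y h h1, hZ0.trans h, h3⟩
    have h1 := measureReal_mono hsub (measure_union_ne_top (hfin _ _ _) measure_Ioc_lt_top.ne)
    have h2 := measureReal_union_le (μ := volume) (G ∩ Icc (Real.log 2) Y) (Ioc 0 Z₀)
    linarith [hY.2]
  · have hsub : {y | scaledErr y < -C} ∩ Ioc 0 Y ⊆
        ({y | scaledErr y < -C} ∩ Ioc Z₀ Y) ∪ Ioc 0 Z₀ := by
      rintro y ⟨h1, h2, h3⟩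
      rcases le_or_gt y Z₀ with h | h
      · exact Or.inr ⟨h2, h⟩
      · exact Or.inl ⟨h1, h, h3⟩
    have h1 := measureReal_mono hsub (measure_union_ne_top (hfin' _ _ _) measure_Ioc_lt_top.ne)
    have h2 := measureReal_union_le (μ := volume) ({y | scaledErr y < -C} ∩ Ioc Z₀ Y) (Ioc 0 Z₀)
    have hdisj : Disjoint ({y | scaledErr y < -C} ∩ Ioc Z₀ Y) (G ∩ Icc (Real.log 2) Y) :=
      Set.disjoint_left.2 fun y hy hy' => hneg y hy.2.1.le hy.1 hy'.1
    have h3 := measureReal_union (μ := volume) hdisj (hGm.inter measurableSet_Icc) (hfin' _ _ _) (hfin _ _ _)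
    have h4 : ({y | scaledErr y < -C} ∩ Ioc Z₀ Y) ∪ (G ∩ Icc (Real.log 2) Y) ⊆ Ioc 0 Y := by
      rintro y (hy | hy)
      · exact ⟨by linarith [hy.2.1], hy.2.2⟩
      · exact ⟨by linarith [hy.2.1], hy.2.2⟩
    have h5 := measureReal_mono h4 measure_Ioc_lt_top.ne (μ := volume)
    rw [Real.volume_real_Ioc_of_le (by linarith), sub_zero] at h5
    linarith [hY.1]

end LogDensity

/-- Assuming RH, the set `M` and its complement both have positive lower
logarithmic density: `δ̲(M) > 0` and `δ̄(M) < 1`. -/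
theorem mertensSet_lowerLogDensity_pos_and_upperLogDensity_lt_one
    (hRH : RiemannHypothesis) :
    0 < lowerLogDensity MertensSet ∧ upperLogDensity MertensSet < 1 := by
  obtain ⟨κ, hκ, h⟩ := exists_mul_le_measureReal_exp_mem_mertensSet hRH
  have hratio : ∀ᶠ x : ℝ in atTop,
      κ ≤ (∫ t in MertensSet ∩ Set.Icc 2 x, 1 / t) / Real.log x ∧
        (∫ t in MertensSet ∩ Set.Icc 2 x, 1 / t) / Real.log x ≤ 1 - κ := by
    filter_upwards [Real.tendsto_log_atTop.eventually h, eventually_ge_atTop (2 : ℝ)] with x hx hx2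
    have hlog : 0 < Real.log x := Real.log_pos (by linarith)
    have heq := integral_inter_Icc_one_div measurableSet_mertensSet (Real.log x)
    rw [Real.exp_log (by linarith)] at heq
    rw [heq, le_div_iff₀ hlog, div_le_iff₀ hlog]
    exact hx
  have hge := hratio.mono fun x hx => hx.1
  have hle := hratio.mono fun x hx => hx.2
  constructor
  · exact hκ.trans_le (le_liminf_of_le (IsBoundedUnder.isCoboundedUnder_ge ⟨_, eventually_map.2 hle⟩) hge)
  · exact (limsup_le_of_le (IsBoundedUnder.isCoboundedUnder_le ⟨_, eventually_map.2 hge⟩) hle).trans_lt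
      (by linarith)
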